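/- For every κ > 0 there exist κ′ > 0 and a constant C > 0 such that the following holds for every squarefree integer q ≥ 1, with G = SL₂(ℤ/qℤ). Let μ : G → ℂ be a complex measure such that for every divisor q₁ of q with q₁ > 1 one has |||π_{q₁}(μ)|||_∞ < q₁^{−κ}·‖μ‖₁. Then for every φ : G → ℂ lying in E_q one has ‖μ ∗ φ‖₂ ≤ C·q^{−κ′}·‖μ‖₁·‖φ‖₂. -/

import Mathlib

open Finset
open scoped Classical

/-- Convolution of two complex-valued functions on a finite group:
`(μ ∗ φ)(x) = Σ_g μ(g) φ(g⁻¹ x)`. -/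
noncomputable def conv {G : Type*} [Group G] [Fintype G] (μ φ : G → ℂ) : G → ℂ :=
  fun x => ∑ g : G, μ g * φ (g⁻¹ * x)

/-- The `ℓ¹` norm `Σ_x |μ(x)|` of a function on a finite group. -/
noncomputable def l1Norm {G : Type*} [Fintype G] (μ : G → ℂ) : ℝ :=
  ∑ x : G, ‖μ x‖

/-- The `ℓ²` norm `(Σ_x |φ(x)|²)^{1/2}` of a function on a finite group. -/
noncomputable def l2Norm {G : Type*} [Fintype G] (φ : G → ℂ) : ℝ :=
  Real.sqrt (∑ x : G, ‖φ x‖ ^ 2)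

/-- The reduction map `SL₂(ℤ/mℤ) → SL₂(ℤ/nℤ)` for `n ∣ m`. -/
noncomputable def redSL (m n : ℕ) [NeZero m] (h : n ∣ m) :
    Matrix.SpecialLinearGroup (Fin 2) (ZMod m) →* Matrix.SpecialLinearGroup (Fin 2) (ZMod n) :=
  Matrix.SpecialLinearGroup.map (ZMod.castHom h (ZMod n))

/-- The pushforward of `μ : SL₂(ℤ/qℤ) → ℂ` under the reduction `SL₂(ℤ/qℤ) → SL₂(ℤ/q₁ℤ)`. -/
noncomputable def pushforward (q q₁ : ℕ) [NeZero q] (h : q₁ ∣ q)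
    (μ : Matrix.SpecialLinearGroup (Fin 2) (ZMod q) → ℂ) :
    Matrix.SpecialLinearGroup (Fin 2) (ZMod q₁) → ℂ :=
  fun y => ∑ x ∈ Finset.univ.filter (fun x => redSL q q₁ h x = y), μ x

/-- Membership in `E_q`: `φ` is orthogonal (counting inner product) to every function
factoring through the reduction `SL₂(ℤ/qℤ) → SL₂(ℤ/q₂ℤ)` for a divisor `q₂ ≠ q` of `q`. -/
def memEq (q : ℕ) [NeZero q] (φ : Matrix.SpecialLinearGroup (Fin 2) (ZMod q) → ℂ) : Prop :=
  ∀ (q₂ : ℕ) (h : q₂ ∣ q), q₂ ≠ q →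
    ∀ ψ : Matrix.SpecialLinearGroup (Fin 2) (ZMod q₂) → ℂ,
      (∑ x : Matrix.SpecialLinearGroup (Fin 2) (ZMod q),
        (starRingEnd ℂ) (ψ (redSL q q₂ h x)) * φ x) = 0

namespace L2Flat
open scoped Pointwise
set_option linter.unusedSectionVars false
set_option linter.unusedSimpArgs false

section Counting

theorem card_mul_le_of_fiber_ge {α β : Type*} (f : α → β) (X : Finset α) (Y : Finset β) (t : ℝ)
    (h : ∀ y ∈ Y, t ≤ #{x ∈ X | f x = y}) : #Y * t ≤ #X := by
  have h1 : ∑ y ∈ Y, #{x ∈ X | f x = y} ≤ #X := by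
    rw [← Finset.card_biUnion]
    · exact Finset.card_le_card (by intro x; simp +contextual)
    · intro a _ b _ hab
      rw [Function.onFun, Finset.disjoint_left]
      intro x hx hx'
      simp only [Finset.mem_filter] at hx hx'
      exact hab (hx.2.symm.trans hx'.2)
  calc (#Y : ℝ) * t = ∑ y ∈ Y, t := by simp
    _ ≤ ∑ y ∈ Y, (#{x ∈ X | f x = y} : ℝ) := Finset.sum_le_sum h
    _ ≤ #X := by exact_mod_cast h1

theorem card_le_mul_of_fiber_le {α β : Type*} (f : α → β) (X : Finset α) (Y : Finset β) (t : ℝ)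
    (hf : ∀ x ∈ X, f x ∈ Y) (h : ∀ y ∈ Y, (#{x ∈ X | f x = y} : ℝ) ≤ t) : (#X : ℝ) ≤ #Y * t := by
  rw [Finset.card_eq_sum_card_fiberwise hf]
  push_cast
  calc _ ≤ ∑ y ∈ Y, t := Finset.sum_le_sum h
    _ = _ := by simp

end Counting

variable {G : Type*} [Group G]

/-- A symmetric set containing `1` whose powers grow at most like `K ^ n`. -/
def Apx (K : ℝ) (A : Finset G) : Prop :=
  1 ∈ A ∧ (∀ x ∈ A, x⁻¹ ∈ A) ∧ ∀ n : ℕ, (#(A ^ n) : ℝ) ≤ K ^ n * #A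

theorem Apx.mono {K L : ℝ} {A : Finset G} (h : Apx K A) (hK : 0 ≤ K) (hKL : K ≤ L) : Apx L A :=
  ⟨h.1, h.2.1, fun n => (h.2.2 n).trans (by gcongr)⟩

section Fin
variable [Fintype G]

theorem sum_mul_right {M : Type*} [AddCommMonoid M] (g : G) (f : G → M) :
    ∑ x, f (x * g) = ∑ x, f x := Equiv.sum_comp (Equiv.mulRight g) f

theorem sum_mul_left {M : Type*} [AddCommMonoid M] (g : G) (f : G → M) :
    ∑ x, f (g * x) = ∑ x, f x := Equiv.sum_comp (Equiv.mulLeft g) f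

theorem sum_inv {M : Type*} [AddCommMonoid M] (f : G → M) :
    ∑ x, f x⁻¹ = ∑ x, f x := Equiv.sum_comp (Equiv.inv G) f

theorem energy_flip (f : G → ℝ) :
    ∑ x, (∑ h, f h * f (h * x)) ^ 2 = ∑ x, (∑ h, f h * f (x * h)) ^ 2 := by
  have h1 : ∀ x, (∑ h, f h * f (h * x)) ^ 2 = ∑ h, ∑ y, f h * f (h * x) * (f (y * h) * f (y * h * x)) := by
    intro x
    rw [sq, Finset.sum_mul]
    refine Finset.sum_congr rfl fun h _ => ?_
    rw [← Finset.mul_sum]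
    congr 1
    exact (Fintype.sum_equiv (Equiv.mulRight h) _ _ (fun y => rfl)).symm
  have h2 : ∀ y, (∑ h, f h * f (y * h)) ^ 2 = ∑ h, ∑ x, f h * f (y * h) * (f (h * x) * f (y * (h * x))) := by
    intro y
    rw [sq, Finset.sum_mul]
    refine Finset.sum_congr rfl fun h _ => ?_
    rw [← Finset.mul_sum]
    congr 1
    exact (Fintype.sum_equiv (Equiv.mulLeft h) _ _ (fun y => rfl)).symm
  simp_rw [h1, h2]
  rw [Finset.sum_comm]
  have h3 : ∀ h : G, ∑ x, ∑ y, f h * f (h * x) * (f (y * h) * f (y * h * x)) =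
      ∑ y, ∑ x, f h * f (y * h) * (f (h * x) * f (y * (h * x))) := by
    intro h
    rw [Finset.sum_comm]
    refine Finset.sum_congr rfl fun y _ => Finset.sum_congr rfl fun x _ => ?_
    rw [mul_assoc y h x]; ring
  rw [Finset.sum_congr rfl fun h _ => h3 h, Finset.sum_comm]

/-- The number of representations `y = b' * b⁻¹` with `b, b' ∈ B`. -/
noncomputable def rep (B : Finset G) (y : G) : ℝ := #{h ∈ B | y * h ∈ B}

/-- The number of representations `y = b⁻¹ * b'` with `b, b' ∈ B`. -/
noncomputable def repL (B : Finset G) (y : G) : ℝ := #{h ∈ B | h * y ∈ B}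

theorem rep_eq (B : Finset G) (y : G) :
    rep B y = ∑ h, (if h ∈ B then (1:ℝ) else 0) * (if y * h ∈ B then 1 else 0) := by
  simp only [rep, Finset.card_filter, ← Finset.sum_filter, ite_mul, one_mul, zero_mul]
  simp

theorem repL_eq (B : Finset G) (y : G) :
    repL B y = ∑ h, (if h ∈ B then (1:ℝ) else 0) * (if h * y ∈ B then 1 else 0) := by
  simp only [repL, Finset.card_filter, ← Finset.sum_filter, ite_mul, one_mul, zero_mul]
  simp

theorem sum_rep_sq (B : Finset G) : ∑ y, rep B y ^ 2 = ∑ y, repL B y ^ 2 := by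
  simp_rw [rep_eq, repL_eq]
  exact (energy_flip _).symm

theorem rep_le (B : Finset G) (y : G) : rep B y ≤ #B := by
  unfold rep; exact_mod_cast Finset.card_filter_le _ _

theorem rep_nonneg (B : Finset G) (y : G) : 0 ≤ rep B y := by unfold rep; positivity

theorem sum_rep (B : Finset G) : ∑ y, rep B y = (#B : ℝ) ^ 2 := by
  simp_rw [rep_eq]
  rw [Finset.sum_comm]
  have : ∀ h : G, ∑ y, (if h ∈ B then (1:ℝ) else 0) * (if y * h ∈ B then 1 else 0) =
      (if h ∈ B then 1 else 0) * #B := by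
    intro h
    rw [← Finset.mul_sum]
    congr 1
    exact (sum_mul_right h (fun y => if y ∈ B then (1:ℝ) else 0)).trans (by simp)
  simp_rw [this, ← Finset.sum_mul]
  simp [sq]

theorem repL_le (B : Finset G) (y : G) : repL B y ≤ #B := by
  unfold repL; exact_mod_cast Finset.card_filter_le _ _

theorem repL_nonneg (B : Finset G) (y : G) : 0 ≤ repL B y := by unfold repL; positivity

theorem sum_repL (B : Finset G) : ∑ y, repL B y = (#B : ℝ) ^ 2 := by
  simp_rw [repL_eq]
  rw [Finset.sum_comm]
  have : ∀ h : G, ∑ y, (if h ∈ B then (1:ℝ) else 0) * (if h * y ∈ B then 1 else 0) =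
      (if h ∈ B then 1 else 0) * #B := by
    intro h
    rw [← Finset.mul_sum]
    congr 1
    exact (sum_mul_left h (fun y => if y ∈ B then (1:ℝ) else 0)).trans (by simp)
  simp_rw [this, ← Finset.sum_mul]
  simp [sq]

theorem repL_inv (B : Finset G) (y : G) : repL B y⁻¹ = repL B y := by
  unfold repL
  congr 1
  refine Finset.card_bij (fun h _ => h * y⁻¹) ?_ ?_ ?_
  · intro a ha; simp only [Finset.mem_filter] at ha ⊢; simpa using ha.symm
  · intro a _ b _ h; simpa using h
  · intro b hb; simp only [Finset.mem_filter] at hb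
    exact ⟨b * y, by simpa using hb.symm, by simp⟩

theorem rep_inv (B : Finset G) (y : G) : rep B y⁻¹ = rep B y := by
  unfold rep
  congr 1
  refine Finset.card_bij (fun h _ => y⁻¹ * h) ?_ ?_ ?_
  · intro a ha; simp only [Finset.mem_filter] at ha ⊢; simpa using ha.symm
  · intro a _ b _ h; simpa using h
  · intro b hb; simp only [Finset.mem_filter] at hb
    exact ⟨y * b, by simpa using hb.symm, by simp⟩

/-- A set with small difference set is commensurable to an approximate group. -/
theorem apx_of_small_diff (D : Finset G) (hD : D.Nonempty) (K : ℝ) (hK : 1 ≤ K)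
    (h : (#(D * D⁻¹) : ℝ) ≤ K * #D) :
    ∃ S : Finset G, Apx (4 * K ^ 4) S ∧ (#S : ℝ) ≤ 2 * K * #D ∧
      ∃ a, (#D : ℝ) ≤ 2 * K * #{x ∈ D | a⁻¹ * x ∈ S} := by
  have hd : (0:ℝ) < #D := by exact_mod_cast hD.card_pos
  set S : Finset G := {s | (#D : ℝ) / (2 * K) ≤ repL D s} with hS
  have memS : ∀ s, s ∈ S ↔ (#D : ℝ) / (2 * K) ≤ repL D s := by intro s; simp [hS]
  have h1S : 1 ∈ S := by
    rw [memS]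
    have : repL D 1 = #D := by unfold repL; simp
    rw [this]
    exact div_le_self hd.le (by linarith)
  have hcardS : (#S : ℝ) ≤ 2 * K * #D := by
    have : #S * ((#D : ℝ) / (2 * K)) ≤ (#D:ℝ)^2 := by
      rw [← sum_repL]
      calc _ = ∑ s ∈ S, (#D : ℝ) / (2 * K) := by simp
        _ ≤ ∑ s ∈ S, repL D s := Finset.sum_le_sum fun s hs => (memS s).1 hs
        _ ≤ _ := Finset.sum_le_sum_of_subset_of_nonneg (Finset.subset_univ _)
            fun s _ _ => repL_nonneg _ _
    rw [mul_div_assoc', div_le_iff₀ (by positivity)] at this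
    nlinarith
  have hen : (#D:ℝ)^3 / K ≤ ∑ y, repL D y ^ 2 := by
    rw [← sum_rep_sq]
    have h0 : ∀ y, y ∉ D * D⁻¹ → rep D y = 0 := by
      intro y hy
      unfold rep
      rw [Nat.cast_eq_zero, Finset.card_eq_zero, Finset.filter_eq_empty_iff]
      intro b hb hb'
      exact hy (by simpa using Finset.mul_mem_mul hb' (Finset.inv_mem_inv hb))
    have e1 : ∑ y ∈ D * D⁻¹, rep D y = (#D:ℝ)^2 := by
      rw [← sum_rep]
      exact Finset.sum_subset (Finset.subset_univ _) fun y _ hy => h0 y hy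
    have e2 : ∑ y ∈ D * D⁻¹, rep D y ^ 2 = ∑ y, rep D y ^ 2 :=
      Finset.sum_subset (Finset.subset_univ _) fun y _ hy => by simp [h0 y hy]
    have := sq_sum_le_card_mul_sum_sq (s := D * D⁻¹) (f := rep D)
    rw [e1, e2] at this
    rw [div_le_iff₀ (by linarith)]
    have hnn : 0 ≤ ∑ y, rep D y ^ 2 := by positivity
    have h3 : ((#D:ℝ)^2) ^ 2 ≤ K * #D * ∑ y, rep D y ^ 2 := this.trans (by gcongr)
    have h4 : (#D:ℝ) * (#D:ℝ)^3 ≤ #D * ((∑ y, rep D y ^ 2) * K) := by nlinarith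
    exact le_of_mul_le_mul_left h4 hd
  have hpop : (#D:ℝ)^2 / (2 * K) ≤ ∑ s ∈ S, repL D s := by
    have hsplit : ∑ y, repL D y ^ 2 ≤ #D * ∑ s ∈ S, repL D s + (#D : ℝ) / (2 * K) * (#D)^2 := by
      rw [← Finset.sum_filter_add_sum_filter_not univ (· ∈ S)]
      refine add_le_add ?_ ?_
      · rw [Finset.mul_sum]
        simp only [Finset.filter_mem_eq_inter, Finset.univ_inter]
        refine Finset.sum_le_sum fun y _ => ?_
        rw [sq]; exact mul_le_mul_of_nonneg_right (repL_le _ _) (repL_nonneg _ _)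
      · rw [← sum_repL D, Finset.mul_sum]
        calc _ ≤ ∑ y with y ∉ S, (#D : ℝ) / (2 * K) * repL D y := by
              refine Finset.sum_le_sum fun y hy => ?_
              rw [sq]
              refine mul_le_mul_of_nonneg_right ?_ (repL_nonneg _ _)
              simp only [Finset.mem_filter, memS, not_le] at hy
              exact hy.2.le
          _ ≤ _ := Finset.sum_le_sum_of_subset_of_nonneg (Finset.filter_subset _ _)
              fun s _ _ => mul_nonneg (by positivity) (repL_nonneg _ _)
    have h5 := hen.trans hsplit
    have h6 : (#D:ℝ)^3 / K = #D * ((#D:ℝ)^2 / (2*K)) + (#D : ℝ) / (2 * K) * (#D)^2 := by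
      field_simp; ring
    rw [h6] at h5
    exact le_of_mul_le_mul_left (by linarith) hd
  refine ⟨S, ⟨h1S, fun x hx => ?_, ?_⟩, hcardS, ?_⟩
  · rw [memS, repL_inv]; exact (memS x).1 hx
  · have hDS : (#D:ℝ) ≤ 2 * K * #S := by
      have : ∑ s ∈ S, repL D s ≤ #S * #D := by
        calc _ ≤ ∑ s ∈ S, (#D:ℝ) := Finset.sum_le_sum fun s _ => repL_le _ _
          _ = _ := by simp
      have h7 := hpop.trans this
      rw [div_le_iff₀ (by positivity)] at h7
      nlinarith
    have step : ∀ n, (#(D * S ^ n * D⁻¹) : ℝ) ≤ (2 * K^2)^n * (K * #D) := by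
      intro n
      induction n with
      | zero => simpa using h
      | succ n ih =>
        have key : #(D * S ^ (n+1) * D⁻¹) * ((#D:ℝ) / (2*K)) ≤ #((D * S^n * D⁻¹) ×ˢ (D * D⁻¹)) := by
          refine card_mul_le_of_fiber_ge (fun z : G × G => z.1 * z.2) _ _ _ ?_
          intro y hy
          obtain ⟨u, hu, d, hd', rfl⟩ := Finset.mem_mul.1 hy
          rw [pow_succ, ← mul_assoc] at hu
          obtain ⟨w, hw, s, hs, rfl⟩ := Finset.mem_mul.1 hu
          refine ((memS s).1 hs).trans ?_
          unfold repL
          rw [Nat.cast_le]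
          refine Finset.card_le_card_of_injOn (fun b => (w * b⁻¹, b * s * d)) ?_ ?_
          · intro b hb
            simp only [Finset.coe_filter, Set.mem_ofPred_eq] at hb
            simp only [Finset.coe_filter, Finset.mem_product, Set.mem_ofPred_eq]
            exact ⟨⟨Finset.mul_mem_mul hw (Finset.inv_mem_inv hb.1), Finset.mul_mem_mul hb.2 hd'⟩, by group⟩
          · intro b _ b' _ hbb
            simpa using congrArg Prod.fst hbb
        rw [Finset.card_product, Nat.cast_mul, mul_div_assoc', div_le_iff₀ (by positivity)] at key
        have : (#(D * S ^ (n+1) * D⁻¹) : ℝ) * #D ≤ (2*K^2)^(n+1) * (K * #D) * #D := by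
          calc _ ≤ _ := key
            _ ≤ ((2 * K^2)^n * (K * #D)) * (K * #D) * (2 * K) := by gcongr
            _ = _ := by ring
        exact le_of_mul_le_mul_right this hd
    intro n
    rcases Nat.eq_zero_or_pos n with rfl | hn
    · simp only [pow_zero, one_mul, Finset.card_one]
      exact_mod_cast Finset.card_pos.2 ⟨1, h1S⟩
    · have e1 : #(S^n) ≤ #(D * S ^ n * D⁻¹) := by
        obtain ⟨d, hd'⟩ := hD
        calc #(S^n) ≤ #(D * S^n) := Finset.card_le_card_mul_left ⟨d, hd'⟩
          _ ≤ _ := Finset.card_le_card_mul_right ⟨d⁻¹, Finset.inv_mem_inv hd'⟩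
      calc (#(S^n):ℝ) ≤ (#(D * S ^ n * D⁻¹):ℝ) := by exact_mod_cast e1
        _ ≤ (2 * K^2)^n * (K * #D) := step n
        _ ≤ (2 * K^2)^n * (K * (2 * K * #S)) := by gcongr
        _ = (2 * K^2)^n * (2*K^2) * #S := by ring
        _ ≤ (2 * K^2)^n * (2*K^2)^n * #S := by
            gcongr
            exact le_self_pow₀ (by nlinarith) (by omega)
        _ = _ := by rw [← mul_pow]; ring_nf
  · by_contra hcon
    push Not at hcon
    have hDD : ∑ s ∈ S, repL D s = ∑ a ∈ D, (#{x ∈ D | a⁻¹ * x ∈ S} : ℝ) := by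
      unfold repL
      push_cast [Finset.card_filter]
      rw [Finset.sum_comm]
      refine Finset.sum_congr rfl fun a _ => ?_
      rw [← Finset.sum_filter, ← Finset.sum_filter]
      refine Finset.sum_bij (fun s _ => a * s) ?_ ?_ ?_ ?_
      · intro s hs; simpa [and_comm] using hs
      · intro s _ s' _ h; simpa using h
      · intro x hx; exact ⟨a⁻¹ * x, by simpa [and_comm] using hx, by simp⟩
      · simp
    rw [hDD] at hpop
    have : ∑ a ∈ D, (#{x ∈ D | a⁻¹ * x ∈ S} : ℝ) < ∑ a ∈ D, (#D:ℝ) / (2*K) := by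
      refine Finset.sum_lt_sum_of_nonempty hD fun a _ => ?_
      rw [lt_div_iff₀ (by positivity)]
      linarith [hcon a]
    simp only [Finset.sum_const, nsmul_eq_mul] at this
    have e : (#D:ℝ) * ((#D:ℝ) / (2*K)) = (#D:ℝ)^2 / (2*K) := by ring
    linarith

end Fin

variable {G : Type*} [Group G] [Fintype G]

set_option maxHeartbeats 1000000 in
/-- Balog–Szemerédi–Gowers for a set. -/
theorem small_diff_of_energy (B : Finset G) (hB : B.Nonempty) (K : ℝ) (hK : 1 ≤ K)
    (hE : (#B : ℝ)^3 / K ≤ ∑ y, rep B y ^ 2) :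
    ∃ D ⊆ B, (#B : ℝ) ≤ 6 * K * #D ∧ (#(D * D⁻¹) : ℝ) ≤ 2^22 * K^10 * #D := by
  set n : ℝ := (#B : ℝ) with hn
  have hn0 : 0 < n := by rw [hn]; exact_mod_cast hB.card_pos
  set P : Finset G := {y | n / (2*K) ≤ rep B y} with hP
  have memP : ∀ y, y ∈ P ↔ n / (2*K) ≤ rep B y := by intro y; simp [hP]
  have Pinv : ∀ y, y⁻¹ ∈ P ↔ y ∈ P := by intro y; rw [memP, memP, rep_inv]
  have hcardP : (#P : ℝ) ≤ 2 * K * n := by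
    have : #P * (n / (2 * K)) ≤ n^2 := by
      rw [hn, ← sum_rep]
      calc _ = ∑ s ∈ P, n / (2 * K) := by simp [hn]
        _ ≤ ∑ s ∈ P, rep B s := Finset.sum_le_sum fun s hs => (memP s).1 hs
        _ ≤ _ := Finset.sum_le_sum_of_subset_of_nonneg (Finset.subset_univ _)
            fun s _ _ => rep_nonneg _ _
    rw [mul_div_assoc', div_le_iff₀ (by positivity)] at this
    nlinarith
  have hpop : n^2 / (2 * K) ≤ ∑ s ∈ P, rep B s := by
    have hsplit : ∑ y, rep B y ^ 2 ≤ n * ∑ s ∈ P, rep B s + n / (2 * K) * n^2 := by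
      rw [← Finset.sum_filter_add_sum_filter_not univ (· ∈ P)]
      refine add_le_add ?_ ?_
      · rw [Finset.mul_sum]
        simp only [Finset.filter_mem_eq_inter, Finset.univ_inter]
        refine Finset.sum_le_sum fun y _ => ?_
        rw [sq]; exact mul_le_mul_of_nonneg_right (rep_le _ _) (rep_nonneg _ _)
      · rw [hn, ← sum_rep B, Finset.mul_sum, ← hn]
        calc _ ≤ ∑ y with y ∉ P, n / (2 * K) * rep B y := by
              refine Finset.sum_le_sum fun y hy => ?_
              rw [sq]
              refine mul_le_mul_of_nonneg_right ?_ (rep_nonneg _ _)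
              simp only [Finset.mem_filter, memP, not_le] at hy
              exact hy.2.le
          _ ≤ _ := Finset.sum_le_sum_of_subset_of_nonneg (Finset.filter_subset _ _)
              fun s _ _ => mul_nonneg (by positivity) (rep_nonneg _ _)
    have h5 := hE.trans hsplit
    have h6 : n^3 / K = n * (n^2 / (2*K)) + n / (2 * K) * n^2 := by
      field_simp; ring
    rw [h6] at h5
    exact le_of_mul_le_mul_left (by linarith) hn0
  let N : G → Finset G := fun z => {x ∈ B | x * z⁻¹ ∈ P}
  have memN : ∀ z x, x ∈ N z ↔ x ∈ B ∧ x * z⁻¹ ∈ P := by intro z x; simp [N]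
  have symN : ∀ x ∈ B, ∀ z ∈ B, (x ∈ N z ↔ z ∈ N x) := by
    intro x hx z hz
    rw [memN, memN, ← Pinv (z * x⁻¹)]
    simp [hx, hz]
  have hedges : n^2 / (2*K) ≤ ∑ z ∈ B, (#(N z) : ℝ) := by
    refine hpop.trans_eq ?_
    unfold rep
    simp only [N]
    push_cast [Finset.card_filter]
    rw [Finset.sum_comm]
    refine Finset.sum_congr rfl fun z _ => ?_
    rw [← Finset.sum_filter, ← Finset.sum_filter]
    refine Finset.sum_bij (fun s _ => s * z) ?_ ?_ ?_ ?_
    · intro s hs; simpa [and_comm] using hs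
    · intro s _ s' _ h; simpa using h
    · intro x hx; exact ⟨x * z⁻¹, by simpa [and_comm] using hx, by simp⟩
    · simp
  set ε : ℝ := 1 / (64 * K^2) with hε
  have h6 : (n / (6 * K) * (ε * n)^2) = n^3 / (24576 * K^5) := by
    rw [hε]; clear_value n; field_simp; norm_num
  let bad : G → G → Prop := fun x y => (#(N x ∩ N y) : ℝ) < ε * n
  have hsq : n^3 / (4*K^2) ≤ ∑ z ∈ B, (#(N z) : ℝ)^2 := by
    have := sq_sum_le_card_mul_sum_sq (s := B) (f := fun z => (#(N z) : ℝ))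
    have h2 : (n^2 / (2*K))^2 ≤ n * ∑ z ∈ B, (#(N z) : ℝ)^2 :=
      (pow_le_pow_left₀ (by positivity) hedges 2).trans this
    refine le_of_mul_le_mul_left ?_ hn0
    calc n * (n^3 / (4*K^2)) = (n^2 / (2*K))^2 := by field_simp; ring
      _ ≤ _ := h2
  let Bd : G → Finset (G × G) := fun z =>
    {w ∈ B ×ˢ B | (w.1 ∈ N z ∧ w.2 ∈ N z) ∧ bad w.1 w.2}
  have hbad : ∑ z ∈ B, (#(Bd z) : ℝ) ≤ ε * n^3 := by
    simp only [Bd]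
    push_cast [Finset.card_filter]
    rw [Finset.sum_comm]
    have : ∀ w ∈ B ×ˢ B, ∑ z ∈ B, (if (w.1 ∈ N z ∧ w.2 ∈ N z) ∧ bad w.1 w.2 then (1:ℝ) else 0) ≤ ε * n := by
      intro w hw
      rw [Finset.mem_product] at hw
      by_cases hb : bad w.1 w.2
      · simp only [hb, and_true]
        refine le_trans ?_ (show (#(N w.1 ∩ N w.2) : ℝ) ≤ ε * n from le_of_lt hb)
        rw [← Finset.sum_filter]
        simp only [Finset.sum_const, nsmul_eq_mul, mul_one, Nat.cast_le]
        refine Finset.card_le_card fun z hz => ?_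
        rw [Finset.mem_filter] at hz
        exact Finset.mem_inter.2 ⟨(symN _ hw.1 _ hz.1).1 hz.2.1, (symN _ hw.2 _ hz.1).1 hz.2.2⟩
      · simp only [hb, and_false, if_false, Finset.sum_const_zero]; positivity
    calc _ ≤ ∑ w ∈ B ×ˢ B, ε * n := Finset.sum_le_sum this
      _ = _ := by simp only [Finset.sum_const, Finset.card_product, nsmul_eq_mul]; push_cast; rw [← hn]; ring
  obtain ⟨z, hz, hz2⟩ : ∃ z ∈ B, n^2 / (8*K^2) + 8 * #(Bd z) ≤ (#(N z) : ℝ)^2 := by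
    by_contra hcon
    push Not at hcon
    have h1 := Finset.sum_lt_sum_of_nonempty hB hcon
    rw [Finset.sum_add_distrib, ← Finset.mul_sum] at h1
    simp only [Finset.sum_const, nsmul_eq_mul] at h1
    rw [← hn] at h1
    have h2 : n * (n^2 / (8*K^2)) + 8 * (ε * n^3) = n^3 / (4*K^2) := by
      rw [hε]; field_simp; ring
    linarith
  set B' := N z with hB'
  have hB'B : B' ⊆ B := fun x hx => ((memN z x).1 hx).1
  have hB'c : n ≤ 3 * K * #B' := by
    have : n^2 / (8*K^2) ≤ (#B' : ℝ)^2 := by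
      have : (0:ℝ) ≤ #(Bd z) := by positivity
      linarith
    rw [div_le_iff₀ (by positivity)] at this
    refine le_of_sq_le_sq ?_ (by positivity)
    nlinarith [sq_nonneg (K * #B')]
  have hB'0 : (0:ℝ) < #B' := by
    by_contra h
    have : (#B':ℝ) = 0 := le_antisymm (not_lt.1 h) (by positivity)
    rw [this] at hB'c; linarith
  set D : Finset G := {x ∈ B' | 4 * #{y ∈ B' | bad x y} ≤ #B'} with hD
  have hDB' : D ⊆ B' := Finset.filter_subset _ _
  have hDc : (#B' : ℝ) ≤ 2 * #D := by
    have h1 : (#(B' \ D) : ℝ) * (#B' / 4) ≤ #(Bd z) := by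
      refine card_mul_le_of_fiber_ge (fun w : G × G => w.1) _ _ _ fun x hx => ?_
      rw [Finset.mem_sdiff] at hx
      have hx2 : #B' < 4 * #{y ∈ B' | bad x y} := by
        by_contra h; exact hx.2 (Finset.mem_filter.2 ⟨hx.1, not_lt.1 h⟩)
      have hx3 : (#B' : ℝ) / 4 ≤ #{y ∈ B' | bad x y} := by
        have : (#B' : ℝ) < 4 * #{y ∈ B' | bad x y} := by exact_mod_cast hx2
        linarith
      refine hx3.trans ?_
      rw [Nat.cast_le]
      refine Finset.card_le_card_of_injOn (fun y => (x, y)) ?_ ?_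
      · intro y hy
        simp only [Finset.coe_filter, Set.mem_ofPred_eq] at hy
        exact Finset.mem_filter.2 ⟨Finset.mem_filter.2 ⟨Finset.mem_product.2
          ⟨hB'B hx.1, hB'B hy.1⟩, ⟨hx.1, hy.1⟩, hy.2⟩, rfl⟩
      · intro y _ y' _ h; simpa using h
    have h2 : 8 * (#(Bd z) : ℝ) ≤ #B' ^ 2 := by
      have : 0 ≤ n^2 / (8*K^2) := by positivity
      linarith
    have h3 : (#(B' \ D) : ℝ) + #D = #B' := by
      exact_mod_cast Finset.card_sdiff_add_card_eq_card hDB'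
    nlinarith
  refine ⟨D, hDB'.trans hB'B, by nlinarith, ?_⟩
  have key : (#(D * D⁻¹) : ℝ) * (#B' / 2 * (ε * n)^2) ≤ #((P ×ˢ P) ×ˢ (P ×ˢ P)) := by
    refine card_mul_le_of_fiber_ge (fun w : (G × G) × (G × G) => (w.1.1 * w.1.2) * (w.2.1 * w.2.2)) _ _ _ fun y hy => ?_
    obtain ⟨b, hb, c, hc, rfl⟩ := Finset.mem_mul.1 hy
    obtain ⟨b', hb', rfl⟩ : ∃ b' ∈ D, b'⁻¹ = c := ⟨c⁻¹, by simpa using hc, inv_inv c⟩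
    set M : Finset G := {x ∈ B' | ¬ bad b x ∧ ¬ bad b' x} with hM
    have hMc : (#B' : ℝ) / 2 ≤ #M := by
      have e1 : #B' ≤ #M + (#{y ∈ B' | bad b y} + #{y ∈ B' | bad b' y}) := by
        refine le_trans (Finset.card_le_card ?_) ((Finset.card_union_le _ _).trans (Nat.add_le_add_left (Finset.card_union_le _ _) _))
        intro x hx
        simp only [hM, Finset.mem_union, Finset.mem_filter]
        tauto
      have e2 := (Finset.mem_filter.1 hb).2
      have e3 := (Finset.mem_filter.1 hb').2
      have : #B' ≤ 2 * #M := by omega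
      have : (#B' : ℝ) ≤ 2 * #M := by exact_mod_cast this
      linarith
    have hsig : (#M : ℝ) * (ε * n)^2 ≤ #(M.sigma fun x => (N b ∩ N x) ×ˢ (N b' ∩ N x)) := by
      rw [Finset.card_sigma]
      push_cast
      calc (#M : ℝ) * (ε * n)^2 = ∑ x ∈ M, (ε * n)^2 := by simp
        _ ≤ _ := by
          refine Finset.sum_le_sum fun x hx => ?_
          have hx := (Finset.mem_filter.1 hx).2
          simp only [bad, not_lt] at hx
          rw [Finset.card_product, sq]; push_cast
          exact mul_le_mul hx.1 hx.2 (by positivity) (by positivity)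
    refine le_trans ?_ (hsig.trans ?_)
    · gcongr
    · rw [Nat.cast_le]
      refine Finset.card_le_card_of_injOn
        (fun w => ((b * w.2.1⁻¹, w.2.1 * w.1⁻¹), (w.1 * w.2.2⁻¹, w.2.2 * b'⁻¹))) ?_ ?_
      · rintro ⟨x, u, v⟩ hw
        simp only [Finset.coe_sigma, Set.mem_sigma_iff, Finset.mem_coe, Finset.mem_product, Finset.mem_inter] at hw
        obtain ⟨hx, ⟨hu1, hu2⟩, hv1, hv2⟩ := hw
        simp only [Finset.coe_filter, Finset.mem_product, Set.mem_ofPred_eq]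
        refine ⟨⟨⟨?_, ((memN _ _).1 hu2).2⟩, ?_, ((memN _ _).1 hv1).2⟩, by group⟩
        · rw [← Pinv]; simpa using ((memN _ _).1 hu1).2
        · rw [← Pinv]; simpa using ((memN _ _).1 hv2).2
      · rintro ⟨x, u, v⟩ _ ⟨x', u', v'⟩ _ h
        simp only [Prod.mk.injEq, mul_right_inj, mul_left_inj, inv_inj] at h
        obtain ⟨⟨rfl, h2⟩, h3, rfl⟩ := h
        simp only [mul_right_inj, inv_inj] at h2
        subst h2; rfl
  simp only [Finset.card_product, Nat.cast_mul] at key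
  have hP4 : (#P : ℝ) * #P * (#P * #P) ≤ (2 * K * n)^4 := by
    calc (#P : ℝ) * #P * (#P * #P) = (#P:ℝ)^4 := by ring
      _ ≤ _ := by gcongr
  have h4 := key.trans hP4
  have h5 : (#(D * D⁻¹) : ℝ) * (n / (6 * K) * (ε * n)^2) ≤ (2 * K * n)^4 := by
    refine le_trans (mul_le_mul_of_nonneg_left (mul_le_mul_of_nonneg_right ?_ (by positivity))
      (by positivity)) h4
    rw [div_le_div_iff₀ (by positivity) (by norm_num)]
    linarith
  rw [h6, mul_div_assoc', div_le_iff₀ (by positivity)] at h5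
  have h7 : (#(D * D⁻¹) : ℝ) ≤ 2^19 * K^9 * n := by
    refine le_of_mul_le_mul_right (h5.trans ?_) (pow_pos hn0 3)
    calc _ = 393216 * K^9 * n * n^3 := by ring
      _ ≤ _ := by gcongr; norm_num
  calc _ ≤ _ := h7
    _ ≤ 2^19 * K^9 * (6 * K * #D) := by gcongr; nlinarith
    _ = (2^19*6) * K^10 * #D := by ring
    _ ≤ _ := by gcongr; norm_num

variable {G : Type*} [Group G] [Fintype G]

/-- The quadrilinear multiplicative energy. -/
noncomputable def en4 (f₁ f₂ f₃ f₄ : G → ℝ) : ℝ :=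
  ∑ y, (∑ h, f₁ h * f₂ (y * h)) * (∑ m, f₃ m * f₄ (y * m))

theorem en4_swap (f₁ f₂ f₃ f₄ : G → ℝ) : en4 f₁ f₂ f₃ f₄ = en4 f₃ f₄ f₁ f₂ := by
  unfold en4; exact Finset.sum_congr rfl fun y _ => mul_comm _ _

theorem en4_flip (f₁ f₂ f₃ f₄ : G → ℝ) : en4 f₁ f₂ f₃ f₄ = en4 f₂ f₁ f₄ f₃ := by
  unfold en4
  rw [← sum_inv]
  refine Finset.sum_congr rfl fun y _ => ?_
  congr 1
  · rw [← sum_mul_left y]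
    exact Finset.sum_congr rfl fun h _ => by rw [inv_mul_cancel_left, mul_comm]
  · rw [← sum_mul_left y]
    exact Finset.sum_congr rfl fun h _ => by rw [inv_mul_cancel_left, mul_comm]

theorem en4_mono {f₁ f₂ f₃ f₄ g₁ g₂ g₃ g₄ : G → ℝ} (h1 : ∀ x, 0 ≤ f₁ x) (h2 : ∀ x, 0 ≤ f₂ x)
    (h3 : ∀ x, 0 ≤ f₃ x) (h4 : ∀ x, 0 ≤ f₄ x) (k1 : ∀ x, f₁ x ≤ g₁ x) (k2 : ∀ x, f₂ x ≤ g₂ x)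
    (k3 : ∀ x, f₃ x ≤ g₃ x) (k4 : ∀ x, f₄ x ≤ g₄ x) : en4 f₁ f₂ f₃ f₄ ≤ en4 g₁ g₂ g₃ g₄ := by
  unfold en4
  refine Finset.sum_le_sum fun y _ => mul_le_mul ?_ ?_ ?_ ?_
  · exact Finset.sum_le_sum fun h _ => mul_le_mul (k1 _) (k2 _) (h2 _) ((h1 _).trans (k1 _))
  · exact Finset.sum_le_sum fun h _ => mul_le_mul (k3 _) (k4 _) (h4 _) ((h3 _).trans (k3 _))
  · exact Finset.sum_nonneg fun h _ => mul_nonneg (h3 _) (h4 _)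
  · exact Finset.sum_nonneg fun h _ => mul_nonneg ((h1 _).trans (k1 _)) ((h2 _).trans (k2 _))

theorem en4_add_left (f f' f₂ f₃ f₄ : G → ℝ) :
    en4 (fun x => f x + f' x) f₂ f₃ f₄ = en4 f f₂ f₃ f₄ + en4 f' f₂ f₃ f₄ := by
  simp only [en4, add_mul, Finset.sum_add_distrib]

theorem en4_const (c : ℝ) (f₂ f₃ f₄ : G → ℝ) :
    en4 (fun _ => c) f₂ f₃ f₄ = c * (∑ x, f₂ x) * (∑ x, f₃ x) * (∑ x, f₄ x) := by
  have : ∀ y : G, ∑ h, c * f₂ (y * h) = c * ∑ x, f₂ x := fun y => by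
    rw [← Finset.mul_sum, sum_mul_left y]
  simp only [en4, this]
  rw [← Finset.mul_sum, Finset.sum_comm]
  have : ∀ m : G, ∑ y, f₃ m * f₄ (y * m) = f₃ m * ∑ x, f₄ x := fun y => by
    rw [← Finset.mul_sum, sum_mul_right y]
  simp only [this]
  rw [← Finset.sum_mul]; ring

theorem en4_le_sq (u β : G → ℝ) (hu : ∀ x, 0 ≤ u x) (hβ : ∀ x, 0 ≤ β x) :
    en4 u β β β ≤ (∑ x, u x) * (∑ x, β x) * ∑ x, β x ^ 2 := by
  have cs : ∀ h m : G, ∑ y, β (y * h) * β (y * m) ≤ ∑ x, β x ^ 2 := by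
    intro h m
    have e1 := sum_mul_right h (fun x => β x ^ 2)
    have e2 := sum_mul_right m (fun x => β x ^ 2)
    have : ∑ y, β (y * h) * β (y * m) ≤ ∑ y, (β (y * h) ^ 2 + β (y * m) ^ 2) / 2 :=
      Finset.sum_le_sum fun y _ => by nlinarith [sq_nonneg (β (y * h) - β (y * m))]
    rw [← Finset.sum_div, Finset.sum_add_distrib, e1, e2] at this
    linarith
  have : en4 u β β β = ∑ h, ∑ m, u h * β m * ∑ y, β (y * h) * β (y * m) := by
    unfold en4
    simp_rw [Finset.sum_mul_sum]
    rw [Finset.sum_comm]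
    refine Finset.sum_congr rfl fun h _ => ?_
    rw [Finset.sum_comm]
    refine Finset.sum_congr rfl fun m _ => ?_
    rw [Finset.mul_sum]
    exact Finset.sum_congr rfl fun y _ => by ring
  rw [this, Finset.sum_mul_sum, Finset.sum_mul]
  refine Finset.sum_le_sum fun h _ => ?_
  rw [Finset.sum_mul]
  exact Finset.sum_le_sum fun m _ => mul_le_mul_of_nonneg_left (cs h m) (mul_nonneg (hu h) (hβ m))

theorem en4_sub_le (β b : G → ℝ) (hb : ∀ x, 0 ≤ b x) (hbβ : ∀ x, b x ≤ β x) :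
    en4 β β β β ≤ en4 b b b b + 4 * en4 (fun x => β x - b x) β β β := by
  have hβ : ∀ x, 0 ≤ β x := fun x => (hb x).trans (hbβ x)
  set u := fun x => β x - b x with hu
  have hu0 : ∀ x, 0 ≤ u x := fun x => sub_nonneg.2 (hbβ x)
  have hsum : β = fun x => b x + u x := by ext x; simp [hu]
  have s1 : en4 β β β β = en4 b β β β + en4 u β β β := by
    conv_lhs => rw [show en4 β β β β = en4 (fun x => b x + u x) β β β by rw [← hsum]]
    exact en4_add_left _ _ _ _ _
  have s2 : en4 b β β β ≤ en4 b b β β + en4 u β β β := by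
    rw [en4_flip b, show en4 β b β β = en4 (fun x => b x + u x) b β β by rw [← hsum], en4_add_left]
    exact add_le_add le_rfl (en4_mono hu0 hb hβ hβ (fun _ => le_rfl) hbβ (fun _ => le_rfl) (fun _ => le_rfl))
  have s3 : en4 b b β β ≤ en4 b b b β + en4 u β β β := by
    rw [en4_swap b, show en4 β β b b = en4 (fun x => b x + u x) β b b by rw [← hsum], en4_add_left,
      en4_swap b b b β]
    exact add_le_add le_rfl (en4_mono hu0 hβ hb hb (fun _ => le_rfl) (fun _ => le_rfl) hbβ hbβ)
  have s4 : en4 b b b β ≤ en4 b b b b + en4 u β β β := by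
    rw [en4_flip b b b β, en4_swap b b β b, show en4 β b b b = en4 (fun x => b x + u x) b b b by rw [← hsum], en4_add_left]
    exact add_le_add le_rfl (en4_mono hu0 hb hb hb (fun _ => le_rfl) hbβ hbβ hbβ)
  linarith

set_option maxRecDepth 4000 in
set_option maxHeartbeats 1000000 in
/-- Balog–Szemerédi–Gowers together with Tao's construction, for a subprobability weight. -/
theorem bsg (β : G → ℝ) (hβ : ∀ x, 0 ≤ β x) (h1 : ∑ x, β x ≤ 1) (δ : ℝ) (hδ : 0 < δ) (hδ1 : δ ≤ 1)
    (hs : 0 < ∑ x, β x ^ 2)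
    (hE : δ * ∑ x, β x ^ 2 ≤ ∑ x, (∑ h, β h * β (h * x)) ^ 2) :
    ∃ A : Finset G, Apx ((16/δ)^400) A ∧ (#A * ∑ x, β x ^ 2 ≤ (16/δ)^400) ∧
      ∃ a, 1 ≤ (16/δ)^400 * ∑ x with a⁻¹ * x ∈ A, β x := by
  set s := ∑ x, β x ^ 2 with hsdef
  set t : ℝ := 16/δ with ht
  have ht16 : 16 ≤ t := by rw [ht, le_div_iff₀ hδ]; linarith
  have ht0 : 0 < t := by linarith
  have hδt : δ = 16 / t := by rw [ht]; field_simp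
  obtain ⟨B, memB⟩ : ∃ B : Finset G, ∀ x, x ∈ B ↔ s / t ≤ β x ∧ β x ≤ s * t :=
    ⟨univ.filter fun x => s / t ≤ β x ∧ β x ≤ s * t, by simp⟩
  set b : G → ℝ := fun x => if x ∈ B then β x else 0 with hb
  have hb0 : ∀ x, 0 ≤ b x := fun x => by simp only [hb]; split_ifs; exacts [hβ x, le_rfl]
  have hbβ : ∀ x, b x ≤ β x := fun x => by simp only [hb]; split_ifs; exacts [le_rfl, hβ x]
  have hEβ : 16 / t * s ≤ en4 β β β β := by
    rw [← hδt]
    refine hE.trans_eq ?_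
    rw [energy_flip]; unfold en4; simp only [sq]
  clear hδt
  have hhi : ∑ x, (if s * t < β x then β x else 0) ≤ 1 / t := by
    have : s * t * ∑ x, (if s * t < β x then β x else 0) ≤ s := by
      rw [Finset.mul_sum, hsdef]
      refine Finset.sum_le_sum fun x _ => ?_
      split_ifs with h
      · nlinarith [hβ x]
      · rw [mul_zero]; positivity
    rw [le_div_iff₀ ht0]
    exact le_of_mul_le_mul_left (by linarith) hs
  have hu : en4 (fun x => β x - b x) β β β ≤ 2 * (s / t) := by
    have p0 : 0 ≤ ∑ x, β x := Finset.sum_nonneg fun x _ => hβ x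
    calc en4 (fun x => β x - b x) β β β ≤ en4 (fun x => (s / t) + (if s * t < β x then β x else 0)) β β β := by
          refine en4_mono (fun x => sub_nonneg.2 (hbβ x)) hβ hβ hβ (fun x => ?_) (fun _ => le_rfl) (fun _ => le_rfl) (fun _ => le_rfl)
          have : 0 < s / t := by positivity
          simp only [hb]
          by_cases hx : x ∈ B
          · rw [if_pos hx]; split_ifs <;> linarith [hβ x]
          · rw [if_neg hx]
            rw [memB, not_and_or, not_le, not_le] at hx
            split_ifs with h
            · linarith
            · rcases hx with hx | hx
              · linarith
              · exact absurd hx h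
      _ = en4 (fun x => s / t) β β β + en4 (fun x => (if s * t < β x then β x else 0)) β β β := en4_add_left _ _ _ _ _
      _ ≤ s / t * 1 * 1 * 1 + 1 / t * 1 * s := by
          refine add_le_add ?_ ?_
          · rw [en4_const]; gcongr
          · refine (en4_le_sq _ _ (fun x => by split_ifs; exacts [hβ x, le_rfl]) hβ).trans ?_
            rw [← hsdef]
            gcongr

      _ = _ := by ring
  have hEb : 8 / t * s ≤ en4 b b b b := by
    have := en4_sub_le β b hb0 hbβ
    have e : 16 / t * s = 8 / t * s + 4 * (2 * (s/t)) := by ring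
    linarith
  have hEB : 8 / t * s ≤ (s * t)^4 * ∑ y, rep B y ^ 2 := by
    refine hEb.trans ?_
    have : en4 b b b b ≤ en4 (fun x => s * t * if x ∈ B then 1 else 0) (fun x => s * t * if x ∈ B then 1 else 0) (fun x => s * t * if x ∈ B then 1 else 0) (fun x => s * t * if x ∈ B then 1 else 0) := by
      have h : ∀ x, b x ≤ s * t * if x ∈ B then 1 else 0 := by
        intro x; simp only [hb]; split_ifs with h
        · rw [mul_one]; exact ((memB x).1 h).2
        · simp
      exact en4_mono hb0 hb0 hb0 hb0 h h h h
    refine this.trans_eq ?_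
    unfold en4
    rw [Finset.mul_sum]
    refine Finset.sum_congr rfl fun y _ => ?_
    rw [rep_eq]
    have : ∑ h : G, s * t * (if h ∈ B then (1:ℝ) else 0) * (s * t * if y * h ∈ B then 1 else 0) =
      (s * t)^2 * ∑ h, (if h ∈ B then (1:ℝ) else 0) * (if y * h ∈ B then 1 else 0) := by
      rw [Finset.mul_sum]; exact Finset.sum_congr rfl fun h _ => by ring
    rw [this]; ring
  have hBle : #B * s ≤ t := by
    have : #B * (s / t) ≤ 1 := by
      calc #B * (s/t) = ∑ x ∈ B, s / t := by simp
        _ ≤ ∑ x ∈ B, β x := Finset.sum_le_sum fun x hx => ((memB x).1 hx).1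
        _ ≤ ∑ x, β x := Finset.sum_le_sum_of_subset_of_nonneg (Finset.subset_univ _) fun x _ _ => hβ x
        _ ≤ 1 := h1
    rwa [mul_div_assoc', div_le_iff₀ ht0, one_mul] at this
  have hlow : 8 ≤ s^3 * t^5 * ∑ y, rep B y ^ 2 := by
    have : s / t * 8 ≤ s / t * (s^3 * t^5 * ∑ y, rep B y ^ 2) := by
      calc s / t * 8 = 8 / t * s := by ring
        _ ≤ _ := hEB
        _ = _ := by field_simp
    exact le_of_mul_le_mul_left this (by positivity)
  have hen3 : ∑ y, rep B y ^ 2 ≤ (#B:ℝ)^3 := by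
    calc _ ≤ ∑ y, #B * rep B y := Finset.sum_le_sum fun y _ => by
            rw [sq]; exact mul_le_mul_of_nonneg_right (rep_le _ _) (rep_nonneg _ _)
      _ = _ := by rw [← Finset.mul_sum, sum_rep]; ring
  have hBge : 1 ≤ t^2 * (#B * s) := by
    have : 1 ≤ (t^2 * (#B * s))^3 := by
      calc (1:ℝ) ≤ 8 := by norm_num
        _ ≤ _ := hlow
        _ ≤ s^3 * t^5 * (#B:ℝ)^3 := by gcongr
        _ = t^5 * (#B * s)^3 := by ring
        _ ≤ t^6 * (#B * s)^3 := by gcongr <;> linarith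
        _ = _ := by ring
    by_contra hc
    push Not at hc
    exact absurd this (not_le.2 (pow_lt_one₀ (by positivity) hc (by norm_num)))
  have hBn : B.Nonempty := by
    rw [Finset.nonempty_iff_ne_empty]
    intro h
    rw [h] at hBge; simp at hBge; linarith
  have hB0 : (0:ℝ) < #B := by exact_mod_cast hBn.card_pos
  obtain ⟨D, hDB, hD1, hD2⟩ := small_diff_of_energy B hBn (t^8) (one_le_pow₀ (by linarith)) (by
    rw [div_le_iff₀ (by positivity)]
    have : (#B * s)^3 ≤ t^3 := by gcongr
    have h0 : 0 ≤ ∑ y, rep B y ^ 2 := by positivity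
    refine le_of_mul_le_mul_left ?_ (pow_pos hs 3)
    calc s^3 * (#B:ℝ)^3 = (#B * s)^3 := by ring
      _ ≤ t^3 := this
      _ ≤ t^3 * (s^3 * t^5 * ∑ y, rep B y ^ 2) := le_mul_of_one_le_right (by positivity) (by linarith)
      _ = _ := by ring)
  have hD0 : (0:ℝ) < #D := by
    by_contra h
    have : (#D:ℝ) = 0 := le_antisymm (not_lt.1 h) (by positivity)
    rw [this] at hD1; linarith
  have h16 : (2:ℝ)^22 ≤ t^6 := by
    calc (2:ℝ)^22 ≤ 16^6 := by norm_num
      _ ≤ _ := by gcongr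
  obtain ⟨S, hS1, hS2, a, ha⟩ := apx_of_small_diff D (Finset.card_pos.1 (by exact_mod_cast hD0)) (t^86)
    (one_le_pow₀ (by linarith)) (hD2.trans (by
      gcongr
      calc (2:ℝ)^22 * (t^8)^10 ≤ t^6 * (t^8)^10 := by gcongr
        _ = t^86 := by ring))
  have ht400 : ∀ n : ℕ, n ≤ 400 → t^n ≤ t^400 := fun n hn => pow_le_pow_right₀ (by linarith) hn
  have h4t : (4:ℝ) ≤ t := by linarith
  refine ⟨S, hS1.mono (by positivity) ?_, ?_, a, ?_⟩
  · calc 4 * (t^86)^4 ≤ t * (t^86)^4 := by gcongr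
      _ = t^345 := by rw [← pow_mul, ← pow_succ']
      _ ≤ t^400 := ht400 _ (by norm_num)
  · calc #S * s ≤ (2 * t^86 * #D) * s := by gcongr
      _ ≤ (2 * t^86 * #B) * s := by gcongr
      _ = 2 * t^86 * (#B * s) := by ring
      _ ≤ t * t^86 * t := by gcongr; linarith
      _ = t^88 := by ring
      _ ≤ t^400 := ht400 _ (by norm_num)
  · have e1 : (#{x ∈ D | a⁻¹ * x ∈ S} : ℝ) * (s / t) ≤ ∑ x with a⁻¹ * x ∈ S, β x := by
      calc _ = ∑ x ∈ D with a⁻¹ * x ∈ S, s / t := by simp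
        _ ≤ ∑ x ∈ D with a⁻¹ * x ∈ S, β x := Finset.sum_le_sum fun x hx =>
            ((memB x).1 (hDB (Finset.mem_filter.1 hx).1)).1
        _ ≤ _ := Finset.sum_le_sum_of_subset_of_nonneg
            (Finset.filter_subset_filter _ (Finset.subset_univ _)) fun x _ _ => hβ x
    calc (1:ℝ) ≤ t^2 * (#B * s) := hBge
      _ ≤ t^2 * ((6 * t^8 * (2 * t^86 * #{x ∈ D | a⁻¹ * x ∈ S})) * s) := by
          gcongr
          exact hD1.trans (by gcongr)
      _ = 12 * t^97 * (#{x ∈ D | a⁻¹ * x ∈ S} * (s / t)) := by field_simp; ring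
      _ ≤ t * t^97 * ∑ x with a⁻¹ * x ∈ S, β x := by gcongr; linarith
      _ = t^98 * ∑ x with a⁻¹ * x ∈ S, β x := by ring
      _ ≤ _ := mul_le_mul_of_nonneg_right (ht400 _ (by norm_num))
          (Finset.sum_nonneg fun x _ => hβ x)

section L2
variable {X : Type*} [Fintype X]

theorem l2Norm_eq (f : X → ℂ) : l2Norm f = ‖WithLp.toLp 2 f‖ := by
  rw [EuclideanSpace.norm_eq]; rfl

theorem l2Norm_nonneg (f : X → ℂ) : 0 ≤ l2Norm f := Real.sqrt_nonneg _

theorem l2Norm_sq (f : X → ℂ) : l2Norm f ^ 2 = ∑ x, ‖f x‖ ^ 2 :=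
  Real.sq_sqrt (Finset.sum_nonneg fun _ _ => by positivity)

theorem l2Norm_add_le (f g : X → ℂ) : l2Norm (f + g) ≤ l2Norm f + l2Norm g := by
  simp only [l2Norm_eq, WithLp.toLp_add]; exact norm_add_le _ _

theorem l2Norm_smul (c : ℂ) (f : X → ℂ) : l2Norm (c • f) = ‖c‖ * l2Norm f := by
  simp only [l2Norm_eq, WithLp.toLp_smul]; exact norm_smul _ _

theorem l2Norm_zero : l2Norm (0 : X → ℂ) = 0 := by simp [l2Norm]

theorem l2Norm_sum_le {ι : Type*} (s : Finset ι) (f : ι → X → ℂ) :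
    l2Norm (∑ i ∈ s, f i) ≤ ∑ i ∈ s, l2Norm (f i) := by
  induction s using Finset.induction_on with
  | empty => simp [l2Norm_zero]
  | insert a s ha ih =>
    rw [Finset.sum_insert ha, Finset.sum_insert ha]
    exact (l2Norm_add_le _ _).trans (by gcongr)

theorem norm_sum_conj_mul_le (f g : X → ℂ) :
    ‖∑ x, (starRingEnd ℂ) (f x) * g x‖ ≤ l2Norm f * l2Norm g := by
  have := norm_inner_le_norm (𝕜 := ℂ) (WithLp.toLp 2 f) (WithLp.toLp 2 g)
  rw [← l2Norm_eq, ← l2Norm_eq, PiLp.inner_apply] at this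
  simpa [mul_comm] using this

end L2

variable {G : Type*} [Group G] [Fintype G]

theorem conv_add_left (μ ν φ : G → ℂ) : conv (μ + ν) φ = conv μ φ + conv ν φ := by
  ext x; simp [conv, add_mul, Finset.sum_add_distrib]

theorem l2Norm_translate (g : G) (φ : G → ℂ) : l2Norm (fun x => φ (g⁻¹ * x)) = l2Norm φ := by
  unfold l2Norm
  rw [sum_mul_left g⁻¹ (fun x => ‖φ x‖ ^ 2)]

theorem l2Norm_translate_right (g : G) (φ : G → ℂ) : l2Norm (fun x => φ (x * g)) = l2Norm φ := by
  unfold l2Norm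
  rw [sum_mul_right g (fun x => ‖φ x‖ ^ 2)]

theorem l2Norm_conv_le (μ φ : G → ℂ) : l2Norm (conv μ φ) ≤ l1Norm μ * l2Norm φ := by
  have : conv μ φ = ∑ g, μ g • (fun x => φ (g⁻¹ * x)) := by
    ext x; simp [conv]
  rw [this]
  refine (l2Norm_sum_le _ _).trans_eq ?_
  unfold l1Norm
  rw [Finset.sum_mul]
  exact Finset.sum_congr rfl fun g _ => by rw [l2Norm_smul, l2Norm_translate]

theorem l2Norm_conv_le_card (μ φ : G → ℂ) :
    l2Norm (conv μ φ) ≤ Real.sqrt (Fintype.card G) * l2Norm μ * l2Norm φ := by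
  refine (l2Norm_conv_le μ φ).trans (mul_le_mul_of_nonneg_right ?_ (l2Norm_nonneg _))
  unfold l1Norm l2Norm
  rw [← Real.sqrt_mul (by positivity)]
  refine Real.le_sqrt_of_sq_le ?_
  have := sq_sum_le_card_mul_sum_sq (s := (univ : Finset G)) (f := fun x => ‖μ x‖)
  simpa using this

/-- Convolution by `μ` has norm at most `t` on the set `E`. -/
def OpB (E : Set (G → ℂ)) (μ : G → ℂ) (t : ℝ) : Prop :=
  ∀ φ ∈ E, l2Norm (conv μ φ) ≤ t * l2Norm φ

theorem OpB.add {E : Set (G → ℂ)} {μ ν : G → ℂ} {s t : ℝ} (h : OpB E μ s) (h' : OpB E ν t) :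
    OpB E (μ + ν) (s + t) := fun φ hφ => by
  rw [conv_add_left, add_mul]
  exact (l2Norm_add_le _ _).trans (add_le_add (h φ hφ) (h' φ hφ))

theorem OpB.mono {E : Set (G → ℂ)} {μ : G → ℂ} {s t : ℝ} (h : OpB E μ s) (hst : s ≤ t) :
    OpB E μ t := fun φ hφ =>
  (h φ hφ).trans (mul_le_mul_of_nonneg_right hst (l2Norm_nonneg _))

/-- The autocorrelation `μ* ∗ μ`. -/
noncomputable def acor (μ : G → ℂ) (x : G) : ℂ := ∑ h, (starRingEnd ℂ) (μ h) * μ (h * x)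

theorem l2Norm_conv_sq (μ φ : G → ℂ) :
    l2Norm (conv μ φ) ^ 2 ≤ l2Norm φ * l2Norm (conv (acor μ) φ) := by
  have key : ((l2Norm (conv μ φ) ^ 2 : ℝ) : ℂ) =
      ∑ y, (starRingEnd ℂ) (φ y) * conv (acor μ) φ y := by
    rw [l2Norm_sq]
    push_cast
    have e1 : ∀ x, ((‖conv μ φ x‖ : ℂ)) ^ 2 = ∑ g, ∑ y, (starRingEnd ℂ) (φ y) * ((starRingEnd ℂ) (μ (x * y⁻¹)) * (μ g * φ (g⁻¹ * x))) := by
      intro x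
      rw [← Complex.conj_mul']
      simp only [conv, map_sum, map_mul]
      rw [Finset.sum_mul_sum, Finset.sum_comm]
      refine Finset.sum_congr rfl fun g _ => ?_
      rw [← sum_mul_left x, ← sum_inv]
      exact Finset.sum_congr rfl fun y _ => by simp; ring
    have e2 : ∀ y, (starRingEnd ℂ) (φ y) * conv (acor μ) φ y = ∑ g, ∑ h, (starRingEnd ℂ) (φ y) * ((starRingEnd ℂ) (μ h) * μ (h * g) * φ (g⁻¹ * y)) := by
      intro y
      simp only [conv, acor, Finset.sum_mul, Finset.mul_sum]
    simp_rw [e1, e2]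
    have e3 : ∀ y, ∑ g, ∑ h, (starRingEnd ℂ) (φ y) * ((starRingEnd ℂ) (μ h) * μ (h * g) * φ (g⁻¹ * y)) =
      ∑ x, ∑ g, (starRingEnd ℂ) (φ y) * ((starRingEnd ℂ) (μ (x * y⁻¹)) * (μ g * φ (g⁻¹ * x))) := by
      intro y
      rw [Finset.sum_comm, ← sum_mul_right y⁻¹]
      refine Finset.sum_congr rfl fun x _ => ?_
      rw [← sum_mul_left (x * y⁻¹)⁻¹]
      exact Finset.sum_congr rfl fun g _ => by simp [mul_assoc]
    simp_rw [e3]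
    exact (Finset.sum_congr rfl fun x _ => Finset.sum_comm).trans Finset.sum_comm
  have h2 := norm_sum_conj_mul_le φ (conv (acor μ) φ)
  rw [← key, Complex.norm_real, Real.norm_of_nonneg (by positivity)] at h2
  exact h2

section Iter
variable (E : Set (G → ℂ)) (NC : (G → ℝ) → Prop) (δ ρ r : ℝ)

theorem decompose (hρ : 0 ≤ ρ) (hδ : 0 < δ) (hδ1 : δ ≤ 1)
    (hmono : ∀ β β' : G → ℝ, (∀ x, 0 ≤ β' x) → (∀ x, β' x ≤ β x) → NC β → NC β')
    (hpiece : ∀ β : G → ℝ, (∀ x, 0 ≤ β x) → ∑ x, β x ≤ 1 → NC β → ∀ A : Finset G,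
      Apx ((16/δ)^400) A → #A * ∑ x, β x ^ 2 ≤ (16/δ)^400 → ∀ a,
      1 ≤ (16/δ)^400 * ∑ x with a⁻¹ * x ∈ A, β x → ∀ η : G → ℂ, (∀ x, ‖η x‖ ≤ β x) →
      (∀ x, a⁻¹ * x ∉ A → η x = 0) → OpB E η ρ) (m : ℕ) :
    ∀ μ : G → ℂ, ∑ x, ‖μ x‖ ≤ 1 → (16/δ)^400 * ∑ x, ‖μ x‖ ≤ m → NC (fun x => ‖μ x‖) →
      ∃ μ' : G → ℂ, (∀ x, ‖μ' x‖ ≤ ‖μ x‖) ∧ OpB E (μ - μ') (m * ρ) ∧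
        ∑ x, (∑ h, ‖μ' h‖ * ‖μ' (h * x)‖) ^ 2 ≤ δ * ∑ x, ‖μ' x‖ ^ 2 := by
  have h00 : OpB E 0 0 := by intro φ _; simp [conv, l2Norm]
  set K : ℝ := (16/δ)^400 with hK
  have hK1 : 1 ≤ K := one_le_pow₀ (by rw [le_div_iff₀ hδ]; linarith)
  clear_value K
  induction m with
  | zero =>
    intro μ _ hμ _
    have h0 : ∑ x, ‖μ x‖ = 0 := by
      refine le_antisymm ?_ (by positivity)
      have : K * ∑ x, ‖μ x‖ ≤ 0 := by simpa using hμ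
      nlinarith [show (0:ℝ) ≤ ∑ x, ‖μ x‖ by positivity]
    rw [Finset.sum_eq_zero_iff_of_nonneg (fun _ _ => norm_nonneg _)] at h0
    refine ⟨μ, fun _ => le_rfl, by simpa using h00, ?_⟩
    simp only [fun x => h0 x (Finset.mem_univ x)]
    simp
  | succ m ih =>
    intro μ hμ1 hμ hNC
    by_cases hc : ∑ x, (∑ h, ‖μ h‖ * ‖μ (h * x)‖) ^ 2 ≤ δ * ∑ x, ‖μ x‖ ^ 2
    · refine ⟨μ, fun _ => le_rfl, ?_, hc⟩
      rw [sub_self]; exact h00.mono (by positivity)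
    · push Not at hc
      have hpos : 0 < ∑ x, ‖μ x‖ ^ 2 := by
        by_contra h
        have h0 : ∑ x, ‖μ x‖ ^ 2 = 0 := le_antisymm (not_lt.1 h) (by positivity)
        rw [Finset.sum_eq_zero_iff_of_nonneg (fun _ _ => by positivity)] at h0
        have h0' : ∀ x, ‖μ x‖ = 0 := fun x => by simpa using h0 x (Finset.mem_univ x)
        simp [h0'] at hc
      obtain ⟨A, hA1, hA2, a, ha⟩ := bsg (fun x => ‖μ x‖) (fun _ => norm_nonneg _) hμ1 δ hδ hδ1 hpos hc.le
      rw [← hK] at hA1 hA2 ha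
      set η : G → ℂ := fun x => if a⁻¹ * x ∈ A then μ x else 0 with hη
      have hη1 : ∀ x, ‖η x‖ ≤ ‖μ x‖ := by
        intro x; simp only [hη]; split_ifs <;> simp
      have hOη : OpB E η ρ := hpiece _ (fun _ => norm_nonneg _) hμ1 hNC A hA1 hA2 a ha η hη1
        (fun x hx => by simp [hη, hx])
      have hsub : ∀ x, ‖(μ - η) x‖ = ‖μ x‖ - if a⁻¹ * x ∈ A then ‖μ x‖ else 0 := by
        intro x; simp only [hη, Pi.sub_apply]; split_ifs <;> simp
      have hsub' : ∀ x, ‖(μ - η) x‖ ≤ ‖μ x‖ := by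
        intro x; rw [hsub]; split_ifs <;> simp
      have hsum : ∑ x, ‖(μ - η) x‖ = ∑ x, ‖μ x‖ - ∑ x with a⁻¹ * x ∈ A, ‖μ x‖ := by
        rw [Finset.sum_filter, ← Finset.sum_sub_distrib]
        exact Finset.sum_congr rfl fun x _ => hsub x
      obtain ⟨μ', h1, h2, h3⟩ := ih (μ - η)
        ((Finset.sum_le_sum fun x _ => hsub' x).trans hμ1)
        (by rw [hsum, mul_sub]; push_cast at hμ; linarith)
        (hmono _ _ (fun _ => norm_nonneg _) hsub' hNC)
      refine ⟨μ', fun x => (h1 x).trans (hsub' x), ?_, h3⟩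
      have : μ - μ' = (μ - η - μ') + η := by abel
      rw [this]
      push_cast
      rw [add_mul, one_mul]
      exact h2.add hOη

theorem iterate_flattening (hρ : 0 ≤ ρ) (hδ : 0 < δ) (hδ1 : δ ≤ 1) (hr : 0 ≤ r) (hr1 : r ≤ 1)
    (hmono : ∀ β β' : G → ℝ, (∀ x, 0 ≤ β' x) → (∀ x, β' x ≤ β x) → NC β → NC β')
    (hacor : ∀ β : G → ℝ, (∀ x, 0 ≤ β x) → ∑ x, β x ≤ 1 → NC β →
      NC (fun x => ∑ h, β h * β (h * x)))
    (hpiece : ∀ β : G → ℝ, (∀ x, 0 ≤ β x) → ∑ x, β x ≤ 1 → NC β → ∀ A : Finset G,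
      Apx ((16/δ)^400) A → #A * ∑ x, β x ^ 2 ≤ (16/δ)^400 → ∀ a,
      1 ≤ (16/δ)^400 * ∑ x with a⁻¹ * x ∈ A, β x → ∀ η : G → ℂ, (∀ x, ‖η x‖ ≤ β x) →
      (∀ x, a⁻¹ * x ∉ A → η x = 0) → OpB E η ρ)
    (hρr : 2 * (16/δ)^400 * ρ ≤ r) (n : ℕ) :
    ∀ μ : G → ℂ, ∑ x, ‖μ x‖ ≤ 1 → NC (fun x => ‖μ x‖) →
      Fintype.card G * δ ^ n * ∑ x, ‖μ x‖ ^ 2 ≤ r ^ 2 → OpB E μ (4 * r ^ ((1/2 : ℝ) ^ n)) := by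
  induction n with
  | zero =>
    intro μ hμ hNC hs φ hφ
    refine (l2Norm_conv_le_card μ φ).trans (mul_le_mul_of_nonneg_right ?_ (l2Norm_nonneg _))
    simp only [pow_zero, mul_one, Real.rpow_one] at hs ⊢
    rw [l2Norm, ← Real.sqrt_mul (by positivity)]
    calc _ ≤ r := Real.sqrt_le_iff.2 ⟨hr, hs⟩
      _ ≤ _ := by linarith
  | succ n ih =>
    intro μ hμ hNC hs
    have hK1 : 1 ≤ (16/δ)^400 := one_le_pow₀ (by rw [le_div_iff₀ hδ]; linarith)
    obtain ⟨μ', h1, h2, h3⟩ := decompose E NC δ ρ hρ hδ hδ1 hmono hpiece ⌈(16/δ)^400⌉₊ μ hμ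
      (by refine le_trans ?_ (Nat.le_ceil _); nlinarith) hNC
    have hm : (⌈(16/δ)^400⌉₊ : ℝ) * ρ ≤ r := by
      refine le_trans ?_ hρr
      gcongr
      have := (Nat.ceil_lt_add_one (a := (16/δ)^400) (by positivity)).le
      linarith
    have hμ'1 : ∑ x, ‖μ' x‖ ≤ 1 := (Finset.sum_le_sum fun x _ => h1 x).trans hμ
    have hNC' : NC (fun x => ‖μ' x‖) := hmono _ _ (fun _ => norm_nonneg _) h1 hNC
    have hac : ∀ x, ‖acor μ' x‖ ≤ ∑ h, ‖μ' h‖ * ‖μ' (h * x)‖ := by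
      intro x
      refine (norm_sum_le _ _).trans_eq ?_
      exact Finset.sum_congr rfl fun h _ => by rw [norm_mul, Complex.norm_conj]
    have hacs : ∑ x, ∑ h, ‖μ' h‖ * ‖μ' (h * x)‖ = (∑ x, ‖μ' x‖) ^ 2 := by
      rw [Finset.sum_comm, sq, Finset.sum_mul]
      refine Finset.sum_congr rfl fun h _ => ?_
      rw [← Finset.mul_sum, sum_mul_left h (fun x => ‖μ' x‖)]
    have hih := ih (acor μ')
      ((Finset.sum_le_sum fun x _ => hac x).trans (by
        rw [hacs]; exact pow_le_one₀ (by positivity) hμ'1))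
      (hmono _ _ (fun _ => norm_nonneg _) hac (hacor _ (fun _ => norm_nonneg _) hμ'1 hNC'))
      (by
        have e1 : ∑ x, ‖acor μ' x‖ ^ 2 ≤ δ * ∑ x, ‖μ x‖ ^ 2 :=
          calc ∑ x, ‖acor μ' x‖ ^ 2 ≤ ∑ x, (∑ h, ‖μ' h‖ * ‖μ' (h * x)‖) ^ 2 :=
                Finset.sum_le_sum fun x _ => pow_le_pow_left₀ (norm_nonneg _) (hac x) 2
            _ ≤ _ := h3
            _ ≤ _ := mul_le_mul_of_nonneg_left
                (Finset.sum_le_sum fun x _ => pow_le_pow_left₀ (norm_nonneg _) (h1 x) 2) hδ.le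
        calc _ ≤ Fintype.card G * δ ^ n * (δ * ∑ x, ‖μ x‖ ^ 2) := by gcongr
          _ = Fintype.card G * δ ^ (n+1) * ∑ x, ‖μ x‖ ^ 2 := by ring
          _ ≤ _ := hs)
    set ri := r ^ ((1/2 : ℝ) ^ n) with hri
    have hri0 : 0 ≤ ri := Real.rpow_nonneg hr _
    have hsq : r ^ ((1/2 : ℝ) ^ (n+1)) = Real.sqrt ri := by
      rw [Real.sqrt_eq_rpow, hri, ← Real.rpow_mul hr, pow_succ]
    have hri1 : ri ≤ 1 := Real.rpow_le_one hr hr1 (by positivity)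
    have hrri : r ≤ ri := by
      rcases hr.eq_or_lt with h | h
      · rw [← h]; exact hri0
      · calc r = r ^ (1:ℝ) := (Real.rpow_one r).symm
          _ ≤ _ := Real.rpow_le_rpow_of_exponent_ge h hr1 (pow_le_one₀ (by norm_num) (by norm_num))
    have hsr : Real.sqrt ri ^ 2 = ri := Real.sq_sqrt hri0
    have hsr1 : Real.sqrt ri ≤ 1 := Real.sqrt_le_one.2 hri1
    have hOμ' : OpB E μ' (2 * Real.sqrt ri) := by
      intro φ hφ
      refine le_of_sq_le_sq ?_ (mul_nonneg (by positivity) (l2Norm_nonneg _))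
      calc _ ≤ l2Norm φ * l2Norm (conv (acor μ') φ) := l2Norm_conv_sq μ' φ
        _ ≤ l2Norm φ * (4 * ri * l2Norm φ) := mul_le_mul_of_nonneg_left (hih φ hφ) (l2Norm_nonneg _)
        _ = _ := by rw [mul_pow, mul_pow, hsr]; ring
    rw [hsq]
    have := (h2.add hOμ').mono (t := 4 * Real.sqrt ri) (by nlinarith [Real.sqrt_nonneg ri])
    simpa using this

end Iter

/-- `SL₂(𝔽_p)`. -/
abbrev SL (p : ℕ) := Matrix.SpecialLinearGroup (Fin 2) (ZMod p)

noncomputable scoped instance slDecidableEq (p : ℕ) : DecidableEq (SL p) := fun a b => Classical.propDecidable (a = b)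

section SL2
variable {F : Type*} [CommRing F]

/-- Upper unipotent elements. -/
def uu (t : F) : Matrix.SpecialLinearGroup (Fin 2) F := ⟨!![1, t; 0, 1], by simp⟩
/-- Lower unipotent elements. -/
def ll (t : F) : Matrix.SpecialLinearGroup (Fin 2) F := ⟨!![1, 0; t, 1], by simp⟩
/-- Diagonal elements. -/
def dd (a : Fˣ) : Matrix.SpecialLinearGroup (Fin 2) F :=
  ⟨!![(a : F), 0; 0, ((a⁻¹ : Fˣ) : F)], by simp⟩
/-- The Weyl element. -/
def ww : Matrix.SpecialLinearGroup (Fin 2) F := ⟨!![0, 1; -1, 0], by simp⟩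

theorem uu_val (t : F) : (uu t).1 = !![1, t; 0, 1] := rfl
theorem ll_val (t : F) : (ll t).1 = !![1, 0; t, 1] := rfl
theorem dd_val (a : Fˣ) : (dd a).1 = !![(a : F), 0; 0, ((a⁻¹ : Fˣ) : F)] := rfl
theorem ww_val : (ww : Matrix.SpecialLinearGroup (Fin 2) F).1 = !![0, 1; -1, 0] := rfl

theorem sl_ext {g h : Matrix.SpecialLinearGroup (Fin 2) F} (h1 : g.1 0 0 = h.1 0 0)
    (h2 : g.1 0 1 = h.1 0 1) (h3 : g.1 1 0 = h.1 1 0) (h4 : g.1 1 1 = h.1 1 1) : g = h := by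
  apply Subtype.ext
  ext i j
  fin_cases i <;> fin_cases j <;> assumption

theorem mul_00 (g h : Matrix.SpecialLinearGroup (Fin 2) F) :
    (g * h).1 0 0 = g.1 0 0 * h.1 0 0 + g.1 0 1 * h.1 1 0 := by
  show (g.1 * h.1) 0 0 = _; simp [Matrix.mul_apply, Fin.sum_univ_two]
theorem mul_01 (g h : Matrix.SpecialLinearGroup (Fin 2) F) :
    (g * h).1 0 1 = g.1 0 0 * h.1 0 1 + g.1 0 1 * h.1 1 1 := by
  show (g.1 * h.1) 0 1 = _; simp [Matrix.mul_apply, Fin.sum_univ_two]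
theorem mul_10 (g h : Matrix.SpecialLinearGroup (Fin 2) F) :
    (g * h).1 1 0 = g.1 1 0 * h.1 0 0 + g.1 1 1 * h.1 1 0 := by
  show (g.1 * h.1) 1 0 = _; simp [Matrix.mul_apply, Fin.sum_univ_two]
theorem mul_11 (g h : Matrix.SpecialLinearGroup (Fin 2) F) :
    (g * h).1 1 1 = g.1 1 0 * h.1 0 1 + g.1 1 1 * h.1 1 1 := by
  show (g.1 * h.1) 1 1 = _; simp [Matrix.mul_apply, Fin.sum_univ_two]

theorem uu_add (s t : F) : uu (s + t) = uu s * uu t := by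
  apply sl_ext <;> simp [uu_val, mul_00, mul_01, mul_10, mul_11, add_comm]

theorem uu_zero : uu (0 : F) = 1 := by
  apply sl_ext <;> simp [uu_val]

end SL2

section SL2field
variable {F : Type*} [Field F]

theorem uu_mul_dd (t : F) (a : Fˣ) : uu t * dd a = dd a * uu (t * ((a⁻¹ : Fˣ) : F) ^ 2) := by
  apply sl_ext <;> simp [uu_val, dd_val, mul_00, mul_01, mul_10, mul_11]
  field_simp

theorem ll_eq (t : F) : ll t = ww⁻¹ * uu (-t) * ww := by
  rw [mul_assoc, eq_inv_mul_iff_mul_eq]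
  apply sl_ext <;> simp [uu_val, ll_val, ww_val, mul_00, mul_01, mul_10, mul_11]

theorem sl_det (g : Matrix.SpecialLinearGroup (Fin 2) F) :
    g.1 0 0 * g.1 1 1 - g.1 0 1 * g.1 1 0 = 1 := by
  rw [← Matrix.det_fin_two]; exact g.2

theorem sl_decomp (g : Matrix.SpecialLinearGroup (Fin 2) F) (hc : g.1 1 0 ≠ 0) :
    g = uu ((g.1 0 0 - 1) / g.1 1 0) * ll (g.1 1 0) * uu ((g.1 1 1 - 1) / g.1 1 0) := by
  have := sl_det g
  apply sl_ext <;> simp [uu_val, ll_val, mul_00, mul_01, mul_10, mul_11]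
  all_goals field_simp
  · ring
  · linear_combination -this
  · ring

theorem sl_gen (H : Subgroup (Matrix.SpecialLinearGroup (Fin 2) F)) (hu : ∀ t, uu t ∈ H)
    (hl : ∀ t, ll t ∈ H) : H = ⊤ := by
  rw [Subgroup.eq_top_iff']
  have main : ∀ g : Matrix.SpecialLinearGroup (Fin 2) F, g.1 1 0 ≠ 0 → g ∈ H := by
    intro g hg
    rw [sl_decomp g hg]
    exact H.mul_mem (H.mul_mem (hu _) (hl _)) (hu _)
  intro g
  by_cases hc : g.1 1 0 = 0
  · have hd := sl_det g
    have : g * ll 1 ∈ H := by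
      apply main
      simp [ll_val, mul_00, mul_01, mul_10, mul_11, hc]
      intro h
      simp [hc, h] at hd
    exact (H.mul_mem_cancel_right (hl 1)).1 this
  · exact main g hc

end SL2field

section Quasirandom
variable {ι : Type*} [Fintype ι] [DecidableEq ι] (p : ι → ℕ) [∀ i, Fact (p i).Prime]

/-- The product of the groups `SL₂(𝔽_{p i})`. -/
abbrev Gp {ι : Type*} (p : ι → ℕ) := ∀ i, SL (p i)

/-- Functions all of whose coordinate fibre sums vanish. -/
def Ez : Set (Gp p → ℂ) :=
  {φ | ∀ (i : ι) (x : Gp p), ∑ g : SL (p i), φ (x * (Pi.mulSingle i g : Gp p)) = 0}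

variable {p}

theorem mulSingle_conj (i : ι) (x : Gp p) (g : SL (p i)) :
    (Pi.mulSingle i g : Gp p) * x = x * Pi.mulSingle i ((x i)⁻¹ * g * x i) := by
  ext1 j
  by_cases h : j = i
  · subst h; simp [mul_assoc]
  · simp [Pi.mulSingle_eq_of_ne h]

theorem sum_conj {M : Type*} [AddCommMonoid M] {G : Type*} [Group G] [Fintype G] (y : G) (f : G → M) :
    ∑ g, f (y⁻¹ * g * y) = ∑ g, f g := by
  rw [← sum_mul_left y⁻¹ f, sum_mul_right y (fun g => f (y⁻¹ * g)) |>.symm]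
  simp [mul_assoc]

theorem Ez_translate {φ : Gp p → ℂ} (h : φ ∈ Ez p) (y : Gp p) : (fun x => φ (x * y)) ∈ Ez p := by
  intro i x
  have : ∀ g : SL (p i), φ (x * (Pi.mulSingle i g : Gp p) * y) = φ (x * y * Pi.mulSingle i ((y i)⁻¹ * g * y i)) := by
    intro g; rw [mul_assoc, mulSingle_conj, ← mul_assoc]
  simp only [this]
  exact (sum_conj (y i) (fun g => φ (x * y * (Pi.mulSingle i g : Gp p)))).trans (h i _)

theorem Ez_add {φ ψ : Gp p → ℂ} (h : φ ∈ Ez p) (h' : ψ ∈ Ez p) : φ + ψ ∈ Ez p := by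
  intro i x; simp [Finset.sum_add_distrib, h i x, h' i x]

theorem Ez_smul {φ : Gp p → ℂ} (h : φ ∈ Ez p) (c : ℂ) : c • φ ∈ Ez p := by
  intro i x; simp [← Finset.mul_sum, h i x]

theorem conv_add_right {G : Type*} [Group G] [Fintype G] (μ φ ψ : G → ℂ) :
    conv μ (φ + ψ) = conv μ φ + conv μ ψ := by
  ext x; simp [conv, mul_add, Finset.sum_add_distrib]

theorem conv_smul_right {G : Type*} [Group G] [Fintype G] (μ φ : G → ℂ) (c : ℂ) :
    conv μ (c • φ) = c • conv μ φ := by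
  ext x; simp [conv, Finset.mul_sum]; exact Finset.sum_congr rfl fun _ _ => by ring

theorem conv_translate {G : Type*} [Group G] [Fintype G] (μ φ : G → ℂ) (y : G) :
    conv μ (fun x => φ (x * y)) = fun x => conv μ φ (x * y) := by
  ext x; simp [conv, mul_assoc]

theorem l2Norm_eq_zero {X : Type*} [Fintype X] {f : X → ℂ} : l2Norm f = 0 ↔ f = 0 := by
  rw [l2Norm_eq, norm_eq_zero]; simp

theorem l2Norm_parallelogram {X : Type*} [Fintype X] (f g : X → ℂ) :
    l2Norm (f + g) ^ 2 + l2Norm (f - g) ^ 2 = 2 * (l2Norm f ^ 2 + l2Norm g ^ 2) := by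
  simp only [l2Norm_eq, WithLp.toLp_add, WithLp.toLp_sub]
  exact parallelogram_law_with_norm ℂ (WithLp.toLp 2 f) (WithLp.toLp 2 g)

/-- Existence of a nonzero right-invariant space of extremal functions. -/
theorem exists_extremal (f : Gp p → ℂ) {φ₀ : Gp p → ℂ} (h₀ : φ₀ ∈ Ez p) (hne : φ₀ ≠ 0) :
    ∃ (l : ℝ) (W : Submodule ℂ (Gp p → ℂ)), W ≠ ⊥ ∧ (∀ w ∈ W, w ∈ Ez p) ∧
      (∀ w ∈ W, l2Norm (conv f w) ^ 2 = l * l2Norm w ^ 2) ∧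
      (∀ w ∈ W, ∀ y, (fun x => w (x * y)) ∈ W) ∧
      ∀ φ ∈ Ez p, l2Norm (conv f φ) ^ 2 ≤ l * l2Norm φ ^ 2 := by
  have hc1 : Continuous fun φ : Gp p → ℂ => l2Norm φ := by
    unfold l2Norm; fun_prop
  have hc2 : Continuous fun φ : Gp p → ℂ => l2Norm (conv f φ) ^ 2 := by
    unfold l2Norm conv; fun_prop
  set Z : Set (Gp p → ℂ) := Ez p ∩ {φ | l2Norm φ = 1} with hZ
  have hcl : IsClosed Z := by
    refine IsClosed.inter ?_ (isClosed_eq hc1 continuous_const)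
    have : Ez p = ⋂ i, ⋂ x, {φ : Gp p → ℂ | ∑ g : SL (p i), φ (x * (Pi.mulSingle i g : Gp p)) = 0} := by
      ext φ; simp [Ez]
    rw [this]
    exact isClosed_iInter fun i => isClosed_iInter fun x => isClosed_eq (by fun_prop) continuous_const
  have hbd : Bornology.IsBounded Z := by
    rw [isBounded_iff_forall_norm_le]
    refine ⟨1, fun φ hφ => ?_⟩
    rw [pi_norm_le_iff_of_nonneg zero_le_one]
    intro x
    have h1 : l2Norm φ ^ 2 = 1 := by rw [hφ.2]; norm_num
    rw [l2Norm_sq] at h1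
    have h2 : ‖φ x‖ ^ 2 ≤ 1 := by
      rw [← h1]
      exact Finset.single_le_sum (f := fun x => ‖φ x‖ ^ 2) (fun _ _ => by positivity) (Finset.mem_univ x)
    exact (sq_le_one_iff₀ (norm_nonneg _)).1 h2
  have hnorm : ∀ φ ∈ Ez p, φ ≠ 0 → ((l2Norm φ : ℂ)⁻¹ • φ) ∈ Z := by
    intro φ hφ h0
    refine ⟨Ez_smul hφ _, ?_⟩
    have : l2Norm φ ≠ 0 := fun h => h0 (l2Norm_eq_zero.1 h)
    simp only [Set.mem_ofPred_eq, l2Norm_smul, norm_inv, Complex.norm_real, Real.norm_of_nonneg (l2Norm_nonneg φ)]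
    field_simp
  obtain ⟨w₀, hw₀, hmax⟩ := (Metric.isCompact_of_isClosed_isBounded hcl hbd).exists_isMaxOn
    ⟨_, hnorm φ₀ h₀ hne⟩ hc2.continuousOn
  set l := l2Norm (conv f w₀) ^ 2 with hl
  have hle : ∀ φ ∈ Ez p, l2Norm (conv f φ) ^ 2 ≤ l * l2Norm φ ^ 2 := by
    intro φ hφ
    by_cases h0 : φ = 0
    · subst h0; simp [conv, l2Norm]
    · have h1 : l2Norm φ ≠ 0 := fun h => h0 (l2Norm_eq_zero.1 h)
      have h2 : 0 < l2Norm φ := lt_of_le_of_ne (l2Norm_nonneg _) (Ne.symm h1)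
      have := hmax (hnorm φ hφ h0)
      simp only [Set.mem_ofPred_eq, conv_smul_right, l2Norm_smul, norm_inv, Complex.norm_real, Real.norm_of_nonneg (l2Norm_nonneg φ)] at this
      rw [mul_pow, inv_pow, inv_mul_le_iff₀ (by positivity)] at this
      linarith
  refine ⟨l, { carrier := {w | w ∈ Ez p ∧ l2Norm (conv f w) ^ 2 = l * l2Norm w ^ 2}, add_mem' := ?_, zero_mem' := ?_, smul_mem' := ?_ }, ?_, ?_, ?_, ?_, hle⟩
  · rintro a b ⟨ha, ha'⟩ ⟨hb, hb'⟩
    refine ⟨Ez_add ha hb, ?_⟩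
    have hbn : -b ∈ Ez p := by simpa using Ez_smul hb (-1)
    have h1 := hle _ (Ez_add ha hb)
    have h2 := hle _ (Ez_add ha hbn)
    rw [← sub_eq_add_neg] at h2
    have e1 := l2Norm_parallelogram a b
    have e2 := l2Norm_parallelogram (conv f a) (conv f b)
    have e3 : conv f (a - b) = conv f a - conv f b := by
      have : a - b = a + (-1 : ℂ) • b := by simp [sub_eq_add_neg]
      rw [this, conv_add_right, conv_smul_right]; simp [sub_eq_add_neg]
    rw [← conv_add_right, ← e3] at e2
    have e4 : l2Norm (conv f (a + b)) ^ 2 + l2Norm (conv f (a - b)) ^ 2 = l * l2Norm (a + b) ^ 2 + l * l2Norm (a - b) ^ 2 := by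
      rw [← mul_add, e1, e2, ha', hb']; ring
    linarith
  · exact ⟨fun i x => by simp, by simp [conv, l2Norm]⟩
  · rintro c a ⟨ha, ha'⟩
    refine ⟨Ez_smul ha c, ?_⟩
    rw [conv_smul_right, l2Norm_smul, l2Norm_smul, mul_pow, mul_pow, ha']; ring
  · intro h
    have : w₀ ∈ (⊥ : Submodule ℂ (Gp p → ℂ)) := by
      rw [← h]
      have h1 : l2Norm w₀ = 1 := hw₀.2
      exact ⟨hw₀.1, by rw [h1]; simp [hl]⟩
    rw [Submodule.mem_bot] at this
    have h1 : l2Norm w₀ = 1 := hw₀.2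
    rw [this, l2Norm_zero] at h1
    exact zero_ne_one h1
  · exact fun w hw => hw.1
  · exact fun w hw => hw.2
  · rintro w ⟨hw, hw'⟩ y
    refine ⟨Ez_translate hw y, ?_⟩
    rw [conv_translate, l2Norm_translate_right y (conv f w), l2Norm_translate_right y w, hw']

end Quasirandom

section Quasirandom
variable {ι : Type*} [Fintype ι] [DecidableEq ι] {p : ι → ℕ} [∀ i, Fact (p i).Prime]

/-- `w` transforms by a nontrivial character under the `i`-th upper unipotent group. -/
def IsCh (w : Gp p → ℂ) (i : ι) (c : ZMod (p i)) : Prop :=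
  ∀ (x : Gp p) (t : ZMod (p i)),
    w (x * (Pi.mulSingle i (uu t) : Gp p)) = ZMod.stdAddChar (c * t) * w x

theorem const_of_dft {N : ℕ} [NeZero N] (f : ZMod N → ℂ)
    (h : ∀ c, c ≠ 0 → ∑ t, ZMod.stdAddChar (-(c * t)) * f t = 0) (t s : ZMod N) : f t = f s := by
  have key : ∀ t, f t = (N : ℂ)⁻¹ • (ZMod.dft f 0) := by
    intro t
    conv_lhs => rw [← ZMod.dft.symm_apply_apply f]
    rw [ZMod.invDFT_apply, Finset.sum_eq_single 0]
    · simp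
    · intro c _ hc
      rw [ZMod.dft_apply]
      have := h c hc
      simp only [smul_eq_mul, mul_comm c] at this ⊢
      rw [this, mul_zero]
    · simp
  rw [key, key s]

theorem mulSingle_commute {i j : ι} (h : i ≠ j) (g : SL (p i)) (k : SL (p j)) :
    (Pi.mulSingle i g : Gp p) * Pi.mulSingle j k = Pi.mulSingle j k * Pi.mulSingle i g :=
  Pi.mulSingle_commute (f := fun i => SL (p i)) h g k

theorem ms_mul (i : ι) (a b : SL (p i)) :
    (Pi.mulSingle i (a * b) : Gp p) = Pi.mulSingle i a * Pi.mulSingle i b :=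
  Pi.mulSingle_mul (f := fun i => SL (p i)) i a b

theorem comm_aux {G : Type*} [Group G] (x : G) {a b c : G} (h : a * c = c * a) (h' : b * c = c * b) :
    x * c * a * b = x * a * b * c := by
  rw [mul_assoc x, ← h, mul_assoc _ b c, h', ← mul_assoc, ← mul_assoc]

set_option maxHeartbeats 400000 in
theorem exists_char (W : Submodule ℂ (Gp p → ℂ)) (hW : W ≠ ⊥) (hE : ∀ w ∈ W, w ∈ Ez p)
    (hinv : ∀ w ∈ W, ∀ y, (fun x => w (x * y)) ∈ W) (s : Finset ι) :
    ∃ w ∈ W, w ≠ 0 ∧ ∀ i ∈ s, ∃ c : ZMod (p i), c ≠ 0 ∧ IsCh w i c := by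
  induction s using Finset.induction_on with
  | empty =>
    obtain ⟨w, hw, h0⟩ := Submodule.exists_mem_ne_zero_of_ne_bot hW
    exact ⟨w, hw, h0, by simp⟩
  | insert i s his ih =>
    obtain ⟨w, hw, h0, hc⟩ := ih
    let P : SL (p i) → ZMod (p i) → Gp p → ℂ := fun g c x =>
      ∑ t, ZMod.stdAddChar (-(c * t)) * w (x * (Pi.mulSingle i (uu t) : Gp p) * Pi.mulSingle i g)
    have hPW : ∀ g c, P g c ∈ W := by
      intro g c
      have : P g c = ∑ t, (ZMod.stdAddChar (-(c * t)) : ℂ) •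
          (fun x => w (x * ((Pi.mulSingle i (uu t) : Gp p) * Pi.mulSingle i g))) := by
        ext x; simp [P, mul_assoc]
      rw [this]
      exact Submodule.sum_mem _ fun t _ => W.smul_mem _ (hinv w hw _)
    by_cases hP : ∃ g c, c ≠ 0 ∧ P g c ≠ 0
    · obtain ⟨g, c, hc0, hP⟩ := hP
      refine ⟨P g c, hPW g c, hP, ?_⟩
      intro j hj
      rcases Finset.mem_insert.1 hj with rfl | hj
      · refine ⟨c, hc0, fun x t => ?_⟩
        simp only [P]
        rw [Finset.mul_sum, ← Equiv.sum_comp (Equiv.subRight t)]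
        refine Finset.sum_congr rfl fun r _ => ?_
        simp only [Equiv.subRight_apply]
        rw [mul_assoc x, ← ms_mul, ← uu_add, ← mul_assoc, ← AddChar.map_add_eq_mul]
        congr 2
        · ring
        · rw [add_sub_cancel]
      · obtain ⟨d, hd, hch⟩ := hc j hj
        refine ⟨d, hd, fun x t => ?_⟩
        have hij : i ≠ j := by rintro rfl; exact his hj
        simp only [P]
        rw [Finset.mul_sum]
        refine Finset.sum_congr rfl fun r _ => ?_
        have e3 := comm_aux x (mulSingle_commute hij (uu r) (uu t)) (mulSingle_commute hij g (uu t))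
        have e4 := hch (x * (Pi.mulSingle i (uu r) : Gp p) * Pi.mulSingle i g) t
        rw [e3, e4]; ring
    · push Not at hP
      exfalso
      have h1 : ∀ g x t, w (x * (Pi.mulSingle i (uu t) : Gp p) * Pi.mulSingle i g) =
          w (x * (Pi.mulSingle i g : Gp p)) := by
        intro g x t
        have := const_of_dft (fun t => w (x * (Pi.mulSingle i (uu t) : Gp p) * Pi.mulSingle i g))
          (fun c hc => congrFun (hP g c hc) x) t 0
        simpa [uu_zero] using this
      let H : Subgroup (SL (p i)) :=
        { carrier := {h | ∀ x, w (x * (Pi.mulSingle i h : Gp p)) = w x}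
          mul_mem' := by
            intro a b ha hb x
            rw [ms_mul, ← mul_assoc, hb, ha]
          one_mem' := by intro x; simp
          inv_mem' := by
            intro a ha x
            have := ha (x * (Pi.mulSingle i a⁻¹ : Gp p))
            rw [mul_assoc, ← ms_mul] at this
            simpa using this.symm }
      have hH : H = ⊤ := by
        apply sl_gen
        · intro t x
          simpa using h1 1 x t
        · intro t x
          rw [ll_eq, ms_mul, ms_mul, ← mul_assoc, ← mul_assoc, h1, mul_assoc,
            ← ms_mul]
          simp
      apply h0
      ext x
      have h2 := hE w hw i x
      have h3 : ∀ g : SL (p i), w (x * (Pi.mulSingle i g : Gp p)) = w x := by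
        intro g
        have : g ∈ H := by rw [hH]; trivial
        exact this x
      simp only [h3, Finset.sum_const, smul_eq_zero] at h2
      rcases h2 with h2 | h2
      · simp at h2
      · simpa using h2

theorem sum_translate_mul {w v : Gp p → ℂ} {i : ι} {c d : ZMod (p i)} (hw : IsCh w i c)
    (hv : IsCh v i d) (h : c ≠ d) : ∑ x, (starRingEnd ℂ) (w x) * v x = 0 := by
  have h1 := sum_mul_right (Pi.mulSingle i (uu 1) : Gp p) (fun x => (starRingEnd ℂ) (w x) * v x)
  have h2 : ∀ x, (starRingEnd ℂ) (w (x * (Pi.mulSingle i (uu 1) : Gp p))) * v (x * (Pi.mulSingle i (uu 1) : Gp p)) =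
      ZMod.stdAddChar (d - c) * ((starRingEnd ℂ) (w x) * v x) := by
    intro x
    rw [hw, hv, map_mul, mul_one, mul_one, ← AddChar.map_neg_eq_conj, sub_eq_add_neg,
      AddChar.map_add_eq_mul]
    ring
  simp only [h2, ← Finset.mul_sum] at h1
  by_contra hne
  have h3 := mul_right_cancel₀ hne (h1.trans (one_mul _).symm)
  rw [← AddChar.map_zero_eq_one (ZMod.stdAddChar (N := p i))] at h3
  exact h (sub_eq_zero.1 (ZMod.injective_stdAddChar h3)).symm

theorem bessel {X T : Type*} [Fintype X] (t : Finset T) (v : T → X → ℂ) (f : X → ℂ) (N : ℝ)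
    (hN : 0 < N) (hv : ∀ a, ∑ x, ‖v a x‖ ^ 2 = N)
    (ho : ∀ a b, a ≠ b → ∑ x, (starRingEnd ℂ) (v a x) * v b x = 0) :
    ∑ a ∈ t, ‖∑ x, f x * v a x‖ ^ 2 ≤ N * ∑ x, ‖f x‖ ^ 2 := by
  have hin : ∀ u u' : X → ℂ, inner ℂ (WithLp.toLp 2 u) (WithLp.toLp 2 u' : EuclideanSpace ℂ X)
      = ∑ x, (starRingEnd ℂ) (u x) * u' x := by
    intro u u'
    rw [PiLp.inner_apply]; simp [mul_comm]
  have hn : ∀ a, ‖(WithLp.toLp 2 (v a) : EuclideanSpace ℂ X)‖ = √N := by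
    intro a
    rw [EuclideanSpace.norm_eq]; congr 1; exact hv a
  have hsN : 0 < √N := Real.sqrt_pos.2 hN
  have hon : Orthonormal ℂ (fun a => ((√N)⁻¹ : ℂ) • (WithLp.toLp 2 (v a) : EuclideanSpace ℂ X)) := by
    constructor
    · intro a
      rw [norm_smul, hn]
      simp [abs_of_pos hsN, hsN.ne']
    · intro a b hab
      rw [inner_smul_left, inner_smul_right, hin, ho a b hab, mul_zero, mul_zero]
  have := hon.sum_inner_products_le (s := t) (WithLp.toLp 2 (fun x => (starRingEnd ℂ) (f x)) : EuclideanSpace ℂ X)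
  have e : ∀ a, ‖inner ℂ (((√N)⁻¹ : ℂ) • (WithLp.toLp 2 (v a) : EuclideanSpace ℂ X))
      (WithLp.toLp 2 (fun x => (starRingEnd ℂ) (f x)) : EuclideanSpace ℂ X)‖ ^ 2 = N⁻¹ * ‖∑ x, f x * v a x‖ ^ 2 := by
    intro a
    rw [inner_smul_left, hin, norm_mul, mul_pow]
    congr 1
    · simp [abs_of_pos hsN, Real.sq_sqrt hN.le]
    · rw [← Complex.norm_conj, map_sum]
      simp [mul_comm]
  simp only [e, ← Finset.mul_sum] at this
  rw [EuclideanSpace.norm_sq_eq, inv_mul_le_iff₀ hN] at this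
  simpa using this

theorem card_squares (P : ℕ) [Fact P.Prime] :
    ((P : ℝ) - 1) / 2 ≤ (Fintype.card {s : (ZMod P)ˣ // IsSquare s} : ℝ) := by
  have h := card_le_mul_of_fiber_le (fun a : (ZMod P)ˣ => a * a) univ (univ.filter IsSquare) 2
    (by intro a _; simp) (by
      intro y hy
      obtain ⟨r, rfl⟩ := (Finset.mem_filter.1 hy).2
      refine (Nat.cast_le.2 ((Finset.card_le_card (t := {r, -r}) ?_).trans Finset.card_le_two)).trans (by norm_num)
      intro x hx
      simp only [Finset.mem_filter, Finset.mem_univ, true_and] at hx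
      simp only [Finset.mem_insert, Finset.mem_singleton]
      have : (x : ZMod P) * x = r * r := by exact_mod_cast congrArg Units.val hx
      rcases mul_self_eq_mul_self_iff.1 this with h | h
      · left; exact Units.ext h
      · right; apply Units.ext; simpa using h)
  rw [Finset.card_univ, ZMod.card_units_eq_totient, Nat.totient_prime Fact.out] at h
  rw [Fintype.card_subtype]
  have h1 : 1 ≤ P := (Fact.out : P.Prime).one_le
  have : ((P - 1 : ℕ) : ℝ) ≤ _ := h
  push_cast [h1] at this
  linarith

/-- Quasirandomness of products of `SL₂(𝔽_p)`. -/
theorem quasirandom (f : Gp p → ℂ) {φ : Gp p → ℂ} (hφ : φ ∈ Ez p) :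
    l2Norm (conv f φ) ^ 2 * ∏ i, (((p i : ℝ) - 1) / 2) ≤
      Fintype.card (Gp p) * l2Norm f ^ 2 * l2Norm φ ^ 2 := by
  by_cases h0 : φ = 0
  · subst h0
    have : conv f 0 = 0 := by ext x; simp [conv]
    rw [this, l2Norm_zero]; simp
  obtain ⟨l, W, hW, hE, hl, hinv, hmax⟩ := exists_extremal f hφ h0
  obtain ⟨w, hw, hw0, hch⟩ := exists_char W hW hE hinv univ
  choose c hc0 hc using fun i => hch i (Finset.mem_univ i)
  let T := ∀ i, {s : (ZMod (p i))ˣ // IsSquare s}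
  let r : T → ∀ i, (ZMod (p i))ˣ := fun a i => (a i).2.choose
  have hr : ∀ (a : T) i, (a i).1 = r a i * r a i := fun a i => (a i).2.choose_spec
  let D : T → Gp p := fun a i => dd (r a i)
  let v : T → Gp p → ℂ := fun a x => w (x * D a)
  have hvch : ∀ a i, IsCh (v a) i (c i * (((r a i)⁻¹ : (ZMod (p i))ˣ) : ZMod (p i)) ^ 2) := by
    intro a i x t
    simp only [v]
    rw [mul_assoc, mulSingle_conj, ← mul_assoc]
    have : (D a i)⁻¹ * uu t * D a i = uu (t * (((r a i)⁻¹ : (ZMod (p i))ˣ) : ZMod (p i)) ^ 2) := by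
      rw [mul_assoc, inv_mul_eq_iff_eq_mul]; exact uu_mul_dd _ _
    rw [this, hc]
    congr 2; ring
  have horth : ∀ a b, a ≠ b → ∑ x, (starRingEnd ℂ) (v a x) * v b x = 0 := by
    intro a b hab
    obtain ⟨i, hi⟩ := Function.ne_iff.1 hab
    refine sum_translate_mul (hvch a i) (hvch b i) ?_
    intro h
    have h1 := mul_left_cancel₀ (hc0 i) h
    apply hi
    apply Subtype.ext
    rw [hr, hr]
    have h2 : ((r a i)⁻¹) ^ 2 = ((r b i)⁻¹) ^ 2 :=
      Units.ext ((Units.val_pow_eq_pow_val _ _).trans (h1.trans (Units.val_pow_eq_pow_val _ _).symm))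
    rw [inv_pow, inv_pow, inv_inj] at h2
    simpa [sq] using h2
  set N := l2Norm w ^ 2 with hN
  have hwpos : 0 < l2Norm w := lt_of_le_of_ne (l2Norm_nonneg _) fun h => hw0 (l2Norm_eq_zero.1 h.symm)
  have hNpos : 0 < N := by positivity
  have hvn : ∀ a, ∑ x, ‖v a x‖ ^ 2 = N := by
    intro a
    rw [hN, l2Norm_sq]
    exact sum_mul_right (D a) (fun x => ‖w x‖ ^ 2)
  have key : (Fintype.card T : ℝ) * (l * N) ≤ Fintype.card (Gp p) * (N * l2Norm f ^ 2) := by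
    have e1 : ∀ a, ∑ x, ‖conv f (v a) x‖ ^ 2 = l * N := by
      intro a
      rw [← l2Norm_sq, hl _ (hinv w hw _), l2Norm_sq (v a), hvn]
    calc (Fintype.card T : ℝ) * (l * N) = ∑ a : T, ∑ x, ‖conv f (v a) x‖ ^ 2 := by
          simp only [e1, Finset.sum_const, Finset.card_univ, nsmul_eq_mul]
      _ = ∑ x, ∑ a : T, ‖conv f (v a) x‖ ^ 2 := Finset.sum_comm
      _ ≤ ∑ x : Gp p, N * l2Norm f ^ 2 := by
          refine Finset.sum_le_sum fun x _ => ?_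
          rw [l2Norm_sq]
          refine bessel univ (fun a g => v a (g⁻¹ * x)) f N hNpos ?_ ?_
          · intro a
            rw [← hvn a, ← sum_inv (fun g => ‖v a (g⁻¹ * x)‖ ^ 2)]
            simp only [inv_inv]
            exact sum_mul_right x (fun g => ‖v a g‖ ^ 2)
          · intro a b hab
            rw [← horth a b hab, ← sum_inv (fun g => (starRingEnd ℂ) (v a (g⁻¹ * x)) * v b (g⁻¹ * x))]
            simp only [inv_inv]
            exact sum_mul_right x (fun g => (starRingEnd ℂ) (v a g) * v b g)
      _ = _ := by simp
  have hlT : (Fintype.card T : ℝ) * l ≤ Fintype.card (Gp p) * l2Norm f ^ 2 := by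
    have : ((Fintype.card T : ℝ) * l) * N ≤ (Fintype.card (Gp p) * l2Norm f ^ 2) * N := by linarith
    exact le_of_mul_le_mul_right this hNpos
  have hT : ∏ i, (((p i : ℝ) - 1) / 2) ≤ (Fintype.card T : ℝ) := by
    rw [Fintype.card_pi, Nat.cast_prod]
    refine Finset.prod_le_prod (fun i _ => ?_) fun i _ => card_squares (p i)
    have h1 : (1 : ℝ) ≤ p i := by exact_mod_cast (Fact.out : (p i).Prime).one_le
    linarith
  calc l2Norm (conv f φ) ^ 2 * ∏ i, (((p i : ℝ) - 1) / 2)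
      ≤ l2Norm (conv f φ) ^ 2 * Fintype.card T := by gcongr
    _ ≤ (l * l2Norm φ ^ 2) * Fintype.card T := by gcongr; exact hmax φ hφ
    _ = (Fintype.card T * l) * l2Norm φ ^ 2 := by ring
    _ ≤ _ := by gcongr

end Quasirandom

theorem quasirandom_prime {p : ℕ} [Fact p.Prime] (f φ : SL p → ℂ) (hφ : ∑ x, φ x = 0) :
    l2Norm (conv f φ) ^ 2 * (((p : ℝ) - 1) / 2) ≤
      Fintype.card (SL p) * l2Norm f ^ 2 * l2Norm φ ^ 2 := by
  let e : (∀ _ : Unit, SL p) ≃ SL p := Equiv.funUnique Unit (SL p)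
  have hsum : ∀ {M : Type} [AddCommMonoid M] (F : SL p → M), ∑ x : (∀ _ : Unit, SL p), F (x ()) = ∑ x, F x :=
    fun F => Equiv.sum_comp e F
  have hl : ∀ F : SL p → ℂ, l2Norm (fun x : (∀ _ : Unit, SL p) => F (x ())) = l2Norm F := by
    intro F
    unfold l2Norm
    rw [hsum (fun x => ‖F x‖ ^ 2)]
  have hc : conv (fun x : (∀ _ : Unit, SL p) => f (x ())) (fun x => φ (x ())) = fun x => conv f φ (x ()) := by
    ext x
    exact hsum (fun g => f g * φ (g⁻¹ * x ()))
  have hcard : Fintype.card (Gp (fun _ : Unit => p)) = Fintype.card (SL p) := Fintype.card_congr e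
  have := quasirandom (p := fun _ : Unit => p) (fun x => f (x ())) (φ := fun x => φ (x ())) (by
    intro i x
    cases i
    have : ∀ g : SL p, φ ((x * (Pi.mulSingle () g : Gp (fun _ : Unit => p))) ()) = φ (x () * g) := by
      intro g; simp
    simp only [this]
    rw [← hφ]
    exact sum_mul_left (x ()) φ)
  rw [hc, hl, hl, hl, hcard] at this
  simpa using this

/-- Gowers' trick. -/
theorem gowers {p : ℕ} [Fact p.Prime] (X Y Z : Finset (SL p))
    (h : (Fintype.card (SL p) : ℝ) ^ 3 < #X * #Y * #Z * (((p : ℝ) - 1) / 2)) (g : SL p) :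
    g ∈ X * Y * Z := by
  by_contra hg
  set N : ℝ := (Fintype.card (SL p) : ℝ) with hN
  have hNpos : 0 < N := by rw [hN]; exact_mod_cast Fintype.card_pos
  have hp1 : (1 : ℝ) < p := by exact_mod_cast (Fact.out : p.Prime).one_lt
  set x : ℝ := (#X : ℝ)
  set y : ℝ := (#Y : ℝ)
  set z : ℝ := (#Z : ℝ)
  let f : SL p → ℂ := fun a => if a ∈ X then 1 else 0
  let b : SL p → ℂ := fun a => if a ∈ Y then 1 else 0
  let φ : SL p → ℂ := fun a => b a - (y / N : ℝ)
  have hφ0 : ∑ a, φ a = 0 := by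
    simp only [φ, b, Finset.sum_sub_distrib, Finset.sum_ite_mem, Finset.univ_inter, Finset.sum_const, Finset.card_univ]
    have : (N : ℂ) ≠ 0 := by exact_mod_cast hNpos.ne'
    simp only [nsmul_eq_mul, mul_one, Complex.ofReal_div]
    have e : ((Fintype.card (SL p) : ℕ) : ℂ) = (N : ℂ) := by simp [hN]
    rw [e, mul_div_cancel₀ _ this]
    simp [y]
  have hf : l2Norm f ^ 2 = x := by
    rw [l2Norm_sq]
    have : ∀ a, ‖f a‖ ^ 2 = if a ∈ X then 1 else 0 := by intro a; simp only [f]; split_ifs <;> simp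
    simp only [this, Finset.sum_ite_mem, Finset.univ_inter, Finset.sum_const]; simp [x]
  have hφ : l2Norm φ ^ 2 ≤ y := by
    rw [l2Norm_sq]
    have : ∀ a, ‖φ a‖ ^ 2 = (if a ∈ Y then 1 else 0) * (1 - 2 * (y / N)) + (y / N) ^ 2 := by
      intro a
      simp only [φ, b]
      split_ifs
      · rw [← Complex.ofReal_one, ← Complex.ofReal_sub, Complex.norm_real, Real.norm_eq_abs, sq_abs]; ring
      · rw [zero_sub, norm_neg, Complex.norm_real, Real.norm_eq_abs, sq_abs]; ring
    simp only [this, Finset.sum_add_distrib, ← Finset.sum_mul, Finset.sum_ite_mem, Finset.univ_inter,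
      Finset.sum_const, Finset.card_univ, nsmul_eq_mul, mul_one]
    rw [← hN]
    have : y * (1 - 2 * (y / N)) + N * (y / N) ^ 2 = y - y ^ 2 / N := by field_simp; ring
    rw [this]
    have : 0 ≤ y ^ 2 / N := by positivity
    linarith
  have hcv : ∀ a, conv f φ a = conv f b a - (x * y / N : ℝ) := by
    intro a
    simp only [conv, φ, mul_sub, Finset.sum_sub_distrib, ← Finset.sum_mul]
    congr 1
    have : ∑ i, f i = x := by simp [f, x]
    rw [this]; push_cast; ring
  have hzero : ∀ c ∈ Z, conv f b (g * c⁻¹) = 0 := by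
    intro c hc
    refine Finset.sum_eq_zero fun a _ => ?_
    simp only [f, b]
    split_ifs with h1 h2 <;> simp
    apply hg
    have : g = a * (a⁻¹ * (g * c⁻¹)) * c := by group
    rw [this]
    exact Finset.mul_mem_mul (Finset.mul_mem_mul h1 h2) hc
  have h1 : z * (x * y / N) ^ 2 ≤ l2Norm (conv f φ) ^ 2 := by
    rw [l2Norm_sq]
    calc z * (x * y / N) ^ 2 = ∑ c ∈ Z, ‖conv f φ (g * c⁻¹)‖ ^ 2 := by
          rw [Finset.sum_congr rfl fun c hc => by rw [hcv, hzero c hc, zero_sub, norm_neg, Complex.norm_real, Real.norm_eq_abs, sq_abs]]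
          simp [z]
      _ ≤ ∑ c, ‖conv f φ (g * c⁻¹)‖ ^ 2 :=
          Finset.sum_le_sum_of_subset_of_nonneg (Finset.subset_univ _) fun _ _ _ => by positivity
      _ = ∑ c, ‖conv f φ c‖ ^ 2 := by
          rw [← sum_inv]; simp only [inv_inv]
          exact sum_mul_left g (fun c => ‖conv f φ c‖ ^ 2)
  have h2 := quasirandom_prime f φ hφ0
  rw [hf, ← hN] at h2
  have h3 : z * (x * y / N) ^ 2 * (((p : ℝ) - 1) / 2) ≤ N * x * y := by
    have : 0 ≤ ((p : ℝ) - 1) / 2 := by linarith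
    calc _ ≤ l2Norm (conv f φ) ^ 2 * (((p : ℝ) - 1) / 2) := by gcongr
      _ ≤ _ := h2
      _ ≤ _ := by gcongr
  have hxy : 0 < x * y := by
    have hx : 0 ≤ x := Nat.cast_nonneg _
    have hy : 0 ≤ y := Nat.cast_nonneg _
    rcases (mul_nonneg hx hy).eq_or_lt with h0 | h0
    · rw [← h0] at h; simp at h
      have := pow_pos hNpos 3
      linarith
    · exact h0
  have h4 : z * (x * y / N) ^ 2 * (((p : ℝ) - 1) / 2) = (x * y) * (x * y * z * (((p : ℝ) - 1) / 2)) / N ^ 2 := by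
    field_simp
  rw [h4, div_le_iff₀ (by positivity)] at h3
  have : (x * y) * (x * y * z * (((p : ℝ) - 1) / 2)) ≤ (x * y) * N ^ 3 := by linarith
  have := le_of_mul_le_mul_left this hxy
  linarith

open scoped commutatorElement

section Count
variable {F : Type*} [Field F] [Fintype F]

theorem card_quad (A B C : F) (hA : A ≠ 0) :
    #(univ.filter fun a : F => A * a ^ 2 + B * a + C = 0) ≤ 2 := by
  rcases Finset.eq_empty_or_nonempty (univ.filter fun a : F => A * a ^ 2 + B * a + C = 0) with h | ⟨x, hx⟩
  · simp [h]
  · refine (Finset.card_le_card (t := {x, -B / A - x}) ?_).trans Finset.card_le_two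
    intro y hy
    simp only [Finset.mem_filter, Finset.mem_univ, true_and] at hx hy
    simp only [Finset.mem_insert, Finset.mem_singleton]
    by_cases h : y = x
    · exact Or.inl h
    · right
      have h1 : (y - x) * (A * (y + x) + B) = 0 := by linear_combination hy - hx
      rcases mul_eq_zero.1 h1 with h2 | h2
      · exact absurd (sub_eq_zero.1 h2) h
      · field_simp; linear_combination h2

theorem card_hyperbola (k : F) :
    #(univ.filter fun x : F × F => x.1 * x.2 = k) ≤ 2 * Fintype.card F := by
  have h : (univ.filter fun x : F × F => x.1 * x.2 = k) ⊆
      (univ.image fun c : F => ((0 : F), c)) ∪ univ.image fun b : F => (b, k / b) := by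
    rintro ⟨b, c⟩ h
    simp only [Finset.mem_filter, Finset.mem_univ, true_and] at h
    simp only [Finset.mem_union, Finset.mem_image, Finset.mem_univ, true_and]
    by_cases hb : b = 0
    · left; exact ⟨c, by simp [hb]⟩
    · right; refine ⟨b, ?_⟩; rw [← h]; field_simp
  calc _ ≤ _ := Finset.card_le_card h
    _ ≤ _ := Finset.card_union_le _ _
    _ ≤ Fintype.card F + Fintype.card F := by
        refine Nat.add_le_add ?_ ?_ <;> exact Finset.card_image_le
    _ = _ := by ring

end Count

section SLp
variable {p : ℕ} [Fact p.Prime]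

/-- Nat version of the fibre bound. -/
theorem card_le_mul_of_fiber_le' {α β : Type*} [DecidableEq β] (f : α → β) (X : Finset α) (Y : Finset β) (t : ℕ)
    (h : ∀ x ∈ X, f x ∈ Y) (h' : ∀ y ∈ Y, #(X.filter fun x => f x = y) ≤ t) : #X ≤ #Y * t := by
  rw [mul_comm]
  exact Finset.card_le_mul_card_image_of_maps_to h t h'

theorem mem_center_iff' {g : SL p} :
    g ∈ Subgroup.center (SL p) ↔ g.1 0 1 = 0 ∧ g.1 1 0 = 0 ∧ g.1 0 0 = g.1 1 1 := by
  constructor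
  · intro h
    rw [Subgroup.mem_center_iff] at h
    have h1 := h (uu 1)
    have h2 := h (ll 1)
    have a1 := congrArg (fun m : SL p => m.1 0 0) h1
    have a2 := congrArg (fun m : SL p => m.1 0 1) h1
    have a3 := congrArg (fun m : SL p => m.1 0 0) h2
    simp only [mul_00, mul_01, uu_val, ll_val] at a1 a2 a3
    simp at a1 a2 a3
    refine ⟨a3, a1, ?_⟩
    linear_combination -a2
  · rintro ⟨h1, h2, h3⟩
    rw [Subgroup.mem_center_iff]
    intro h
    apply sl_ext <;> simp only [mul_00, mul_01, mul_10, mul_11, h1, h2, h3] <;> ring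

theorem card_center : #(univ.filter fun g : SL p => g ∈ Subgroup.center (SL p)) ≤ 2 := by
  refine le_trans ?_ (card_quad (F := ZMod p) 1 0 (-1) one_ne_zero)
  refine Finset.card_le_card_of_injOn (fun g => g.1 0 0) ?_ ?_
  · intro g hg
    simp only [Finset.coe_filter, Finset.mem_univ, true_and, Set.mem_ofPred_eq, mem_center_iff'] at hg ⊢
    have := sl_det g
    rw [hg.1, hg.2.2] at *
    linear_combination this
  · intro g hg h hh e
    simp only [Finset.coe_filter, Finset.mem_univ, true_and, Set.mem_ofPred_eq, mem_center_iff'] at hg hh e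
    apply sl_ext
    · exact e
    · rw [hg.1, hh.1]
    · rw [hg.2.1, hh.2.1]
    · rw [← hg.2.2, ← hh.2.2, e]

theorem card_centralizer {h : SL p} (hh : h ∉ Subgroup.center (SL p)) :
    #(univ.filter fun g : SL p => g * h = h * g) ≤ 2 * p := by
  have hF : Fintype.card (ZMod p) = p := ZMod.card p
  have key : ∀ g : SL p, g * h = h * g → g.1 0 1 * h.1 1 0 = g.1 1 0 * h.1 0 1 ∧
      (g.1 0 0 - g.1 1 1) * h.1 0 1 = g.1 0 1 * (h.1 0 0 - h.1 1 1) ∧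
      (g.1 0 0 - g.1 1 1) * h.1 1 0 = g.1 1 0 * (h.1 0 0 - h.1 1 1) := by
    intro g e
    have a1 := congrArg (fun m : SL p => m.1 0 0) e
    have a2 := congrArg (fun m : SL p => m.1 0 1) e
    have a3 := congrArg (fun m : SL p => m.1 1 0) e
    simp only [mul_00, mul_01, mul_10] at a1 a2 a3
    refine ⟨?_, ?_, ?_⟩
    · linear_combination a1
    · linear_combination a2
    · linear_combination -a3
  obtain ⟨f, hf⟩ : ∃ f : SL p → ZMod p, ∀ g : SL p, g * h = h * g →
      g.1 0 1 = f g * h.1 0 1 ∧ g.1 1 0 = f g * h.1 1 0 ∧ g.1 0 0 - g.1 1 1 = f g * (h.1 0 0 - h.1 1 1) := by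
    by_cases h1 : h.1 0 1 = 0
    · by_cases h2 : h.1 1 0 = 0
      · have h3 : h.1 0 0 - h.1 1 1 ≠ 0 := fun h3 => hh (mem_center_iff'.2 ⟨h1, h2, sub_eq_zero.1 h3⟩)
        refine ⟨fun g => (g.1 0 0 - g.1 1 1) / (h.1 0 0 - h.1 1 1), fun g e => ?_⟩
        obtain ⟨k1, k2, k3⟩ := key g e
        refine ⟨?_, ?_, ?_⟩
        · field_simp; exact k2.symm
        · field_simp; exact k3.symm
        · field_simp
      · refine ⟨fun g => g.1 1 0 / h.1 1 0, fun g e => ?_⟩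
        obtain ⟨k1, k2, k3⟩ := key g e
        refine ⟨?_, ?_, ?_⟩
        · field_simp; exact k1
        · field_simp
        · field_simp; exact k3
    · refine ⟨fun g => g.1 0 1 / h.1 0 1, fun g e => ?_⟩
      obtain ⟨k1, k2, k3⟩ := key g e
      refine ⟨?_, ?_, ?_⟩
      · field_simp
      · field_simp; exact k1.symm
      · field_simp; exact k2
  have := card_le_mul_of_fiber_le' f (univ.filter fun g : SL p => g * h = h * g) univ 2 (by simp) ?_
  · rw [Finset.card_univ, hF] at this; linarith
  intro t _
  refine le_trans ?_ (card_quad (F := ZMod p) 1 (t * (h.1 0 0 - h.1 1 1)) (-t ^ 2 * (h.1 0 1 * h.1 1 0) - 1) one_ne_zero)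
  refine Finset.card_le_card_of_injOn (fun g => g.1 1 1) ?_ ?_
  · intro g hg
    simp only [Finset.coe_filter, Finset.mem_univ, true_and, Set.mem_ofPred_eq, Finset.mem_filter] at hg ⊢
    obtain ⟨k1, k2, k3⟩ := hf g hg.1
    rw [hg.2] at k1 k2 k3
    have := sl_det g
    rw [k1, k2] at this
    linear_combination this - g.1 1 1 * k3
  · intro g hg g' hg' e
    simp only [Finset.coe_filter, Finset.mem_univ, true_and, Set.mem_ofPred_eq, Finset.mem_filter] at hg hg' e
    obtain ⟨k1, k2, k3⟩ := hf g hg.1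
    obtain ⟨k1', k2', k3'⟩ := hf g' hg'.1
    rw [hg.2] at k1 k2 k3
    rw [hg'.2] at k1' k2' k3'
    apply sl_ext
    · linear_combination k3 - k3' + e
    · rw [k1, k1']
    · rw [k2, k2']
    · exact e

/-- The trace. -/
def tr (g : SL p) : ZMod p := g.1 0 0 + g.1 1 1

theorem tr_mul_comm (g h : SL p) : tr (g * h) = tr (h * g) := by
  simp only [tr, mul_00, mul_11]; ring

theorem tr_conj (g h : SL p) : tr (g * h * g⁻¹) = tr h := by
  rw [tr_mul_comm]; simp

theorem card_two_traces {h : SL p} (hh : h ∉ Subgroup.center (SL p)) (τ τ' : ZMod p) :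
    #(univ.filter fun z : SL p => tr z = τ ∧ tr (z * h) = τ') ≤ 2 * p := by
  have hF : Fintype.card (ZMod p) = p := ZMod.card p
  have key : ∀ z : SL p, tr z = τ ∧ tr (z * h) = τ' → z.1 1 1 = τ - z.1 0 0 ∧
      z.1 0 0 * h.1 0 0 + z.1 0 1 * h.1 1 0 + z.1 1 0 * h.1 0 1 + (τ - z.1 0 0) * h.1 1 1 = τ' ∧
      z.1 0 0 * (τ - z.1 0 0) - z.1 0 1 * z.1 1 0 = 1 := by
    rintro z ⟨h1, h2⟩
    simp only [tr, mul_00, mul_11] at h1 h2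
    have e : z.1 1 1 = τ - z.1 0 0 := by linear_combination h1
    have := sl_det z
    rw [e] at this h2
    exact ⟨e, by linear_combination h2, this⟩
  by_cases h1 : h.1 0 1 = 0
  · by_cases h2 : h.1 1 0 = 0
    · have h3 : h.1 0 0 - h.1 1 1 ≠ 0 := fun h3 => hh (mem_center_iff'.2 ⟨h1, h2, sub_eq_zero.1 h3⟩)
      set a : ZMod p := (τ' - τ * h.1 1 1) / (h.1 0 0 - h.1 1 1) with ha
      have ka : ∀ z : SL p, tr z = τ ∧ tr (z * h) = τ' → z.1 0 0 = a := by
        intro z hz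
        obtain ⟨k1, k2, k3⟩ := key z hz
        rw [h1, h2] at k2
        rw [ha, eq_div_iff h3]
        linear_combination k2
      refine le_trans ?_ ((card_hyperbola (F := ZMod p) (a * (τ - a) - 1)).trans (by rw [hF]))
      refine Finset.card_le_card_of_injOn (fun z => (z.1 0 1, z.1 1 0)) ?_ ?_
      · intro z hz
        simp only [Finset.coe_filter, Finset.mem_univ, true_and, Set.mem_ofPred_eq] at hz ⊢
        obtain ⟨k1, k2, k3⟩ := key z hz
        rw [ka z hz] at k3
        linear_combination -k3
      · intro z hz w hw e
        simp only [Finset.coe_filter, Finset.mem_univ, true_and, Set.mem_ofPred_eq, Prod.mk.injEq] at hz hw e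
        apply sl_ext
        · rw [ka z hz, ka w hw]
        · exact e.1
        · exact e.2
        · rw [(key z hz).1, (key w hw).1, ka z hz, ka w hw]
    · have := card_le_mul_of_fiber_le' (fun z : SL p => z.1 1 0)
        (univ.filter fun z : SL p => tr z = τ ∧ tr (z * h) = τ') univ 2 (by simp) ?_
      · rw [Finset.card_univ, hF] at this; linarith
      intro c _
      refine le_trans ?_ (card_quad (F := ZMod p) (-h.1 1 0) (h.1 1 0 * τ + c * (h.1 0 0 - h.1 1 1))
        (-h.1 1 0 - c * (τ' - τ * h.1 1 1 - c * h.1 0 1)) (neg_ne_zero.2 h2))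
      refine Finset.card_le_card_of_injOn (fun z => z.1 0 0) ?_ ?_
      · intro z hz
        simp only [Finset.coe_filter, Finset.mem_univ, true_and, Set.mem_ofPred_eq, Finset.mem_filter] at hz ⊢
        obtain ⟨k1, k2, k3⟩ := key z hz.1
        rw [hz.2] at k2 k3
        linear_combination h.1 1 0 * k3 + c * k2
      · intro z hz w hw e
        simp only [Finset.coe_filter, Finset.mem_univ, true_and, Set.mem_ofPred_eq, Finset.mem_filter] at hz hw e
        obtain ⟨k1, k2, k3⟩ := key z hz.1
        obtain ⟨k1', k2', k3'⟩ := key w hw.1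
        rw [hz.2] at k2
        rw [hw.2] at k2'
        apply sl_ext
        · exact e
        · apply mul_right_cancel₀ h2
          rw [e] at k2
          linear_combination k2 - k2'
        · rw [hz.2, hw.2]
        · rw [k1, k1', e]
  · have := card_le_mul_of_fiber_le' (fun z : SL p => z.1 0 1)
      (univ.filter fun z : SL p => tr z = τ ∧ tr (z * h) = τ') univ 2 (by simp) ?_
    · rw [Finset.card_univ, hF] at this; linarith
    intro c _
    refine le_trans ?_ (card_quad (F := ZMod p) (-h.1 0 1) (h.1 0 1 * τ + c * (h.1 0 0 - h.1 1 1))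
      (-h.1 0 1 - c * (τ' - τ * h.1 1 1 - c * h.1 1 0)) (neg_ne_zero.2 h1))
    refine Finset.card_le_card_of_injOn (fun z => z.1 0 0) ?_ ?_
    · intro z hz
      simp only [Finset.coe_filter, Finset.mem_univ, true_and, Set.mem_ofPred_eq, Finset.mem_filter] at hz ⊢
      obtain ⟨k1, k2, k3⟩ := key z hz.1
      rw [hz.2] at k2 k3
      linear_combination h.1 0 1 * k3 + c * k2
    · intro z hz w hw e
      simp only [Finset.coe_filter, Finset.mem_univ, true_and, Set.mem_ofPred_eq, Finset.mem_filter] at hz hw e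
      obtain ⟨k1, k2, k3⟩ := key z hz.1
      obtain ⟨k1', k2', k3'⟩ := key w hw.1
      rw [hz.2] at k2
      rw [hw.2] at k2'
      apply sl_ext
      · exact e
      · rw [hz.2, hw.2]
      · apply mul_right_cancel₀ h1
        rw [e] at k2
        linear_combination k2 - k2'
      · rw [k1, k1', e]

theorem card_sl_add : Fintype.card (SL p) + p = p ^ 3 := by
  have hF : Fintype.card (ZMod p) = p := ZMod.card p
  have hU : Fintype.card (ZMod p)ˣ + 1 = p := by
    rw [ZMod.card_units_eq_totient, Nat.totient_prime Fact.out]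
    exact Nat.sub_add_cancel (Fact.out : p.Prime).one_le
  let e1 : {g : SL p // g.1 1 0 ≠ 0} ≃ ZMod p × (ZMod p)ˣ × ZMod p :=
    { toFun := fun g => (g.1.1 0 0, Units.mk0 _ g.2, g.1.1 1 1)
      invFun := fun x => ⟨⟨!![x.1, (x.1 * x.2.2 - 1) / x.2.1; (x.2.1 : ZMod p), x.2.2], by
        rw [Matrix.det_fin_two_of]; field_simp; ring⟩, x.2.1.ne_zero⟩
      left_inv := by
        rintro ⟨g, hg⟩
        apply Subtype.ext
        have := sl_det g
        have hg' : g.1 1 0 ≠ 0 := hg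
        refine sl_ext rfl ?_ rfl rfl
        show (g.1 0 0 * g.1 1 1 - 1) / g.1 1 0 = g.1 0 1
        rw [div_eq_iff hg']; linear_combination this
      right_inv := by
        rintro ⟨a, c, d⟩
        refine Prod.ext rfl (Prod.ext ?_ rfl)
        exact Units.ext rfl }
  let e2 : {g : SL p // ¬ g.1 1 0 ≠ 0} ≃ (ZMod p)ˣ × ZMod p :=
    { toFun := fun g => (⟨g.1.1 0 0, g.1.1 1 1, by
        have := sl_det g.1; rw [not_not.1 g.2] at this; linear_combination this, by
        have := sl_det g.1; rw [not_not.1 g.2] at this; linear_combination this⟩, g.1.1 0 1)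
      invFun := fun x => ⟨⟨!![(x.1 : ZMod p), x.2; 0, ((x.1⁻¹ : (ZMod p)ˣ) : ZMod p)], by
        rw [Matrix.det_fin_two_of, mul_zero, sub_zero, Units.mul_inv]⟩, fun h => h rfl⟩
      left_inv := by
        rintro ⟨g, hg⟩
        apply Subtype.ext
        exact sl_ext rfl rfl (not_not.1 hg).symm rfl
      right_inv := by
        rintro ⟨a, d⟩
        exact Prod.ext (Units.ext rfl) rfl }
  have h := Fintype.card_subtype_compl (fun g : SL p => g.1 1 0 ≠ 0)
  have h' := Fintype.card_subtype_le (fun g : SL p => g.1 1 0 ≠ 0)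
  rw [Fintype.card_congr e2] at h
  rw [Fintype.card_congr e1] at h h'
  simp only [Fintype.card_prod, hF] at h h'
  set u := Fintype.card (ZMod p)ˣ
  have h2 : Fintype.card (SL p) = u * p + p * (u * p) := by omega
  rw [h2, ← hU]; ring

theorem card_sl_ge : (p : ℝ) ^ 3 / 2 ≤ Fintype.card (SL p) := by
  have h : (Fintype.card (SL p) : ℝ) + p = (p : ℝ) ^ 3 := by exact_mod_cast card_sl_add (p := p)
  have h2 : (2 : ℝ) ≤ p := by exact_mod_cast (Fact.out : p.Prime).two_le
  nlinarith [mul_nonneg (sub_nonneg.2 h2) (by positivity : (0:ℝ) ≤ p), sq_nonneg ((p:ℝ))]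

theorem card_sl_le : (Fintype.card (SL p) : ℝ) ≤ (p : ℝ) ^ 3 := by
  have h : (Fintype.card (SL p) : ℝ) + p = (p : ℝ) ^ 3 := by exact_mod_cast card_sl_add (p := p)
  have : (0 : ℝ) ≤ p := Nat.cast_nonneg _
  linarith

theorem card_central_pairs (Y : Finset (SL p)) :
    #((Y ×ˢ Y).filter fun x => x.1⁻¹ * x.2 ∈ Subgroup.center (SL p)) ≤ #Y * 2 := by
  refine card_le_mul_of_fiber_le' (fun x => x.1) _ Y 2 ?_ ?_
  · intro x hx
    simp only [Finset.mem_filter, Finset.mem_product] at hx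
    exact hx.1.1
  · intro y _
    refine le_trans ?_ (card_center (p := p))
    refine Finset.card_le_card_of_injOn (fun x => x.1⁻¹ * x.2) ?_ ?_
    · intro x hx
      simp only [Finset.coe_filter, Finset.mem_univ, true_and, Set.mem_ofPred_eq, Finset.mem_filter] at hx ⊢
      exact hx.1.2
    · rintro ⟨x, x'⟩ hx ⟨z, z'⟩ hz e
      simp only [Finset.coe_filter, Finset.mem_univ, true_and, Set.mem_ofPred_eq, Finset.mem_filter] at hx hz e
      obtain ⟨_, rfl⟩ := hx
      obtain ⟨_, rfl⟩ := hz
      simpa using e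

/-- Pairs with quotient of given trace. -/
noncomputable def nTr (τ : ZMod p) (Y : Finset (SL p)) : ℕ :=
  #((Y ×ˢ Y).filter fun x => tr (x.1⁻¹ * x.2) = τ)

theorem nTr_sq_le (τ : ZMod p) (Y : Finset (SL p)) : nTr τ Y ^ 2 ≤ 4 * p * #Y ^ 3 := by
  have e1 : nTr τ Y = ∑ z ∈ Y, #(Y.filter fun z' => tr (z⁻¹ * z') = τ) := by
    rw [nTr, Finset.card_filter, Finset.sum_product]
    simp only [Finset.card_filter]
  have e2 : nTr τ Y ^ 2 ≤ #Y * ∑ z ∈ Y, #(Y.filter fun z' => tr (z⁻¹ * z') = τ) ^ 2 := by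
    rw [e1]; exact sq_sum_le_card_mul_sum_sq
  have e3 : ∑ z ∈ Y, #(Y.filter fun z' => tr (z⁻¹ * z') = τ) ^ 2 =
      ∑ x ∈ Y ×ˢ Y, #(Y.filter fun z => tr (z⁻¹ * x.1) = τ ∧ tr (z⁻¹ * x.2) = τ) := by
    simp only [Finset.card_filter, sq, Finset.sum_mul_sum]
    conv_rhs => rw [Finset.sum_comm]
    refine Finset.sum_congr rfl fun z _ => ?_
    rw [Finset.sum_product]
    refine Finset.sum_congr rfl fun a _ => Finset.sum_congr rfl fun b _ => ?_
    by_cases h1 : tr (z⁻¹ * a) = τ <;> by_cases h2 : tr (z⁻¹ * b) = τ <;> simp [h1, h2]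
  have e4 : ∀ x ∈ Y ×ˢ Y, #(Y.filter fun z => tr (z⁻¹ * x.1) = τ ∧ tr (z⁻¹ * x.2) = τ) ≤
      2 * p + (if x.1⁻¹ * x.2 ∈ Subgroup.center (SL p) then #Y else 0) := by
    intro x _
    split_ifs with h
    · exact (Finset.card_filter_le _ _).trans (Nat.le_add_left _ _)
    · rw [add_zero]
      refine le_trans ?_ (card_two_traces h τ τ)
      refine Finset.card_le_card_of_injOn (fun z => z⁻¹ * x.1) ?_ ?_
      · intro z hz
        simp only [Finset.coe_filter, Finset.mem_univ, true_and, Set.mem_ofPred_eq] at hz ⊢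
        refine ⟨hz.2.1, ?_⟩
        have : z⁻¹ * x.1 * (x.1⁻¹ * x.2) = z⁻¹ * x.2 := by group
        rw [this]; exact hz.2.2
      · intro z _ w _ e
        simpa using e
  rw [e3] at e2
  have e5 := Finset.sum_le_sum e4
  rw [Finset.sum_add_distrib, Finset.sum_const, ← Finset.sum_filter, Finset.sum_const, Finset.card_product,
    smul_eq_mul, smul_eq_mul] at e5
  have e6 := card_central_pairs Y
  have hp := (Fact.out : p.Prime).one_le
  calc nTr τ Y ^ 2 ≤ _ := e2
    _ ≤ #Y * (#Y * #Y * (2 * p) + #Y * 2 * #Y) := by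
        refine Nat.mul_le_mul_left _ (e5.trans ?_); gcongr
    _ ≤ #Y * (#Y * #Y * (2 * p) + #Y * (2 * p) * #Y) := by gcongr; omega
    _ = _ := by ring

/-- Number of collisions `x a y = x' a y'`. -/
noncomputable def coll {G : Type*} [Group G] (X : Finset G) (a : G) (Y : Finset G) : ℕ :=
  #(((X ×ˢ X) ×ˢ (Y ×ˢ Y)).filter fun x => x.1.1 * a * x.2.1 = x.1.2 * a * x.2.2)

theorem card_conj_eq (u w : SL p) :
    #(univ.filter fun a : SL p => u * a = a * w) ≤
      (if u ∈ Subgroup.center (SL p) ∧ u = w then Fintype.card (SL p) else 0) +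
      (if tr w = tr u then 2 * p else 0) := by
  by_cases hu : u ∈ Subgroup.center (SL p)
  · by_cases huw : u = w
    · simp only [hu, huw, and_self, if_true]
      refine (Finset.card_le_univ _).trans ?_
      rw [huw] at hu
      simp [hu]
    · have : (univ.filter fun a : SL p => u * a = a * w) = ∅ := by
        ext a
        simp only [Finset.mem_filter, Finset.mem_univ, true_and, Finset.notMem_empty, iff_false]
        intro h
        rw [← Subgroup.mem_center_iff.1 hu a] at h
        exact huw (mul_left_cancel h)
      rw [this]; simp
  · simp only [hu, false_and, if_false, zero_add]
    rcases Finset.eq_empty_or_nonempty (univ.filter fun a : SL p => u * a = a * w) with h | ⟨b, hb⟩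
    · rw [h]; simp
    · simp only [Finset.mem_filter, Finset.mem_univ, true_and] at hb
      have hw : u = b * w * b⁻¹ := by rw [← hb]; group
      have : tr w = tr u := by rw [hw, tr_conj]
      rw [if_pos this]
      refine le_trans ?_ (card_centralizer hu)
      refine Finset.card_le_card_of_injOn (fun a => a * b⁻¹) ?_ ?_
      · intro a ha
        simp only [Finset.coe_filter, Finset.mem_univ, true_and, Set.mem_ofPred_eq] at ha ⊢
        have e1 : a * b⁻¹ * u = a * w * b⁻¹ := by rw [hw]; group
        rw [e1, ← ha]; group
      · intro a _ b _ e; simpa using e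

theorem sum_coll_le (X Y : Finset (SL p)) (α : SL p → ℝ)
    (hα : ∀ a, α a ≤ 2 / Fintype.card (SL p)) :
    ∑ a, α a * coll X a Y ≤ 4 * #X * #Y + 16 * (p : ℝ) ^ (-(3/2) : ℝ) * #X ^ 2 * (#Y : ℝ) ^ (3/2 : ℝ) := by
  set N := Fintype.card (SL p) with hN
  have hp : (1 : ℝ) ≤ p := by exact_mod_cast (Fact.out : p.Prime).one_le
  have hN0 : (0 : ℝ) < N := by rw [hN]; exact_mod_cast Fintype.card_pos
  have e1 : ∑ a, coll X a Y = ∑ x ∈ X ×ˢ X, ∑ y ∈ Y ×ˢ Y,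
      #(univ.filter fun a : SL p => (x.2⁻¹ * x.1) * a = a * (y.2 * y.1⁻¹)) := by
    simp only [coll, Finset.card_filter]
    rw [Finset.sum_comm, Finset.sum_product]
    refine Finset.sum_congr rfl fun x _ => Finset.sum_congr rfl fun y _ => Finset.sum_congr rfl fun a _ => ?_
    congr 1
    rw [eq_iff_iff, mul_assoc x.2⁻¹, inv_mul_eq_iff_eq_mul, ← mul_assoc a, ← mul_assoc x.2, eq_mul_inv_iff_mul_eq,
      ← mul_assoc x.2]
  have e2 : ∀ x ∈ X ×ˢ X, ∑ y ∈ Y ×ˢ Y,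
      #(univ.filter fun a : SL p => (x.2⁻¹ * x.1) * a = a * (y.2 * y.1⁻¹)) ≤
      (if x.2⁻¹ * x.1 ∈ Subgroup.center (SL p) then #Y * N else 0) + 2 * p * nTr (tr (x.2⁻¹ * x.1)) Y := by
    intro x _
    refine (Finset.sum_le_sum fun y _ => card_conj_eq _ _).trans ?_
    rw [Finset.sum_add_distrib]
    refine Nat.add_le_add ?_ ?_
    · split_ifs with h
      · rw [Finset.sum_product]
        calc _ = ∑ y ∈ Y, ∑ y' ∈ Y, if x.2⁻¹ * x.1 * y = y' then N else 0 := by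
              refine Finset.sum_congr rfl fun y _ => Finset.sum_congr rfl fun y' _ => ?_
              simp only [h, true_and, eq_mul_inv_iff_mul_eq, hN]
          _ ≤ ∑ y ∈ Y, N := by
              refine Finset.sum_le_sum fun y _ => ?_
              rw [Finset.sum_ite_eq]; split_ifs <;> simp
          _ = _ := by simp
      · simp [h]
    · rw [← Finset.sum_filter, Finset.sum_const, smul_eq_mul, mul_comm, nTr]
      refine Nat.mul_le_mul_left _ (le_of_eq ?_)
      congr 1
      refine Finset.filter_congr fun y _ => ?_
      rw [tr_mul_comm]
  have e3 : ∑ a, coll X a Y ≤ #X * 2 * (#Y * N) + 2 * p * ∑ x ∈ X ×ˢ X, nTr (tr (x.2⁻¹ * x.1)) Y := by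
    rw [e1]
    refine (Finset.sum_le_sum e2).trans ?_
    rw [Finset.sum_add_distrib, ← Finset.mul_sum, ← Finset.sum_filter, Finset.sum_const, smul_eq_mul]
    refine Nat.add_le_add_right (Nat.mul_le_mul_right _ ?_) _
    refine le_trans (le_of_eq ?_) (card_central_pairs X)
    refine Finset.card_bij (fun x _ => x.swap) ?_ ?_ ?_
    · intro x hx; simp only [Finset.mem_filter, Finset.mem_product, Prod.fst_swap, Prod.snd_swap] at hx ⊢; tauto
    · intro x _ y _ e; exact Prod.swap_injective e
    · intro x hx
      refine ⟨x.swap, ?_, by simp⟩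
      simp only [Finset.mem_filter, Finset.mem_product, Prod.fst_swap, Prod.snd_swap] at hx ⊢; tauto
  have e4 : ∀ τ : ZMod p, (nTr τ Y : ℝ) ≤ 2 * (p : ℝ) ^ (1/2 : ℝ) * (#Y : ℝ) ^ (3/2 : ℝ) := by
    intro τ
    have h := nTr_sq_le τ Y
    have h' : (nTr τ Y : ℝ) ^ 2 ≤ 4 * p * (#Y : ℝ) ^ 3 := by exact_mod_cast h
    refine le_of_sq_le_sq ?_ (by positivity)
    have r1 : ((p : ℝ) ^ (1/2 : ℝ)) ^ 2 = p := by
      rw [← Real.rpow_natCast, ← Real.rpow_mul (by positivity)]; norm_num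
    have r2 : ((#Y : ℝ) ^ (3/2 : ℝ)) ^ 2 = (#Y : ℝ) ^ 3 := by
      rw [← Real.rpow_natCast, ← Real.rpow_mul (by positivity), ← Real.rpow_natCast (#Y : ℝ) 3]; norm_num
    rw [mul_pow, mul_pow, r1, r2]
    linarith
  have e5 : (∑ a, (coll X a Y : ℝ)) ≤ 2 * #X * #Y * N + 4 * (p : ℝ) ^ (3/2 : ℝ) * #X ^ 2 * (#Y : ℝ) ^ (3/2 : ℝ) := by
    have h1 : (∑ a, (coll X a Y : ℝ)) ≤ #X * 2 * (#Y * N) + 2 * p * ∑ x ∈ X ×ˢ X, (nTr (tr (x.2⁻¹ * x.1)) Y : ℝ) := by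
      exact_mod_cast e3
    have h2 : ∑ x ∈ X ×ˢ X, (nTr (tr (x.2⁻¹ * x.1)) Y : ℝ) ≤ #X ^ 2 * (2 * (p : ℝ) ^ (1/2 : ℝ) * (#Y : ℝ) ^ (3/2 : ℝ)) := by
      refine (Finset.sum_le_sum fun x _ => e4 _).trans (le_of_eq ?_)
      rw [Finset.sum_const, Finset.card_product, nsmul_eq_mul]; push_cast; ring
    have h3 : (p : ℝ) ^ (3/2 : ℝ) = p * (p : ℝ) ^ (1/2 : ℝ) := by
      rw [← Real.rpow_one_add' (by positivity) (by norm_num)]; norm_num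
    rw [h3]
    calc _ ≤ _ := h1
      _ ≤ #X * 2 * (#Y * N) + 2 * p * (#X ^ 2 * (2 * (p : ℝ) ^ (1/2 : ℝ) * (#Y : ℝ) ^ (3/2 : ℝ))) := by gcongr
      _ = _ := by ring
  calc ∑ a, α a * coll X a Y ≤ ∑ a, 2 / N * (coll X a Y : ℝ) := by
        refine Finset.sum_le_sum fun a _ => ?_
        exact mul_le_mul_of_nonneg_right (hα a) (Nat.cast_nonneg _)
    _ = 2 / N * ∑ a, (coll X a Y : ℝ) := by rw [Finset.mul_sum]
    _ ≤ 2 / N * (2 * #X * #Y * N + 4 * (p : ℝ) ^ (3/2 : ℝ) * #X ^ 2 * (#Y : ℝ) ^ (3/2 : ℝ)) := by gcongr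
    _ = 4 * #X * #Y + (8 * (p : ℝ) ^ (3/2 : ℝ) / N) * (#X ^ 2 * (#Y : ℝ) ^ (3/2 : ℝ)) := by field_simp; ring
    _ ≤ 4 * #X * #Y + (16 * (p : ℝ) ^ (-(3/2) : ℝ)) * (#X ^ 2 * (#Y : ℝ) ^ (3/2 : ℝ)) := by
        gcongr
        rw [div_le_iff₀ hN0]
        have h6 : (p : ℝ) ^ (3/2 : ℝ) = (p : ℝ) ^ (-(3/2) : ℝ) * (p : ℝ) ^ 3 := by
          rw [← Real.rpow_natCast, ← Real.rpow_add (by positivity)]; norm_num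
        have h7 := card_sl_ge (p := p)
        have h8 : (0 : ℝ) < (p : ℝ) ^ (-(3/2) : ℝ) := by positivity
        rw [h6]
        nlinarith
    _ = _ := by ring

theorem card_tr_eq (τ : ZMod p) : #(univ.filter fun y : SL p => tr y = τ) ≤ 2 * p * p := by
  have hF : Fintype.card (ZMod p) = p := ZMod.card p
  have := card_le_mul_of_fiber_le' (fun z : SL p => z.1 0 0)
    (univ.filter fun z : SL p => tr z = τ) univ (2 * p) (by simp) ?_
  · rw [Finset.card_univ, hF] at this; linarith
  intro a _
  refine le_trans ?_ (hF ▸ card_hyperbola (F := ZMod p) (a * (τ - a) - 1))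
  refine Finset.card_le_card_of_injOn (fun z => (z.1 0 1, z.1 1 0)) ?_ ?_
  · intro z hz
    simp only [Finset.coe_filter, Finset.mem_univ, true_and, Set.mem_ofPred_eq, Finset.mem_filter] at hz ⊢
    have := sl_det z
    obtain ⟨h1, rfl⟩ := hz
    rw [← h1, tr]
    linear_combination -this
  · intro z hz w hw e
    simp only [Finset.coe_filter, Finset.mem_univ, true_and, Set.mem_ofPred_eq, Finset.mem_filter, Prod.mk.injEq] at hz hw e
    rw [tr] at hz hw
    refine sl_ext (by rw [hz.2, hw.2]) e.1 e.2 ?_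
    linear_combination hz.1 - hz.2 - hw.1 + hw.2

theorem card_tr_mul_eq {c : SL p} (hc : c ≠ 1) :
    #(univ.filter fun y : SL p => tr (c * y) = tr y) ≤ 2 * p * p := by
  have hF : Fintype.card (ZMod p) = p := ZMod.card p
  by_cases h : c ∈ Subgroup.center (SL p)
  · refine le_trans (Finset.card_le_card ?_) (card_tr_eq 0)
    intro y hy
    simp only [Finset.mem_filter, Finset.mem_univ, true_and] at hy ⊢
    obtain ⟨h1, h2, h3⟩ := mem_center_iff'.1 h
    have hy' : c.1 0 0 * tr y = tr y := by
      conv_rhs => rw [← hy]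
      rw [tr, tr, mul_00, mul_11, h1, h2, ← h3]; ring
    by_contra h0
    apply hc
    have h4 : c.1 0 0 = 1 := by
      apply mul_right_cancel₀ h0; rw [hy', one_mul]
    exact sl_ext h4 h1 h2 (h3 ▸ h4)
  · have := card_le_mul_of_fiber_le' (fun z : SL p => tr z)
      (univ.filter fun z : SL p => tr (c * z) = tr z) univ (2 * p) (by simp) ?_
    · rw [Finset.card_univ, hF] at this; linarith
    intro t _
    refine le_trans (Finset.card_le_card ?_) (card_two_traces h t t)
    intro y hy
    simp only [Finset.mem_filter, Finset.mem_univ, true_and] at hy ⊢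
    rw [tr_mul_comm]
    exact ⟨hy.2, hy.1.trans hy.2⟩

theorem card_conj_solutions (c y : SL p) (hy : y ∉ Subgroup.center (SL p)) :
    #(univ.filter fun x : SL p => ⁅x, y⁆ = c) ≤ if tr (c * y) = tr y then 2 * p else 0 := by
  rcases Finset.eq_empty_or_nonempty (univ.filter fun x : SL p => ⁅x, y⁆ = c) with h | ⟨b, hb⟩
  · rw [h]; simp
  simp only [Finset.mem_filter, Finset.mem_univ, true_and] at hb
  have h1 : c * y = b * y * b⁻¹ := by rw [← hb, commutatorElement_def]; group
  rw [if_pos (by rw [h1, tr_conj])]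
  refine le_trans ?_ (card_centralizer hy)
  refine Finset.card_le_card_of_injOn (fun a => b⁻¹ * a) ?_ ?_
  · intro a ha
    simp only [Finset.coe_filter, Finset.mem_univ, true_and, Set.mem_ofPred_eq] at ha ⊢
    have h2 : a * y * a⁻¹ = b * y * b⁻¹ := by
      rw [← h1, ← ha, commutatorElement_def]; group
    calc b⁻¹ * a * y = b⁻¹ * (a * y * a⁻¹) * a := by group
      _ = _ := by rw [h2]; group
  · intro a _ b _ e; simpa using e

/-- The probability that a commutator of independent elements takes a given value. -/
theorem commutator_law (α β : SL p → ℝ) (C : ℝ) (hC : 1 ≤ C) (hα : ∀ x, 0 ≤ α x) (hβ : ∀ x, 0 ≤ β x)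
    (hα1 : ∑ x, α x ≤ 1) (hβ1 : ∑ x, β x ≤ 1)
    (hαC : ∀ x, x ≠ 1 → α x ≤ C / Fintype.card (SL p)) (hβC : ∀ x, x ≠ 1 → β x ≤ C / Fintype.card (SL p))
    (hα0 : α 1 ≤ C / p) (hβ0 : β 1 ≤ C / p) :
    (∀ c, c ≠ 1 → ∑ x, ∑ y, (if ⁅x, y⁆ = c then α x * β y else 0) ≤ 8 * C ^ 2 / Fintype.card (SL p)) ∧
    ∑ x, ∑ y, (if ⁅x, y⁆ = 1 then α x * β y else 0) ≤ 8 * C ^ 2 / p := by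
  set N : ℝ := (Fintype.card (SL p) : ℝ) with hN
  have hp : (1 : ℝ) ≤ p := by exact_mod_cast (Fact.out : p.Prime).one_le
  have hN0 : 0 < N := by rw [hN]; exact_mod_cast Fintype.card_pos
  have hNp := card_sl_ge (p := p)
  rw [← hN] at hNp
  have hp2 : (2 : ℝ) ≤ p := by exact_mod_cast (Fact.out : p.Prime).two_le
  have hpN : (p : ℝ) ≤ N := by
    have : (2 * 2 : ℝ) ≤ p * p := by gcongr
    nlinarith
  constructor
  · intro c hc
    rw [Finset.sum_comm]
    have key : ∀ y, ∑ x, (if ⁅x, y⁆ = c then α x * β y else 0) ≤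
        if tr (c * y) = tr y then (C / N) * (C / N) * (2 * p) else 0 := by
      intro y
      have h0 : (0 : ℝ) ≤ if tr (c * y) = tr y then (C / N) * (C / N) * (2 * p) else 0 := by
        split_ifs <;> positivity
      by_cases hy : y ∈ Subgroup.center (SL p)
      · refine le_trans (le_of_eq (Finset.sum_eq_zero fun x _ => ?_)) h0
        rw [if_neg]
        intro h
        apply hc
        rw [← h, commutatorElement_eq_one_iff_mul_comm]
        exact Subgroup.mem_center_iff.1 hy x
      · have hy1 : y ≠ 1 := fun h => hy (h ▸ Subgroup.one_mem _)
        calc _ ≤ ∑ x, (if ⁅x, y⁆ = c then (C / N) * (C / N) else 0) := by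
              refine Finset.sum_le_sum fun x _ => ?_
              split_ifs with h
              · refine mul_le_mul (hαC x ?_) (hβC y hy1) (hβ y) (by positivity)
                rintro rfl
                apply hc; rw [← h]; simp
              · exact le_rfl
          _ = #(univ.filter fun x : SL p => ⁅x, y⁆ = c) * ((C / N) * (C / N)) := by
              rw [← Finset.sum_filter, Finset.sum_const, nsmul_eq_mul]
          _ ≤ ((if tr (c * y) = tr y then 2 * p else 0 : ℕ) : ℝ) * ((C / N) * (C / N)) := by
              gcongr
              exact_mod_cast card_conj_solutions c y hy
          _ = _ := by split_ifs <;> push_cast <;> ring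
    calc _ ≤ _ := Finset.sum_le_sum fun y _ => key y
      _ = #(univ.filter fun y : SL p => tr (c * y) = tr y) * ((C / N) * (C / N) * (2 * p)) := by
          rw [← Finset.sum_filter, Finset.sum_const, nsmul_eq_mul]
      _ ≤ (2 * p * p : ℕ) * ((C / N) * (C / N) * (2 * p)) := by
          gcongr; exact card_tr_mul_eq hc
      _ = C ^ 2 / N * (4 * p ^ 3 / N) := by push_cast; field_simp; norm_num
      _ ≤ C ^ 2 / N * 8 := by
          gcongr
          rw [div_le_iff₀ hN0]; linarith
      _ = _ := by ring
  · have hα' : ∀ x, α x ≤ C / p := by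
      intro x
      by_cases hx : x = 1
      · rw [hx]; exact hα0
      · refine (hαC x hx).trans ?_
        gcongr
    have hβ' : ∀ x, β x ≤ C / p := by
      intro x
      by_cases hx : x = 1
      · rw [hx]; exact hβ0
      · refine (hβC x hx).trans ?_
        gcongr
    rw [Finset.sum_comm]
    have key : ∀ y, ∑ x, (if ⁅x, y⁆ = 1 then α x * β y else 0) ≤
        (if y ∈ Subgroup.center (SL p) then C / p else 0) + β y * (5 * C / p) := by
      intro y
      by_cases hy : y ∈ Subgroup.center (SL p)
      · rw [if_pos hy]
        calc _ ≤ ∑ x, α x * β y := by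
              refine Finset.sum_le_sum fun x _ => ?_
              have := mul_nonneg (hα x) (hβ y)
              split_ifs <;> linarith
          _ = (∑ x, α x) * β y := by rw [Finset.sum_mul]
          _ ≤ 1 * (C / p) := mul_le_mul hα1 (hβ' y) (hβ y) zero_le_one
          _ ≤ _ := by
              have := hβ y
              rw [one_mul]; linarith [mul_nonneg this (by positivity : 0 ≤ 5 * C / p)]
      · rw [if_neg hy, zero_add]
        have h1 : ∀ x, (if ⁅x, y⁆ = 1 then α x * β y else 0) ≤
            β y * ((if x = 1 then C / p else 0) + (if ⁅x, y⁆ = 1 then C / N else 0)) := by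
          intro x
          have hC0 : 0 ≤ C / N := by positivity
          by_cases hx : x = 1
          · subst hx
            rw [if_pos (by simp), if_pos rfl, if_pos (by simp), mul_comm]
            exact mul_le_mul_of_nonneg_left (by linarith) (hβ y)
          · rw [if_neg hx]
            split_ifs with h
            · rw [mul_comm, zero_add]; exact mul_le_mul_of_nonneg_left (hαC x hx) (hβ y)
            · simp
        refine (Finset.sum_le_sum fun x _ => h1 x).trans ?_
        rw [← Finset.mul_sum]
        refine mul_le_mul_of_nonneg_left ?_ (hβ y)
        rw [Finset.sum_add_distrib, Finset.sum_ite_eq' , if_pos (Finset.mem_univ _), ← Finset.sum_filter,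
          Finset.sum_const, nsmul_eq_mul]
        have h2 : (#(univ.filter fun x : SL p => ⁅x, y⁆ = 1) : ℝ) ≤ 2 * p := by
          have := card_conj_solutions 1 y hy
          rw [one_mul, if_pos rfl] at this
          exact_mod_cast this
        calc _ ≤ C / p + 2 * p * (C / N) := by gcongr
          _ ≤ C / p + 4 * C / p := by
              have : 2 * p * (C / N) ≤ 4 * C / p := by
                rw [mul_div_assoc', div_le_div_iff₀ hN0 (by positivity)]
                have : (p : ℝ) ^ 2 ≤ 2 * N := by nlinarith
                nlinarith
              linarith
          _ = _ := by ring
    calc _ ≤ _ := Finset.sum_le_sum fun y _ => key y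
      _ = #(univ.filter fun y : SL p => y ∈ Subgroup.center (SL p)) * (C / p) + (∑ y, β y) * (5 * C / p) := by
          rw [Finset.sum_add_distrib, ← Finset.sum_filter, Finset.sum_const, nsmul_eq_mul, Finset.sum_mul]
      _ ≤ 2 * (C / p) + 1 * (5 * C / p) := by
          gcongr
          exact_mod_cast card_center (p := p)
      _ = 7 * C / p := by ring
      _ ≤ _ := by
          gcongr
          · norm_num
          · nlinarith

end SLp

section Pivot
variable {p : ℕ} [Fact p.Prime]

theorem centralizer_repr {h : SL p} (hh : h ∉ Subgroup.center (SL p)) {g : SL p} (e : g * h = h * g) :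
    ∃ α β : ZMod p, g.1 0 0 = α + β * h.1 0 0 ∧ g.1 0 1 = β * h.1 0 1 ∧ g.1 1 0 = β * h.1 1 0 ∧
      g.1 1 1 = α + β * h.1 1 1 := by
  have a1 := congrArg (fun m : SL p => m.1 0 0) e
  have a2 := congrArg (fun m : SL p => m.1 0 1) e
  have a3 := congrArg (fun m : SL p => m.1 1 0) e
  simp only [mul_00, mul_01, mul_10] at a1 a2 a3
  have k1 : g.1 0 1 * h.1 1 0 = g.1 1 0 * h.1 0 1 := by linear_combination a1
  have k2 : (g.1 0 0 - g.1 1 1) * h.1 0 1 = g.1 0 1 * (h.1 0 0 - h.1 1 1) := by linear_combination a2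
  have k3 : (g.1 0 0 - g.1 1 1) * h.1 1 0 = g.1 1 0 * (h.1 0 0 - h.1 1 1) := by linear_combination -a3
  obtain ⟨f, h1, h2, h3⟩ : ∃ f : ZMod p,
      g.1 0 1 = f * h.1 0 1 ∧ g.1 1 0 = f * h.1 1 0 ∧ g.1 0 0 - g.1 1 1 = f * (h.1 0 0 - h.1 1 1) := by
    by_cases h1 : h.1 0 1 = 0
    · by_cases h2 : h.1 1 0 = 0
      · have h3 : h.1 0 0 - h.1 1 1 ≠ 0 := fun h3 => hh (mem_center_iff'.2 ⟨h1, h2, sub_eq_zero.1 h3⟩)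
        refine ⟨(g.1 0 0 - g.1 1 1) / (h.1 0 0 - h.1 1 1), ?_, ?_, ?_⟩
        · apply mul_right_cancel₀ h3
          rw [← k2, h1]; ring
        · apply mul_right_cancel₀ h3
          rw [← k3, h2]; ring
        · field_simp
      · refine ⟨g.1 1 0 / h.1 1 0, ?_, ?_, ?_⟩
        · field_simp; exact k1
        · field_simp
        · field_simp; exact k3
    · refine ⟨g.1 0 1 / h.1 0 1, ?_, ?_, ?_⟩
      · field_simp
      · field_simp; exact k1.symm
      · field_simp; exact k2
  exact ⟨g.1 0 0 - f * h.1 0 0, f, by ring, h1, h2, by linear_combination -h3⟩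

theorem centralizer_comm {h : SL p} (hh : h ∉ Subgroup.center (SL p)) {x y : SL p} (hx : x * h = h * x)
    (hy : y * h = h * y) : x * y = y * x := by
  obtain ⟨a, b, h1, h2, h3, h4⟩ := centralizer_repr hh hx
  obtain ⟨c, d, k1, k2, k3, k4⟩ := centralizer_repr hh hy
  apply sl_ext <;> simp only [mul_00, mul_01, mul_10, mul_11, h1, h2, h3, h4, k1, k2, k3, k4] <;> ring

theorem not_central_of_tr {b : SL p} (h2 : tr b ^ 2 ≠ 4) : b ∉ Subgroup.center (SL p) := by
  intro h
  obtain ⟨k1, k2, k3⟩ := mem_center_iff'.1 h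
  apply h2
  have := sl_det b
  rw [tr, ← k3]
  rw [k1, k2, ← k3] at this
  linear_combination 4 * this

theorem card_torus_tr {b : SL p} (h2 : tr b ^ 2 ≠ 4) (w : SL p) (σ : ZMod p)
    (hw : ¬ (tr w = 0 ∧ tr (w * b) = 0)) :
    #(univ.filter fun y : SL p => y * b = b * y ∧ tr (w * y) = σ) ≤ 2 := by
  have hb := not_central_of_tr h2
  have key : ∀ y : SL p, y * b = b * y → ∃ α β : ZMod p, y.1 0 0 = α + β * b.1 0 0 ∧ y.1 0 1 = β * b.1 0 1 ∧
      y.1 1 0 = β * b.1 1 0 ∧ y.1 1 1 = α + β * b.1 1 1 := fun y => centralizer_repr hb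
  choose! α β hαβ using key
  have htr : ∀ y : SL p, y * b = b * y → tr (w * y) = α y * tr w + β y * tr (w * b) := by
    intro y hy
    obtain ⟨k1, k2, k3, k4⟩ := hαβ y hy
    simp only [tr, mul_00, mul_11, k1, k2, k3, k4]; ring
  have hdet : ∀ y : SL p, y * b = b * y → α y ^ 2 + tr b * (α y * β y) + β y ^ 2 = 1 := by
    intro y hy
    obtain ⟨k1, k2, k3, k4⟩ := hαβ y hy
    have := sl_det y
    have hb := sl_det b
    rw [← this, k1, k2, k3, k4, tr]
    linear_combination -β y ^ 2 * hb
  have hinj : ∀ y z : SL p, y * b = b * y → z * b = b * z → α y = α z → β y = β z → y = z := by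
    intro y z hy hz e1 e2
    obtain ⟨k1, k2, k3, k4⟩ := hαβ y hy
    obtain ⟨l1, l2, l3, l4⟩ := hαβ z hz
    apply sl_ext
    · rw [k1, l1, e1, e2]
    · rw [k2, l2, e2]
    · rw [k3, l3, e2]
    · rw [k4, l4, e1, e2]
  have quad : ∀ A B C : ZMod p, ¬ (A = 0 ∧ B = 0 ∧ C = 0) →
      #(univ.filter fun a : ZMod p => A * a ^ 2 + B * a + C = 0) ≤ 2 := by
    intro A B C h
    by_cases hA : A = 0
    · by_cases hB : B = 0
      · have : (univ.filter fun a : ZMod p => A * a ^ 2 + B * a + C = 0) = ∅ := by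
          ext a
          simp only [Finset.mem_filter, Finset.mem_univ, true_and, Finset.notMem_empty, iff_false, hA, hB]
          intro h'
          exact h ⟨hA, hB, by linear_combination h'⟩
        rw [this]; simp
      · refine le_trans (Finset.card_le_card (t := {-C / B}) ?_) (by simp)
        intro a ha
        simp only [Finset.mem_filter, Finset.mem_univ, true_and, Finset.mem_singleton, hA] at ha ⊢
        rw [eq_div_iff hB]; linear_combination ha
    · convert card_quad A B C hA
  set m := tr w
  set n := tr (w * b)
  set t := tr b
  by_cases hn : n = 0
  · have hm : m ≠ 0 := fun h => hw ⟨h, hn⟩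
    refine le_trans ?_ (quad (1 : ZMod p) (t * (σ / m)) ((σ / m) ^ 2 - 1) (by simp))
    refine Finset.card_le_card_of_injOn β ?_ ?_
    · intro y hy
      simp only [Finset.coe_filter, Finset.mem_univ, true_and, Set.mem_ofPred_eq] at hy ⊢
      have e1 := htr y hy.1
      rw [hy.2, hn, mul_zero, add_zero] at e1
      rw [e1, mul_div_cancel_right₀ _ hm]
      linear_combination hdet y hy.1
    · intro y hy z hz e
      simp only [Finset.coe_filter, Finset.mem_univ, true_and, Set.mem_ofPred_eq] at hy hz e
      refine hinj y z hy.1 hz.1 ?_ e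
      have e1 := htr y hy.1
      have e2 := htr z hz.1
      rw [hy.2, hn, mul_zero, add_zero] at e1
      rw [hz.2, hn, mul_zero, add_zero] at e2
      exact mul_right_cancel₀ hm (e1.symm.trans e2)
  · refine le_trans ?_ (quad (n ^ 2 - t * m * n + m ^ 2) (σ * (t * n - 2 * m)) (σ ^ 2 - n ^ 2) ?_)
    · refine Finset.card_le_card_of_injOn α ?_ ?_
      · intro y hy
        simp only [Finset.coe_filter, Finset.mem_univ, true_and, Set.mem_ofPred_eq] at hy ⊢
        have e1 := htr y hy.1
        have e2 := hdet y hy.1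
        rw [hy.2] at e1
        have e3 : β y * n = σ - α y * m := by linear_combination -e1
        have e4 : β y = (σ - α y * m) / n := by rw [← e3]; field_simp
        rw [e4] at e2
        field_simp at e2
        linear_combination e2
      · intro y hy z hz e
        simp only [Finset.coe_filter, Finset.mem_univ, true_and, Set.mem_ofPred_eq] at hy hz e
        refine hinj y z hy.1 hz.1 e ?_
        have e1 := htr y hy.1
        have e2 := htr z hz.1
        rw [hy.2] at e1
        rw [hz.2, ← e] at e2
        apply mul_right_cancel₀ hn
        linear_combination e2 - e1
    · rintro ⟨q1, q2, q3⟩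
      have hσ : σ ≠ 0 := by
        rintro rfl
        apply hn
        apply pow_eq_zero_iff (two_ne_zero) |>.1
        linear_combination -q3
      have q4 : t * n - 2 * m = 0 := by simpa [hσ] using q2
      apply h2
      have hn2 : n ^ 2 ≠ 0 := pow_ne_zero _ hn
      apply mul_right_cancel₀ hn2
      linear_combination (t * n + 2 * m) * q4 - 4 * (m * q4 + q1)

theorem orbit_centralizer {G : Type*} [Group G] [Fintype G] (A : Finset G) (hinv : ∀ x ∈ A, x⁻¹ ∈ A) (b : G) (V : Finset G)
    (hV : ∀ x ∈ A, x * b * x⁻¹ ∈ V) : #A ≤ #V * #((A ^ 2).filter fun y => y * b = b * y) := by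
  refine card_le_mul_of_fiber_le' (fun x => x * b * x⁻¹) A V _ hV ?_
  intro v _
  rcases Finset.eq_empty_or_nonempty (A.filter fun x => x * b * x⁻¹ = v) with h | ⟨x₀, hx₀⟩
  · rw [h]; simp
  simp only [Finset.mem_filter] at hx₀
  refine Finset.card_le_card_of_injOn (fun x => x₀⁻¹ * x) ?_ ?_
  · intro x hx
    simp only [Finset.coe_filter, Set.mem_ofPred_eq] at hx ⊢
    refine ⟨?_, ?_⟩
    · rw [sq]; exact Finset.mul_mem_mul (hinv _ hx₀.1) hx.1
    · have : x * b = x₀ * b * x₀⁻¹ * x := by rw [hx₀.2, ← hx.2]; group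
      rw [mul_assoc, this]; group
  · intro x _ y _ e; simpa using e

theorem subgroup_slice {G : Type*} [Group G] [Fintype G] (A : Finset G) (hinv : ∀ x ∈ A, x⁻¹ ∈ A) (H : Subgroup G) (n : ℕ) :
    #A * #((A ^ n).filter fun y => y ∈ H) ≤ #(A ^ (n + 1)) * #((A ^ 2).filter fun y => y ∈ H) := by
  rw [← Finset.card_product]
  refine card_le_mul_of_fiber_le' (fun x : G × G => x.1 * x.2) _ _ _ ?_ ?_
  · intro x hx
    simp only [Finset.mem_product, Finset.mem_filter] at hx
    rw [pow_succ']
    exact Finset.mul_mem_mul hx.1 hx.2.1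
  intro v _
  rcases Finset.eq_empty_or_nonempty ((A ×ˢ (A ^ n).filter fun y => y ∈ H).filter fun x => x.1 * x.2 = v) with h | ⟨x₀, hx₀⟩
  · rw [h]; simp
  simp only [Finset.mem_filter, Finset.mem_product] at hx₀
  refine Finset.card_le_card_of_injOn (fun x => x₀.1⁻¹ * x.1) ?_ ?_
  · intro x hx
    simp only [Finset.coe_filter, Finset.mem_product, Finset.mem_filter, Set.mem_ofPred_eq] at hx ⊢
    refine ⟨?_, ?_⟩
    · rw [sq]; exact Finset.mul_mem_mul (hinv _ hx₀.1.1) hx.1.1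
    · have : x₀.1⁻¹ * x.1 = x₀.2 * x.2⁻¹ := by
        rw [inv_mul_eq_iff_eq_mul, ← mul_assoc, hx₀.2, ← hx.2]; group
      rw [this]
      exact H.mul_mem hx₀.1.2.2 (H.inv_mem hx.1.2.2)
  · intro x hx y hy e
    simp only [Finset.coe_filter, Finset.mem_product, Finset.mem_filter, Set.mem_ofPred_eq] at hx hy
    have e1 : x.1 = y.1 := by simpa using e
    have e2 := hx.2.trans hy.2.symm
    rw [e1] at e2
    exact Prod.ext e1 (mul_left_cancel e2)

theorem eq_of_trace_forms {x y : SL p} (h : ∀ g : SL p, tr (x * g) = tr (y * g)) : x = y := by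
  have a0 := h 1
  have a1 := h (uu 1)
  have a2 := h (ll 1)
  have a3 := h ww
  have a4 := h (ww * uu 1)
  simp only [mul_one, tr, mul_00, mul_11, mul_01, mul_10, uu_val, ll_val, ww_val] at a0 a1 a2 a3 a4
  simp at a0 a1 a2 a3 a4
  have b1 : x.1 1 0 = y.1 1 0 := by linear_combination a1 - a0
  have b2 : x.1 0 1 = y.1 0 1 := by linear_combination a2 - a0
  have b3 : x.1 1 1 = y.1 1 1 := by rw [b1, b2] at a4; linear_combination -a4
  exact sl_ext (by linear_combination a0 - b3) b2 b1 b3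

theorem traces_many (A : Finset (SL p)) (h1 : 1 ∈ A) (hgen : Subgroup.closure (A : Set (SL p)) = ⊤)
    (hinv : ∀ x ∈ A, x⁻¹ ∈ A) : #A ≤ #((A ^ 4).image tr) ^ 4 := by
  let V : ℕ → Submodule (ZMod p) (Matrix (Fin 2) (Fin 2) (ZMod p)) := fun n =>
    Submodule.span (ZMod p) ((fun g : SL p => g.1) '' (A ^ n : Finset (SL p)))
  have hmono : ∀ n, V n ≤ V (n + 1) := fun n =>
    Submodule.span_mono (Set.image_mono (Finset.coe_subset.2 (Finset.pow_subset_pow_right h1 (Nat.le_succ n))))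
  obtain ⟨n, hn, hst⟩ : ∃ n ≤ 3, V (n + 1) ≤ V n := by
    by_contra hc
    push Not at hc
    obtain ⟨d, hd⟩ : ∃ d : ℕ → ℕ, ∀ n, d n = Module.finrank (ZMod p) (V n) := ⟨_, fun _ => rfl⟩
    have hlt : ∀ n ≤ 3, d n < d (n + 1) := fun n hn =>
      by rw [hd, hd]; exact Submodule.finrank_lt_finrank_of_lt (lt_of_le_not_ge (hmono n) (hc n hn))
    have h0 : 0 < Module.finrank (ZMod p) (V 0) := by
      rw [Module.finrank_pos_iff_exists_ne_zero]
      refine ⟨⟨(1 : SL p).1, Submodule.subset_span ⟨1, by simp, rfl⟩⟩, ?_⟩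
      intro h
      have := congrFun (congrFun (congrArg Subtype.val h) 0) 0
      simp at this
    have h4 : Module.finrank (ZMod p) (V 4) ≤ 4 := by
      refine (Submodule.finrank_le _).trans ?_
      rw [Module.finrank_matrix]; simp
    rw [← hd] at h0 h4
    have q0 : d 0 < d 1 := hlt 0 (by norm_num)
    have q1 : d 1 < d 2 := hlt 1 (by norm_num)
    have q2 : d 2 < d 3 := hlt 2 (by norm_num)
    have q3 : d 3 < d 4 := hlt 3 (by norm_num)
    omega
  have hstab : ∀ a ∈ A, ∀ v ∈ V n, a.1 * v ∈ V n := by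
    intro a ha v hv
    apply hst
    induction hv using Submodule.span_induction with
    | mem x hx =>
      obtain ⟨g, hg, rfl⟩ := hx
      refine Submodule.subset_span ⟨a * g, ?_, rfl⟩
      rw [pow_succ']
      exact Finset.mul_mem_mul ha hg
    | zero => simp
    | add x y _ _ hx hy => rw [mul_add]; exact Submodule.add_mem _ hx hy
    | smul c x _ hx => rw [mul_smul_comm]; exact Submodule.smul_mem _ _ hx
  have hall : ∀ g : SL p, ∀ v ∈ V n, g.1 * v ∈ V n := by
    intro g
    have : g ∈ Subgroup.closure (A : Set (SL p)) := by rw [hgen]; trivial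
    induction this using Subgroup.closure_induction'' with
    | one => intro v hv; simpa using hv
    | mem x hx => exact hstab x hx
    | inv_mem x hx => exact hstab _ (hinv x hx)
    | mul x y _ _ hx hy =>
      intro v hv
      have := hx _ (hy v hv)
      rwa [← mul_assoc] at this
  have hall' : ∀ g : SL p, g.1 ∈ V n := by
    intro g
    have := hall g 1 (Submodule.subset_span ⟨1, Finset.one_mem_pow h1, rfl⟩)
    rwa [mul_one] at this
  obtain ⟨b, hb, hspan, hli⟩ := exists_linearIndependent (ZMod p) ((fun g : SL p => g.1) '' (A ^ n : Finset (SL p)))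
  have hbf : b.Finite := Set.Finite.subset (Set.Finite.image _ (Finset.finite_toSet _)) hb
  have hbc : Nat.card b ≤ 4 := by
    have := hbf.fintype
    rw [Nat.card_eq_fintype_card]
    refine hli.fintype_card_le_finrank.trans ?_
    rw [Module.finrank_matrix]; simp
  have := hbf.fintype
  have hcard : #A ≤ Fintype.card (b → ((A ^ 4).image tr : Finset (ZMod p))) := by
    have hch : ∀ v : b, ∃ g : SL p, g ∈ A ^ n ∧ g.1 = v.1 := fun v => hb v.2
    choose γ hγ hγ' using hch
    have hmem : ∀ x ∈ A, ∀ v : b, tr (x * γ v) ∈ (A ^ 4).image tr := by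
      intro x hx v
      refine Finset.mem_image_of_mem _ ?_
      have : x * γ v ∈ A ^ (n + 1) := by rw [pow_succ']; exact Finset.mul_mem_mul hx (hγ v)
      exact Finset.pow_subset_pow_right h1 (by omega) this
    rw [← Finset.card_univ, ← Finset.card_attach]
    refine Finset.card_le_card_of_injOn (fun x => fun v => ⟨tr (x.1 * γ v), hmem x.1 x.2 v⟩) (by simp) ?_
    rintro ⟨x, hx⟩ _ ⟨y, hy⟩ _ e
    have e' : ∀ v : b, tr (x * γ v) = tr (y * γ v) := fun v => congrArg Subtype.val (congrFun e v)
    apply Subtype.ext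
    apply eq_of_trace_forms
    intro g
    have hg : g.1 ∈ Submodule.span (ZMod p) b := by rw [hspan]; exact hall' g
    have : ∀ v ∈ Submodule.span (ZMod p) b, Matrix.trace (x.1 * v) = Matrix.trace (y.1 * v) := by
      intro v hv
      induction hv using Submodule.span_induction with
      | mem v hv =>
        have := e' ⟨v, hv⟩
        have h2 : v = (γ ⟨v, hv⟩).1 := (hγ' ⟨v, hv⟩).symm
        have h3 : ∀ z : SL p, Matrix.trace (z.1 * v) = tr (z * γ ⟨v, hv⟩) := by
          intro z
          rw [Matrix.trace_fin_two, tr]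
          conv_lhs => rw [h2]
          rfl
        rw [h3, h3]
        exact this
      | zero => simp
      | add v w _ _ h1 h2 => rw [mul_add, mul_add, Matrix.trace_add, Matrix.trace_add, h1, h2]
      | smul c v _ h => rw [mul_smul_comm, mul_smul_comm, Matrix.trace_smul, Matrix.trace_smul, h]
    have := this _ hg
    rw [Matrix.trace_fin_two, Matrix.trace_fin_two] at this
    exact this
  refine hcard.trans ?_
  rw [Fintype.card_fun, Fintype.card_coe]
  rw [Nat.card_eq_fintype_card] at hbc
  refine Nat.pow_le_pow_right ?_ hbc
  exact Finset.card_pos.2 ⟨tr (1 : SL p), Finset.mem_image_of_mem _ (Finset.one_mem_pow h1)⟩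

end Pivot

section Pivot
variable {p : ℕ} [Fact p.Prime]

theorem card_torus_tr_ne {b : SL p} (h2 : tr b ^ 2 ≠ 4) (w : SL p) {σ : ZMod p} (hσ : σ ≠ 0) :
    #(univ.filter fun y : SL p => y * b = b * y ∧ tr (w * y) = σ) ≤ 2 := by
  by_cases h : tr w = 0 ∧ tr (w * b) = 0
  · have : (univ.filter fun y : SL p => y * b = b * y ∧ tr (w * y) = σ) = ∅ := by
      ext y
      simp only [Finset.mem_filter, Finset.mem_univ, true_and, Finset.notMem_empty, iff_false]
      rintro ⟨h3, h4⟩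
      obtain ⟨α, β, k1, k2, k3, k4⟩ := centralizer_repr (not_central_of_tr h2) h3
      apply hσ
      rw [← h4]
      have e : tr (w * y) = α * tr w + β * tr (w * b) := by
        simp only [tr, mul_00, mul_11, k1, k2, k3, k4]; ring
      rw [e, h.1, h.2]; ring
    rw [this]; simp
  · exact card_torus_tr h2 w σ h

theorem two_ne_zero_zmod (hp : p ≠ 2) : (2 : ZMod p) ≠ 0 := by
  have : ((2 : ℕ) : ZMod p) ≠ 0 := by
    rw [Ne, ZMod.natCast_eq_zero_iff]
    intro h
    exact hp ((Nat.prime_dvd_prime_iff_eq Fact.out Nat.prime_two).1 h)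
  exact_mod_cast this

theorem card_bad_torus (hp : p ≠ 2) {b : SL p} (h2 : tr b ^ 2 ≠ 4) :
    #(univ.filter fun y : SL p => y * b = b * y ∧ ¬ (tr y ≠ 0 ∧ tr y ^ 2 ≠ 4)) ≤ 6 := by
  have h1 : ∀ σ, #(univ.filter fun y : SL p => y * b = b * y ∧ tr y = σ) ≤ 2 := by
    intro σ
    have := card_torus_tr h2 1 σ (by
      rintro ⟨h, _⟩
      have e : tr (1 : SL p) = 2 := by simp [tr]; norm_num
      exact two_ne_zero_zmod hp (e ▸ h))
    simpa using this
  refine le_trans (Finset.card_le_card (t := (univ.filter fun y : SL p => y * b = b * y ∧ tr y = 0) ∪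
    ((univ.filter fun y : SL p => y * b = b * y ∧ tr y = 2) ∪ (univ.filter fun y : SL p => y * b = b * y ∧ tr y = -2))) ?_) ?_
  · intro y hy
    simp only [Finset.mem_union, Finset.mem_filter, Finset.mem_univ, true_and] at hy ⊢
    obtain ⟨h3, h4⟩ := hy
    by_cases h5 : tr y = 0
    · exact Or.inl ⟨h3, h5⟩
    · have h6 : tr y ^ 2 = 4 := by by_contra h; exact h4 ⟨h5, h⟩
      have h7 : (tr y - 2) * (tr y + 2) = 0 := by linear_combination h6
      rcases mul_eq_zero.1 h7 with h | h
      · exact Or.inr (Or.inl ⟨h3, sub_eq_zero.1 h⟩)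
      · exact Or.inr (Or.inr ⟨h3, eq_neg_of_add_eq_zero_left h⟩)
  · refine (Finset.card_union_le _ _).trans ?_
    have := Finset.card_union_le (univ.filter fun y : SL p => y * b = b * y ∧ tr y = 2)
      (univ.filter fun y : SL p => y * b = b * y ∧ tr y = -2)
    have := h1 0
    have := h1 2
    have := h1 (-2)
    omega

theorem card_good_conj {b t : SL p} (hb : tr b ^ 2 ≠ 4) (ht0 : tr t ≠ 0) (ht : tr t ^ 2 ≠ 4) :
    #(univ.filter fun g : SL p => t * (g * b * g⁻¹) = (g * b * g⁻¹) * t) ≤ 2 * (2 * p) := by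
  have h := card_torus_tr_ne hb 1 ht0
  refine (card_le_mul_of_fiber_le' (fun g : SL p => g⁻¹ * t * g) _
    (univ.filter fun y : SL p => y * b = b * y ∧ tr (1 * y) = tr t) (2 * p) ?_ ?_).trans (Nat.mul_le_mul_right _ h)
  · intro g hg
    simp only [Finset.mem_filter, Finset.mem_univ, true_and, one_mul] at hg ⊢
    refine ⟨?_, ?_⟩
    · calc g⁻¹ * t * g * b = g⁻¹ * (t * (g * b * g⁻¹)) * g := by group
        _ = _ := by rw [hg]; group
    · have := tr_conj g⁻¹ t
      rwa [inv_inv] at this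
  · intro w _
    have h3 := card_conj_eq t w
    have hc := not_central_of_tr ht
    simp only [hc, false_and, if_false, zero_add] at h3
    refine le_trans (Finset.card_le_card ?_) (h3.trans (by split_ifs <;> simp))
    intro g hg
    simp only [Finset.mem_filter, Finset.mem_univ, true_and] at hg ⊢
    rw [← hg.2]; group

theorem mem_cent {G : Type*} [Group G] {b y : G} : y ∈ Subgroup.centralizer {b} ↔ y * b = b * y := by
  rw [Subgroup.mem_centralizer_singleton_iff]

theorem exists_sparse_trace {A : Finset (SL p)} (hA1 : 1 ∈ A) (hinv : ∀ x ∈ A, x⁻¹ ∈ A)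
    (hgen : Subgroup.closure (A : Set (SL p)) = ⊤) {s M : ℝ} (hs : s ^ 4 = #A) (hs6 : 6 ≤ s)
    (hM : (#(A ^ 6) : ℝ) ≤ M) :
    ∃ b ∈ A ^ 4, tr b ≠ 0 ∧ tr b ^ 2 ≠ 4 ∧ (#((A ^ 6).filter fun v => tr v = tr b) : ℝ) * (s / 2) ≤ M := by
  obtain ⟨T, hT⟩ : ∃ T, T = (A ^ 4).image tr := ⟨_, rfl⟩
  have hTs : s ≤ #T := by
    have := traces_many A hA1 hgen hinv
    have h' : (#A : ℝ) ≤ (#T : ℝ) ^ 4 := by rw [hT]; exact_mod_cast this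
    rw [← hs] at h'
    exact le_of_pow_le_pow_left₀ (n := 4) (by norm_num) (by positivity) h'
  obtain ⟨T', hT'⟩ : ∃ T', T' = T.filter fun τ => τ ≠ 0 ∧ τ ^ 2 ≠ 4 := ⟨_, rfl⟩
  have hTT : #T ≤ #T' + 3 := by
    have h3 : #(T \ T') ≤ 3 := by
      refine le_trans (Finset.card_le_card (t := {0, 2, -2}) ?_) Finset.card_le_three
      intro τ hτ
      simp only [hT', Finset.mem_sdiff, Finset.mem_filter, Finset.mem_insert, Finset.mem_singleton, not_and] at hτ ⊢
      by_cases h5 : τ = 0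
      · exact Or.inl h5
      · have h6 : τ ^ 2 = 4 := by by_contra h; exact hτ.2 hτ.1 h5 h
        have h7 : (τ - 2) * (τ + 2) = 0 := by linear_combination h6
        rcases mul_eq_zero.1 h7 with h | h
        · exact Or.inr (Or.inl (sub_eq_zero.1 h))
        · exact Or.inr (Or.inr (eq_neg_of_add_eq_zero_left h))
    have : #T - #T' ≤ #(T \ T') := Finset.le_card_sdiff _ _
    omega
  have hT's : s / 2 ≤ #T' := by
    have : (#T : ℝ) ≤ #T' + 3 := by exact_mod_cast hTT
    linarith
  have h0 : (0 : ℝ) < #T' := by linarith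
  have hsum : (∑ τ ∈ T', (#((A ^ 6).filter fun v => tr v = τ) : ℝ)) ≤ M := by
    refine le_trans ?_ hM
    rw [← Nat.cast_sum, ← Finset.card_biUnion]
    · refine Nat.cast_le.2 (Finset.card_le_card ?_)
      intro x hx
      rw [Finset.mem_biUnion] at hx
      obtain ⟨_, _, h⟩ := hx
      exact (Finset.mem_filter.1 h).1
    · intro x _ y _ hxy
      rw [Function.onFun, Finset.disjoint_left]
      intro z hz hz'
      exact hxy ((Finset.mem_filter.1 hz).2.symm.trans (Finset.mem_filter.1 hz').2)
  have hne : T'.Nonempty := Finset.card_pos.1 (by exact_mod_cast h0)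
  obtain ⟨τ, hτ, hle⟩ : ∃ τ ∈ T', (#((A ^ 6).filter fun v => tr v = τ) : ℝ) ≤ M / #T' := by
    by_contra hc
    push Not at hc
    have := Finset.sum_lt_sum_of_nonempty hne hc
    rw [Finset.sum_const, nsmul_eq_mul, mul_div_cancel₀ _ h0.ne'] at this
    linarith
  rw [hT', Finset.mem_filter, hT, Finset.mem_image] at hτ
  obtain ⟨⟨b, hb, rfl⟩, h1, h4⟩ := hτ
  refine ⟨b, hb, h1, h4, ?_⟩
  rw [le_div_iff₀ h0] at hle
  refine le_trans ?_ hle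
  gcongr

theorem conj_mem_pow {G : Type*} [Group G] {A : Finset G} (hinv : ∀ x ∈ A, x⁻¹ ∈ A) {x y : G} (hx : x ∈ A) {n : ℕ}
    (hy : y ∈ A ^ n) : x * y * x⁻¹ ∈ A ^ (n + 2) := by
  have : A ^ (n + 2) = A * A ^ n * A := by rw [pow_succ, pow_succ']
  rw [this]
  exact Finset.mul_mem_mul (Finset.mul_mem_mul hx hy) (hinv x hx)

/-- Number of elements of `A²` commuting with `b`. -/
noncomputable def cz (A : Finset (SL p)) (b : SL p) : ℕ := #((A ^ 2).filter fun y => y * b = b * y)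

/-- Number of elements of `Aᵐ` of trace `σ`. -/
noncomputable def cl (A : Finset (SL p)) (m : ℕ) (σ : ZMod p) : ℕ := #((A ^ m).filter fun v => tr v = σ)

/-- Number of elements of `A²` of generic trace commuting with `b`. -/
noncomputable def gz (A : Finset (SL p)) (b : SL p) : ℕ :=
  #((A ^ 2).filter fun y => y * b = b * y ∧ tr y ≠ 0 ∧ tr y ^ 2 ≠ 4)

theorem card_le_cl_mul_cz {A : Finset (SL p)} (hinv : ∀ x ∈ A, x⁻¹ ∈ A) {b : SL p} {m : ℕ} (hb : b ∈ A ^ m) :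
    #A ≤ cl A (m + 2) (tr b) * cz A b := by
  refine orbit_centralizer A hinv b ((A ^ (m + 2)).filter fun v => tr v = tr b) (fun x hx => ?_)
  rw [Finset.mem_filter, tr_conj]
  exact ⟨conj_mem_pow hinv hx hb, rfl⟩

theorem cl_mul_cz_le {A : Finset (SL p)} {b : SL p} (hb4 : tr b ^ 2 ≠ 4) {σ : ZMod p} (hσ : σ ≠ 0) (m : ℕ) :
    cl A m σ * cz A b ≤ #(A ^ (m + 2)) * 2 := by
  have h := card_le_mul_of_fiber_le' (fun x : SL p × SL p => x.1 * x.2)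
    (((A ^ m).filter fun v => tr v = σ) ×ˢ ((A ^ 2).filter fun y => y * b = b * y)) (A ^ (m + 2)) 2 ?_ ?_
  · rw [Finset.card_product] at h; exact h
  · intro x hx
    simp only [Finset.mem_product, Finset.mem_filter] at hx
    rw [pow_add]
    exact Finset.mul_mem_mul hx.1.1 hx.2.1
  · intro w _
    refine le_trans ?_ (card_torus_tr_ne hb4 w hσ)
    refine Finset.card_le_card_of_injOn (fun x => x.2⁻¹) ?_ ?_
    · intro x hx
      simp only [Finset.coe_filter, Finset.mem_product, Finset.mem_filter, Set.mem_ofPred_eq, Finset.mem_univ, true_and] at hx ⊢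
      obtain ⟨⟨⟨_, h1⟩, _, h2⟩, h3⟩ := hx
      refine ⟨?_, ?_⟩
      · rw [inv_mul_eq_iff_eq_mul, ← mul_assoc, h2]; group
      · rw [← h3, ← h1]; group
    · intro x hx y hy e
      simp only [Finset.coe_filter, Finset.mem_product, Finset.mem_filter, Set.mem_ofPred_eq] at hx hy
      have e2 : x.2 = y.2 := inv_injective e
      have e3 := hx.2.trans hy.2.symm
      rw [e2] at e3
      exact Prod.ext (mul_right_cancel e3) e2

theorem cz_le_gz (hp : p ≠ 2) (A : Finset (SL p)) {b : SL p} (hb4 : tr b ^ 2 ≠ 4) : cz A b ≤ gz A b + 6 := by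
  have h1 := card_bad_torus hp hb4
  have h2 := Finset.card_filter_add_card_filter_not (s := (A ^ 2).filter fun y => y * b = b * y)
    (fun y => tr y ≠ 0 ∧ tr y ^ 2 ≠ 4)
  rw [Finset.filter_filter, Finset.filter_filter] at h2
  have h3 : #((A ^ 2).filter fun y => y * b = b * y ∧ ¬ (tr y ≠ 0 ∧ tr y ^ 2 ≠ 4)) ≤ 6 :=
    (Finset.card_le_card (Finset.filter_subset_filter _ (Finset.subset_univ _))).trans h1
  rw [cz, gz, ← h2]
  exact Nat.add_le_add (le_of_eq (by congr)) h3

theorem cz_conj {A : Finset (SL p)} (hinv : ∀ x ∈ A, x⁻¹ ∈ A) {x : SL p} (hx : x ∈ A) (b : SL p) :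
    #A * cz A b ≤ #(A ^ 5) * cz A (x * b * x⁻¹) := by
  have hsl := subgroup_slice A hinv (Subgroup.centralizer {x * b * x⁻¹}) 4
  simp only [mem_cent] at hsl
  refine le_trans (Nat.mul_le_mul_left _ ?_) hsl
  refine Finset.card_le_card_of_injOn (fun y => x * y * x⁻¹) ?_ ?_
  · intro y hy
    simp only [Finset.coe_filter, Set.mem_ofPred_eq] at hy ⊢
    refine ⟨conj_mem_pow hinv hx hy.1, ?_⟩
    calc x * y * x⁻¹ * (x * b * x⁻¹) = x * (y * b) * x⁻¹ := by group
      _ = _ := by rw [hy.2]; group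
  · intro y _ z _ e; simpa using e

theorem exists_gz {A : Finset (SL p)} {b : SL p} (h : gz A b ≠ 0) :
    ∃ b' ∈ A ^ 2, tr b' ≠ 0 ∧ tr b' ^ 2 ≠ 4 ∧ cz A b' ≤ cz A b := by
  obtain ⟨b', hb'⟩ := Finset.card_pos.1 (Nat.pos_of_ne_zero h)
  simp only [Finset.mem_filter] at hb'
  obtain ⟨hbA', hcomm, hb0', hb4'⟩ := hb'
  refine ⟨b', hbA', hb0', hb4', Finset.card_le_card ?_⟩
  intro y hy
  simp only [Finset.mem_filter] at hy ⊢
  exact ⟨hy.1, centralizer_comm (not_central_of_tr hb4') hy.2 hcomm.symm⟩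

theorem sum_gz_le (A : Finset (SL p)) {b : SL p} (hb4 : tr b ^ 2 ≠ 4) :
    ∑ g : SL p, gz A (g * b * g⁻¹) ≤ #(A ^ 2) * (2 * (2 * p)) := by
  simp only [gz, Finset.card_filter]
  rw [Finset.sum_comm]
  rw [← smul_eq_mul, ← Finset.sum_const]
  refine Finset.sum_le_sum fun t _ => ?_
  rw [← Finset.card_filter]
  by_cases ht : tr t ≠ 0 ∧ tr t ^ 2 ≠ 4
  · refine le_trans (Finset.card_le_card ?_) (card_good_conj hb4 ht.1 ht.2)
    intro g hg
    simp only [Finset.mem_filter, Finset.mem_univ, true_and] at hg ⊢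
    exact hg.1
  · simp [ht]

theorem pivot (hp : p ≠ 2) {K : ℝ} (hK : 2 ≤ K) {A : Finset (SL p)} (hA : Apx K A)
    (hgen : Subgroup.closure (A : Set (SL p)) = ⊤) (hbig : K ^ 92 ≤ #A) :
    (p : ℝ) ^ 8 ≤ K ^ 100 * (#A : ℝ) ^ 3 := by
  obtain ⟨hA1, hinv, hpow⟩ := hA
  have hK0 : 0 < K := by linarith
  obtain ⟨a, ha⟩ : ∃ a : ℝ, a = (#A : ℝ) := ⟨_, rfl⟩
  rw [← ha] at hbig hpow ⊢
  have ha0 : 0 < a := lt_of_lt_of_le (by positivity) hbig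
  obtain ⟨s, hs0, hs⟩ : ∃ s : ℝ, 0 < s ∧ s ^ 4 = a :=
    ⟨a ^ (1/4 : ℝ), by positivity, by rw [← Real.rpow_natCast, ← Real.rpow_mul ha0.le]; norm_num⟩
  have hsK : K ^ 23 ≤ s := by
    refine le_of_pow_le_pow_left₀ (n := 4) (by norm_num) hs0.le ?_
    rw [hs, ← pow_mul]; exact hbig
  have hK6 : (64 : ℝ) ≤ K ^ 6 := by
    calc (64 : ℝ) = 2 ^ 6 := by norm_num
      _ ≤ K ^ 6 := by gcongr
  have hs17 : 64 * K ^ 17 ≤ s := by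
    calc 64 * K ^ 17 ≤ K ^ 6 * K ^ 17 := by gcongr
      _ = K ^ 23 := by ring
      _ ≤ s := hsK
  have hK1 : (1 : ℝ) ≤ K := by linarith
  have hs64 : 64 ≤ s := le_trans (by nlinarith [one_le_pow₀ hK1 (n := 17)]) hs17
  obtain ⟨b, hbA, hb0, hb4, hbs⟩ := exists_sparse_trace hA1 hinv hgen (hs.trans ha) (by linarith) (hpow 6)
  change (cl A 6 (tr b) : ℝ) * (s / 2) ≤ K ^ 6 * a at hbs
  have hsc : s ≤ 2 * K ^ 6 * cz A b := by
    have h' : a ≤ cl A 6 (tr b) * cz A b := by rw [ha]; exact_mod_cast card_le_cl_mul_cz hinv hbA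
    have h3 : a * (s / 2) ≤ a * (K ^ 6 * cz A b) := by
      calc a * (s / 2) ≤ cl A 6 (tr b) * cz A b * (s / 2) := by gcongr
        _ = cl A 6 (tr b) * (s / 2) * cz A b := by ring
        _ ≤ K ^ 6 * a * cz A b := by gcongr
        _ = _ := by ring
    have := le_of_mul_le_mul_left h3 ha0
    linarith
  have hV : ∀ σ : ZMod p, σ ≠ 0 → ∀ m, (cl A m σ : ℝ) * s ≤ 4 * K ^ (m + 8) * a := by
    intro σ hσ m
    have h' : (cl A m σ : ℝ) * cz A b ≤ #(A ^ (m + 2)) * 2 := by exact_mod_cast cl_mul_cz_le hb4 hσ m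
    calc (cl A m σ : ℝ) * s ≤ cl A m σ * (2 * K ^ 6 * cz A b) := by gcongr
      _ = 2 * K ^ 6 * (cl A m σ * cz A b) := by ring
      _ ≤ 2 * K ^ 6 * (K ^ (m + 2) * a * 2) := by
          refine mul_le_mul_of_nonneg_left (h'.trans ?_) (by positivity)
          have := hpow (m + 2)
          linarith
      _ = _ := by ring
  have hgood : ∀ g : SL p, s ≤ 4 * K ^ 17 * cz A (g * b * g⁻¹) → s ≤ 8 * K ^ 17 * gz A (g * b * g⁻¹) := by
    intro g hg
    have h4 : (cz A (g * b * g⁻¹) : ℝ) ≤ gz A (g * b * g⁻¹) + 6 := by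
      exact_mod_cast cz_le_gz hp A (by rwa [tr_conj])
    have h5 := mul_le_mul_of_nonneg_left h4 (by positivity : 0 ≤ 4 * K ^ 17)
    linarith
  have hstep : ∀ x ∈ A, ∀ g : SL p, s ≤ 4 * K ^ 17 * cz A (g * b * g⁻¹) →
      s ≤ 4 * K ^ 17 * cz A ((x * g) * b * (x * g)⁻¹) := by
    intro x hx g hg
    have h1 := hgood g hg
    obtain ⟨b', hbA', hb0', hb4', hle⟩ := exists_gz (A := A) (b := g * b * g⁻¹) (by
      intro h0
      rw [h0] at h1; simp at h1; linarith)
    have hle' : (cz A b' : ℝ) ≤ cz A (g * b * g⁻¹) := by exact_mod_cast hle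
    have h' : a ≤ cl A 4 (tr b') * cz A b' := by rw [ha]; exact_mod_cast card_le_cl_mul_cz hinv hbA'
    have h2 : s ≤ 4 * K ^ 12 * cz A (g * b * g⁻¹) := by
      have h3 : a * s ≤ a * (4 * K ^ 12 * cz A b') := by
        calc a * s ≤ cl A 4 (tr b') * cz A b' * s := by gcongr
          _ = cl A 4 (tr b') * s * cz A b' := by ring
          _ ≤ (4 * K ^ (4 + 8) * a) * cz A b' := mul_le_mul_of_nonneg_right (hV _ hb0' 4) (by positivity)
          _ = _ := by ring
      exact (le_of_mul_le_mul_left h3 ha0).trans (by gcongr)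
    have hcj := cz_conj hinv hx (g * b * g⁻¹)
    have e : x * (g * b * g⁻¹) * x⁻¹ = x * g * b * (x * g)⁻¹ := by group
    rw [e] at hcj
    have h5 : a * cz A (g * b * g⁻¹) ≤ K ^ 5 * a * cz A (x * g * b * (x * g)⁻¹) := by
      have : a * cz A (g * b * g⁻¹) ≤ (#(A ^ 5) : ℝ) * cz A (x * g * b * (x * g)⁻¹) := by
        rw [ha]; exact_mod_cast hcj
      refine this.trans ?_
      gcongr; exact hpow 5
    have h6 : (cz A (g * b * g⁻¹) : ℝ) ≤ K ^ 5 * cz A (x * g * b * (x * g)⁻¹) := le_of_mul_le_mul_left (by linarith) ha0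
    calc s ≤ 4 * K ^ 12 * cz A (g * b * g⁻¹) := h2
      _ ≤ 4 * K ^ 12 * (K ^ 5 * cz A (x * g * b * (x * g)⁻¹)) := by gcongr
      _ = _ := by ring
  have h1 : s ≤ 4 * K ^ 17 * cz A ((1 : SL p) * b * (1 : SL p)⁻¹) := by
    rw [one_mul, inv_one, mul_one]
    refine hsc.trans ?_
    gcongr
    · norm_num
    · norm_num
  have hind : ∀ x : SL p, ∀ g : SL p, s ≤ 4 * K ^ 17 * cz A (g * b * g⁻¹) →
      s ≤ 4 * K ^ 17 * cz A ((x * g) * b * (x * g)⁻¹) := by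
    intro x
    have : x ∈ Subgroup.closure (A : Set (SL p)) := by rw [hgen]; trivial
    induction this using Subgroup.closure_induction'' with
    | one => intro g hg; rwa [one_mul]
    | mem x hx => exact hstep x hx
    | inv_mem x hx => exact hstep _ (hinv x hx)
    | mul x y _ _ hx hy =>
      intro g hg
      rw [mul_assoc x y g]
      exact hx _ (hy g hg)
  have hrich : ∀ g : SL p, s ≤ 4 * K ^ 17 * cz A (g * b * g⁻¹) := by
    intro g
    have := hind g 1 h1
    rwa [mul_one] at this
  obtain ⟨N, hN⟩ : ∃ N : ℝ, N = (Fintype.card (SL p) : ℝ) := ⟨_, rfl⟩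
  have hfin : N * s ≤ 32 * K ^ 19 * a * p := by
    have h2 : (∑ g : SL p, (gz A (g * b * g⁻¹) : ℝ)) ≤ #(A ^ 2) * (2 * (2 * p)) := by exact_mod_cast sum_gz_le A hb4
    calc N * s = ∑ g : SL p, s := by rw [Finset.sum_const, nsmul_eq_mul, Finset.card_univ, hN]
      _ ≤ ∑ g : SL p, 8 * K ^ 17 * (gz A (g * b * g⁻¹) : ℝ) :=
          Finset.sum_le_sum fun g _ => hgood g (hrich g)
      _ = 8 * K ^ 17 * ∑ g : SL p, (gz A (g * b * g⁻¹) : ℝ) := by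
          rw [Finset.mul_sum]
      _ ≤ 8 * K ^ 17 * (K ^ 2 * a * (2 * (2 * p))) := by
          gcongr; exact h2.trans (by gcongr; exact hpow 2)
      _ = _ := by ring
  have hp0 : (0 : ℝ) < p := by exact_mod_cast (Fact.out : p.Prime).pos
  have hNp := card_sl_ge (p := p)
  rw [← hN] at hNp
  have h7 : (p : ℝ) ^ 2 ≤ K ^ 25 * s ^ 3 := by
    have h8 : (p : ℝ) * s * p ^ 2 ≤ p * s * (64 * K ^ 19 * s ^ 3) := by
      have : (p : ℝ) ^ 3 / 2 * s ≤ N * s := by gcongr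
      rw [← hs] at hfin
      nlinarith
    have h9 := le_of_mul_le_mul_left h8 (by positivity)
    calc (p : ℝ) ^ 2 ≤ _ := h9
      _ ≤ K ^ 6 * K ^ 19 * s ^ 3 := by gcongr
      _ = _ := by ring
  calc (p : ℝ) ^ 8 = ((p : ℝ) ^ 2) ^ 4 := by ring
    _ ≤ (K ^ 25 * s ^ 3) ^ 4 := by gcongr
    _ = K ^ 100 * (s ^ 4) ^ 3 := by ring
    _ = _ := by rw [hs]

end Pivot

section PrimeFlat

/-- Non-concentration on cosets of the subgroups satisfying `P`. -/
def NonConc {G : Type*} [Group G] [Fintype G] (P : Subgroup G → Prop) (b : ℝ) (β : G → ℝ) : Prop :=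
  ∀ H : Subgroup G, P H → ∀ a : G, ∑ x with a⁻¹ * x ∈ H, β x ≤ b

theorem NonConc.mono {G : Type*} [Group G] [Fintype G] {P : Subgroup G → Prop} {b : ℝ} {β β' : G → ℝ}
    (h : NonConc P b β) (hle : ∀ x, β' x ≤ β x) : NonConc P b β' :=
  fun H hH a => (Finset.sum_le_sum fun x _ => hle x).trans (h H hH a)

theorem NonConc.acor {G : Type*} [Group G] [Fintype G] {P : Subgroup G → Prop} {b : ℝ} (hb : 0 ≤ b) {β : G → ℝ}
    (h : NonConc P b β) (h0 : ∀ x, 0 ≤ β x) (h1 : ∑ x, β x ≤ 1) :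
    NonConc P b (fun x => ∑ y, β y * β (y * x)) := by
  intro H hH a
  rw [Finset.sum_comm]
  have key : ∀ y, ∑ x with a⁻¹ * x ∈ H, β y * β (y * x) ≤ β y * b := by
    intro y
    rw [← Finset.mul_sum]
    refine mul_le_mul_of_nonneg_left ?_ (h0 y)
    refine le_trans (le_of_eq ?_) (h H hH (y * a))
    rw [Finset.sum_filter, Finset.sum_filter,
      ← sum_mul_left y (fun x => if (y * a)⁻¹ * x ∈ H then β x else 0)]
    refine Finset.sum_congr rfl fun x _ => ?_
    have e : (y * a)⁻¹ * (y * x) = a⁻¹ * x := by group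
    rw [e]
  calc _ ≤ ∑ y, β y * b := Finset.sum_le_sum fun y _ => key y
    _ = (∑ y, β y) * b := by rw [Finset.sum_mul]
    _ ≤ 1 * b := by gcongr
    _ = b := one_mul b

instance {p : ℕ} [Fact p.Prime] : Nontrivial (SL p) :=
  ⟨⟨uu 1, 1, fun h => one_ne_zero (α := ZMod p) (by
    have := congrArg (fun m : SL p => m.1 0 1) h
    simpa [uu_val] using this)⟩⟩

theorem prime_piece {p : ℕ} [Fact p.Prime] {t b : ℝ} (ht : 16 ≤ t) (hp : t ^ 82402 ≤ p) (hb : b * t ^ 74400 < 1)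
    {β : SL p → ℝ} (h0 : ∀ x, 0 ≤ β x) (hN : NonConc (fun H => H ≠ ⊤) b β) {A : Finset (SL p)}
    (hA : Apx (t ^ 800) A) (hAβ : #A * ∑ x, β x ^ 2 ≤ t ^ 800) {a : SL p}
    (ha : 1 ≤ t ^ 800 * ∑ x with a⁻¹ * x ∈ A, β x) {η : SL p → ℂ} (hη : ∀ x, ‖η x‖ ≤ β x) :
    OpB {φ : SL p → ℂ | ∑ x, φ x = 0} η ((p : ℝ) ^ (-(1/6) : ℝ)) := by
  have t1 : (1:ℝ) ≤ t := by linarith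
  have t0 : (0:ℝ) < t := by linarith
  have hp16 : (16 : ℝ) ≤ p := ht.trans ((le_self_pow₀ t1 (by norm_num)).trans hp)
  have hp2 : p ≠ 2 := by
    rintro rfl
    norm_num at hp16
  have hcl : Subgroup.closure (A : Set (SL p)) = ⊤ := by
    by_contra hne
    have h1 := hN _ hne a
    have h2 : ∑ x with a⁻¹ * x ∈ A, β x ≤ b := by
      refine le_trans (Finset.sum_le_sum_of_subset_of_nonneg ?_ fun x _ _ => h0 x) h1
      intro x hx
      simp only [Finset.mem_filter, Finset.mem_univ, true_and] at hx ⊢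
      exact Subgroup.subset_closure hx
    have h3 : t ^ 800 * b ≤ 1 := by
      by_contra hc
      push Not at hc
      have hb0 : 0 < b := by
        by_contra hb0
        push Not at hb0
        have : t ^ 800 * b ≤ 0 := mul_nonpos_of_nonneg_of_nonpos (by positivity) hb0
        linarith
      have : t ^ 800 * b ≤ t ^ 74400 * b := by
        gcongr
        norm_num
      linarith
    have h4 : t ^ 800 * ∑ x with a⁻¹ * x ∈ A, β x ≤ t ^ 800 * b := by gcongr
    have hb0 : 0 < b := by
      by_contra hb0
      push Not at hb0
      have : t ^ 800 * b ≤ 0 := mul_nonpos_of_nonneg_of_nonpos (by positivity) hb0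
      linarith
    have : t ^ 800 * b ≤ t ^ 74400 * b := by
      gcongr
      norm_num
    linarith
  have hbig : (t ^ 800) ^ 92 ≤ (#A : ℝ) := by
    by_contra hc
    push Not at hc
    have hpt : ∀ x, β x ≤ b := by
      intro x
      refine le_trans ?_ (hN ⊥ bot_ne_top x)
      refine Finset.single_le_sum (f := β) (fun y _ => h0 y) ?_
      simp
    have h2 : ∑ x with a⁻¹ * x ∈ A, β x ≤ #A * b := by
      calc ∑ x with a⁻¹ * x ∈ A, β x ≤ ∑ x with a⁻¹ * x ∈ A, b := Finset.sum_le_sum fun x _ => hpt x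
        _ = #(Finset.univ.filter fun x => a⁻¹ * x ∈ A) * b := by rw [Finset.sum_const, nsmul_eq_mul]
        _ ≤ #A * b := by
          have hb0 : 0 ≤ b := (h0 1).trans (hpt 1)
          refine mul_le_mul_of_nonneg_right (Nat.cast_le.2 ?_) hb0
          refine Finset.card_le_card_of_injOn (fun x => a⁻¹ * x) ?_ ?_
          · intro x hx
            simpa using hx
          · intro x _ y _ e
            simpa using e
    have hb0 : 0 ≤ b := (h0 1).trans (hpt 1)
    have h3 : t ^ 800 * ∑ x with a⁻¹ * x ∈ A, β x ≤ t ^ 800 * ((t ^ 800) ^ 92 * b) := by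
      gcongr
      exact h2.trans (by gcongr)
    have e : t ^ 800 * ((t ^ 800) ^ 92 * b) = b * t ^ 74400 := by
      rw [← pow_mul, ← mul_assoc, ← pow_add, mul_comm]
    linarith
  have hpv := pivot hp2 (by
    calc (2:ℝ) ≤ t := by linarith
      _ ≤ t ^ 800 := le_self_pow₀ t1 (by norm_num)) hA hcl hbig
  have hA0 : (0:ℝ) < #A := lt_of_lt_of_le (by positivity) hbig
  intro φ hφ
  have hq := quasirandom_prime η φ hφ
  have hηs : l2Norm η ^ 2 ≤ ∑ x, β x ^ 2 := by
    rw [l2Norm_sq]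
    exact Finset.sum_le_sum fun x _ => pow_le_pow_left₀ (norm_nonneg _) (hη x) 2
  obtain ⟨X, hX⟩ : ∃ X : ℝ, X = 4 * (p:ℝ) ^ 2 * t ^ 800 / #A := ⟨_, rfl⟩
  have hX0 : 0 ≤ X := by rw [hX]; positivity
  have hX3 : X ^ 3 ≤ 1 / p := by
    have hp8 : (p:ℝ)^8 ≤ t ^ 80000 * (#A:ℝ)^3 := by rw [← pow_mul] at hpv; exact hpv
    rw [hX, div_pow, div_le_div_iff₀ (by positivity) (by positivity), one_mul]
    have h5 : (4 * (p:ℝ) ^ 2 * t ^ 800) ^ 3 * p * p ≤ (#A : ℝ) ^ 3 * p := by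
      calc (4 * (p:ℝ) ^ 2 * t ^ 800) ^ 3 * p * p = 64 * t ^ 2400 * p ^ 8 := by
            rw [mul_pow, mul_pow, ← pow_mul, ← pow_mul]; ring
        _ ≤ t ^ 2 * t ^ 2400 * (t ^ 80000 * (#A:ℝ)^3) := by
            gcongr
            nlinarith
        _ = t ^ 82402 * (#A:ℝ)^3 := by rw [← pow_add, ← mul_assoc, ← pow_add]
        _ ≤ p * (#A:ℝ)^3 := by gcongr
        _ = _ := by ring
    exact le_of_mul_le_mul_right h5 (by positivity)
  have hXp : X ≤ ((p : ℝ) ^ (-(1/6) : ℝ)) ^ 2 := by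
    refine le_of_pow_le_pow_left₀ (n := 3) (by norm_num) (by positivity) ?_
    refine hX3.trans (le_of_eq ?_)
    rw [← pow_mul, ← Real.rpow_natCast, ← Real.rpow_mul (by positivity)]
    norm_num
    rw [Real.rpow_neg_one]
  refine le_of_pow_le_pow_left₀ (n := 2) (by norm_num) (mul_nonneg (by positivity) (l2Norm_nonneg φ)) ?_
  rw [mul_pow]
  refine le_trans ?_ (mul_le_mul_of_nonneg_right hXp (by positivity))
  have h6 : l2Norm (conv η φ) ^ 2 * ((p:ℝ) / 4) ≤ X * l2Norm φ ^ 2 * (p / 4) := by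
    calc l2Norm (conv η φ) ^ 2 * ((p:ℝ) / 4) ≤ l2Norm (conv η φ) ^ 2 * (((p:ℝ) - 1) / 2) := by
          refine mul_le_mul_of_nonneg_left ?_ (by positivity)
          linarith
      _ ≤ _ := hq
      _ ≤ (p:ℝ) ^ 3 * (t ^ 800 / #A) * l2Norm φ ^ 2 := by
          gcongr
          · exact card_sl_le
          · rw [le_div_iff₀ hA0, mul_comm]
            exact le_trans (by gcongr) hAβ
      _ = _ := by rw [hX]; field_simp
  exact le_of_mul_le_mul_right h6 (by positivity)

theorem prime_op {κ : ℝ} (hκ : 0 < κ) : ∃ c > (0:ℝ), ∃ p0 : ℕ, ∀ (p : ℕ) [Fact p.Prime], p0 ≤ p →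
    ∀ μ : SL p → ℂ, ∑ x, ‖μ x‖ ≤ 1 → NonConc (fun H => H ≠ ⊤) ((p:ℝ) ^ (-κ)) (fun x => ‖μ x‖) →
      OpB {φ : SL p → ℂ | ∑ x, φ x = 0} μ (4 * (p:ℝ) ^ (-c)) := by
  obtain ⟨τ, hτ⟩ : ∃ τ : ℝ, τ = min κ 1 / 10 ^ 6 := ⟨_, rfl⟩
  have hτ0 : 0 < τ := by rw [hτ]; have := lt_min hκ one_pos; positivity
  have hτκ : τ * 10 ^ 6 ≤ κ := by rw [hτ]; have := min_le_left κ 1; linarith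
  have hτ1 : τ * 10 ^ 6 ≤ 1 := by rw [hτ]; have := min_le_right κ 1; linarith
  obtain ⟨n, hn⟩ := exists_nat_ge (4 / τ)
  rw [div_le_iff₀ hτ0] at hn
  refine ⟨(1/12) * (1/2) ^ n, by positivity, ⌈(16:ℝ) ^ (1/τ)⌉₊, ?_⟩
  intro p _ hp0 μ hμ hN
  have hpr : (16:ℝ) ^ (1/τ) ≤ p := Nat.ceil_le.1 hp0
  have hp1 : (1:ℝ) < p := by exact_mod_cast (Fact.out : p.Prime).one_lt
  have hp00 : (0:ℝ) < p := by linarith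
  obtain ⟨t, ht⟩ : ∃ t : ℝ, t = (p:ℝ) ^ τ := ⟨_, rfl⟩
  have ht16 : 16 ≤ t := by
    rw [ht]
    calc (16:ℝ) = ((16:ℝ) ^ (1/τ)) ^ τ := by rw [← Real.rpow_mul (by norm_num), one_div_mul_cancel hτ0.ne', Real.rpow_one]
      _ ≤ _ := by gcongr
  have t0 : 0 < t := by linarith
  have t1 : 1 ≤ t := by linarith
  have htn : ∀ k : ℕ, t ^ k = (p:ℝ) ^ (τ * k) := fun k => by rw [ht, Real.rpow_mul hp00.le, Real.rpow_natCast]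
  have e16 : 16 / t⁻¹ ≤ t ^ 2 := by rw [div_inv_eq_mul]; nlinarith
  have e400 : (16 / t⁻¹) ^ 400 ≤ t ^ 800 := by
    calc (16 / t⁻¹) ^ 400 ≤ (t ^ 2) ^ 400 := by gcongr
      _ = _ := by rw [← pow_mul]
  have hb : (p:ℝ) ^ (-κ) * t ^ 74400 < 1 := by
    rw [htn, ← Real.rpow_add hp00]
    refine Real.rpow_lt_one_of_one_lt_of_neg hp1 ?_
    push_cast
    nlinarith
  have hpt : t ^ 82402 ≤ p := by
    rw [htn]
    nth_rewrite 2 [← Real.rpow_one (p:ℝ)]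
    refine Real.rpow_le_rpow_of_exponent_le hp1.le ?_
    push_cast
    linarith
  have hr12 : (p:ℝ) ^ (-(1/12) : ℝ) ≤ 1 := Real.rpow_le_one_of_one_le_of_nonpos hp1.le (by norm_num)
  have key := iterate_flattening (G := SL p) {φ : SL p → ℂ | ∑ x, φ x = 0}
    (NonConc (fun H => H ≠ ⊤) ((p:ℝ) ^ (-κ))) t⁻¹ ((p : ℝ) ^ (-(1/6) : ℝ)) ((p : ℝ) ^ (-(1/12) : ℝ))
    (by positivity) (by positivity) (inv_le_one_of_one_le₀ t1) (by positivity) hr12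
    (fun β β' _ h h' => h'.mono h) (fun β h0 h1 h => h.acor (by positivity) h0 h1)
    (fun β h0 h1 h A hA hAβ a ha η hη _ => prime_piece ht16 hpt hb h0 h (hA.mono (by positivity) e400)
      (hAβ.trans e400) (ha.trans (mul_le_mul_of_nonneg_right e400 (Finset.sum_nonneg fun x _ => h0 x))) hη)
    (by
      calc 2 * (16 / t⁻¹) ^ 400 * (p : ℝ) ^ (-(1/6) : ℝ) ≤ t * t ^ 800 * (p : ℝ) ^ (-(1/6) : ℝ) := by
            gcongr; linarith
        _ = (p:ℝ) ^ (τ * (801:ℕ)) * (p : ℝ) ^ (-(1/6) : ℝ) := by rw [← htn, pow_succ' t 800]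
        _ = (p:ℝ) ^ (τ * (801:ℕ) + -(1/6)) := by rw [← Real.rpow_add hp00]
        _ ≤ _ := Real.rpow_le_rpow_of_exponent_le hp1.le (by push_cast; linarith)) n μ hμ hN
    (by
      have h2 : ∑ x, ‖μ x‖ ^ 2 ≤ 1 := by
        refine le_trans (Finset.sum_le_sum fun x _ => ?_) hμ
        have h3 : ‖μ x‖ ≤ 1 := (Finset.single_le_sum (f := fun x => ‖μ x‖) (fun y _ => norm_nonneg _) (Finset.mem_univ x)).trans hμ
        nlinarith [norm_nonneg (μ x)]
      calc (Fintype.card (SL p) : ℝ) * t⁻¹ ^ n * ∑ x, ‖μ x‖ ^ 2 ≤ (p:ℝ) ^ 3 * t⁻¹ ^ n * 1 := by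
            gcongr; exact card_sl_le
        _ = (p:ℝ) ^ ((3:ℕ) + -(τ * n)) := by
            rw [mul_one, inv_pow, htn, ← Real.rpow_neg hp00.le, Real.rpow_add hp00, Real.rpow_natCast]
        _ ≤ (p:ℝ) ^ (-(1/12) * (2:ℕ) : ℝ) := Real.rpow_le_rpow_of_exponent_le hp1.le (by push_cast; linarith)
        _ = _ := by rw [Real.rpow_mul hp00.le, Real.rpow_natCast])
  refine key.mono (le_of_eq ?_)
  rw [← Real.rpow_mul hp00.le, neg_mul]

end PrimeFlat

section Laws
variable {G H : Type*} [Fintype G] [Fintype H]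

/-- The law of `op x y` for independent `x ~ α`, `y ~ β`. -/
noncomputable def bin (op : G → G → G) (α β : G → ℝ) : G → ℝ :=
  fun c => ∑ x, ∑ y, if op x y = c then α x * β y else 0

/-- The law of `f x` for `x ~ α`. -/
noncomputable def push (f : G → H) (α : G → ℝ) : H → ℝ := fun y => ∑ x, if f x = y then α x else 0

theorem sum_bin_mul (op : G → G → G) (α β F : G → ℝ) :
    ∑ c, bin op α β c * F c = ∑ x, ∑ y, α x * β y * F (op x y) := by
  simp only [bin, Finset.sum_mul]
  rw [Finset.sum_comm]
  refine Finset.sum_congr rfl fun x _ => ?_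
  rw [Finset.sum_comm]
  refine Finset.sum_congr rfl fun y _ => ?_
  simp [ite_mul]

theorem sum_push_mul (f : G → H) (α : G → ℝ) (F : H → ℝ) :
    ∑ c, push f α c * F c = ∑ x, α x * F (f x) := by
  simp only [push, Finset.sum_mul]
  rw [Finset.sum_comm]
  refine Finset.sum_congr rfl fun x _ => ?_
  simp [ite_mul]

theorem push_bin (f : G → H) (op : G → G → G) (op' : H → H → H) (h : ∀ x y, f (op x y) = op' (f x) (f y))
    (α β : G → ℝ) : push f (bin op α β) = bin op' (push f α) (push f β) := by
  funext c
  have h1 := sum_bin_mul op α β (fun z => if f z = c then 1 else 0)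
  have h2 : push f (bin op α β) c = ∑ z, bin op α β z * (if f z = c then 1 else 0) := by
    simp [push]
  rw [h2, h1]
  have h3 : bin op' (push f α) (push f β) c
      = ∑ x', push f α x' * ∑ y', push f β y' * (if op' x' y' = c then 1 else 0) := by
    simp [bin, Finset.mul_sum]
  rw [h3, sum_push_mul]
  refine Finset.sum_congr rfl fun x _ => ?_
  rw [sum_push_mul, Finset.mul_sum]
  refine Finset.sum_congr rfl fun y _ => ?_
  rw [h]
  ring

/-- A probability mass function. -/
def IsProb (α : G → ℝ) : Prop := (∀ x, 0 ≤ α x) ∧ ∑ x, α x = 1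

theorem IsProb.bin {op : G → G → G} {α β : G → ℝ} (hα : IsProb α) (hβ : IsProb β) : IsProb (bin op α β) := by
  refine ⟨fun c => Finset.sum_nonneg fun x _ => Finset.sum_nonneg fun y _ => ?_, ?_⟩
  · split_ifs
    · exact mul_nonneg (hα.1 x) (hβ.1 y)
    · exact le_rfl
  · have := sum_bin_mul op α β (fun _ => 1)
    simp only [mul_one] at this
    rw [this]
    simp only [← Finset.mul_sum, hβ.2, mul_one, hα.2]

theorem IsProb.push {f : G → H} {α : G → ℝ} (hα : IsProb α) : IsProb (push f α) := by
  refine ⟨fun c => Finset.sum_nonneg fun x _ => ?_, ?_⟩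
  · split_ifs
    · exact hα.1 x
    · exact le_rfl
  · have := sum_push_mul f α (fun _ => 1)
    simp only [mul_one] at this
    rw [this, hα.2]

theorem IsProb.le_one {α : G → ℝ} (hα : IsProb α) (x : G) : α x ≤ 1 := by
  rw [← hα.2]
  exact Finset.single_le_sum (f := α) (fun y _ => hα.1 y) (Finset.mem_univ x)

theorem bin_ne_zero {op : G → G → G} {α β : G → ℝ} {c : G} (h : bin op α β c ≠ 0) :
    ∃ x y, op x y = c ∧ α x ≠ 0 ∧ β y ≠ 0 := by
  obtain ⟨x, _, hx⟩ := Finset.exists_ne_zero_of_sum_ne_zero h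
  obtain ⟨y, _, hy⟩ := Finset.exists_ne_zero_of_sum_ne_zero hx
  refine ⟨x, y, ?_, ?_, ?_⟩
  · by_contra hc; rw [if_neg hc] at hy; exact hy rfl
  · rintro h0; rw [h0] at hy; simp at hy
  · rintro h0; rw [h0] at hy; simp at hy

/-- Convolution powers: `rpw ν n` is the law of the product of `n + 1` independent samples of `ν`. -/
noncomputable def rpw [Mul G] (ν : G → ℝ) : ℕ → G → ℝ
  | 0 => ν
  | n + 1 => bin (· * ·) ν (rpw ν n)

theorem IsProb.rpw [Mul G] {ν : G → ℝ} (h : IsProb ν) (n : ℕ) : IsProb (rpw ν n) := by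
  induction n with
  | zero => exact h
  | succ n ih => exact h.bin ih

theorem push_rpw [Group G] [Group H] (f : G →* H) (ν : G → ℝ) (n : ℕ) : push f (rpw ν n) = rpw (push f ν) n := by
  induction n with
  | zero => rfl
  | succ n ih => rw [rpw, rpw, push_bin f _ (· * ·) (fun x y => map_mul f x y), ih]

theorem rpw_support [Group G] {ν : G → ℝ} {A : Finset G} (h : ∀ x, ν x ≠ 0 → x ∈ A) (n : ℕ) :
    ∀ x, rpw ν n x ≠ 0 → x ∈ A ^ (n + 1) := by
  induction n with
  | zero => intro x hx; rw [zero_add, pow_one]; exact h x hx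
  | succ n ih =>
    intro x hx
    obtain ⟨y, z, rfl, hy, hz⟩ := bin_ne_zero hx
    rw [pow_succ']
    exact Finset.mul_mem_mul (h y hy) (ih z hz)

theorem norm_le_l2Norm (φ : G → ℂ) (x : G) : ‖φ x‖ ≤ l2Norm φ := by
  rw [l2Norm]
  refine Real.le_sqrt_of_sq_le ?_
  exact Finset.single_le_sum (f := fun x => ‖φ x‖ ^ 2) (fun y _ => by positivity) (Finset.mem_univ x)

end Laws

theorem rpw_le [hG : Group G] [Fintype G] {ν : G → ℝ} (hν : IsProb ν) {ρ : ℝ} (hρ : 0 ≤ ρ)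
    (hop : OpB {φ : G → ℂ | ∑ x, φ x = 0} (fun x => (ν x : ℂ)) ρ) (n : ℕ) (x : G) :
    rpw ν n x ≤ 1 / Fintype.card G + ρ ^ n * Fintype.card G := by
  obtain ⟨N, hN⟩ : ∃ N : ℝ, N = (Fintype.card G : ℝ) := ⟨_, rfl⟩
  have hN0 : 1 ≤ N := by rw [hN]; exact_mod_cast Fintype.card_pos (α := G)
  rw [← hN]
  obtain ⟨g, hg⟩ : ∃ g : ℕ → G → ℂ, ∀ n x, g n x = ((rpw ν n x - 1 / N : ℝ) : ℂ) := ⟨_, fun _ _ => rfl⟩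
  have hg0 : ∀ n, ∑ x, g n x = 0 := by
    intro n
    simp only [hg]
    rw [← Complex.ofReal_sum, Finset.sum_sub_distrib, (hν.rpw n).2, Finset.sum_const, Finset.card_univ, nsmul_eq_mul,
      ← hN, mul_one_div_cancel (by positivity)]
    simp
  have hgs : ∀ n, g (n + 1) = conv (fun x => (ν x : ℂ)) (g n) := by
    intro n
    funext x
    rw [hg, conv]
    simp only [hg]
    rw [rpw, bin]
    have e1 : ∀ y, (∑ z, if y * z = x then ν y * rpw ν n z else 0) = ν y * rpw ν n (y⁻¹ * x) := by
      intro y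
      rw [Finset.sum_eq_single (y⁻¹ * x)]
      · simp
      · intro z _ hz
        rw [if_neg]
        rintro rfl
        simp at hz
      · simp
    simp only [e1]
    rw [← sub_eq_zero]
    simp only [← Complex.ofReal_mul]
    rw [← Complex.ofReal_sum, ← Complex.ofReal_sub]
    simp only [mul_sub, Finset.sum_sub_distrib, ← Finset.sum_mul, hν.2]
    simp
  have hb : ∀ n, l2Norm (g n) ≤ ρ ^ n * N := by
    intro n
    induction n with
    | zero =>
      rw [pow_zero, one_mul]
      have : l2Norm (g 0) ^ 2 ≤ N ^ 2 := by
        rw [l2Norm_sq]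
        calc ∑ x, ‖g 0 x‖ ^ 2 ≤ ∑ x : G, (1:ℝ) := by
              refine Finset.sum_le_sum fun x _ => ?_
              rw [hg, Complex.norm_real, Real.norm_eq_abs, sq_abs]
              have h1 := (hν.rpw 0).le_one x
              have h2 := (hν.rpw 0).1 x
              have h3 : 1 / N ≤ 1 := by rw [div_le_one (by linarith)]; exact hN0
              have h4 : 0 ≤ 1 / N := by positivity
              nlinarith
          _ = N := by simp [hN]
          _ ≤ N ^ 2 := by nlinarith
      exact le_of_pow_le_pow_left₀ (by norm_num) (by linarith) this
    | succ n ih =>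
      rw [hgs]
      refine (hop (g n) (hg0 n)).trans ?_
      calc ρ * l2Norm (g n) ≤ ρ * (ρ ^ n * N) := by gcongr
        _ = _ := by ring
  have h1 := (norm_le_l2Norm (g n) x).trans (hb n)
  rw [hg, Complex.norm_real, Real.norm_eq_abs] at h1
  have := (le_abs_self _).trans h1
  linarith

theorem flat_power {κ : ℝ} (hκ : 0 < κ) : ∃ m : ℕ, ∃ p0 : ℕ, ∀ (p : ℕ) [Fact p.Prime], p0 ≤ p →
    ∀ ν : SL p → ℝ, IsProb ν → NonConc (fun H => H ≠ ⊤) ((p:ℝ) ^ (-κ)) ν →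
      ∀ x, rpw ν m x ≤ 2 / Fintype.card (SL p) := by
  obtain ⟨c, hc, p1, h⟩ := prime_op hκ
  obtain ⟨m, hm⟩ := exists_nat_ge (6 / (c / 2))
  rw [div_le_iff₀ (by positivity)] at hm
  refine ⟨m, max p1 ⌈(4:ℝ) ^ (1/(c/2))⌉₊, ?_⟩
  intro p _ hp ν hν hN x
  have hp1 : (1:ℝ) < p := by exact_mod_cast (Fact.out : p.Prime).one_lt
  have hp00 : (0:ℝ) < p := by linarith
  have h4 : (4:ℝ) ≤ (p:ℝ) ^ (c/2) := by
    have hpr : (4:ℝ) ^ (1/(c/2)) ≤ p := Nat.ceil_le.1 ((le_max_right _ _).trans hp)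
    calc (4:ℝ) = ((4:ℝ) ^ (1/(c/2))) ^ (c/2) := by
          rw [← Real.rpow_mul (by norm_num), one_div_mul_cancel (by positivity), Real.rpow_one]
      _ ≤ _ := by gcongr
  have hn : ∀ x, ‖(ν x : ℂ)‖ = ν x := fun x => by
    rw [Complex.norm_real, Real.norm_eq_abs, abs_of_nonneg (hν.1 x)]
  have hop := h p ((le_max_left _ _).trans hp) (fun x => (ν x : ℂ)) (by simp only [hn]; exact hν.2.le)
    (by simp only [hn]; exact hN)
  have hop' : OpB {φ : SL p → ℂ | ∑ x, φ x = 0} (fun x => (ν x : ℂ)) ((p:ℝ) ^ (-(c/2))) := by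
    refine hop.mono ?_
    calc 4 * (p:ℝ) ^ (-c) ≤ (p:ℝ) ^ (c/2) * (p:ℝ) ^ (-c) := by gcongr
      _ = _ := by rw [← Real.rpow_add hp00]; congr 1; ring
  refine (rpw_le hν (by positivity) hop' m x).trans ?_
  have hcard := card_sl_le (p := p)
  have hcard0 : (0:ℝ) < Fintype.card (SL p) := by exact_mod_cast Fintype.card_pos
  have h5 : ((p:ℝ) ^ (-(c/2))) ^ m * Fintype.card (SL p) ≤ 1 / Fintype.card (SL p) := by
    rw [le_div_iff₀ hcard0]
    calc ((p:ℝ) ^ (-(c/2))) ^ m * Fintype.card (SL p) * Fintype.card (SL p)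
        ≤ ((p:ℝ) ^ (-(c/2))) ^ m * (p:ℝ)^3 * (p:ℝ)^3 := by gcongr
      _ = (p:ℝ) ^ (-(c/2) * m + (6:ℕ)) := by
          rw [Real.rpow_add hp00, Real.rpow_natCast, Real.rpow_mul hp00.le, Real.rpow_natCast]; ring
      _ ≤ 1 := Real.rpow_le_one_of_one_le_of_nonpos hp1.le (by push_cast; linarith)
  calc _ ≤ 1 / (Fintype.card (SL p) : ℝ) + 1 / Fintype.card (SL p) := by gcongr
    _ = _ := by ring

section Arith

/-- Either `e = 0`, or `e / n = (1 - 1/u) / k` with `k ∈ {1, 2}` and `u ≥ 2`. -/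
def Slot (n e u : ℕ) : Prop := e = 0 ∨ (2 ≤ u ∧ (e * u = n * (u - 1) ∨ e * (2 * u) = n * (u - 1)))

theorem Slot.size {n e u : ℕ} (h : Slot n e u) :
    e = 0 ∨ 4 * e = n ∨ (n ≤ 3 * e ∧ 2 * e ≤ n) ∨ 2 * e = n ∨ 2 * n ≤ 3 * e := by
  rcases h with h | ⟨hu, h | h⟩
  · exact Or.inl h
  · obtain ⟨v, rfl⟩ := Nat.exists_eq_add_of_le hu
    rw [show 2 + v - 1 = v + 1 by omega] at h
    rcases Nat.eq_zero_or_pos v with rfl | hv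
    · omega
    · right; right; right; right
      nlinarith
  · obtain ⟨v, rfl⟩ := Nat.exists_eq_add_of_le hu
    rw [show 2 + v - 1 = v + 1 by omega] at h
    rcases Nat.eq_zero_or_pos v with rfl | hv
    · omega
    · right; right; left
      constructor <;> nlinarith

theorem Slot.dvd {n e u : ℕ} (h : Slot n e u) (hu5 : u ≤ 5) : ∃ v, 120 * e = n * v := by
  rcases h with h | ⟨hu, h | h⟩
  · exact ⟨0, by simp [h]⟩
  · interval_cases u
    · exact ⟨60, by omega⟩
    · exact ⟨80, by omega⟩
    · exact ⟨90, by omega⟩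
    · exact ⟨96, by omega⟩
  · interval_cases u
    · exact ⟨30, by omega⟩
    · exact ⟨40, by omega⟩
    · exact ⟨45, by omega⟩
    · exact ⟨48, by omega⟩

theorem Slot.large {n z e f g u v w : ℕ} (hz : 1 ≤ z) (h : Slot n e u) (h0 : e ≠ 0) (hu6 : 6 ≤ u) (hf : Slot n f v)
    (hg : Slot n g w) (hs : e + f + g + z = n) : n ≤ 2 * (z * u) := by
  have k1 := hf.size
  have k2 := hg.size
  rcases h with h | ⟨hu, h | h⟩
  · exact absurd h h0
  · obtain ⟨x, rfl⟩ := Nat.exists_eq_add_of_le hu6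
    rw [show 6 + x - 1 = x + 5 by omega] at h
    have h5 : 5 * n ≤ 6 * e := by nlinarith
    have : f = 0 ∧ g = 0 := by omega
    obtain ⟨rfl, rfl⟩ := this
    nlinarith
  · obtain ⟨x, rfl⟩ := Nat.exists_eq_add_of_le hu6
    rw [show 6 + x - 1 = x + 5 by omega] at h
    have h5 : 5 * n ≤ 12 * e := by nlinarith
    have : 2 * (f + g) ≤ n := by omega
    have h6 : n ≤ 2 * e + 2 * z := by omega
    nlinarith

theorem slots_conclusion {n z e f g u v w : ℕ} (hz : 1 ≤ z) (he : Slot n e u) (hf : Slot n f v)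
    (hg : Slot n g w) (hs : e + f + g + z = n) :
    n ≤ 120 * z ∨ (e ≠ 0 ∧ n ≤ 2 * (z * u)) ∨ (f ≠ 0 ∧ n ≤ 2 * (z * v)) ∨ (g ≠ 0 ∧ n ≤ 2 * (z * w)) := by
  by_cases h1 : e ≠ 0 ∧ 6 ≤ u
  · exact Or.inr (Or.inl ⟨h1.1, Slot.large hz he h1.1 h1.2 hf hg hs⟩)
  by_cases h2 : f ≠ 0 ∧ 6 ≤ v
  · exact Or.inr (Or.inr (Or.inl ⟨h2.1, Slot.large hz hf h2.1 h2.2 he hg (by omega)⟩))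
  by_cases h3 : g ≠ 0 ∧ 6 ≤ w
  · exact Or.inr (Or.inr (Or.inr ⟨h3.1, Slot.large hz hg h3.1 h3.2 he hf (by omega)⟩))
  left
  have aux : ∀ {e u : ℕ}, Slot n e u → ¬ (e ≠ 0 ∧ 6 ≤ u) → ∃ v, 120 * e = n * v := by
    intro e u h hn
    by_cases h0 : e = 0
    · exact ⟨0, by simp [h0]⟩
    · exact h.dvd (by by_contra hc; exact hn ⟨h0, by omega⟩)
  obtain ⟨a, ha⟩ := aux he h1
  obtain ⟨b, hb⟩ := aux hf h2
  obtain ⟨c, hc⟩ := aux hg h3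
  have hV : n * (a + b + c) + 120 * z = n * 120 := by
    have := congrArg (fun t => 120 * t) hs
    simp only [mul_add] at this
    rw [ha, hb, hc] at this
    linarith
  by_cases h120 : 120 ≤ a + b + c
  · nlinarith
  · have : a + b + c + 1 ≤ 120 := by omega
    nlinarith

end Arith

section Torus
variable {p : ℕ} [Fact p.Prime]

theorem eq_or_eq_inv_of_tr (hp : p ≠ 2) {x y : SL p} (hx : tr x ^ 2 ≠ 4) (hc : y * x = x * y) (ht : tr y = tr x) :
    y = x ∨ y = x⁻¹ := by
  obtain ⟨α, β, h1, h2, h3, h4⟩ := centralizer_repr (not_central_of_tr hx) hc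
  have h20 := two_ne_zero_zmod hp
  have d1 := sl_det x
  have d2 := sl_det y
  rw [tr] at ht hx
  rw [tr] at ht
  rw [h1, h2, h3, h4] at d2
  rw [h1, h4] at ht
  have e1 : 2 * α = (x.1 0 0 + x.1 1 1) * (1 - β) := by linear_combination ht
  have e2 : (1 - β) * (1 + β) * ((x.1 0 0 + x.1 1 1) ^ 2 - 4) = 0 := by
    linear_combination 4 * d2 - 4 * β ^ 2 * d1 - (2 * α + (x.1 0 0 + x.1 1 1) * (1 - β) + 2 * β * (x.1 0 0 + x.1 1 1)) * e1
  have e3 := sub_ne_zero.2 hx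
  rcases mul_eq_zero.1 e2 with e | e
  · rcases mul_eq_zero.1 e with e | e
    · left
      have hβ : β = 1 := by linear_combination -e
      have hα : α = 0 := by
        have : 2 * α = 0 := by rw [e1, hβ]; ring
        exact (mul_eq_zero.1 this).resolve_left h20
      subst hβ hα
      apply sl_ext
      · rw [h1]; ring
      · rw [h2]; ring
      · rw [h3]; ring
      · rw [h4]; ring
    · right
      have hβ : β = -1 := by linear_combination e
      have hα : α = x.1 0 0 + x.1 1 1 := by
        have : 2 * α = 2 * (x.1 0 0 + x.1 1 1) := by rw [e1, hβ]; ring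
        exact mul_left_cancel₀ h20 this
      subst hβ hα
      rw [eq_inv_iff_mul_eq_one]
      apply sl_ext
      · rw [mul_00, h1, h2]
        simp only [Matrix.SpecialLinearGroup.coe_one, Matrix.one_apply_eq]
        linear_combination d1
      · rw [mul_01, h1, h2]
        simp
        ring
      · rw [mul_10, h3, h4]
        simp
        ring
      · rw [mul_11, h3, h4]
        simp only [Matrix.SpecialLinearGroup.coe_one, Matrix.one_apply_eq]
        linear_combination d1
  · exact absurd e e3

end Torus

section ClassEq
variable {p : ℕ} [Fact p.Prime]

theorem comm_iff_of_comm {x y : SL p} (hx : x ∉ Subgroup.center (SL p)) (hy : y ∉ Subgroup.center (SL p))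
    (hxy : x * y = y * x) (u : SL p) : u * x = x * u ↔ u * y = y * u :=
  ⟨fun h => centralizer_comm hx h hxy.symm, fun h => centralizer_comm hy h hxy⟩

theorem conj_comm_iff (g x y : SL p) : (g * x * g⁻¹) * (g * y * g⁻¹) = (g * y * g⁻¹) * (g * x * g⁻¹) ↔ x * y = y * x := by
  have e1 : (g * x * g⁻¹) * (g * y * g⁻¹) = g * (x * y) * g⁻¹ := by group
  have e2 : (g * y * g⁻¹) * (g * x * g⁻¹) = g * (y * x) * g⁻¹ := by group
  rw [e1, e2, mul_left_inj, mul_right_inj]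

theorem conj_central_iff (g x : SL p) : g * x * g⁻¹ ∈ Subgroup.center (SL p) ↔ x ∈ Subgroup.center (SL p) := by
  constructor
  · intro h
    have := Subgroup.Normal.conj_mem inferInstance _ h g⁻¹
    simpa [mul_assoc] using this
  · intro h
    exact Subgroup.Normal.conj_mem inferInstance _ h g

variable (H : Subgroup (SL p))

/-- Order of the centralizer of `x` in `H`. -/
noncomputable def tc (x : SL p) : ℕ := #(univ.filter fun y : SL p => y ∈ H ∧ y * x = x * y)
/-- Order of the normalizer in `H` of the centralizer of `x`. -/
noncomputable def nc (x : SL p) : ℕ :=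
  #(univ.filter fun h : SL p => h ∈ H ∧ (h * x * h⁻¹) * x = x * (h * x * h⁻¹))
/-- Number of central elements in `H`. -/
noncomputable def zc : ℕ := #(univ.filter fun y : SL p => y ∈ H ∧ y ∈ Subgroup.center (SL p))
/-- The noncentral elements of `H` that are conjugate in `H` to an element commuting with `x`. -/
noncomputable def tor (x : SL p) : Finset (SL p) :=
  univ.filter fun w => w ∈ H ∧ w ∉ Subgroup.center (SL p) ∧ ∃ h ∈ H, (h * w * h⁻¹) * x = x * (h * w * h⁻¹)

variable {H}

theorem nc_eq (hp : p ≠ 2) (hss : ∀ x ∈ H, x ∉ Subgroup.center (SL p) → tr x ^ 2 ≠ 4) {x : SL p} (hx : x ∈ H)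
    (hxz : x ∉ Subgroup.center (SL p)) : nc H x = tc H x ∨ nc H x = 2 * tc H x := by
  have hx4 := hss x hx hxz
  have hne : x ≠ x⁻¹ := by
    intro e
    apply hx4
    have h2 : x * x = 1 := by nth_rewrite 2 [e]; simp
    have h00 := congrArg (fun m : SL p => m.1 0 0) h2
    have h01 := congrArg (fun m : SL p => m.1 0 1) h2
    have h10 := congrArg (fun m : SL p => m.1 1 0) h2
    have h11 := congrArg (fun m : SL p => m.1 1 1) h2
    simp only [mul_00, mul_01, mul_10, mul_11] at h00 h01 h10 h11
    simp at h00 h01 h10 h11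
    have hd := sl_det x
    rw [tr]
    linear_combination h00 + h11 + 2 * hd
  have hsplit : nc H x = #(univ.filter fun h : SL p => h ∈ H ∧ h * x * h⁻¹ = x) +
      #(univ.filter fun h : SL p => h ∈ H ∧ h * x * h⁻¹ = x⁻¹) := by
    rw [nc, ← Finset.card_union_of_disjoint]
    · congr 1
      ext h
      simp only [Finset.mem_filter, Finset.mem_univ, true_and, Finset.mem_union]
      constructor
      · rintro ⟨h1, h2⟩
        rcases eq_or_eq_inv_of_tr hp hx4 h2 (tr_conj h x) with e | e
        · exact Or.inl ⟨h1, e⟩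
        · exact Or.inr ⟨h1, e⟩
      · rintro (⟨h1, h2⟩ | ⟨h1, h2⟩)
        · exact ⟨h1, by rw [h2]⟩
        · exact ⟨h1, by rw [h2]; simp⟩
    · rw [Finset.disjoint_left]
      intro h h1 h2
      simp only [Finset.mem_filter, Finset.mem_univ, true_and] at h1 h2
      exact hne (h1.2.symm.trans h2.2)
  have e1 : #(univ.filter fun h : SL p => h ∈ H ∧ h * x * h⁻¹ = x) = tc H x := by
    rw [tc]
    congr 1
    ext h
    simp only [Finset.mem_filter, mul_inv_eq_iff_eq_mul]
  rw [hsplit, e1]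
  by_cases hE : ∃ h0 ∈ H, h0 * x * h0⁻¹ = x⁻¹
  · right
    obtain ⟨h0, hh0, e0⟩ := hE
    have e2 : #(univ.filter fun h : SL p => h ∈ H ∧ h * x * h⁻¹ = x⁻¹) = tc H x := by
      rw [← e1]
      symm
      refine Finset.card_bij (fun h _ => h0 * h) ?_ ?_ ?_
      · intro h hh
        simp only [Finset.mem_filter, Finset.mem_univ, true_and] at hh ⊢
        refine ⟨H.mul_mem hh0 hh.1, ?_⟩
        calc h0 * h * x * (h0 * h)⁻¹ = h0 * (h * x * h⁻¹) * h0⁻¹ := by group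
          _ = _ := by rw [hh.2, e0]
      · intro a _ b _ e; exact mul_left_cancel e
      · intro h hh
        simp only [Finset.mem_filter, Finset.mem_univ, true_and] at hh
        refine ⟨h0⁻¹ * h, ?_, by group⟩
        simp only [Finset.mem_filter, Finset.mem_univ, true_and]
        refine ⟨H.mul_mem (H.inv_mem hh0) hh.1, ?_⟩
        calc h0⁻¹ * h * x * (h0⁻¹ * h)⁻¹ = h0⁻¹ * (h * x * h⁻¹) * h0 := by group
          _ = h0⁻¹ * (h0 * x * h0⁻¹) * h0 := by rw [hh.2, e0]
          _ = x := by group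
    omega
  · left
    push Not at hE
    rw [Finset.card_eq_zero.2 (Finset.filter_eq_empty_iff.2 (by rintro h _ ⟨h1, h2⟩; exact hE h h1 h2))]
    simp

theorem card_tor_mul {x : SL p} (hx : x ∈ H) (hxz : x ∉ Subgroup.center (SL p)) :
    #(tor H x) * nc H x + #(univ.filter fun h : SL p => h ∈ H) * zc H = #(univ.filter fun h : SL p => h ∈ H) * tc H x := by
  have ht : tc H x = zc H + #(univ.filter fun y : SL p => y ∈ H ∧ y ∉ Subgroup.center (SL p) ∧ y * x = x * y) := by
    rw [tc, zc, ← Finset.card_union_of_disjoint]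
    · congr 1
      ext y
      simp only [Finset.mem_filter, Finset.mem_univ, true_and, Finset.mem_union]
      constructor
      · rintro ⟨h1, h2⟩
        by_cases hy : y ∈ Subgroup.center (SL p)
        · exact Or.inl ⟨h1, hy⟩
        · exact Or.inr ⟨h1, hy, h2⟩
      · rintro (⟨h1, h2⟩ | ⟨h1, _, h2⟩)
        · exact ⟨h1, (Subgroup.mem_center_iff.1 h2 x).symm⟩
        · exact ⟨h1, h2⟩
    · rw [Finset.disjoint_left]
      intro h h1 h2
      simp only [Finset.mem_filter, Finset.mem_univ, true_and] at h1 h2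
      exact h2.2.1 h1.2
  obtain ⟨P, hP⟩ : ∃ P : Finset (SL p × SL p), P = (univ.filter fun h : SL p => h ∈ H) ×ˢ
      (univ.filter fun y : SL p => y ∈ H ∧ y ∉ Subgroup.center (SL p) ∧ y * x = x * y) := ⟨_, rfl⟩
  have hPc : #P = #(tor H x) * nc H x := by
    refine (Finset.card_eq_sum_card_fiberwise (f := fun q : SL p × SL p => q.1⁻¹ * q.2 * q.1) (t := tor H x) ?_).trans
      (Finset.sum_const_nat ?_)
    · intro q hq
      rw [hP, Finset.mem_coe] at hq
      simp only [Finset.mem_product, Finset.mem_filter, Finset.mem_univ, true_and] at hq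
      obtain ⟨h1, h2, h3, h4⟩ := hq
      rw [Finset.mem_coe]
      simp only [tor, Finset.mem_filter, Finset.mem_univ, true_and]
      refine ⟨H.mul_mem (H.mul_mem (H.inv_mem h1) h2) h1, ?_, q.1, h1, ?_⟩
      · have := conj_central_iff q.1⁻¹ q.2
        rw [inv_inv] at this
        rwa [this]
      · have e : q.1 * (q.1⁻¹ * q.2 * q.1) * q.1⁻¹ = q.2 := by group
        rw [e, h4]
    · intro w hw
      simp only [tor, Finset.mem_filter, Finset.mem_univ, true_and] at hw
      obtain ⟨hwH, hwz, h0, hh0, hc⟩ := hw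
      rw [nc]
      have hcy : h0 * w * h0⁻¹ ∉ Subgroup.center (SL p) := by rwa [conj_central_iff]
      have hiff : ∀ g : SL p, (g * (h0 * w * h0⁻¹) * g⁻¹) * x = x * (g * (h0 * w * h0⁻¹) * g⁻¹) ↔
          (g * x * g⁻¹) * x = x * (g * x * g⁻¹) := by
        intro g
        have a1 := comm_iff_of_comm (x := g * x * g⁻¹) (y := g * (h0 * w * h0⁻¹) * g⁻¹) (by rwa [conj_central_iff])
          (by rwa [conj_central_iff]) ((conj_comm_iff _ _ _).2 hc.symm) x
        constructor
        · intro h; exact (a1.2 h.symm).symm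
        · intro h; exact (a1.1 h.symm).symm
      refine Finset.card_bij (fun q _ => q.1 * h0⁻¹) ?_ ?_ ?_
      · intro q hq
        rw [hP] at hq
        simp only [Finset.mem_product, Finset.mem_filter, Finset.mem_univ, true_and] at hq ⊢
        obtain ⟨⟨h1, h2, h3, h4⟩, h5⟩ := hq
        refine ⟨H.mul_mem h1 (H.inv_mem hh0), ?_⟩
        rw [← hiff]
        have e : q.1 * h0⁻¹ * (h0 * w * h0⁻¹) * (q.1 * h0⁻¹)⁻¹ = q.2 := by rw [← h5]; group
        rw [e, h4]
      · intro a ha b hb e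
        simp only [hP, Finset.mem_product, Finset.mem_filter, Finset.mem_univ, true_and] at ha hb
        have e1 : a.1 = b.1 := mul_right_cancel e
        have e2 := ha.2.trans hb.2.symm
        rw [e1] at e2
        exact Prod.ext e1 (mul_left_cancel (mul_right_cancel e2))
      · intro g hg
        simp only [Finset.mem_filter, Finset.mem_univ, true_and] at hg
        refine ⟨(g * h0, g * (h0 * w * h0⁻¹) * g⁻¹), ?_, by simp⟩
        simp only [hP, Finset.mem_product, Finset.mem_filter, Finset.mem_univ, true_and]
        refine ⟨⟨H.mul_mem hg.1 hh0, ?_, by rwa [conj_central_iff], (hiff g).2 hg.2⟩, by group⟩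
        exact H.mul_mem (H.mul_mem hg.1 (H.mul_mem (H.mul_mem hh0 hwH) (H.inv_mem hh0))) (H.inv_mem hg.1)
  rw [← hPc, hP, Finset.card_product, ht]
  ring

theorem tor_disjoint {x w : SL p} (hx : x ∉ Subgroup.center (SL p)) (hw : w ∈ H) (hwz : w ∉ Subgroup.center (SL p)) (hn : w ∉ tor H x) :
    Disjoint (tor H x) (tor H w) := by
  rw [Finset.disjoint_left]
  intro v hv hv'
  apply hn
  simp only [tor, Finset.mem_filter, Finset.mem_univ, true_and] at hv hv' ⊢
  obtain ⟨hvH, hvz, h, hh, hc⟩ := hv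
  obtain ⟨-, -, k, hk, hd⟩ := hv'
  refine ⟨hw, hwz, h * k⁻¹, H.mul_mem hh (H.inv_mem hk), ?_⟩
  have e1 := (conj_comm_iff (h * k⁻¹) _ _).2 hd
  have e : h * k⁻¹ * (k * v * k⁻¹) * (h * k⁻¹)⁻¹ = h * v * h⁻¹ := by group
  rw [e] at e1
  exact ((comm_iff_of_comm hx (by rwa [conj_central_iff]) hc.symm _).2 e1.symm)

theorem mem_tor_self {x : SL p} (hx : x ∈ H) (hxz : x ∉ Subgroup.center (SL p)) : x ∈ tor H x := by
  simp only [tor, Finset.mem_filter, Finset.mem_univ, true_and]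
  exact ⟨hx, hxz, 1, H.one_mem, by simp⟩

theorem filter_card_eq (K : Subgroup (SL p)) : #(univ.filter fun h : SL p => h ∈ K) = Nat.card K := by
  rw [Nat.card_eq_fintype_card, Fintype.card_subtype]

theorem tc_eq (x : SL p) : tc H x = Nat.card (H ⊓ Subgroup.centralizer {x} : Subgroup (SL p)) := by
  rw [← filter_card_eq, tc]
  congr 1
  ext y
  simp only [Finset.mem_filter, Finset.mem_univ, true_and, Subgroup.mem_inf, mem_cent]

theorem zc_eq : zc H = Nat.card (H ⊓ Subgroup.center (SL p) : Subgroup (SL p)) := by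
  rw [← filter_card_eq, zc]
  congr 1
  ext y
  simp only [Finset.mem_filter, Finset.mem_univ, true_and, Subgroup.mem_inf]

theorem zc_dvd_tc (x : SL p) : zc H ∣ tc H x := by
  rw [tc_eq, zc_eq]
  refine Subgroup.card_dvd_of_le (inf_le_inf_left _ ?_)
  intro y hy
  rw [mem_cent]
  exact (Subgroup.mem_center_iff.1 hy x).symm

theorem zc_pos : 1 ≤ zc H := by rw [zc_eq]; exact Nat.card_pos

theorem zc_le : zc H ≤ 2 := by
  refine le_trans (Finset.card_le_card ?_) (card_center (p := p))
  intro y hy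
  simp only [Finset.mem_filter, Finset.mem_univ, true_and] at hy ⊢
  exact hy.2

theorem tor_slot (hp : p ≠ 2) (hss : ∀ x ∈ H, x ∉ Subgroup.center (SL p) → tr x ^ 2 ≠ 4) {x : SL p} (hx : x ∈ H)
    (hxz : x ∉ Subgroup.center (SL p)) :
    ∃ u, tc H x = zc H * u ∧ Slot (Nat.card H) #(tor H x) u := by
  obtain ⟨u, hu⟩ := zc_dvd_tc (H := H) x
  refine ⟨u, hu, Or.inr ?_⟩
  have hz := zc_pos (H := H)
  have hlt : zc H < tc H x := by
    rw [zc, tc]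
    refine Finset.card_lt_card ?_
    rw [Finset.ssubset_iff_of_subset]
    · exact ⟨x, by simp [hx], by simp [hxz]⟩
    · intro y hy
      simp only [Finset.mem_filter, Finset.mem_univ, true_and] at hy ⊢
      exact ⟨hy.1, (Subgroup.mem_center_iff.1 hy.2 x).symm⟩
  have hu2 : 2 ≤ u := by
    rw [hu] at hlt
    by_contra hc
    have : u ≤ 1 := by omega
    nlinarith
  have key := card_tor_mul hx hxz
  rw [filter_card_eq] at key
  obtain ⟨v, rfl⟩ := Nat.exists_eq_add_of_le hu2
  rw [show 2 + v - 1 = v + 1 by omega]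
  refine ⟨hu2, ?_⟩
  rcases nc_eq hp hss hx hxz with h | h
  · left
    rw [h, hu] at key
    refine Nat.eq_of_mul_eq_mul_left hz ?_
    nlinarith
  · right
    rw [h, hu] at key
    refine Nat.eq_of_mul_eq_mul_left hz ?_
    nlinarith

theorem semisimple_case (hp : p ≠ 2) (hss : ∀ x ∈ H, x ∉ Subgroup.center (SL p) → tr x ^ 2 ≠ 4) :
    Nat.card H ≤ 240 ∨ ∃ x ∈ H, x ∉ Subgroup.center (SL p) ∧ Nat.card H ≤ 2 * tc H x := by
  obtain ⟨NZ, hNZ⟩ : ∃ NZ : Finset (SL p), ∀ x, x ∈ NZ ↔ x ∈ H ∧ x ∉ Subgroup.center (SL p) :=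
    ⟨univ.filter fun x => x ∈ H ∧ x ∉ Subgroup.center (SL p), by simp⟩
  have hn : #NZ + zc H = Nat.card H := by
    rw [← filter_card_eq, zc, ← Finset.card_union_of_disjoint]
    · congr 1
      ext y
      simp only [Finset.mem_filter, Finset.mem_univ, true_and, Finset.mem_union, hNZ]
      tauto
    · rw [Finset.disjoint_left]
      intro h h1 h2
      simp only [Finset.mem_filter, Finset.mem_univ, true_and, hNZ] at h1 h2
      exact h1.2 h2.2
  have hsub : ∀ x, tor H x ⊆ NZ := by
    intro x w hw
    simp only [tor, Finset.mem_filter, Finset.mem_univ, true_and] at hw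
    exact (hNZ w).2 ⟨hw.1, hw.2.1⟩
  have hz := zc_pos (H := H)
  have hz2 := zc_le (H := H)
  have h0 : Slot (Nat.card H) 0 0 := Or.inl rfl
  have hquarter : ∀ {e u}, Slot (Nat.card H) e u → e ≠ 0 → Nat.card H ≤ 4 * e := by
    intro e u h he
    have := h.size
    omega
  have hne0 : ∀ {x}, x ∈ NZ → #(tor H x) ≠ 0 := fun {x} hx =>
    (Finset.card_pos.2 ⟨x, mem_tor_self ((hNZ x).1 hx).1 ((hNZ x).1 hx).2⟩).ne'
  have fin : ∀ {e f g u v w : ℕ}, Slot (Nat.card H) e u → Slot (Nat.card H) f v → Slot (Nat.card H) g w →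
      e + f + g = #NZ → Nat.card H ≤ 240 ∨ (e ≠ 0 ∧ Nat.card H ≤ 2 * (zc H * u)) ∨
        (f ≠ 0 ∧ Nat.card H ≤ 2 * (zc H * v)) ∨ (g ≠ 0 ∧ Nat.card H ≤ 2 * (zc H * w)) := by
    intro e f g u v w he hf hg hs
    rcases slots_conclusion hz he hf hg (by omega) with h | h
    · left; omega
    · right; exact h
  by_cases c1 : ∃ x1, x1 ∈ NZ
  swap
  · push Not at c1
    rw [Finset.eq_empty_of_forall_notMem c1] at hn
    left
    rw [Finset.card_empty] at hn
    omega
  obtain ⟨x1, hx1⟩ := c1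
  obtain ⟨a1, b1⟩ := (hNZ x1).1 hx1
  obtain ⟨u1, e1, s1⟩ := tor_slot hp hss a1 b1
  by_cases c2 : ∃ x2, x2 ∈ NZ \ tor H x1
  swap
  · push Not at c2
    have hs : NZ ⊆ tor H x1 := Finset.sdiff_eq_empty_iff_subset.1 (Finset.eq_empty_of_forall_notMem c2)
    have hs' := Finset.Subset.antisymm hs (hsub x1)
    rcases fin s1 h0 h0 (by rw [hs']; rfl) with h | h | h | h
    · exact Or.inl h
    · exact Or.inr ⟨x1, a1, b1, by rw [e1]; exact h.2⟩
    · exact absurd rfl h.1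
    · exact absurd rfl h.1
  obtain ⟨x2, hx2⟩ := c2
  rw [Finset.mem_sdiff] at hx2
  obtain ⟨a2, b2⟩ := (hNZ x2).1 hx2.1
  obtain ⟨u2, e2, s2⟩ := tor_slot hp hss a2 b2
  have d12 := tor_disjoint b1 a2 b2 hx2.2
  by_cases c3 : ∃ x3, x3 ∈ NZ \ (tor H x1 ∪ tor H x2)
  swap
  · push Not at c3
    have hs : NZ ⊆ tor H x1 ∪ tor H x2 := Finset.sdiff_eq_empty_iff_subset.1 (Finset.eq_empty_of_forall_notMem c3)
    have hs' := Finset.Subset.antisymm hs (Finset.union_subset (hsub x1) (hsub x2))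
    rcases fin s1 s2 h0 (by rw [hs', Finset.card_union_of_disjoint d12]; rfl) with h | h | h | h
    · exact Or.inl h
    · exact Or.inr ⟨x1, a1, b1, by rw [e1]; exact h.2⟩
    · exact Or.inr ⟨x2, a2, b2, by rw [e2]; exact h.2⟩
    · exact absurd rfl h.1
  obtain ⟨x3, hx3⟩ := c3
  rw [Finset.mem_sdiff, Finset.mem_union, not_or] at hx3
  obtain ⟨a3, b3⟩ := (hNZ x3).1 hx3.1
  obtain ⟨u3, e3, s3⟩ := tor_slot hp hss a3 b3
  have d13 := tor_disjoint b1 a3 b3 hx3.2.1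
  have d23 := tor_disjoint b2 a3 b3 hx3.2.2
  have d123 : Disjoint (tor H x1 ∪ tor H x2) (tor H x3) := Finset.disjoint_union_left.2 ⟨d13, d23⟩
  have hc123 : #(tor H x1 ∪ tor H x2 ∪ tor H x3) = #(tor H x1) + #(tor H x2) + #(tor H x3) := by
    rw [Finset.card_union_of_disjoint d123, Finset.card_union_of_disjoint d12]
  have hs123 := Finset.union_subset (Finset.union_subset (hsub x1) (hsub x2)) (hsub x3)
  have q1 := hquarter s1 (hne0 hx1)
  have q2 := hquarter s2 (hne0 hx2.1)
  have q3 := hquarter s3 (hne0 hx3.1)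
  by_cases c4 : ∃ x4, x4 ∈ NZ \ (tor H x1 ∪ tor H x2 ∪ tor H x3)
  swap
  · push Not at c4
    have hs : NZ ⊆ tor H x1 ∪ tor H x2 ∪ tor H x3 :=
      Finset.sdiff_eq_empty_iff_subset.1 (Finset.eq_empty_of_forall_notMem c4)
    have hs' := Finset.Subset.antisymm hs hs123
    rcases fin s1 s2 s3 (by rw [hs', hc123]) with h | h | h | h
    · exact Or.inl h
    · exact Or.inr ⟨x1, a1, b1, by rw [e1]; exact h.2⟩
    · exact Or.inr ⟨x2, a2, b2, by rw [e2]; exact h.2⟩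
    · exact Or.inr ⟨x3, a3, b3, by rw [e3]; exact h.2⟩
  obtain ⟨x4, hx4⟩ := c4
  rw [Finset.mem_sdiff, Finset.mem_union, Finset.mem_union, not_or, not_or] at hx4
  obtain ⟨a4, b4⟩ := (hNZ x4).1 hx4.1
  obtain ⟨u4, e4, s4⟩ := tor_slot hp hss a4 b4
  have d4 : Disjoint (tor H x1 ∪ tor H x2 ∪ tor H x3) (tor H x4) :=
    Finset.disjoint_union_left.2 ⟨Finset.disjoint_union_left.2 ⟨tor_disjoint b1 a4 b4 hx4.2.1.1,
      tor_disjoint b2 a4 b4 hx4.2.1.2⟩, tor_disjoint b3 a4 b4 hx4.2.2⟩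
  have q4 := hquarter s4 (hne0 hx4.1)
  have := Finset.card_le_card (Finset.union_subset hs123 (hsub x4))
  rw [Finset.card_union_of_disjoint d4, hc123] at this
  omega

end ClassEq

section Metabelian

/-- The second derived subgroup of `L` is trivial, in elementwise form. -/
def Metab {G : Type*} [Group G] (L : Subgroup G) : Prop :=
  ∀ x ∈ L, ∀ y ∈ L, ∀ z ∈ L, ∀ t ∈ L, ⁅⁅x, y⁆, ⁅z, t⁆⁆ = 1

theorem Metab.bot {G : Type*} [Group G] : Metab (⊥ : Subgroup G) := by
  intro x hx y hy z hz t ht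
  rw [Subgroup.mem_bot] at hx hz
  subst hx; subst hz
  simp

theorem Metab.of_comm {G : Type*} [Group G] {L : Subgroup G} (h : ∀ x ∈ L, ∀ y ∈ L, x * y = y * x) : Metab L := by
  intro x hx y hy z hz t ht
  rw [commutatorElement_eq_one_iff_mul_comm.2 (h x hx y hy)]
  simp

variable {p : ℕ} [Fact p.Prime]

theorem conj_lower_zero {v : SL p} (ht : tr v = 2) : ∃ g : SL p, (g * v * g⁻¹).1 1 0 = 0 := by
  by_cases h : v.1 1 0 = 0
  · exact ⟨1, by simpa using h⟩
  · refine ⟨ww * uu ((1 - v.1 0 0) / v.1 1 0), ?_⟩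
    have hd := sl_det v
    rw [tr] at ht
    have e : ∀ s : ZMod p, (ww * uu s * v * (ww * uu s)⁻¹ : SL p).1 1 0 =
        -(v.1 0 1 + s * v.1 1 1 - s * (v.1 0 0 + s * v.1 1 0)) := by
      intro s
      have : (ww * uu s * v * (ww * uu s)⁻¹ : SL p) = ww * (uu s * v * uu (-s)) * ww⁻¹ := by
        have : (uu (-s) : SL p) = (uu s)⁻¹ := by
          rw [eq_inv_iff_mul_eq_one, ← uu_add, neg_add_cancel, uu_zero]
        rw [this]; group
      rw [this]
      simp [mul_00, mul_01, mul_10, mul_11, uu_val, ww_val, Matrix.adjugate_fin_two]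
      ring
    rw [e]
    have h1 : v.1 1 1 = 2 - v.1 0 0 := by linear_combination ht
    rw [h1] at hd ⊢
    field_simp
    linear_combination hd

theorem eq_uu_of_tr {v : SL p} (ht : tr v = 2) (h : v.1 1 0 = 0) : v = uu (v.1 0 1) := by
  have hd := sl_det v
  rw [tr] at ht
  have h1 : v.1 1 1 = 2 - v.1 0 0 := by linear_combination ht
  rw [h, h1] at hd
  have h0 : v.1 0 0 = 1 := by
    have : (v.1 0 0 - 1) ^ 2 = 0 := by linear_combination -hd
    have := pow_eq_zero_iff (two_ne_zero) |>.1 this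
    linear_combination this
  refine sl_ext ?_ ?_ ?_ ?_ <;> simp [uu_val, h, h1, h0]
  norm_num

theorem ll_add (s t : ZMod p) : (ll (s + t) : SL p) = ll s * ll t := by
  refine sl_ext ?_ ?_ ?_ ?_ <;> simp [mul_00, mul_01, mul_10, mul_11, ll_val]

theorem all_mem_of_add (P : ZMod p → Prop) (h0 : P 0) (hadd : ∀ s t, P s → P t → P (s + t)) {c : ZMod p} (hc : c ≠ 0)
    (h : P c) (t : ZMod p) : P t := by
  have key : ∀ n : ℕ, P (n * c) := by
    intro n
    induction n with
    | zero => simpa using h0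
    | succ k ih =>
      have := hadd _ _ ih h
      push_cast
      convert this using 1
      ring
  have := key (t / c).val
  rw [ZMod.natCast_val, ZMod.cast_id] at this
  rwa [div_mul_cancel₀ _ hc] at this

theorem upper_comm {x y : SL p} (hx : x.1 1 0 = 0) (hy : y.1 1 0 = 0) : ∃ c, ⁅x, y⁆ = uu c := by
  have dx := sl_det x
  have dy := sl_det y
  rw [hx] at dx
  rw [hy] at dy
  have h10 : (⁅x, y⁆ : SL p).1 1 0 = 0 := by
    rw [commutatorElement_def]
    simp [mul_00, mul_01, mul_10, mul_11, Matrix.adjugate_fin_two, hx, hy]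
  refine ⟨_, eq_uu_of_tr ?_ h10⟩
  rw [tr, commutatorElement_def]
  simp [mul_00, mul_01, mul_10, mul_11, Matrix.adjugate_fin_two, hx, hy]
  have e1 : x.1 0 0 * x.1 1 1 = 1 := by linear_combination dx
  have e2 : y.1 0 0 * y.1 1 1 = 1 := by linear_combination dy
  linear_combination (2 * y.1 0 0 * y.1 1 1) * e1 + 2 * e2

theorem unipotent_case (hp : p ≠ 2) {H : Subgroup (SL p)} (hH : H ≠ ⊤) {x : SL p} (hx : x ∈ H)
    (hxz : x ∉ Subgroup.center (SL p)) (ht : tr x ^ 2 = 4) : Metab H := by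
  have h2 := two_ne_zero_zmod hp
  have htx : tr (x * x) = 2 := by
    have hd := sl_det x
    rw [tr] at ht ⊢
    rw [mul_00, mul_11]
    linear_combination ht - 2 * hd
  obtain ⟨g, hg⟩ := conj_lower_zero htx
  have hu := eq_uu_of_tr (by rw [tr_conj]; exact htx) hg
  obtain ⟨c, hc⟩ : ∃ c, c = (g * (x * x) * g⁻¹).1 0 1 := ⟨_, rfl⟩
  rw [← hc] at hu
  have hc0 : c ≠ 0 := by
    rintro h0
    rw [h0, uu_zero] at hu
    have hxx : x * x = 1 := by
      have := congrArg (fun z => g⁻¹ * z * g) hu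
      have e : g⁻¹ * (g * (x * x) * g⁻¹) * g = x * x := by group
      rw [e] at this
      rw [this]; group
    apply hxz
    rw [mem_center_iff']
    have hd := sl_det x
    have ht0 : x.1 0 0 + x.1 1 1 ≠ 0 := by
      intro h
      rw [tr, h] at ht
      have : (2:ZMod p) * 2 = 0 := by linear_combination -ht
      rcases mul_eq_zero.1 this with h | h <;> exact h2 h
    have e00 := congrArg (fun m : SL p => m.1 0 0) hxx
    have e01 := congrArg (fun m : SL p => m.1 0 1) hxx
    have e10 := congrArg (fun m : SL p => m.1 1 0) hxx
    have e11 := congrArg (fun m : SL p => m.1 1 1) hxx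
    simp only [mul_00, mul_01, mul_10, mul_11] at e00 e01 e10 e11
    simp at e00 e01 e10 e11
    have f01 : x.1 0 1 * (x.1 0 0 + x.1 1 1) = 0 := by linear_combination e01
    have f10 : x.1 1 0 * (x.1 0 0 + x.1 1 1) = 0 := by linear_combination e10
    have fd : (x.1 0 0 - x.1 1 1) * (x.1 0 0 + x.1 1 1) = 0 := by linear_combination e00 - e11
    have g01 := (mul_eq_zero.1 f01).resolve_right ht0
    have g10 := (mul_eq_zero.1 f10).resolve_right ht0
    have gd := (mul_eq_zero.1 fd).resolve_right ht0
    exact ⟨g01, g10, by linear_combination gd⟩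
  obtain ⟨H', hH'⟩ : ∃ H' : Subgroup (SL p), ∀ y, y ∈ H' ↔ g⁻¹ * y * g ∈ H :=
    ⟨H.comap (MulAut.conj g⁻¹).toMonoidHom, fun y => by simp [Subgroup.mem_comap]⟩
  have huH : ∀ t, uu t ∈ H' := by
    refine all_mem_of_add (fun t => uu t ∈ H') ?_ ?_ hc0 ?_
    · simp only [uu_zero]; exact H'.one_mem
    · intro s t hs ht
      simp only [uu_add]; exact H'.mul_mem hs ht
    · rw [← hu, hH']
      have e : g⁻¹ * (g * (x * x) * g⁻¹) * g = x * x := by group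
      rw [e]
      exact H.mul_mem hx hx
  have hup : ∀ h ∈ H', h.1 1 0 = 0 := by
    intro h hh
    by_contra h0
    have hl : ll (h.1 1 0) ∈ H' := by
      rw [sl_decomp h h0] at hh
      exact (H'.mul_mem_cancel_left (huH _)).1 ((H'.mul_mem_cancel_right (huH _)).1 hh)
    have hlH : ∀ t, ll t ∈ H' := by
      refine all_mem_of_add (fun t => ll t ∈ H') ?_ ?_ h0 hl
      · have : (ll 0 : SL p) = 1 := by
          refine sl_ext ?_ ?_ ?_ ?_ <;> simp [ll_val]
        simp only [this]; exact H'.one_mem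
      · intro s t hs ht
        simp only [ll_add]; exact H'.mul_mem hs ht
    have htop := sl_gen H' huH hlH
    apply hH
    rw [Subgroup.eq_top_iff']
    intro y
    have := (hH' (g * y * g⁻¹)).1 (htop ▸ Subgroup.mem_top _)
    have e : g⁻¹ * (g * y * g⁻¹) * g = y := by group
    rwa [e] at this
  have hcj : ∀ y ∈ H, (g * y * g⁻¹).1 1 0 = 0 := by
    intro y hy
    apply hup
    rw [hH']
    have e : g⁻¹ * (g * y * g⁻¹) * g = y := by group
    rwa [e]
  intro a ha b hb d hd e he
  obtain ⟨s, hs⟩ := upper_comm (hcj a ha) (hcj b hb)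
  obtain ⟨t, ht⟩ := upper_comm (hcj d hd) (hcj e he)
  have h1 : g * ⁅⁅a, b⁆, ⁅d, e⁆⁆ * g⁻¹ = 1 := by
    have : g * ⁅⁅a, b⁆, ⁅d, e⁆⁆ * g⁻¹ = ⁅⁅g * a * g⁻¹, g * b * g⁻¹⁆, ⁅g * d * g⁻¹, g * e * g⁻¹⁆⁆ := by
      simp only [commutatorElement_def]; group
    rw [this, hs, ht, commutatorElement_eq_one_iff_mul_comm, ← uu_add, ← uu_add, add_comm]
  have := congrArg (fun z => g⁻¹ * z * g) h1
  have e1 : g⁻¹ * (g * ⁅⁅a, b⁆, ⁅d, e⁆⁆ * g⁻¹) * g = ⁅⁅a, b⁆, ⁅d, e⁆⁆ := by group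
  rw [e1] at this
  rw [this]; group

theorem metab_centralizer {H : Subgroup (SL p)} {x : SL p} (hxz : x ∉ Subgroup.center (SL p)) :
    Metab (H ⊓ Subgroup.centralizer {x}) :=
  Metab.of_comm fun _ ha _ hb => centralizer_comm hxz (mem_cent.1 ha.2) (mem_cent.1 hb.2)

/-- A weak form of Dickson's theorem: proper subgroups of `SL₂(𝔽_p)` are metabelian up to bounded index. -/
theorem exists_metab (hp : p ≠ 2) {H : Subgroup (SL p)} (hH : H ≠ ⊤) :
    ∃ L ≤ H, Metab L ∧ Nat.card H ≤ 240 * Nat.card L := by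
  by_cases h : ∃ x ∈ H, x ∉ Subgroup.center (SL p) ∧ tr x ^ 2 = 4
  · obtain ⟨x, hx, hxz, ht⟩ := h
    exact ⟨H, le_rfl, unipotent_case hp hH hx hxz ht, by omega⟩
  · push Not at h
    rcases semisimple_case (H := H) hp h with h1 | ⟨x, hx, hxz, h1⟩
    · exact ⟨⊥, bot_le, Metab.bot, by simpa using h1⟩
    · refine ⟨H ⊓ Subgroup.centralizer {x}, inf_le_left, metab_centralizer hxz, ?_⟩
      rw [tc_eq] at h1
      omega

/-- Mass of a coset of `H` in terms of the masses of cosets of a subgroup of bounded index. -/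
theorem coset_mass_le {G : Type*} [Group G] [Fintype G] {L H : Subgroup G} (hLH : L ≤ H) {N : ℕ}
    (hc : Nat.card H ≤ N * Nat.card L) {β : G → ℝ} (h0 : ∀ x, 0 ≤ β x) {b : ℝ}
    (hb : ∀ a, ∑ x with a⁻¹ * x ∈ L, β x ≤ b) (a : G) : ∑ x with a⁻¹ * x ∈ H, β x ≤ N * b := by
  have hb0 : 0 ≤ b := (Finset.sum_nonneg fun x _ => h0 x).trans (hb 1)
  have cardf : ∀ K : Subgroup G, ((#(univ.filter fun h : G => h ∈ K) : ℕ) : ℝ) = Nat.card K := by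
    intro K
    rw [Nat.card_eq_fintype_card, Fintype.card_subtype]
  have key : ∑ h with h ∈ H, ∑ x with (a * h)⁻¹ * x ∈ L, β x =
      (Nat.card L : ℝ) * ∑ x with a⁻¹ * x ∈ H, β x := by
    simp only [Finset.sum_filter]
    rw [Finset.mul_sum]
    have : ∀ h : G, (if h ∈ H then ∑ x, (if (a * h)⁻¹ * x ∈ L then β x else 0) else 0) =
        ∑ x, (if h ∈ H ∧ (a * h)⁻¹ * x ∈ L then β x else 0) := by
      intro h
      by_cases hh : h ∈ H <;> simp [hh]
    simp only [this]
    rw [Finset.sum_comm]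
    refine Finset.sum_congr rfl fun x _ => ?_
    by_cases hx : a⁻¹ * x ∈ H
    · rw [if_pos hx, ← Finset.sum_filter, Finset.sum_const, nsmul_eq_mul]
      congr 1
      rw [← cardf L]
      norm_cast
      refine Finset.card_bij (fun h _ => h⁻¹ * (a⁻¹ * x)) ?_ ?_ ?_
      · intro h hh
        simp only [Finset.mem_filter, Finset.mem_univ, true_and] at hh ⊢
        have := hh.2
        rwa [mul_inv_rev, mul_assoc] at this
      · intro h _ h' _ e
        exact inv_injective (mul_right_cancel e)
      · intro l hl
        simp only [Finset.mem_filter, Finset.mem_univ, true_and] at hl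
        refine ⟨a⁻¹ * x * l⁻¹, ?_, by group⟩
        simp only [Finset.mem_filter, Finset.mem_univ, true_and]
        refine ⟨H.mul_mem hx (H.inv_mem (hLH hl)), ?_⟩
        have e : (a * (a⁻¹ * x * l⁻¹))⁻¹ * x = l := by group
        rwa [e]
    · rw [if_neg hx, mul_zero]
      refine Finset.sum_eq_zero fun h _ => ?_
      rw [if_neg]
      rintro ⟨h1, h2⟩
      apply hx
      have e : a⁻¹ * x = h * ((a * h)⁻¹ * x) := by group
      rw [e]
      exact H.mul_mem h1 (hLH h2)
  have hle : ∑ h with h ∈ H, ∑ x with (a * h)⁻¹ * x ∈ L, β x ≤ (Nat.card H : ℝ) * b := by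
    rw [← cardf H, ← nsmul_eq_mul]
    exact Finset.sum_le_card_nsmul _ _ _ fun h _ => hb _
  have hL : (0:ℝ) < Nat.card L := by exact_mod_cast Nat.card_pos
  rw [key] at hle
  have hc' : (Nat.card H : ℝ) ≤ N * Nat.card L := by exact_mod_cast hc
  have := hle.trans (mul_le_mul_of_nonneg_right hc' hb0)
  refine le_of_mul_le_mul_left ?_ hL
  linarith

end Metabelian

section NoSurjection

theorem exists_sq_ne_one {q : ℕ} [Fact q.Prime] (hq : 5 ≤ q) : ∃ a : ZMod q, a ≠ 0 ∧ a ^ 2 ≠ 1 := by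
  have hk : ∀ k : ℕ, 0 < k → k < 5 → ((k : ℕ) : ZMod q) ≠ 0 := by
    intro k h0 h5 h
    rw [ZMod.natCast_eq_zero_iff] at h
    exact absurd (Nat.le_of_dvd h0 h) (by omega)
  refine ⟨2, ?_, fun h => ?_⟩
  · exact_mod_cast hk 2 (by norm_num) (by norm_num)
  · apply hk 3 (by norm_num) (by norm_num)
    push_cast
    linear_combination h

theorem psl_simple {q : ℕ} [Fact q.Prime] (hq : 5 ≤ q) :
    IsSimpleGroup (SL q ⧸ Subgroup.center (SL q)) := by
  have := Matrix.ProjectiveSpecialLinearGroup.rank_two_simple' (exists_sq_ne_one hq)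
  convert this

theorem psl_center {q : ℕ} [Fact q.Prime] (hq : 5 ≤ q) :
    Subgroup.center (SL q ⧸ Subgroup.center (SL q)) = ⊥ := by
  have hs := psl_simple hq
  rcases IsSimpleGroup.eq_bot_or_eq_top_of_normal (Subgroup.center (SL q ⧸ Subgroup.center (SL q))) inferInstance with h | h
  · exact h
  · exfalso
    have h1 := (commutator_eq_bot_iff_center_eq_top _).2 h
    have h2 : commutator (SL q ⧸ Subgroup.center (SL q)) = ⊤ := by
      have := SL2Simple.PSL_commutator_eq_top (exists_sq_ne_one hq)
      convert this
    rw [h2] at h1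
    exact top_ne_bot h1

theorem neg_one_mem_center {q : ℕ} [Fact q.Prime] : (dd (-1) : SL q) ∈ Subgroup.center (SL q) := by
  rw [mem_center_iff']
  simp [dd_val]

theorem neg_one_ne_one {q : ℕ} [Fact q.Prime] (hq : q ≠ 2) : (1 : SL q) ≠ dd (-1) := by
  intro h
  have h3 : (1 : SL q).1 0 0 = (dd (-1) : SL q).1 0 0 := congrArg (fun m : SL q => m.1 0 0) h
  rw [dd_val] at h3
  simp at h3
  apply two_ne_zero_zmod hq
  linear_combination h3

theorem card_center_eq {q : ℕ} [Fact q.Prime] (hq : 5 ≤ q) : Nat.card (Subgroup.center (SL q)) = 2 := by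
  have hne := neg_one_ne_one (q := q) (by omega)
  have hz := filter_card_eq (Subgroup.center (SL q))
  have h2 := (card_center (p := q))
  refine le_antisymm ?_ ?_
  · rw [← hz]
    refine le_trans (Finset.card_le_card fun x hx => ?_) h2
    simp only [Finset.mem_filter] at hx ⊢
    exact hx
  rw [← hz]
  refine (Finset.card_pair hne).symm.le.trans (Finset.card_le_card fun x hx => ?_)
  simp only [Finset.mem_filter]
  refine ⟨Finset.mem_univ _, ?_⟩
  rw [Finset.mem_insert, Finset.mem_singleton] at hx
  rcases hx with h | h
  · rw [h]; exact Subgroup.one_mem _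
  · rw [h]; exact neg_one_mem_center

theorem sl_card_inj {s q : ℕ} [Fact s.Prime] [Fact q.Prime] (h : Nat.card (SL s) = Nat.card (SL q)) : s = q := by
  have h1 := card_sl_add (p := s)
  have h2 := card_sl_add (p := q)
  rw [Nat.card_eq_fintype_card, Nat.card_eq_fintype_card] at h
  have s2 := (Fact.out : s.Prime).two_le
  have q2 := (Fact.out : q.Prime).two_le
  rw [h] at h1
  have key : s ^ 3 + q = q ^ 3 + s := by omega
  rcases lt_trichotomy s q with hl | hl | hl
  · exfalso
    obtain ⟨d, rfl⟩ := Nat.exists_eq_add_of_lt hl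
    ring_nf at key
    nlinarith [mul_pos (by omega : 0 < s) (by omega : 0 < s)]
  · exact hl
  · exfalso
    obtain ⟨d, rfl⟩ := Nat.exists_eq_add_of_lt hl
    ring_nf at key
    nlinarith [mul_pos (by omega : 0 < q) (by omega : 0 < q)]

theorem psl_eq_of_surjective {s q : ℕ} [Fact s.Prime] [Fact q.Prime] (hs : 5 ≤ s) (hq : 5 ≤ q)
    (f : SL s →* SL q ⧸ Subgroup.center (SL q)) (hf : Function.Surjective f) : s = q := by
  have ss := psl_simple hs
  have cq := psl_center hq
  have sq := psl_simple hq
  have hz : ∀ z ∈ Subgroup.center (SL s), f z = 1 := by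
    intro z hz
    have : f z ∈ Subgroup.center (SL q ⧸ Subgroup.center (SL q)) := by
      rw [Subgroup.mem_center_iff]
      intro y
      obtain ⟨x, rfl⟩ := hf y
      rw [← map_mul, ← map_mul, Subgroup.mem_center_iff.1 hz x]
    rwa [cq, Subgroup.mem_bot] at this
  have hker : f.ker = Subgroup.center (SL s) := by
    refine le_antisymm ?_ fun z h => hz z h
    have hn : (f.ker.map (QuotientGroup.mk' (Subgroup.center (SL s)))).Normal :=
      Subgroup.Normal.map inferInstance _ (QuotientGroup.mk'_surjective _)
    rcases IsSimpleGroup.eq_bot_or_eq_top_of_normal _ hn with h | h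
    · rw [Subgroup.map_eq_bot_iff, QuotientGroup.ker_mk'] at h
      exact h
    · exfalso
      have htriv : ∀ g, f g = 1 := by
        intro g
        have : QuotientGroup.mk' (Subgroup.center (SL s)) g ∈ f.ker.map (QuotientGroup.mk' (Subgroup.center (SL s))) := by
          rw [h]; exact Subgroup.mem_top _
        obtain ⟨n, hn, e⟩ := this
        rw [QuotientGroup.mk'_apply, QuotientGroup.mk'_apply, QuotientGroup.eq] at e
        have := hz _ e
        rw [map_mul, map_inv, MonoidHom.mem_ker.1 hn] at this
        simpa using this
      obtain ⟨y, hy⟩ := exists_ne (1 : SL q ⧸ Subgroup.center (SL q))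
      obtain ⟨x, rfl⟩ := hf y
      exact hy (htriv x)
  apply sl_card_inj
  rw [Subgroup.card_eq_card_quotient_mul_card_subgroup (Subgroup.center (SL s)),
    Subgroup.card_eq_card_quotient_mul_card_subgroup (Subgroup.center (SL q)), card_center_eq hs,
    card_center_eq hq, ← Nat.card_congr (QuotientGroup.quotientKerEquivOfSurjective f hf).toEquiv, hker]

theorem exists_index_of_surjective {ι : Type*} [Fintype ι] [DecidableEq ι] {p : ι → ℕ} [∀ i, Fact (p i).Prime]
    {q : ℕ} [Fact q.Prime] (hq : 5 ≤ q) (f : Gp p →* SL q ⧸ Subgroup.center (SL q)) (hf : Function.Surjective f)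
    (hp : ∀ i, (∃ x : SL (p i), f (Pi.mulSingle i x : Gp p) ≠ 1) → 5 ≤ p i) :
    ∃ i, (∃ x : SL (p i), f (Pi.mulSingle i x : Gp p) ≠ 1) ∧ p i = q := by
  have sq := psl_simple hq
  by_contra hno
  push Not at hno
  have key : ∀ i, ∀ x : SL (p i), f (Pi.mulSingle i x : Gp p) = 1 := by
    intro i
    by_contra hx
    push Not at hx
    have hn : ((f.comp (MonoidHom.mulSingle (fun i => SL (p i)) i)).range).Normal := by
      constructor
      rintro _ ⟨x, rfl⟩ y
      obtain ⟨z, rfl⟩ := hf y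
      refine ⟨z i * x * (z i)⁻¹, ?_⟩
      rw [MonoidHom.comp_apply, MonoidHom.comp_apply, ← map_inv, ← map_mul, ← map_mul]
      congr 1
      have h := mulSingle_conj (p := p) i z (z i * x * (z i)⁻¹)
      have e : (z i)⁻¹ * (z i * x * (z i)⁻¹) * z i = x := by group
      rw [e] at h
      exact eq_mul_inv_of_mul_eq h
    rcases IsSimpleGroup.eq_bot_or_eq_top_of_normal _ hn with h | h
    · obtain ⟨x, hx⟩ := hx
      have : (f.comp (MonoidHom.mulSingle (fun i => SL (p i)) i)) x ∈ (f.comp (MonoidHom.mulSingle (fun i => SL (p i)) i)).range := ⟨x, rfl⟩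
      rw [h, Subgroup.mem_bot] at this
      exact hx this
    · obtain ⟨x, hx'⟩ := hx
      exact absurd (psl_eq_of_surjective (hp i ⟨x, hx'⟩) hq _ (MonoidHom.range_eq_top.1 h)) (hno i ⟨x, hx'⟩)
  have h1 : f = 1 := MonoidHom.pi_ext fun i x => by rw [key]; rfl
  obtain ⟨y, hy⟩ := exists_ne (1 : SL q ⧸ Subgroup.center (SL q))
  obtain ⟨x, rfl⟩ := hf y
  exact hy (by rw [h1]; rfl)

end NoSurjection

section HomStability
variable {G Q : Type*} [Group G] [Fintype G] [Group Q]

/-- The number of elements satisfying `P`, as a real number. -/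
noncomputable def cnt {X : Type*} [Fintype X] (P : X → Prop) : ℝ := (#(univ.filter P) : ℕ)

theorem cnt_nonneg {X : Type*} [Fintype X] (P : X → Prop) : 0 ≤ cnt P := Nat.cast_nonneg _

theorem cnt_true {X : Type*} [Fintype X] : cnt (fun _ : X => True) = Fintype.card X := by
  simp [cnt]

theorem cnt_prod {X Y : Type*} [Fintype X] [Fintype Y] (P : X → Y → Prop) :
    cnt (fun q : X × Y => P q.1 q.2) = ∑ x, cnt (fun y => P x y) := by
  simp only [cnt, Finset.card_filter]
  rw [Fintype.sum_prod_type]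
  push_cast
  rfl

theorem cnt_prod' {X Y : Type*} [Fintype X] [Fintype Y] (P : X → Y → Prop) :
    cnt (fun q : X × Y => P q.1 q.2) = ∑ y, cnt (fun x => P x y) := by
  simp only [cnt, Finset.card_filter]
  rw [Fintype.sum_prod_type, Finset.sum_comm]
  push_cast
  rfl

theorem exists_fiber_le {X : Type*} [Fintype X] [Nonempty X] (P : X → X → Prop) {t : ℝ}
    (h : cnt (fun q : X × X => P q.1 q.2) ≤ t * Fintype.card X) : ∃ z, cnt (fun y => P y z) ≤ t := by
  by_contra hno
  push Not at hno
  rw [cnt_prod'] at h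
  have : ∑ z : X, t < ∑ z : X, cnt (fun y => P y z) :=
    Finset.sum_lt_sum_of_nonempty Finset.univ_nonempty fun z _ => hno z
  rw [Finset.sum_const, Finset.card_univ, nsmul_eq_mul] at this
  linarith

theorem cnt_le_add {X : Type*} [Fintype X] {P P₁ P₂ : X → Prop} (h : ∀ x, P x → P₁ x ∨ P₂ x) :
    cnt P ≤ cnt P₁ + cnt P₂ := by
  rw [cnt, cnt, cnt]
  norm_cast
  refine le_trans (Finset.card_le_card fun x hx => ?_) (Finset.card_union_le _ _)
  simp only [Finset.mem_filter, Finset.mem_univ, true_and, Finset.mem_union] at hx ⊢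
  exact h x hx

theorem cnt_equiv {X Y : Type*} [Fintype X] [Fintype Y] (e : X ≃ Y) {P : X → Prop} (P' : Y → Prop)
    (h : ∀ x, P x ↔ P' (e x)) : cnt P = cnt P' := by
  rw [cnt, cnt]
  norm_cast
  refine Finset.card_bij (fun x _ => e x) ?_ ?_ ?_
  · intro x hx
    simp only [Finset.mem_filter, Finset.mem_univ, true_and] at hx ⊢
    exact (h x).1 hx
  · intro x _ y _ hxy
    exact e.injective hxy
  · intro y hy
    simp only [Finset.mem_filter, Finset.mem_univ, true_and] at hy
    refine ⟨e.symm y, ?_, by simp⟩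
    simp only [Finset.mem_filter, Finset.mem_univ, true_and]
    rw [h]; simpa using hy

theorem exists_majority (f : G → Q) {θ : ℝ}
    (h : cnt (fun q : G × G => f q.1 * f q.2 ≠ f (q.1 * q.2)) ≤ θ * Fintype.card G * Fintype.card G) (x : G) :
    ∃ v : Q, cnt (fun y => f (x * y) * (f y)⁻¹ ≠ v) ≤ 2 * θ * Fintype.card G := by
  have key : ∀ q : G × G, f (x * q.1) * (f q.1)⁻¹ ≠ f (x * q.2) * (f q.2)⁻¹ →
      f q.1 * f (q.1⁻¹ * q.2) ≠ f (q.1 * (q.1⁻¹ * q.2)) ∨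
      f (x * q.1) * f (q.1⁻¹ * q.2) ≠ f (x * q.1 * (q.1⁻¹ * q.2)) := by
    rintro ⟨y, z⟩ hne
    by_contra hno
    push Not at hno
    obtain ⟨e1, e2⟩ := hno
    apply hne
    simp only at e1 e2 ⊢
    rw [show y * (y⁻¹ * z) = z by group] at e1
    rw [show x * y * (y⁻¹ * z) = x * z by group] at e2
    rw [← e1, ← e2]
    group
  have k := cnt_le_add key
  have e1 := cnt_equiv (X := G × G) (Y := G × G)
    ⟨fun q => (q.1, q.1⁻¹ * q.2), fun q => (q.1, q.1 * q.2), fun q => by simp, fun q => by simp⟩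
    (P := fun q => f q.1 * f (q.1⁻¹ * q.2) ≠ f (q.1 * (q.1⁻¹ * q.2))) (fun q => f q.1 * f q.2 ≠ f (q.1 * q.2))
    (fun q => Iff.rfl)
  have e2 := cnt_equiv (X := G × G) (Y := G × G)
    ⟨fun q => (x * q.1, q.1⁻¹ * q.2), fun q => (x⁻¹ * q.1, x⁻¹ * q.1 * q.2), fun q => by simp, fun q => by simp [mul_assoc]⟩
    (P := fun q => f (x * q.1) * f (q.1⁻¹ * q.2) ≠ f (x * q.1 * (q.1⁻¹ * q.2))) (fun q => f q.1 * f q.2 ≠ f (q.1 * q.2))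
    (fun q => Iff.rfl)
  rw [e1, e2] at k
  obtain ⟨z, hz⟩ := exists_fiber_le (fun y z => f (x * y) * (f y)⁻¹ ≠ f (x * z) * (f z)⁻¹) (t := 2 * θ * Fintype.card G)
    (by linarith)
  exact ⟨_, hz⟩

/-- A function that is a homomorphism on most pairs is close to a genuine homomorphism. -/
theorem hom_stability (f : G → Q) {θ : ℝ} (hθ : 6 * θ < 1)
    (h : cnt (fun q : G × G => f q.1 * f q.2 ≠ f (q.1 * q.2)) ≤ θ * Fintype.card G * Fintype.card G) :
    ∃ F : G →* Q, cnt (fun x => f x ≠ F x) ≤ 3 * θ * Fintype.card G := by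
  have hN : (0:ℝ) < Fintype.card G := by exact_mod_cast Fintype.card_pos
  choose F hF using exists_majority f h
  have hmul : ∀ x x', F (x * x') = F x * F x' := by
    intro x x'
    by_contra hne
    have e1 := cnt_equiv (Equiv.mulLeft x') (P := fun y => f (x * (x' * y)) * (f (x' * y))⁻¹ ≠ F x)
      (fun y => f (x * y) * (f y)⁻¹ ≠ F x) (fun y => Iff.rfl)
    have k1 := cnt_le_add (X := G) (P := fun _ => True) (P₁ := fun y => f (x' * y) * (f y)⁻¹ ≠ F x')
      (P₂ := fun y => f (x * (x' * y)) * (f (x' * y))⁻¹ ≠ F x ∨ f (x * x' * y) * (f y)⁻¹ ≠ F (x * x')) ?_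
    · have k2 := cnt_le_add (X := G) (P := fun y => f (x * (x' * y)) * (f (x' * y))⁻¹ ≠ F x ∨ f (x * x' * y) * (f y)⁻¹ ≠ F (x * x'))
        (fun y h => h)
      rw [e1] at k2
      have k3 := hF x
      have k4 := hF x'
      have k5 := hF (x * x')
      rw [cnt_true] at k1
      nlinarith
    · intro y _
      by_contra hno
      push Not at hno
      obtain ⟨a1, a2, a3⟩ := hno
      apply hne
      rw [← a1, ← a2, ← a3, mul_assoc x x' y]
      group
  refine ⟨MonoidHom.mk' F hmul, ?_⟩
  have k := cnt_le_add (X := G × G) (P := fun q => f q.1 ≠ F q.1) (P₁ := fun q => f q.1 * f q.2 ≠ f (q.1 * q.2))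
    (P₂ := fun q => f (q.1 * q.2) * (f q.2)⁻¹ ≠ F q.1) ?_
  · have e1 : cnt (fun q : G × G => f q.1 ≠ F q.1) = cnt (fun x => f x ≠ F x) * Fintype.card G := by
      rw [cnt_prod' (fun x _ => f x ≠ F x), Finset.sum_const, Finset.card_univ, nsmul_eq_mul, mul_comm]
    have e2 : cnt (fun q : G × G => f (q.1 * q.2) * (f q.2)⁻¹ ≠ F q.1) ≤ Fintype.card G * (2 * θ * Fintype.card G) := by
      rw [cnt_prod (fun x y => f (x * y) * (f y)⁻¹ ≠ F x), ← nsmul_eq_mul, ← Finset.card_univ]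
      exact Finset.sum_le_card_nsmul _ _ _ fun x _ => hF x
    rw [e1] at k
    have : cnt (fun x => f x ≠ F x) * Fintype.card G ≤ 3 * θ * Fintype.card G * Fintype.card G := by linarith
    exact le_of_mul_le_mul_right this hN
  · rintro ⟨x, y⟩ hne
    by_contra hno
    push Not at hno
    obtain ⟨a1, a2⟩ := hno
    apply hne
    simp only at a1 a2 ⊢
    rw [← a2, ← a1]; group

end HomStability

section Step

theorem jensen_log {X : Type*} (s : Finset X) (w x : X → ℝ) (hw : ∀ i ∈ s, 0 ≤ w i) (h1 : ∑ i ∈ s, w i = 1)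
    (hx : ∀ i ∈ s, 0 < x i) : ∑ i ∈ s, w i * Real.log (x i) ≤ Real.log (∑ i ∈ s, w i * x i) := by
  have := (strictConcaveOn_log_Ioi.concaveOn).le_map_sum (t := s) (w := w) (p := x) hw h1 (fun i hi => hx i hi)
  simpa [smul_eq_mul] using this

/-- The set `B a C`. -/
noncomputable def sand {G : Type*} [Group G] (B : Finset G) (a : G) (C : Finset G) : Finset G :=
  (B ×ˢ C).image fun q => q.1 * a * q.2

theorem mem_sand {G : Type*} [Group G] {B : Finset G} {a : G} {C : Finset G} {x : G} :
    x ∈ sand B a C ↔ ∃ b ∈ B, ∃ c ∈ C, b * a * c = x := by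
  simp only [sand, Finset.mem_image, Finset.mem_product, Prod.exists]
  constructor
  · rintro ⟨b, c, ⟨hb, hc⟩, e⟩; exact ⟨b, hb, c, hc, e⟩
  · rintro ⟨b, hb, c, hc, e⟩; exact ⟨b, c, ⟨hb, hc⟩, e⟩

/-- The number of representations of `z` in `X a Y`. -/
noncomputable def sandRep {G : Type*} [Group G] (X : Finset G) (a : G) (Y : Finset G) (z : G) : ℕ :=
  #((X ×ˢ Y).filter fun q => q.1 * a * q.2 = z)

theorem sandRep_pos {G : Type*} [Group G] {X : Finset G} {a : G} {Y : Finset G} {q : G × G} (hq : q ∈ X ×ˢ Y) :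
    0 < sandRep X a Y (q.1 * a * q.2) :=
  Finset.card_pos.2 ⟨q, by rw [Finset.mem_filter]; exact ⟨hq, rfl⟩⟩

theorem sum_div_sandRep {G : Type*} [Group G] (X : Finset G) (a : G) (Y : Finset G) (m : G → ℝ) :
    ∑ q ∈ X ×ˢ Y, m (q.1 * a * q.2) / (sandRep X a Y (q.1 * a * q.2) : ℝ) = ∑ z ∈ sand X a Y, m z := by
  rw [← Finset.sum_fiberwise_of_maps_to (s := X ×ˢ Y) (t := sand X a Y) (g := fun q => q.1 * a * q.2)
    (fun q hq => Finset.mem_image_of_mem _ hq)]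
  refine Finset.sum_congr rfl fun z hz => ?_
  have hc : ∀ q ∈ (X ×ˢ Y).filter (fun q => q.1 * a * q.2 = z),
      m (q.1 * a * q.2) / (sandRep X a Y (q.1 * a * q.2) : ℝ) = m z / (sandRep X a Y z : ℝ) := by
    intro q hq
    simp only [Finset.mem_filter] at hq
    rw [hq.2]
  have hp : (0:ℝ) < sandRep X a Y z := by
    obtain ⟨q, hq, e⟩ := Finset.mem_image.1 hz
    have := sandRep_pos (a := a) hq
    rw [e] at this
    exact_mod_cast this
  rw [Finset.sum_congr rfl hc, Finset.sum_const, nsmul_eq_mul]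
  change (sandRep X a Y z : ℝ) * _ = _
  field_simp

theorem coll_eq {G : Type*} [Group G] (X : Finset G) (a : G) (Y : Finset G) :
    coll X a Y = ∑ q ∈ X ×ˢ Y, sandRep X a Y (q.1 * a * q.2) := by
  simp only [sandRep, Finset.card_filter, coll, Finset.sum_product]
  refine Finset.sum_congr rfl fun x _ => ?_
  rw [Finset.sum_comm]
  refine Finset.sum_congr rfl fun y _ => ?_
  refine Finset.sum_congr rfl fun x' _ => ?_
  refine Finset.sum_congr rfl fun y' _ => ?_
  simp only [eq_comm]

theorem coll_pos {G : Type*} [Group G] {X : Finset G} (a : G) {Y : Finset G} (hX : X.Nonempty) (hY : Y.Nonempty) :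
    0 < coll X a Y := by
  obtain ⟨x, hx⟩ := hX
  obtain ⟨y, hy⟩ := hY
  exact Finset.card_pos.2 ⟨((x, x), (y, y)), by simp [hx, hy]⟩

theorem coll_le {G : Type*} [Group G] (X : Finset G) (a : G) (Y : Finset G) : coll X a Y ≤ #X ^ 2 * #Y ^ 2 := by
  refine (Finset.card_filter_le _ _).trans ?_
  simp only [Finset.card_product]
  exact le_of_eq (by ring)

/-- One step of the entropy count for `X a Y`. -/
theorem log_step {G : Type*} [Group G] {X : Finset G} (a : G) {Y : Finset G} (hX : X.Nonempty) (hY : Y.Nonempty)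
    (M : G × G → ℝ) (hM : ∀ q ∈ X ×ˢ Y, 0 < M q) (m : G → ℝ) (hm : ∀ q ∈ X ×ˢ Y, M q ≤ m (q.1 * a * q.2)) {W : ℝ}
    (hW : ∑ z ∈ sand X a Y, m z ≤ W) :
    (∑ q ∈ X ×ˢ Y, Real.log (M q)) / (#X * #Y) - Real.log (coll X a Y / (#X ^ 2 * #Y ^ 2)) ≤ Real.log W := by
  have hXp : (0:ℝ) < #X := by exact_mod_cast hX.card_pos
  have hYp : (0:ℝ) < #Y := by exact_mod_cast hY.card_pos
  obtain ⟨r, hr⟩ : ∃ r : G × G → ℝ, ∀ q, r q = sandRep X a Y (q.1 * a * q.2) := ⟨_, fun q => rfl⟩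
  have hrp : ∀ q ∈ X ×ˢ Y, 0 < r q := fun q hq => by
    rw [hr]; exact_mod_cast sandRep_pos hq
  have hsum : (coll X a Y : ℝ) = ∑ q ∈ X ×ˢ Y, r q := by
    rw [coll_eq]; push_cast; exact Finset.sum_congr rfl fun q _ => (hr q).symm
  have hN : (0:ℝ) < #X * #Y := by positivity
  have hcard : ((#(X ×ˢ Y) : ℕ) : ℝ) = #X * #Y := by rw [Finset.card_product]; push_cast; ring
  have hw1 : ∑ q ∈ X ×ˢ Y, 1 / ((#X : ℝ) * #Y) = 1 := by
    rw [Finset.sum_const, nsmul_eq_mul, hcard]; field_simp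
  have j1 := jensen_log (X ×ˢ Y) (fun _ => 1 / ((#X : ℝ) * #Y)) (fun q => r q / (#X * #Y)) (fun _ _ => by positivity) hw1
    (fun q hq => div_pos (hrp q hq) hN)
  have j2 := jensen_log (X ×ˢ Y) (fun _ => 1 / ((#X : ℝ) * #Y)) (fun q => M q * (#X * #Y) / r q) (fun _ _ => by positivity) hw1
    (fun q hq => div_pos (mul_pos (hM q hq) hN) (hrp q hq))
  have e1 : ∑ q ∈ X ×ˢ Y, 1 / ((#X : ℝ) * #Y) * (r q / (#X * #Y)) = coll X a Y / (#X ^ 2 * #Y ^ 2) := by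
    rw [← Finset.mul_sum, ← Finset.sum_div, ← hsum]
    field_simp
  have e2 : ∑ q ∈ X ×ˢ Y, 1 / ((#X : ℝ) * #Y) * (M q * (#X * #Y) / r q) ≤ W := by
    have : ∀ q ∈ X ×ˢ Y, 1 / ((#X : ℝ) * #Y) * (M q * (#X * #Y) / r q) ≤ m (q.1 * a * q.2) / r q := by
      intro q hq
      have := hrp q hq
      rw [show 1 / ((#X : ℝ) * #Y) * (M q * (#X * #Y) / r q) = M q / r q by field_simp]
      exact div_le_div_of_nonneg_right (hm q hq) this.le
    refine (Finset.sum_le_sum this).trans (le_trans (le_of_eq ?_) hW)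
    rw [← sum_div_sandRep]
    exact Finset.sum_congr rfl fun q _ => by rw [hr]
  have hpos : 0 < ∑ q ∈ X ×ˢ Y, 1 / ((#X : ℝ) * #Y) * (M q * (#X * #Y) / r q) :=
    Finset.sum_pos (fun q hq => by have := hrp q hq; have := hM q hq; positivity) (hX.product hY)
  rw [e1] at j1
  have j3 := j2.trans (Real.log_le_log hpos e2)
  have e3 : ∑ q ∈ X ×ˢ Y, 1 / ((#X : ℝ) * #Y) * Real.log (M q * (#X * #Y) / r q) =
      (∑ q ∈ X ×ˢ Y, Real.log (M q)) / (#X * #Y) - ∑ q ∈ X ×ˢ Y, 1 / ((#X : ℝ) * #Y) * Real.log (r q / (#X * #Y)) := by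
    rw [Finset.sum_div, ← Finset.sum_sub_distrib]
    refine Finset.sum_congr rfl fun q hq => ?_
    have h1 := hrp q hq
    have h2 := hM q hq
    rw [mul_div_assoc, Real.log_mul h2.ne' (by positivity), Real.log_div hN.ne' h1.ne', Real.log_div h1.ne' hN.ne']
    ring
  rw [e3] at j3
  linarith

end Step

section Tree
variable {ι : Type*} [Fintype ι] [LinearOrder ι] {G : ι → Type*} [∀ i, Group (G i)] [∀ i, Fintype (G i)]

/-- Values of the `i`-th coordinate on elements of `B` agreeing with `x` below `i`. -/
noncomputable def Ch (i : ι) (B : Finset (∀ i, G i)) (x : ∀ i, G i) : Finset (G i) :=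
  (B.filter fun b => ∀ j, j < i → b j = x j).image fun b => b i

/-- Elements of `B` agreeing with `x` outside `T`. -/
noncomputable def fib (T : Finset ι) (B : Finset (∀ i, G i)) (x : ∀ i, G i) : Finset (∀ i, G i) :=
  B.filter fun b => ∀ j, j ∉ T → b j = x j

theorem mem_Ch {i : ι} {B : Finset (∀ i, G i)} {x : ∀ i, G i} {u : G i} :
    u ∈ Ch i B x ↔ ∃ b ∈ B, (∀ j, j < i → b j = x j) ∧ b i = u := by
  simp [Ch, and_assoc]

theorem mem_fib {T : Finset ι} {B : Finset (∀ i, G i)} {x b : ∀ i, G i} :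
    b ∈ fib T B x ↔ b ∈ B ∧ ∀ j, j ∉ T → b j = x j := by
  simp [fib]

theorem Ch_nonempty {i : ι} {B : Finset (∀ i, G i)} {x : ∀ i, G i} (hx : x ∈ B) : (Ch i B x).Nonempty :=
  ⟨x i, mem_Ch.2 ⟨x, hx, fun _ _ => rfl, rfl⟩⟩

theorem fib_nonempty {T : Finset ι} {B : Finset (∀ i, G i)} {x : ∀ i, G i} (hx : x ∈ B) : (fib T B x).Nonempty :=
  ⟨x, mem_fib.2 ⟨hx, fun _ _ => rfl⟩⟩

theorem fib_univ (B : Finset (∀ i, G i)) (x : ∀ i, G i) : fib univ B x = B := by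
  ext b; simp [mem_fib]

theorem Ch_congr {i : ι} {B : Finset (∀ i, G i)} {x y : ∀ i, G i} (h : ∀ j, j < i → x j = y j) :
    Ch i B x = Ch i B y := by
  ext u
  simp only [mem_Ch]
  refine exists_congr fun b => and_congr_right fun _ => and_congr_left fun _ => forall₂_congr fun j hj => ?_
  rw [h j hj]

/-- Induction over the upper sets of a finite linear order. -/
theorem upper_induction {P : Finset ι → Prop} (h0 : P ∅)
    (hs : ∀ a s, a ∉ s → (∀ j, j ∉ insert a s ↔ j < a) → P s → P (insert a s)) : P univ := by
  have : ∀ T : Finset ι, (∀ i ∈ T, ∀ j, i ≤ j → j ∈ T) → P T := by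
    intro T
    induction T using Finset.induction_on_min with
    | empty => exact fun _ => h0
    | insert a s has ih =>
      intro hT
      have hns : a ∉ s := fun h => lt_irrefl _ (has a h)
      refine hs a s hns (fun j => ⟨fun hj => ?_, fun hj hj' => ?_⟩) (ih fun i hi j hij => ?_)
      · by_contra h
        exact hj (hT a (Finset.mem_insert_self _ _) j (not_lt.1 h))
      · rcases Finset.mem_insert.1 hj' with rfl | h
        · exact lt_irrefl _ hj
        · exact lt_asymm hj (has j h)
      · rcases Finset.mem_insert.1 (hT i (Finset.mem_insert_of_mem hi) j hij) with rfl | h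
        · exact absurd (has i hi) (not_lt.2 hij)
        · exact h
  exact this univ fun _ _ _ _ => Finset.mem_univ _

theorem fib_step {B : Finset (∀ i, G i)} {a : ι} {s : Finset ι} (has : a ∉ s) (hT : ∀ j, j ∉ insert a s ↔ j < a)
    {x r : ∀ i, G i} (hr : ∀ j, j < a → r j = x j) {b : ∀ i, G i} :
    b ∈ fib s B r ↔ b ∈ fib (insert a s) B x ∧ b a = r a := by
  simp only [mem_fib, and_assoc]
  refine and_congr_right fun _ => ⟨fun h => ⟨fun j hj => ?_, h a has⟩, fun h j hj => ?_⟩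
  · rw [h j (fun h' => hj (Finset.mem_insert_of_mem h')), hr j ((hT j).1 hj)]
  · by_cases e : j = a
    · subst e; exact h.2
    · have : j ∉ insert a s := by simp [e, hj]
      rw [h.1 j this, hr j ((hT j).1 this)]

theorem card_fib_step {B : Finset (∀ i, G i)} {a : ι} {s : Finset ι} (has : a ∉ s) (hT : ∀ j, j ∉ insert a s ↔ j < a)
    (x : ∀ i, G i) (r : G a → ∀ i, G i)
    (hr : ∀ u ∈ Ch a B x, r u ∈ B ∧ (∀ j, j < a → r u j = x j) ∧ r u a = u) :
    #(fib (insert a s) B x) = ∑ u ∈ Ch a B x, #(fib s B (r u)) := by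
  rw [Finset.card_eq_sum_card_fiberwise (f := fun b : ∀ i, G i => b a) (t := Ch a B x)]
  · refine Finset.sum_congr rfl fun u hu => congrArg _ ?_
    ext b
    rw [fib_step has hT (hr u hu).2.1, (hr u hu).2.2, Finset.mem_filter]
  · intro b hb
    have := mem_fib.1 (Finset.mem_coe.1 hb)
    exact Finset.mem_coe.2 (mem_Ch.2 ⟨b, this.1, fun j hj => this.2 j ((hT j).2 hj), rfl⟩)

theorem exists_rep (B : Finset (∀ i, G i)) (a : ι) (x : ∀ i, G i) :
    ∃ r : G a → ∀ i, G i, ∀ u ∈ Ch a B x, r u ∈ B ∧ (∀ j, j < a → r u j = x j) ∧ r u a = u := by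
  have : ∀ u : G a, ∃ b : ∀ i, G i, u ∈ Ch a B x → b ∈ B ∧ (∀ j, j < a → b j = x j) ∧ b a = u := by
    intro u
    by_cases h : u ∈ Ch a B x
    · obtain ⟨b, hb⟩ := mem_Ch.1 h
      exact ⟨b, fun _ => hb⟩
    · exact ⟨1, fun h' => absurd h' h⟩
  choose r hr using this
  exact ⟨r, hr⟩

theorem card_le_prod_Ch (B : Finset (∀ i, G i)) (D : ι → ℝ) (hD0 : ∀ i, 0 ≤ D i)
    (hD : ∀ i, ∀ x ∈ B, (#(Ch i B x) : ℝ) ≤ D i) : (#B : ℝ) ≤ ∏ i, D i := by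
  by_cases hB : B.Nonempty
  swap
  · rw [Finset.not_nonempty_iff_eq_empty.1 hB]
    simpa using Finset.prod_nonneg fun i _ => hD0 i
  obtain ⟨x, hx⟩ := hB
  have := upper_induction (P := fun T : Finset ι => ∀ x ∈ B, (#(fib T B x) : ℝ) ≤ ∏ i ∈ T, D i) ?_ ?_ x hx
  · rwa [fib_univ] at this
  · intro x hx
    rw [Finset.prod_empty]
    norm_cast
    rw [Finset.card_le_one]
    intro b hb c hc
    ext i
    rw [(mem_fib.1 hb).2 i (by simp), (mem_fib.1 hc).2 i (by simp)]
  · intro a s has hT ih x hx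
    obtain ⟨r, hr⟩ := exists_rep B a x
    rw [card_fib_step has hT x r hr, Finset.prod_insert has]
    push_cast
    refine (Finset.sum_le_sum fun u hu => ih (r u) (hr u hu).1).trans ?_
    rw [Finset.sum_const, nsmul_eq_mul]
    exact mul_le_mul_of_nonneg_right (hD a x hx) (Finset.prod_nonneg fun i _ => hD0 i)

theorem prod_Ch_le_card (B : Finset (∀ i, G i)) (hB : B.Nonempty) (D : ι → ℝ) (hD0 : ∀ i, 0 ≤ D i)
    (hD : ∀ i, ∀ x ∈ B, D i ≤ (#(Ch i B x) : ℝ)) : ∏ i, D i ≤ (#B : ℝ) := by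
  obtain ⟨x, hx⟩ := hB
  have := upper_induction (P := fun T : Finset ι => ∀ x ∈ B, ∏ i ∈ T, D i ≤ (#(fib T B x) : ℝ)) ?_ ?_ x hx
  · rwa [fib_univ] at this
  · intro x hx
    rw [Finset.prod_empty]
    exact_mod_cast (fib_nonempty hx).card_pos
  · intro a s has hT ih x hx
    obtain ⟨r, hr⟩ := exists_rep B a x
    rw [card_fib_step has hT x r hr, Finset.prod_insert has]
    push_cast
    refine le_trans ?_ (Finset.sum_le_sum fun u hu => ih (r u) (hr u hu).1)
    rw [Finset.sum_const, nsmul_eq_mul]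
    exact mul_le_mul_of_nonneg_right (hD a x hx) (Finset.prod_nonneg fun i _ => hD0 i)

/-- A large subset on which the branching numbers at the levels in `T` are dyadically constant. -/
theorem regularize (B : Finset (∀ i, G i)) (hB : B.Nonempty) (T : Finset ι) :
    ∃ B' ⊆ B, B'.Nonempty ∧ (∃ d : ι → ℕ, ∀ i ∈ T, ∀ x ∈ B', Nat.log 2 #(Ch i B' x) = d i) ∧
      #B ≤ #B' * ∏ i ∈ T, (Nat.log 2 (Fintype.card (G i)) + 1) := by
  induction T using Finset.induction_on_min with
  | empty => exact ⟨B, subset_rfl, hB, ⟨fun _ => 0, by simp⟩, by simp⟩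
  | insert a s has ih =>
    have hns : a ∉ s := fun h => lt_irrefl _ (has a h)
    obtain ⟨B1, hB1, hne, ⟨d, hd⟩, hc⟩ := ih
    obtain ⟨L, hL⟩ : ∃ L, L = Nat.log 2 (Fintype.card (G a)) + 1 := ⟨_, rfl⟩
    have hmaps : ∀ x ∈ B1, Nat.log 2 #(Ch a B1 x) ∈ Finset.range L := by
      intro x _
      rw [Finset.mem_range, hL, Nat.lt_succ_iff]
      exact Nat.log_mono_right (Finset.card_le_univ _)
    obtain ⟨e, -, he⟩ : ∃ e ∈ Finset.range L, #B1 ≤ #(B1.filter fun x => Nat.log 2 #(Ch a B1 x) = e) * L := by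
      by_contra hcon
      push Not at hcon
      have hLp : (Finset.range L).Nonempty := by rw [hL]; exact ⟨0, by simp⟩
      have h2 := Finset.card_eq_sum_card_fiberwise (f := fun x => Nat.log 2 #(Ch a B1 x)) (s := B1)
        (t := Finset.range L) (fun x hx => hmaps x hx)
      have h3 : ∑ e ∈ Finset.range L, #(B1.filter fun x => Nat.log 2 #(Ch a B1 x) = e) * L < ∑ _e ∈ Finset.range L, #B1 :=
        Finset.sum_lt_sum_of_nonempty hLp hcon
      rw [← Finset.sum_mul, ← h2, Finset.sum_const, Finset.card_range, smul_eq_mul] at h3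
      exact absurd h3 (by rw [mul_comm]; exact lt_irrefl _)
    obtain ⟨B2, hB2⟩ : ∃ B2, B2 = B1.filter fun x => Nat.log 2 #(Ch a B1 x) = e := ⟨_, rfl⟩
    rw [← hB2] at he
    have mB2 : ∀ x, x ∈ B2 ↔ x ∈ B1 ∧ Nat.log 2 #(Ch a B1 x) = e := fun x => by rw [hB2, Finset.mem_filter]
    have hCh : ∀ i, a ≤ i → ∀ x ∈ B2, Ch i B2 x = Ch i B1 x := by
      intro i hi x hx
      ext u
      simp only [mem_Ch]
      refine exists_congr fun b => ⟨fun h => ⟨((mB2 b).1 h.1).1, h.2⟩, fun h => ⟨(mB2 b).2 ⟨h.1, ?_⟩, h.2⟩⟩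
      rw [Ch_congr (y := x) fun j hj => h.2.1 j (lt_of_lt_of_le hj hi)]
      exact ((mB2 x).1 hx).2
    refine ⟨B2, fun x hx => hB1 ((mB2 x).1 hx).1, ?_, ⟨Function.update d a e, ?_⟩, ?_⟩
    · rw [← Finset.card_pos]
      have := hne.card_pos
      by_contra h
      rw [Nat.eq_zero_of_not_pos h, zero_mul] at he
      omega
    · intro i hi x hx
      by_cases h : i = a
      · subst h
        rw [Function.update_self, hCh i le_rfl x hx]
        exact ((mB2 x).1 hx).2
      · have his := (Finset.mem_insert.1 hi).resolve_left h
        rw [Function.update_of_ne h, hCh i (has i his).le x hx]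
        exact hd i his x ((mB2 x).1 hx).1
    · rw [Finset.prod_insert hns, ← hL, ← mul_assoc]
      exact hc.trans (Nat.mul_le_mul_right _ he)

theorem surjection (B : Finset (∀ i, G i)) (hB : B.Nonempty) (S : Finset ι)
    (h : ∀ i ∈ S, ∀ x ∈ B, ∀ y ∈ B, ∀ z ∈ B, ∀ g : G i, g ∈ Ch i B x * Ch i B y * Ch i B z) (g : ∀ i, G i) :
    ∃ x ∈ B, ∃ y ∈ B, ∃ z ∈ B, ∀ i ∈ S, x i * y i * z i = g i := by
  suffices hT : ∀ T : Finset ι, ∃ x ∈ B, ∃ y ∈ B, ∃ z ∈ B, ∀ i ∈ T, i ∈ S → x i * y i * z i = g i by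
    obtain ⟨x, hx, y, hy, z, hz, h⟩ := hT univ
    exact ⟨x, hx, y, hy, z, hz, fun i hi => h i (Finset.mem_univ _) hi⟩
  intro T
  induction T using Finset.induction_on_max with
  | empty =>
    obtain ⟨x, hx⟩ := hB
    exact ⟨x, hx, x, hx, x, hx, by simp⟩
  | insert a s has ih =>
    obtain ⟨x, hx, y, hy, z, hz, hs⟩ := ih
    by_cases haS : a ∈ S
    · obtain ⟨uv, huv, w, hw, e⟩ := Finset.mem_mul.1 (h a haS x hx y hy z hz (g a))
      obtain ⟨u, hu, v, hv, e'⟩ := Finset.mem_mul.1 huv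
      obtain ⟨x', hx', hx1, hx2⟩ := mem_Ch.1 hu
      obtain ⟨y', hy', hy1, hy2⟩ := mem_Ch.1 hv
      obtain ⟨z', hz', hz1, hz2⟩ := mem_Ch.1 hw
      refine ⟨x', hx', y', hy', z', hz', fun i hi hiS => ?_⟩
      rcases Finset.mem_insert.1 hi with rfl | hi
      · rw [hx2, hy2, hz2, e', e]
      · rw [hx1 i (has i hi), hy1 i (has i hi), hz1 i (has i hi)]
        exact hs i hi hiS
    · refine ⟨x, hx, y, hy, z, hz, fun i hi hiS => ?_⟩
      rcases Finset.mem_insert.1 hi with rfl | hi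
      · exact absurd hiS haS
      · exact hs i hi hiS

theorem growth_step {B : Finset (∀ i, G i)} {a : ι} {s : Finset ι} (has : a ∉ s) (hT : ∀ j, j ∉ insert a s ↔ j < a)
    {x y : ∀ i, G i} (hx : x ∈ B) (hy : y ∈ B) (r r' : G a → ∀ i, G i)
    (hr : ∀ u ∈ Ch a B x, r u ∈ B ∧ (∀ j, j < a → r u j = x j) ∧ r u a = u)
    (hr' : ∀ u ∈ Ch a B y, r' u ∈ B ∧ (∀ j, j < a → r' u j = y j) ∧ r' u a = u) (c : ∀ i, G i) :
    (∑ q ∈ Ch a B x ×ˢ Ch a B y, Real.log (#(sand (fib s B (r q.1)) c (fib s B (r' q.2))) : ℕ)) /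
        (#(Ch a B x) * #(Ch a B y)) -
      Real.log (coll (Ch a B x) (c a) (Ch a B y) / (#(Ch a B x) ^ 2 * #(Ch a B y) ^ 2)) ≤
    Real.log (#(sand (fib (insert a s) B x) c (fib (insert a s) B y)) : ℕ) := by
  obtain ⟨W, hW⟩ : ∃ W, W = sand (fib (insert a s) B x) c (fib (insert a s) B y) := ⟨_, rfl⟩
  obtain ⟨F, hF⟩ : ∃ F : G a → Finset (∀ i, G i), ∀ z w, w ∈ F z ↔ w ∈ W ∧ w a = z :=
    ⟨fun z => W.filter fun w => w a = z, fun z w => by rw [Finset.mem_filter]⟩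
  refine log_step (c a) (Ch_nonempty hx) (Ch_nonempty hy)
    (fun q => (#(sand (fib s B (r q.1)) c (fib s B (r' q.2))) : ℕ)) (fun q hq => ?_) (fun z => (#(F z) : ℕ)) (fun q hq => ?_) ?_
  · have hq := Finset.mem_product.1 hq
    obtain ⟨b, hb⟩ := fib_nonempty (T := s) (hr q.1 hq.1).1
    obtain ⟨b', hb'⟩ := fib_nonempty (T := s) (hr' q.2 hq.2).1
    exact_mod_cast Finset.card_pos.2 ⟨_, mem_sand.2 ⟨b, hb, b', hb', rfl⟩⟩
  · have hq := Finset.mem_product.1 hq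
    norm_cast
    refine Finset.card_le_card fun w hw => ?_
    obtain ⟨b, hb, b', hb', rfl⟩ := mem_sand.1 hw
    rw [fib_step has hT (hr q.1 hq.1).2.1, (hr q.1 hq.1).2.2] at hb
    rw [fib_step has hT (hr' q.2 hq.2).2.1, (hr' q.2 hq.2).2.2] at hb'
    rw [hF, hW]
    exact ⟨mem_sand.2 ⟨b, hb.1, b', hb'.1, rfl⟩, by simp [hb.2, hb'.2]⟩
  · rw [← hW]
    norm_cast
    rw [← Finset.card_biUnion]
    · refine Finset.card_le_card fun w hw => ?_
      obtain ⟨z, -, hz⟩ := Finset.mem_biUnion.1 hw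
      exact ((hF z w).1 hz).1
    · intro z _ z' _ hne
      rw [Function.onFun, Finset.disjoint_left]
      intro w hw hw'
      exact hne (((hF z w).1 hw).2.symm.trans ((hF z' w).1 hw').2)

theorem tree_growth (B : Finset (∀ i, G i)) (hB : B.Nonempty) (α : (∀ i, G i) → ℝ) (hα : ∀ a, 0 ≤ α a)
    (h1 : ∑ a, α a = 1) (g : ι → ℝ)
    (hg : ∀ i, ∀ x ∈ B, ∀ y ∈ B, ∑ a, α a * coll (Ch i B x) (a i) (Ch i B y) ≤
      Real.exp (-g i) * (#(Ch i B x) ^ 2 * #(Ch i B y) ^ 2)) :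
    ∑ i, g i ≤ ∑ a, α a * Real.log (#(sand B a B) : ℕ) := by
  obtain ⟨x, hx⟩ := hB
  have := upper_induction (P := fun T : Finset ι => ∀ x ∈ B, ∀ y ∈ B, ∑ i ∈ T, g i ≤
    ∑ a, α a * Real.log (#(sand (fib T B x) a (fib T B y)) : ℕ)) ?_ ?_ x hx x hx
  · simpa only [fib_univ] using this
  · intro x hx y hy
    rw [Finset.sum_empty]
    exact Finset.sum_nonneg fun a _ => mul_nonneg (hα a) (Real.log_natCast_nonneg _)
  · intro a s has hT ih x hx y hy
    obtain ⟨r, hr⟩ := exists_rep B a x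
    obtain ⟨r', hr'⟩ := exists_rep B a y
    have hX : (0:ℝ) < #(Ch a B x) := by exact_mod_cast (Ch_nonempty (i := a) hx).card_pos
    have hY : (0:ℝ) < #(Ch a B y) := by exact_mod_cast (Ch_nonempty (i := a) hy).card_pos
    have hcp : ∀ c : ∀ i, G i, (0:ℝ) < coll (Ch a B x) (c a) (Ch a B y) / (#(Ch a B x) ^ 2 * #(Ch a B y) ^ 2) := by
      intro c
      have : (0:ℝ) < coll (Ch a B x) (c a) (Ch a B y) := by
        exact_mod_cast coll_pos (c a) (Ch_nonempty hx) (Ch_nonempty hy)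
      positivity
    have h2 := Finset.sum_le_sum fun c (_ : c ∈ univ) =>
      mul_le_mul_of_nonneg_left (growth_step has hT hx hy r r' hr hr' c) (hα c)
    refine le_trans ?_ h2
    simp only [mul_sub]
    rw [Finset.sum_sub_distrib, Finset.sum_insert has]
    have h3 := jensen_log univ α (fun c => coll (Ch a B x) (c a) (Ch a B y) / (#(Ch a B x) ^ 2 * #(Ch a B y) ^ 2))
      (fun c _ => hα c) h1 (fun c _ => hcp c)
    have h4 : ∑ c, α c * ((coll (Ch a B x) (c a) (Ch a B y) : ℝ) / (#(Ch a B x) ^ 2 * #(Ch a B y) ^ 2)) ≤ Real.exp (-g a) := by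
      simp only [← mul_div_assoc]
      rw [← Finset.sum_div, div_le_iff₀ (by positivity)]
      exact hg a x hx y hy
    have h5 : 0 < ∑ c, α c * ((coll (Ch a B x) (c a) (Ch a B y) : ℝ) / (#(Ch a B x) ^ 2 * #(Ch a B y) ^ 2)) := by
      obtain ⟨c, -, hc⟩ := Finset.exists_ne_zero_of_sum_ne_zero (h1.trans_ne one_ne_zero)
      exact Finset.sum_pos' (fun c _ => mul_nonneg (hα c) (hcp c).le)
        ⟨c, Finset.mem_univ _, mul_pos (lt_of_le_of_ne (hα c) (Ne.symm hc)) (hcp c)⟩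
    have h6 := h3.trans (Real.log_le_log h5 h4)
    rw [Real.log_exp] at h6
    have h7 : ∑ i ∈ s, g i ≤ ∑ c, α c * ((∑ q ∈ Ch a B x ×ˢ Ch a B y,
        Real.log (#(sand (fib s B (r q.1)) c (fib s B (r' q.2))) : ℕ)) / (#(Ch a B x) * #(Ch a B y))) := by
      simp only [← mul_div_assoc]
      rw [← Finset.sum_div, le_div_iff₀ (by positivity)]
      simp only [Finset.mul_sum]
      rw [Finset.sum_comm]
      calc (∑ i ∈ s, g i) * (#(Ch a B x) * #(Ch a B y)) = ∑ q ∈ Ch a B x ×ˢ Ch a B y, ∑ i ∈ s, g i := by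
            rw [Finset.sum_const, Finset.card_product, nsmul_eq_mul]; push_cast; ring
        _ ≤ _ := Finset.sum_le_sum fun q hq => by
            have hq := Finset.mem_product.1 hq
            exact ih _ (hr q.1 hq.1).1 _ (hr' q.2 hq.2).1
    linarith

end Tree

section Select
variable {ι : Type*} [Fintype ι] [LinearOrder ι] {G : ι → Type*} [∀ i, Group (G i)] [∀ i, Fintype (G i)]

/-- `x` lies in the coset of `∏ H i` through `a`, as far as the coordinates in `Q` are concerned. -/
def InCoset (Q : Finset ι) (H : ∀ i, Subgroup (G i)) (a x : ∀ i, G i) : Prop :=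
  ∀ i ∈ Q, (a i)⁻¹ * x i ∈ H i

/-- The mass of `β` on the points satisfying `P`. -/
noncomputable def mass {X : Type*} [Fintype X] (β : X → ℝ) (P : X → Prop) : ℝ := ∑ x, if P x then β x else 0

theorem mass_mono {X : Type*} [Fintype X] {β : X → ℝ} (h0 : ∀ x, 0 ≤ β x) {P P' : X → Prop} (h : ∀ x, P x → P' x) :
    mass β P ≤ mass β P' := by
  refine Finset.sum_le_sum fun x _ => ?_
  by_cases hx : P x
  · rw [if_pos hx, if_pos (h x hx)]
  · rw [if_neg hx]; split_ifs
    · exact h0 x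
    · exact le_rfl

theorem mass_nonneg {X : Type*} [Fintype X] {β : X → ℝ} (h0 : ∀ x, 0 ≤ β x) (P : X → Prop) : 0 ≤ mass β P :=
  Finset.sum_nonneg fun x _ => by split_ifs <;> [exact h0 x; exact le_rfl]

theorem mass_eq_sum_filter {X : Type*} [Fintype X] (β : X → ℝ) (P : X → Prop) : mass β P = ∑ x with P x, β x := by
  rw [mass, Finset.sum_filter]

theorem exists_mass_ge {X Y : Type*} [Fintype X] [Fintype Y] [Nonempty Y] (β : X → ℝ) (P : X → Prop) (f : X → Y) :
    ∃ y, mass β P ≤ Fintype.card Y * mass β (fun x => P x ∧ f x = y) := by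
  obtain ⟨y, hy⟩ := Finite.exists_max fun y => mass β (fun x => P x ∧ f x = y)
  refine ⟨y, ?_⟩
  calc mass β P = ∑ y, mass β (fun x => P x ∧ f x = y) := by
        simp only [mass]
        rw [Finset.sum_comm]
        refine Finset.sum_congr rfl fun x _ => ?_
        by_cases hx : P x <;> simp [hx]
    _ ≤ ∑ _y : Y, mass β (fun x => P x ∧ f x = y) := Finset.sum_le_sum fun y' _ => hy y'
    _ = _ := by rw [Finset.sum_const, nsmul_eq_mul, Finset.card_univ]

theorem exists_mass_coords (β : (∀ i, G i) → ℝ) (P : (∀ i, G i) → Prop) (T : Finset ι) :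
    ∃ b : ∀ i, G i, mass β P ≤ (∏ i ∈ T, (Fintype.card (G i) : ℝ)) * mass β (fun x => P x ∧ ∀ i ∈ T, x i = b i) := by
  induction T using Finset.induction_on with
  | empty => exact ⟨1, by simp⟩
  | insert a s has ih =>
    obtain ⟨b, hb⟩ := ih
    obtain ⟨g, hg⟩ := exists_mass_ge β (fun x => P x ∧ ∀ i ∈ s, x i = b i) (fun x : ∀ i, G i => x a)
    refine ⟨Function.update b a g, hb.trans ?_⟩
    rw [Finset.prod_insert has, mul_comm (Fintype.card (G a) : ℝ), mul_assoc]
    refine mul_le_mul_of_nonneg_left (hg.trans (le_of_eq ?_)) (Finset.prod_nonneg fun i _ => Nat.cast_nonneg _)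
    congr 2
    funext x
    rw [and_assoc, eq_iff_iff]
    refine and_congr_right fun _ => ⟨fun h i hi => ?_, fun h => ⟨fun i hi => ?_, ?_⟩⟩
    · by_cases e : i = a
      · subst e; rw [Function.update_self]; exact h.2
      · rw [Function.update_of_ne e]; exact h.1 i ((Finset.mem_insert.1 hi).resolve_left e)
    · have e : i ≠ a := fun e => has (e ▸ hi)
      have := h i (Finset.mem_insert_of_mem hi)
      rwa [Function.update_of_ne e] at this
    · have := h a (Finset.mem_insert_self _ _)
      rwa [Function.update_self] at this

/-- Selection of a set of coordinates in which `β` is maximally concentrated. -/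
theorem select (Alw : ∀ i, Subgroup (G i) → Prop) (hbot : ∀ i, Alw i ⊥) (w : ι → ℝ) (hw : ∀ i, 1 ≤ w i)
    (β : (∀ i, G i) → ℝ) (h0 : ∀ x, 0 ≤ β x) (Q0 : Finset ι) (cm : ℝ)
    (hcm : ∀ H : ∀ i, Subgroup (G i), (∀ i, Alw i (H i)) → ∀ a, mass β (InCoset univ H a) ≤ cm) :
    ∃ Q, Q0 ⊆ Q ∧ ∃ H : ∀ i, Subgroup (G i), (∀ i, Alw i (H i)) ∧ ∃ a : ∀ i, G i,
      ∑ x, β x ≤ (∏ i ∈ Q0, (Fintype.card (G i) : ℝ)) * (mass β (InCoset Q H a) * ∏ i ∈ Q, w i) ∧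
      (∀ T, Disjoint Q T → ∀ H' : ∀ i, Subgroup (G i), (∀ i, Alw i (H' i)) → ∀ b,
        mass β (fun x => InCoset Q H a x ∧ InCoset T H' b x) * ∏ i ∈ T, w i ≤ mass β (InCoset Q H a)) ∧
      mass β (InCoset Q H a) ≤ (∏ i ∈ Qᶜ, (Fintype.card (G i) : ℝ)) * cm := by
  have wpos : ∀ T : Finset ι, 0 < ∏ i ∈ T, w i := fun T => Finset.prod_pos fun i _ => one_pos.trans_le (hw i)
  let α := {t : Finset ι × (∀ i, Subgroup (G i)) × (∀ i, G i) // Q0 ⊆ t.1 ∧ ∀ i, Alw i (t.2.1 i)}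
  have : Nonempty α := ⟨⟨(Q0, fun _ => ⊥, 1), subset_rfl, hbot⟩⟩
  obtain ⟨⟨⟨Q, H, a⟩, hQ, hH⟩, hmax⟩ := Finite.exists_max
    fun t : α => mass β (InCoset t.1.1 t.1.2.1 t.1.2.2) * ∏ i ∈ t.1.1, w i
  have hmax' : ∀ (Q' : Finset ι) (H' : ∀ i, Subgroup (G i)) a', Q0 ⊆ Q' → (∀ i, Alw i (H' i)) →
      mass β (InCoset Q' H' a') * ∏ i ∈ Q', w i ≤ mass β (InCoset Q H a) * ∏ i ∈ Q, w i :=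
    fun Q' H' a' h1 h2 => hmax ⟨(Q', H', a'), h1, h2⟩
  dsimp only at hQ hH
  have hpw : ∀ (T : Finset ι) (H' : ∀ i, Subgroup (G i)) (b x : ∀ i, G i), Disjoint Q T → InCoset Q H a x ∧ InCoset T H' b x →
      InCoset (Q ∪ T) (fun i => if i ∈ Q then H i else H' i) (fun i => if i ∈ Q then a i else b i) x := by
    intro T H' b x hd h i hi
    dsimp only
    by_cases hiQ : i ∈ Q
    · rw [if_pos hiQ, if_pos hiQ]; exact h.1 i hiQ
    · rw [if_neg hiQ, if_neg hiQ]; exact h.2 i ((Finset.mem_union.1 hi).resolve_left hiQ)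
  have halw : ∀ H' : ∀ i, Subgroup (G i), (∀ i, Alw i (H' i)) → ∀ i, Alw i (if i ∈ Q then H i else H' i) := by
    intro H' h i
    split_ifs
    · exact hH i
    · exact h i
  refine ⟨Q, hQ, H, hH, a, ?_, ?_, ?_⟩
  · obtain ⟨b, hb⟩ := exists_mass_coords β (fun _ => True) Q0
    have e : ∑ x, β x = mass β (fun _ => True) := by simp [mass]
    rw [e]
    refine hb.trans (mul_le_mul_of_nonneg_left ?_ (Finset.prod_nonneg fun i _ => Nat.cast_nonneg _))
    refine le_trans ?_ (hmax' Q0 (fun _ => ⊥) b subset_rfl hbot)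
    refine le_trans (mass_mono h0 fun x hx => ?_) (le_mul_of_one_le_right (mass_nonneg h0 _) ?_)
    · intro i hi
      rw [hx.2 i hi]; simp
    · calc (1:ℝ) = ∏ _i ∈ Q0, (1:ℝ) := by simp
        _ ≤ _ := Finset.prod_le_prod (fun _ _ => zero_le_one) fun i _ => hw i
  · intro T hT H' hH' b
    have h1 := hmax' (Q ∪ T) _ (fun i => if i ∈ Q then a i else b i) (hQ.trans Finset.subset_union_left) (halw H' hH')
    rw [Finset.prod_union hT, mul_comm (∏ i ∈ Q, w i), ← mul_assoc] at h1
    refine le_trans ?_ (le_of_mul_le_mul_right h1 (wpos Q))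
    exact mul_le_mul_of_nonneg_right (mass_mono h0 fun x hx => hpw T H' b x hT hx) (wpos T).le
  · obtain ⟨b, hb⟩ := exists_mass_coords β (InCoset Q H a) Qᶜ
    refine hb.trans (mul_le_mul_of_nonneg_left ?_ (Finset.prod_nonneg fun i _ => Nat.cast_nonneg _))
    refine le_trans (mass_mono h0 fun x hx => ?_) (hcm _ (halw (fun _ => ⊥) hbot) (fun i => if i ∈ Q then a i else b i))
    have := hpw Qᶜ (fun _ => ⊥) b x disjoint_compl_right ⟨hx.1, fun i hi => by rw [hx.2 i hi]; simp⟩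
    rwa [Finset.union_compl] at this

end Select

noncomputable scoped instance gpDecidableEq {ι : Type*} (p : ι → ℕ) : DecidableEq (Gp p) := fun a b => Classical.propDecidable (a = b)

section Nu

variable {ι : Type*} [Fintype ι] [LinearOrder ι] {p : ι → ℕ} [∀ i, Fact (p i).Prime]

/-- The product of the primes indexed by `T`. -/
noncomputable def qq (p : ι → ℕ) (T : Finset ι) : ℝ := ∏ i ∈ T, (p i : ℝ)

theorem one_le_qq (T : Finset ι) : 1 ≤ qq p T := by
  calc (1:ℝ) = ∏ _ ∈ T, (1:ℝ) := by simp
    _ ≤ _ := Finset.prod_le_prod (fun _ _ => zero_le_one) fun i _ => by exact_mod_cast (Fact.out : (p i).Prime).one_le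

theorem qq_pos (T : Finset ι) : 0 < qq p T := one_pos.trans_le (one_le_qq T)

theorem qq_rpow (T : Finset ι) (κ : ℝ) : qq p T ^ κ = ∏ i ∈ T, (p i : ℝ) ^ κ :=
  (Real.finsetProd_rpow _ _ (fun i _ => Nat.cast_nonneg _) κ).symm

theorem qq_mul_compl (T : Finset ι) : qq p T * qq p Tᶜ = qq p univ := by
  rw [qq, qq, qq, Finset.prod_mul_prod_compl]

theorem prod_card_le (T : Finset ι) : ∏ i ∈ T, (Fintype.card (SL (p i)) : ℝ) ≤ qq p T ^ 3 := by
  rw [qq, ← Finset.prod_pow]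
  exact Finset.prod_le_prod (fun _ _ => Nat.cast_nonneg _) fun i _ => card_sl_le

theorem prod_card_small_le (hp : Function.Injective p) (p0 : ℕ) :
    ∏ i ∈ univ.filter (fun i => p i < p0), (Fintype.card (SL (p i)) : ℝ) ≤ ∏ n ∈ Finset.range p0, ((n : ℝ) + 1) ^ 3 := by
  calc ∏ i ∈ univ.filter (fun i => p i < p0), (Fintype.card (SL (p i)) : ℝ)
      ≤ ∏ i ∈ univ.filter (fun i => p i < p0), ((p i : ℝ) + 1) ^ 3 :=
        Finset.prod_le_prod (fun _ _ => Nat.cast_nonneg _) fun i _ =>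
          card_sl_le.trans (pow_le_pow_left₀ (Nat.cast_nonneg _) (by linarith) 3)
    _ = ∏ n ∈ (univ.filter (fun i => p i < p0)).image p, ((n : ℝ) + 1) ^ 3 :=
        (Finset.prod_image (f := fun n : ℕ => ((n : ℝ) + 1) ^ 3) fun i _ j _ h => hp h).symm
    _ ≤ _ := by
        refine Finset.prod_le_prod_of_subset_of_one_le (f := fun n : ℕ => ((n : ℝ) + 1) ^ 3) ?_ (fun n _ => by positivity) fun n _ _ => ?_
        · intro n hn
          obtain ⟨i, hi, rfl⟩ := Finset.mem_image.1 hn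
          simpa using hi
        · exact one_le_pow₀ (by linarith [(Nat.cast_nonneg n : (0:ℝ) ≤ n)])

theorem size_numerics {κ K P M qQ qR : ℝ} (hκ : 0 < κ) (hQ : 1 ≤ qQ) (hR : 1 ≤ qR) (hK : 0 < K) (hP : 0 < P)
    (hKP : K * P ≤ (qQ * qR) ^ (κ / 4)) (h1 : 1 ≤ K * (P * (M * qQ ^ (κ / 2)))) (h3 : M ≤ qR ^ 3 * (qQ * qR) ^ (-κ)) :
    (qQ * qR) ^ (κ / 12) ≤ qR := by
  obtain ⟨q, hq⟩ : ∃ q, q = qQ * qR := ⟨_, rfl⟩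
  have hq0 : 0 < q := by rw [hq]; positivity
  have hqle : qQ ≤ q := by rw [hq]; nlinarith
  rw [← hq] at hKP h3 ⊢
  have hQq : qQ ^ (κ / 2) ≤ q ^ (κ / 2) :=
    Real.rpow_le_rpow (by positivity) hqle (by positivity)
  have h4 : 1 ≤ q ^ (κ / 4) * (qR ^ 3 * q ^ (-κ) * q ^ (κ / 2)) := by
    calc 1 ≤ K * (P * (M * qQ ^ (κ / 2))) := h1
      _ = (K * P) * (M * qQ ^ (κ / 2)) := by ring
      _ ≤ (K * P) * ((qR ^ 3 * q ^ (-κ)) * q ^ (κ / 2)) := by gcongr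
      _ ≤ _ := by gcongr
  have h5 : q ^ (κ / 4) * (qR ^ 3 * q ^ (-κ) * q ^ (κ / 2)) = qR ^ 3 * q ^ (-(κ / 4)) := by
    have : q ^ (-(κ / 4)) = q ^ (κ / 4) * q ^ (-κ) * q ^ (κ / 2) := by
      rw [← Real.rpow_add hq0, ← Real.rpow_add hq0]; congr 1; ring
    rw [this]; ring
  rw [h5, Real.rpow_neg hq0.le, ← div_eq_mul_inv, one_le_div (by positivity)] at h4
  have h6 : (q ^ (κ / 12)) ^ 3 = q ^ (κ / 4) := by
    rw [← Real.rpow_natCast, ← Real.rpow_mul hq0.le]; congr 1; push_cast; ring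
  rw [← h6] at h4
  exact (pow_le_pow_iff_left₀ (by positivity) (by positivity) (by norm_num)).1 h4

/-- After conditioning and translating, `β` looks generic at a substantial set `R` of primes and
metabelian elsewhere. -/
theorem exists_generic {κ : ℝ} (hκ : 0 < κ) (p0 : ℕ) : ∃ P : ℝ, 0 < P ∧ ∀ {ι : Type} [Fintype ι] [LinearOrder ι] {p : ι → ℕ}
    [∀ i, Fact (p i).Prime], Function.Injective p → ∀ K : ℝ, 0 < K → K * P ≤ qq p univ ^ (κ / 4) →
    ∀ β : Gp p → ℝ, (∀ x, 0 ≤ β x) →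
    (∀ H : ∀ i, Subgroup (SL (p i)), (∀ i, H i ≠ ⊤) → ∀ a, mass β (InCoset univ H a) ≤ qq p univ ^ (-κ)) →
    ∀ A : Finset (Gp p), (∀ x ∈ A, x⁻¹ ∈ A) → ∀ a : Gp p, 1 ≤ K * mass β (fun x => a⁻¹ * x ∈ A) →
    ∃ R : Finset ι, (∀ i ∈ R, p0 ≤ p i) ∧ qq p univ ^ (κ / 12) ≤ qq p R ∧ ∃ ν : Gp p → ℝ, IsProb ν ∧
      (∀ z, ν z ≠ 0 → z ∈ A ^ 2) ∧
      (∃ H : ∀ i, Subgroup (SL (p i)), (∀ i, Metab (H i)) ∧ ∀ z, ν z ≠ 0 → ∀ i ∉ R, z i ∈ H i) ∧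
      ∀ T ⊆ R, ∀ H' : ∀ i, Subgroup (SL (p i)), (∀ i ∈ T, H' i ≠ ⊤ ∧ Metab (H' i)) → ∀ b,
        mass ν (InCoset T H' b) ≤ qq p T ^ (-(κ / 2)) := by
  refine ⟨∏ n ∈ Finset.range p0, ((n : ℝ) + 1) ^ 3, Finset.prod_pos fun n _ => by positivity, ?_⟩
  intro ι _ _ p _ hp K hK hKP β h0 hN A hA a hmass
  obtain ⟨β', hβ'⟩ : ∃ β' : Gp p → ℝ, ∀ x, β' x = if a⁻¹ * x ∈ A then β x else 0 := ⟨_, fun _ => rfl⟩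
  have h0' : ∀ x, 0 ≤ β' x := fun x => by rw [hβ']; split_ifs <;> [exact h0 x; exact le_rfl]
  have hle : ∀ x, β' x ≤ β x := fun x => by rw [hβ']; split_ifs <;> [exact le_rfl; exact h0 x]
  have hsum : ∑ x, β' x = mass β (fun x => a⁻¹ * x ∈ A) := Finset.sum_congr rfl fun x _ => by
    rw [hβ']; by_cases h : a⁻¹ * x ∈ A <;> simp [h]
  obtain ⟨Q, hQ, H, hH, c, s1, s2, s3⟩ := select (fun i L => L ≠ ⊤ ∧ Metab L) (fun i => ⟨bot_ne_top, Metab.bot⟩)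
    (fun i => (p i : ℝ) ^ (κ / 2)) (fun i => Real.one_le_rpow (by exact_mod_cast (Fact.out : (p i).Prime).one_le) (by positivity))
    β' h0' (univ.filter fun i => p i < p0) (qq p univ ^ (-κ)) (fun H hH a => by
      refine le_trans (Finset.sum_le_sum fun x _ => ?_) (hN H (fun i => (hH i).1) a)
      split_ifs <;> [exact hle x; exact le_rfl])
  rw [hsum, ← qq_rpow] at s1
  obtain ⟨M, hM⟩ : ∃ M, M = mass β' (InCoset Q H c) := ⟨_, rfl⟩
  have hM0 : 0 ≤ M := by rw [hM]; exact mass_nonneg h0' _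
  rw [← hM] at s1 s2 s3
  obtain ⟨P, hPdef⟩ : ∃ P : ℝ, P = ∏ n ∈ Finset.range p0, ((n : ℝ) + 1) ^ 3 := ⟨_, rfl⟩
  have hP0 : 0 < P := by rw [hPdef]; exact Finset.prod_pos fun n _ => by positivity
  rw [← hPdef] at hKP
  have k1 : 1 ≤ K * (P * (M * qq p Q ^ (κ / 2))) := by
    refine hmass.trans (mul_le_mul_of_nonneg_left (s1.trans ?_) hK.le)
    refine mul_le_mul_of_nonneg_right ?_ (mul_nonneg hM0 (Real.rpow_nonneg (qq_pos Q).le _))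
    rw [hPdef]
    exact prod_card_small_le hp p0
  have k3 : M ≤ qq p Qᶜ ^ 3 * (qq p Q * qq p Qᶜ) ^ (-κ) := by
    rw [qq_mul_compl]
    exact s3.trans (mul_le_mul_of_nonneg_right (prod_card_le _) (Real.rpow_nonneg (qq_pos _).le _))
  rw [← qq_mul_compl Q] at hKP ⊢
  have hMp : 0 < M := by
    refine lt_of_le_of_ne hM0 fun h => ?_
    rw [← h] at k1
    norm_num at k1
  obtain ⟨γ, hγ⟩ : ∃ γ : Gp p → ℝ, ∀ x, γ x = (if InCoset Q H c x then β' x else 0) / M := ⟨_, fun _ => rfl⟩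
  have hγ0 : ∀ x, 0 ≤ γ x := fun x => by
    rw [hγ]; refine div_nonneg ?_ hM0; split_ifs <;> [exact h0' x; exact le_rfl]
  have hγ1 : ∑ x, γ x = 1 := by
    simp only [hγ]
    rw [← Finset.sum_div]
    have : ∑ x, (if InCoset Q H c x then β' x else 0) = M := hM.symm
    rw [this, div_self hMp.ne']
  have hγs : ∀ x, γ x ≠ 0 → InCoset Q H c x ∧ a⁻¹ * x ∈ A := by
    intro x hx
    rw [hγ] at hx
    constructor <;> by_contra h
    · rw [if_neg h, zero_div] at hx; exact hx rfl
    · rw [hβ', if_neg h, ite_self, zero_div] at hx; exact hx rfl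
  obtain ⟨y, -, hy⟩ := Finset.exists_ne_zero_of_sum_ne_zero (hγ1.trans_ne one_ne_zero)
  have hy := hγs y hy
  refine ⟨Qᶜ, fun i hi => ?_, size_numerics hκ (one_le_qq _) (one_le_qq _) hK hP0 hKP k1 k3,
    fun z => γ (y * z), ⟨fun z => hγ0 _, ?_⟩, fun z hz => ?_, ⟨H, fun i => (hH i).2, fun z hz i hi => ?_⟩, ?_⟩
  · by_contra h
    exact Finset.mem_compl.1 hi (hQ (by simpa using h))
  · rw [sum_mul_left y γ, hγ1]
  · have e : z = (a⁻¹ * y)⁻¹ * (a⁻¹ * (y * z)) := by group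
    rw [e, pow_two]
    exact Finset.mul_mem_mul (hA _ hy.2) (hγs _ hz).2
  · have hiQ : i ∈ Q := by simpa using hi
    have e : z i = ((c i)⁻¹ * y i)⁻¹ * ((c i)⁻¹ * (y * z) i) := by rw [Pi.mul_apply]; group
    rw [e]
    exact (H i).mul_mem ((H i).inv_mem (hy.1 i hiQ)) ((hγs _ hz).1 i hiQ)
  · intro T hT H' hH' b
    have h1 := s2 T (Finset.disjoint_left.2 fun i hi hi' => Finset.mem_compl.1 (hT hi') hi) (fun i => if i ∈ T then H' i else ⊥)
      (fun i => by split_ifs with h; exacts [hH' i h, ⟨bot_ne_top, Metab.bot⟩]) (y * b)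
    rw [← qq_rpow] at h1
    have e : mass (fun z => γ (y * z)) (InCoset T H' b) = mass β' (fun x => InCoset Q H c x ∧
        InCoset T (fun i => if i ∈ T then H' i else ⊥) (y * b) x) / M := by
      rw [mass, mass, Finset.sum_div]
      refine (Finset.sum_congr rfl fun z _ => ?_).trans (sum_mul_left y _)
      have : InCoset T (fun i => if i ∈ T then H' i else ⊥) (y * b) (y * z) ↔ InCoset T H' b z := by
        refine forall₂_congr fun i hi => ?_
        simp only [if_pos hi, Pi.mul_apply]
        rw [show (y i * b i)⁻¹ * (y i * z i) = (b i)⁻¹ * z i by group]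
      rw [hγ]
      by_cases h2 : InCoset T H' b z <;> by_cases h3 : InCoset Q H c (y * z) <;> simp [this, h2, h3]
    rw [e, Real.rpow_neg (qq_pos T).le, div_le_iff₀ hMp, ← div_eq_inv_mul, le_div_iff₀ (Real.rpow_pos_of_pos (qq_pos T) _)]
    exact h1

end Nu

section Slice

variable {ι : Type*} [Fintype ι] [LinearOrder ι] {p : ι → ℕ} [∀ i, Fact (p i).Prime]

/-- The elements supported on the coordinates in `R`. -/
def GS (p : ι → ℕ) (R : Finset ι) : Subgroup (Gp p) where
  carrier := {x | ∀ i, i ∉ R → x i = 1}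
  mul_mem' := fun {a b} ha hb i hi => by rw [Pi.mul_apply, ha i hi, hb i hi, mul_one]
  one_mem' := fun _ _ => rfl
  inv_mem' := fun {a} ha i hi => by rw [Pi.inv_apply, ha i hi, inv_one]

theorem mem_GS {R : Finset ι} {x : Gp p} : x ∈ GS p R ↔ ∀ i, i ∉ R → x i = 1 := Iff.rfl

theorem GS_conj {R : Finset ι} {x : Gp p} (hx : x ∈ GS p R) (a : Gp p) : a * x * a⁻¹ ∈ GS p R := fun i hi => by
  rw [Pi.mul_apply, Pi.mul_apply, hx i hi, mul_one, ← Pi.mul_apply, mul_inv_cancel, Pi.one_apply]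

/-- The elements of `A ^ n` supported on `R`. -/
noncomputable def slice (A : Finset (Gp p)) (n : ℕ) (R : Finset ι) : Finset (Gp p) := (A ^ n).filter fun x => x ∈ GS p R

theorem mem_slice {A : Finset (Gp p)} {n : ℕ} {R : Finset ι} {x : Gp p} : x ∈ slice A n R ↔ x ∈ A ^ n ∧ x ∈ GS p R :=
  Finset.mem_filter

theorem mul_mem_slice {A : Finset (Gp p)} {n m : ℕ} {R : Finset ι} {x y : Gp p} (hx : x ∈ slice A n R)
    (hy : y ∈ slice A m R) : x * y ∈ slice A (n + m) R := by
  rw [mem_slice] at *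
  exact ⟨by rw [pow_add]; exact Finset.mul_mem_mul hx.1 hy.1, mul_mem hx.2 hy.2⟩

theorem inv_mem_pow {G : Type*} [Group G] [DecidableEq G] {A : Finset G} (hA : ∀ x ∈ A, x⁻¹ ∈ A) (n : ℕ) :
    ∀ x ∈ A ^ n, x⁻¹ ∈ A ^ n := by
  induction n with
  | zero => intro x hx; rw [pow_zero, Finset.mem_one] at *; rw [hx, inv_one]
  | succ n ih =>
    intro x hx
    rw [pow_succ, Finset.mem_mul] at hx
    obtain ⟨y, hy, z, hz, rfl⟩ := hx
    rw [mul_inv_rev, pow_succ']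
    exact Finset.mul_mem_mul (hA z hz) (ih y hy)

theorem inv_mem_slice {A : Finset (Gp p)} (hA : ∀ x ∈ A, x⁻¹ ∈ A) {n : ℕ} {R : Finset ι} {x : Gp p}
    (hx : x ∈ slice A n R) : x⁻¹ ∈ slice A n R := by
  rw [mem_slice] at *
  exact ⟨inv_mem_pow hA n x hx.1, inv_mem hx.2⟩

theorem card_slice_le {A : Finset (Gp p)} {K : ℝ} (hA : Apx K A) (n : ℕ) (R : Finset ι) :
    (#(slice A n R) : ℝ) ≤ K ^ (n + 1) * #(slice A 2 R) := by
  have h := subgroup_slice A hA.2.1 (GS p R) n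
  have h0 : (0:ℝ) < #A := by exact_mod_cast Finset.card_pos.2 ⟨1, hA.1⟩
  have h1 : (#A : ℝ) * #(slice A n R) ≤ #(A ^ (n + 1)) * #(slice A 2 R) := by exact_mod_cast h
  have h2 := mul_le_mul_of_nonneg_right (hA.2.2 (n + 1)) (Nat.cast_nonneg (α := ℝ) #(slice A 2 R))
  refine le_of_mul_le_mul_left ?_ h0
  linarith

theorem card_GS (S : Finset ι) : (#(univ.filter fun x => x ∈ GS p S) : ℝ) = ∏ i ∈ S, (Fintype.card (SL (p i)) : ℝ) := by
  have : (univ.filter fun x => x ∈ GS p S) = Fintype.piFinset fun i => if i ∈ S then (univ : Finset (SL (p i))) else {1} := by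
    ext x
    rw [Finset.mem_filter, Fintype.mem_piFinset, mem_GS]
    refine ⟨fun h i => ?_, fun h => ⟨mem_univ _, fun i hi => ?_⟩⟩
    · by_cases hi : i ∈ S
      · rw [if_pos hi]; exact mem_univ _
      · rw [if_neg hi, h.2 i hi]; exact Finset.mem_singleton_self _
    · have := h i
      rwa [if_neg hi, Finset.mem_singleton] at this
  rw [this, Fintype.card_piFinset, Nat.cast_prod]
  rw [← Finset.prod_subset (Finset.subset_univ S)]
  · exact Finset.prod_congr rfl fun i hi => by rw [if_pos hi, Finset.card_univ]
  · intro i _ hi; rw [if_neg hi]; simp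

end Slice

section Sampling

variable {ι : Type*} [Fintype ι] [LinearOrder ι] {p : ι → ℕ} [∀ i, Fact (p i).Prime]

theorem comm_mem_pow {G : Type*} [Group G] [DecidableEq G] {A : Finset G} (hA : ∀ x ∈ A, x⁻¹ ∈ A) {n : ℕ} {x y : G}
    (hx : x ∈ A ^ n) (hy : y ∈ A ^ n) : ⁅x, y⁆ ∈ A ^ (4 * n) := by
  rw [commutatorElement_def, show 4 * n = n + n + n + n by ring, pow_add, pow_add, pow_add]
  exact Finset.mul_mem_mul (Finset.mul_mem_mul (Finset.mul_mem_mul hx hy) (inv_mem_pow hA n _ hx)) (inv_mem_pow hA n _ hy)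

theorem bin_forall {G : Type*} [Fintype G] {op : G → G → G} {α β : G → ℝ} {P Q W : G → Prop} (hα : ∀ x, α x ≠ 0 → P x)
    (hβ : ∀ x, β x ≠ 0 → Q x) (h : ∀ x y, P x → Q y → W (op x y)) (z : G) (hz : bin op α β z ≠ 0) : W z := by
  obtain ⟨x, y, e, hx, hy⟩ := bin_ne_zero hz
  rw [← e]
  exact h x y (hα x hx) (hβ y hy)

theorem marginal_nonConc {ν : Gp p → ℝ} {κ : ℝ} (hν : IsProb ν) {i : ι} (h2 : p i ≠ 2)
    (h : ∀ H' : ∀ i, Subgroup (SL (p i)), (∀ j ∈ ({i} : Finset ι), H' j ≠ ⊤ ∧ Metab (H' j)) → ∀ b,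
        mass ν (InCoset {i} H' b) ≤ qq p {i} ^ (-(κ / 2)))
    (hl : 240 ≤ (p i : ℝ) ^ (κ / 4)) :
    NonConc (fun H => H ≠ ⊤) ((p i : ℝ) ^ (-(κ / 4))) (push (Pi.evalMonoidHom (fun i => SL (p i)) i) ν) := by
  intro H hH a
  obtain ⟨L, hL, hm, hc⟩ := exists_metab h2 hH
  have hp0 : (0:ℝ) < p i := by exact_mod_cast (Fact.out : (p i).Prime).pos
  refine (coset_mass_le hL hc hν.push.1 (b := (p i : ℝ) ^ (-(κ / 2))) (fun a => ?_) a).trans ?_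
  · have hLt : L ≠ ⊤ := fun h => hH (top_le_iff.1 (h ▸ hL))
    have h1 := h (Function.update (fun _ => ⊥) i L) (fun j hj => by
      obtain rfl := Finset.mem_singleton.1 hj
      rw [Function.update_self]; exact ⟨hLt, hm⟩) (Function.update 1 i a)
    rw [qq, Finset.prod_singleton] at h1
    refine le_trans (le_of_eq ?_) h1
    have h3 := sum_push_mul (Pi.evalMonoidHom (fun i => SL (p i)) i) ν (fun x => if a⁻¹ * x ∈ L then 1 else 0)
    rw [Finset.sum_filter, mass]
    refine (Finset.sum_congr rfl fun x _ => ?_).trans (h3.trans (Finset.sum_congr rfl fun x _ => ?_))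
    · by_cases hx : a⁻¹ * x ∈ L <;> simp [hx]
    · have e : InCoset {i} (Function.update (fun _ => ⊥) i L) (Function.update 1 i a) x ↔ a⁻¹ * x i ∈ L := by
        simp [InCoset]
      by_cases hx : a⁻¹ * x i ∈ L <;> simp [hx, e]
  · have : (p i : ℝ) ^ (-(κ / 4)) = (p i : ℝ) ^ (κ / 4) * (p i : ℝ) ^ (-(κ / 2)) := by
      rw [← Real.rpow_add hp0]; congr 1; ring
    rw [this]
    exact mul_le_mul_of_nonneg_right (by exact_mod_cast hl) (Real.rpow_nonneg hp0.le _)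

/-- Words in samples of `ν` that are nearly uniform in every coordinate of `R`. -/
theorem exists_samples {κ : ℝ} (hκ : 0 < κ) : ∃ m p0 : ℕ, ∀ {ι : Type} [Fintype ι] [LinearOrder ι] {p : ι → ℕ}
    [∀ i, Fact (p i).Prime] (R : Finset ι) (ν : Gp p → ℝ) (A : Finset (Gp p)), (∀ i ∈ R, p0 ≤ p i) → IsProb ν →
    (∀ x ∈ A, x⁻¹ ∈ A) → (∀ z, ν z ≠ 0 → z ∈ A ^ 2) →
    (∃ H : ∀ i, Subgroup (SL (p i)), (∀ i, Metab (H i)) ∧ ∀ z, ν z ≠ 0 → ∀ i ∉ R, z i ∈ H i) →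
    (∀ T ⊆ R, ∀ H' : ∀ i, Subgroup (SL (p i)), (∀ i ∈ T, H' i ≠ ⊤ ∧ Metab (H' i)) → ∀ b,
        mass ν (InCoset T H' b) ≤ qq p T ^ (-(κ / 2))) →
    (∃ α : Gp p → ℝ, IsProb α ∧ (∀ z, α z ≠ 0 → z ∈ A ^ m) ∧
      ∀ i ∈ R, ∀ x, push (Pi.evalMonoidHom (fun i => SL (p i)) i) α x ≤ 2 / Fintype.card (SL (p i))) ∧
    ∃ V : Gp p → ℝ, IsProb V ∧ (∀ z, V z ≠ 0 → z ∈ slice A (16 * m) R) ∧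
      ∀ i ∈ R, (∀ x, x ≠ 1 → push (Pi.evalMonoidHom (fun i => SL (p i)) i) V x ≤ 8192 / Fintype.card (SL (p i))) ∧
        push (Pi.evalMonoidHom (fun i => SL (p i)) i) V 1 ≤ 8192 / p i := by
  obtain ⟨m, p1, hm⟩ := flat_power (κ := κ / 4) (by positivity)
  obtain ⟨p2, hp2⟩ := Filter.eventually_atTop.1 ((tendsto_rpow_atTop (y := κ / 4) (by positivity)).comp
    tendsto_natCast_atTop_atTop |>.eventually (Filter.eventually_ge_atTop (240 : ℝ)))
  refine ⟨2 * (m + 1), max (max p1 p2) 3, ?_⟩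
  intro ι _ _ p _ R ν A hR hν hA hs hH hT
  have hR' : ∀ i ∈ R, p1 ≤ p i ∧ p2 ≤ p i ∧ 3 ≤ p i := fun i hi => by
    have := hR i hi
    simp only [max_le_iff] at this
    exact ⟨this.1.1, this.1.2, this.2⟩
  obtain ⟨α, hα⟩ : ∃ α, α = rpw ν m := ⟨_, rfl⟩
  have hαP : IsProb α := by rw [hα]; exact hν.rpw m
  have hαm : ∀ i ∈ R, ∀ x, push (Pi.evalMonoidHom (fun i => SL (p i)) i) α x ≤ 2 / Fintype.card (SL (p i)) := by
    intro i hi x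
    rw [hα, push_rpw]
    refine hm (p i) (hR' i hi).1 _ hν.push (marginal_nonConc hν (by have := (hR' i hi).2.2; omega)
      (hT _ (Finset.singleton_subset_iff.2 hi)) (hp2 _ (hR' i hi).2.1)) x
  have hαs : ∀ z, α z ≠ 0 → z ∈ A ^ (2 * (m + 1)) := fun z hz => by
    rw [pow_mul]; rw [hα] at hz; exact rpw_support hs m z hz
  refine ⟨⟨α, hαP, hαs, hαm⟩, ?_⟩
  obtain ⟨H, hHm, hHs⟩ := hH
  have hαH : ∀ z, α z ≠ 0 → ∀ i ∉ R, z i ∈ H i := by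
    rw [hα]
    clear hαs hαm hαP hα hm
    induction m with
    | zero => exact hHs
    | succ n ih =>
      intro z hz i hi
      obtain ⟨x, y, e, hx, hy⟩ := bin_ne_zero hz
      rw [← e]
      exact (H i).mul_mem (hHs x hx i hi) (ih y hy i hi)
  obtain ⟨op, hop⟩ : ∃ op : Gp p → Gp p → Gp p, ∀ x y, op x y = ⁅x, y⁆ := ⟨fun x y => ⁅x, y⁆, fun _ _ => rfl⟩
  generalize hn : 16 * (2 * (m + 1)) = n
  refine ⟨bin op (bin op α α) (bin op α α), (hαP.bin hαP).bin (hαP.bin hαP), ?_, ?_⟩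
  · intro z hz
    refine bin_forall (fun u hu => hu) (fun v hv => hv) (fun u v hu hv => ?_) z hz
    refine bin_forall (W := fun u => op u v ∈ _) (fun x hx => hx) (fun y hy => hy) (fun x y hx hy => ?_) u hu
    refine bin_forall (W := fun v => op (op x y) v ∈ _) (fun x hx => hx) (fun y hy => hy) (fun x' y' hx' hy' => ?_) v hv
    rw [hop, hop, hop, mem_slice]
    refine ⟨?_, fun i hi => ?_⟩
    · rw [← hn, show 16 * (2 * (m + 1)) = 4 * (4 * (2 * (m + 1))) by omega]
      clear hn
      generalize 2 * (m + 1) = k at hαs ⊢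
      exact comm_mem_pow hA (comm_mem_pow hA (hαs x hx) (hαs y hy)) (comm_mem_pow hA (hαs x' hx') (hαs y' hy'))
    · exact hHm i _ (hαH x hx i hi) _ (hαH y hy i hi) _ (hαH x' hx' i hi) _ (hαH y' hy' i hi)
  · intro i hi
    have e : ∀ α β : Gp p → ℝ, push (Pi.evalMonoidHom (fun i => SL (p i)) i) (bin op α β) =
        bin (fun x y => ⁅x, y⁆) (push (Pi.evalMonoidHom (fun i => SL (p i)) i) α) (push (Pi.evalMonoidHom (fun i => SL (p i)) i) β) :=
      fun α β => push_bin _ _ _ (fun x y => by rw [hop]; rfl) α β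
    have hp1 : (1:ℝ) ≤ p i := by exact_mod_cast (Fact.out : (p i).Prime).one_le
    have hcard : (p i : ℝ) ≤ Fintype.card (SL (p i)) := by
      have h3 : (3:ℝ) ≤ p i := by exact_mod_cast (hR' i hi).2.2
      have := card_sl_ge (p := p i)
      nlinarith [mul_nonneg (sub_nonneg.2 h3) (sub_nonneg.2 h3)]
    obtain ⟨a, ha⟩ : ∃ a, a = push (Pi.evalMonoidHom (fun i => SL (p i)) i) α := ⟨_, rfl⟩
    have haP : IsProb a := by rw [ha]; exact hαP.push
    have h1 := commutator_law a a 2 (by norm_num) haP.1 haP.1 haP.2.le haP.2.le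
      (fun x _ => by rw [ha]; exact hαm i hi x) (fun x _ => by rw [ha]; exact hαm i hi x)
      (by rw [ha]; exact (hαm i hi 1).trans (by gcongr)) (by rw [ha]; exact (hαm i hi 1).trans (by gcongr))
    rw [e, e, ← ha]
    obtain ⟨w, hw⟩ : ∃ w, w = bin (fun x y => ⁅x, y⁆) a a := ⟨_, rfl⟩
    have hwP : IsProb w := by rw [hw]; exact haP.bin haP
    have hw1 : ∀ x, x ≠ 1 → w x ≤ 32 / Fintype.card (SL (p i)) := fun x hx => by
      rw [hw]; refine le_trans (h1.1 x hx) (by norm_num)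
    have hw2 : w 1 ≤ 32 / p i := by rw [hw]; refine le_trans h1.2 (by norm_num)
    have h2 := commutator_law w w 32 (by norm_num) hwP.1 hwP.1 hwP.2.le hwP.2.le hw1 hw1 hw2 hw2
    rw [← hw]
    exact ⟨fun x hx => le_trans (h2.1 x hx) (by norm_num), le_trans h2.2 (by norm_num)⟩

end Sampling

theorem exists_log_bound {ε : ℝ} (hε : 0 < ε) : ∃ p0 : ℕ, ∀ p : ℕ, [Fact p.Prime] → p0 ≤ p →
    40 * ((Nat.log 2 (Fintype.card (SL p)) : ℝ) + 1) ≤ (p : ℝ) ^ ε := by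
  have h1 := ((isLittleO_log_rpow_atTop hε).bound (show (0:ℝ) < 1 / 400 by norm_num)).and
    ((tendsto_rpow_atTop hε).eventually (Filter.eventually_ge_atTop (80 : ℝ)))
  obtain ⟨p0, hp0⟩ := Filter.eventually_atTop.1 (tendsto_natCast_atTop_atTop.eventually h1)
  refine ⟨p0, fun p _ hp => ?_⟩
  obtain ⟨h2, h3⟩ := hp0 p hp
  have hp1 : (1:ℝ) ≤ p := by exact_mod_cast (Fact.out : p.Prime).one_le
  rw [Real.norm_of_nonneg (Real.log_nonneg hp1), Real.norm_of_nonneg (by positivity)] at h2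
  have h4 : (Nat.log 2 (Fintype.card (SL p)) : ℝ) * Real.log 2 ≤ 3 * Real.log p := by
    have e : ((2:ℝ) ^ (Nat.log 2 (Fintype.card (SL p)))) ≤ (p:ℝ) ^ 3 := by
      refine le_trans ?_ (card_sl_le (p := p))
      exact_mod_cast Nat.pow_log_le_self 2 (Fintype.card_ne_zero)
    have := Real.log_le_log (by positivity) e
    rwa [Real.log_pow, Real.log_pow] at this
  have h5 := Real.log_two_gt_d9
  have h6 : (0:ℝ) ≤ Nat.log 2 (Fintype.card (SL p)) := Nat.cast_nonneg _
  nlinarith [Real.log_nonneg hp1]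

theorem coll_numerics {P D X Y e : ℝ} (hD : 1 ≤ D) (hX : D ≤ X) (hY : D ≤ Y) (he : e ≤ 2) (hP : P ≤ D ^ (-(e - 1 / 2))) :
    4 * X * Y + 16 * P * X ^ 2 * Y ^ (3 / 2 : ℝ) ≤ 20 * D ^ (-e) * (X ^ 2 * Y ^ 2) := by
  have hD0 : 0 < D := by linarith
  have hX0 : 0 < X := by linarith
  have hY0 : 0 < Y := by linarith
  have h1 : 1 ≤ D ^ (-e) * (X * Y) := by
    calc (1:ℝ) ≤ D ^ (-e + 2) := Real.one_le_rpow hD (by linarith)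
      _ = D ^ (-e) * (D * D) := by rw [Real.rpow_add hD0, Real.rpow_two, sq]
      _ ≤ _ := by gcongr
  have h2 : P * Y ^ (3 / 2 : ℝ) ≤ D ^ (-e) * Y ^ 2 := by
    calc P * Y ^ (3 / 2 : ℝ) ≤ D ^ (-(e - 1 / 2)) * Y ^ (3 / 2 : ℝ) := by gcongr
      _ = D ^ (-e) * (D ^ (1 / 2 : ℝ) * Y ^ (3 / 2 : ℝ)) := by
        rw [← mul_assoc, ← Real.rpow_add hD0]; congr 2; ring
      _ ≤ D ^ (-e) * (Y ^ (1 / 2 : ℝ) * Y ^ (3 / 2 : ℝ)) := by gcongr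
      _ = _ := by rw [← Real.rpow_add hY0, ← Real.rpow_two]; norm_num
  have h3 : 0 < X * Y := by positivity
  nlinarith [mul_le_mul_of_nonneg_left h1 h3.le, mul_le_mul_of_nonneg_left h2 (sq_nonneg X)]

section Growth

variable {ι : Type*} [Fintype ι] [LinearOrder ι] {p : ι → ℕ} [∀ i, Fact (p i).Prime]

theorem coll_exp_bound {α : Gp p → ℝ} {i : ι}
    (hm : ∀ x, push (Pi.evalMonoidHom (fun i => SL (p i)) i) α x ≤ 2 / Fintype.card (SL (p i)))
    {X Y : Finset (SL (p i))} {D e : ℝ} (hD : 1 ≤ D) (hX : D ≤ #X) (hY : D ≤ #Y) (he : e ≤ 2)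
    (hP : (p i : ℝ) ^ (-(3/2) : ℝ) ≤ D ^ (-(e - 1 / 2))) :
    ∑ a, α a * coll X (a i) Y ≤ Real.exp (-(e * Real.log D - Real.log 20)) * ((#X : ℝ) ^ 2 * (#Y : ℝ) ^ 2) := by
  have h1 := sum_coll_le X Y _ hm
  rw [sum_push_mul] at h1
  have h2 : Real.exp (-(e * Real.log D - Real.log 20)) = 20 * D ^ (-e) := by
    rw [Real.rpow_def_of_pos (by linarith), ← Real.exp_log (show (0:ℝ) < 20 by norm_num), ← Real.exp_add, Real.exp_log (by norm_num)]
    congr 1; ring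
  rw [h2]
  exact h1.trans (coll_numerics hD hX hY he hP)

theorem card_sand_le {A B : Finset (Gp p)} {K : ℝ} (hA : Apx K A) {R : Finset ι} {c : ℕ} (hB : B ⊆ slice A 2 R)
    {a : Gp p} (ha : a ∈ A ^ c) : (#(sand B a B) : ℝ) ≤ K ^ (2 * c + 5) * #(slice A 2 R) := by
  refine le_trans ?_ (card_slice_le hA (2 * c + 4) R)
  refine Nat.cast_le.2 (Finset.card_le_card_of_injOn (fun x => x * a⁻¹) ?_ ?_)
  · intro x hx
    obtain ⟨b, hb, b', hb', rfl⟩ := mem_sand.1 hx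
    have hb := mem_slice.1 (hB hb)
    have hb' := mem_slice.1 (hB hb')
    show b * a * b' * a⁻¹ ∈ _
    rw [Finset.mem_coe, mem_slice]
    constructor
    · rw [show 2 * c + 4 = 2 + c + 2 + c by ring, pow_add, pow_add, pow_add]
      exact Finset.mul_mem_mul (Finset.mul_mem_mul (Finset.mul_mem_mul hb.1 ha) hb'.1) (inv_mem_pow hA.2.1 c _ ha)
    · rw [show b * a * b' * a⁻¹ = b * (a * b' * a⁻¹) by group]
      exact mul_mem hb.2 (GS_conj hb'.2 a)
  · intro x _ y _ e; exact mul_right_cancel e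

theorem Ch_card_le_one {B : Finset (Gp p)} {R : Finset ι} (hB : ∀ x ∈ B, x ∈ GS p R) {i : ι} (hi : i ∉ R) (x : Gp p) :
    #(Ch i B x) ≤ 1 := by
  refine Finset.card_le_one.2 fun u hu v hv => ?_
  obtain ⟨b, hb, -, rfl⟩ := mem_Ch.1 hu
  obtain ⟨b', hb', -, rfl⟩ := mem_Ch.1 hv
  rw [hB b hb i hi, hB b' hb' i hi]

end Growth

/-- The tree of the slice of an approximate group has small total branching over the
coordinates in which the branching is not nearly full. -/
theorem growth {ε : ℝ} (hε : 0 < ε) : ∃ p0 : ℕ, ∀ {ι : Type} [Fintype ι] [LinearOrder ι] {p : ι → ℕ}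
    [∀ i, Fact (p i).Prime] (R : Finset ι) (A : Finset (Gp p)) (K : ℝ) (c : ℕ) (α : Gp p → ℝ),
    (∀ i ∈ R, p0 ≤ p i) → 1 ≤ K → Apx K A → IsProb α → (∀ z, α z ≠ 0 → z ∈ A ^ c) →
    (∀ i ∈ R, ∀ x, push (Pi.evalMonoidHom (fun i => SL (p i)) i) α x ≤ 2 / Fintype.card (SL (p i))) →
    ∃ B ⊆ slice A 2 R, B.Nonempty ∧ ∃ D : ι → ℝ, (∀ i, 1 ≤ D i) ∧
      (∀ i ∈ R, ∀ x ∈ B, D i ≤ #(Ch i B x) ∧ (#(Ch i B x) : ℝ) ≤ 2 * D i) ∧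
      (#(slice A 2 R) : ℝ) ≤ #B * qq p R ^ ε ∧ (2:ℝ) ^ #R ≤ qq p R ^ ε ∧
      ∏ i ∈ R.filter (fun i => D i < (p i : ℝ) ^ (2.9 : ℝ)), D i ≤ (K ^ (2 * c + 5) * qq p R ^ ε) ^ 100 := by
  obtain ⟨p0, hp0⟩ := exists_log_bound hε
  refine ⟨p0, ?_⟩
  intro ι _ _ p _ R A K c α hR hK hA hα hs hm
  obtain ⟨L, hL⟩ : ∃ L : ι → ℝ, ∀ i, L i = (Nat.log 2 (Fintype.card (SL (p i))) : ℝ) + 1 := ⟨_, fun _ => rfl⟩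
  have hL1 : ∀ i, 1 ≤ L i := fun i => by rw [hL]; exact le_add_of_nonneg_left (Nat.cast_nonneg _)
  have hLR : ∏ i ∈ R, 40 * L i ≤ qq p R ^ ε := by
    rw [qq_rpow]
    refine Finset.prod_le_prod (fun i _ => by linarith [hL1 i]) fun i hi => ?_
    rw [hL]; exact hp0 (p i) (hR i hi)
  have h1s : (1 : Gp p) ∈ slice A 2 R := mem_slice.2 ⟨by
    rw [pow_two, ← one_mul (1 : Gp p)]; exact Finset.mul_mem_mul hA.1 hA.1, one_mem _⟩
  obtain ⟨B, hB, hBn, ⟨d, hd⟩, hc⟩ := regularize (slice A 2 R) ⟨1, h1s⟩ R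
  have hBR : ∀ x ∈ B, x ∈ GS p R := fun x hx => (mem_slice.1 (hB hx)).2
  have hc' : (#(slice A 2 R) : ℝ) ≤ #B * ∏ i ∈ R, L i := by
    simp only [hL]
    exact_mod_cast hc
  obtain ⟨D, hD⟩ : ∃ D : ι → ℝ, ∀ i, D i = (2:ℝ) ^ d i := ⟨_, fun _ => rfl⟩
  have hD1 : ∀ i, 1 ≤ D i := fun i => by rw [hD]; exact one_le_pow₀ (by norm_num)
  have hCh : ∀ i ∈ R, ∀ x ∈ B, D i ≤ #(Ch i B x) ∧ (#(Ch i B x) : ℝ) ≤ 2 * D i := by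
    intro i hi x hx
    have h0 : #(Ch i B x) ≠ 0 := (Finset.card_pos.2 (Ch_nonempty hx)).ne'
    rw [hD, ← hd i hi x hx]
    constructor
    · exact_mod_cast Nat.pow_log_le_self 2 h0
    · have := (Nat.lt_pow_succ_log_self (b := 2) (by norm_num) #(Ch i B x)).le
      rw [Nat.pow_succ, mul_comm] at this
      exact_mod_cast this
  have hpR1 : 1 ≤ ∏ i ∈ R, L i := Finset.one_le_prod fun i _ => hL1 i
  have h40 : ∏ i ∈ R, 40 * L i = (∏ i ∈ R, 40) * ∏ i ∈ R, L i := Finset.prod_mul_distrib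
  have h40' : (1:ℝ) ≤ ∏ i ∈ R, 40 := by rw [Finset.prod_const]; exact one_le_pow₀ (by norm_num)
  refine ⟨B, hB, hBn, D, hD1, hCh, hc'.trans ?_, ?_, ?_⟩
  · refine mul_le_mul_of_nonneg_left (le_trans ?_ hLR) (Nat.cast_nonneg _)
    rw [h40]; nlinarith
  · refine le_trans ?_ hLR
    rw [← Finset.prod_const]
    exact Finset.prod_le_prod (fun _ _ => by norm_num) fun i _ => by linarith [hL1 i]
  obtain ⟨J, hJ⟩ : ∃ J, J = R.filter (fun i => D i < (p i : ℝ) ^ (2.9 : ℝ)) := ⟨_, rfl⟩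
  rw [← hJ]
  obtain ⟨g, hg⟩ : ∃ g : ι → ℝ, ∀ i, g i = if i ∈ R then (if i ∈ J then 1.01 else 1) * Real.log (D i) - Real.log 20 else 0 :=
    ⟨_, fun _ => rfl⟩
  have hp1 : ∀ i, (1:ℝ) ≤ p i := fun i => by exact_mod_cast (Fact.out : (p i).Prime).one_le
  have hgB : ∀ i, ∀ x ∈ B, ∀ y ∈ B, ∑ a, α a * coll (Ch i B x) (a i) (Ch i B y) ≤
      Real.exp (-g i) * ((#(Ch i B x) : ℝ) ^ 2 * (#(Ch i B y) : ℝ) ^ 2) := by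
    intro i x hx y hy
    by_cases hi : i ∈ R
    · rw [hg, if_pos hi]
      refine coll_exp_bound (hm i hi) (hD1 i) (hCh i hi x hx).1 (hCh i hi y hy).1 (by split_ifs <;> norm_num) ?_
      split_ifs with hiJ
      · rw [hJ, Finset.mem_filter] at hiJ
        calc (p i : ℝ) ^ (-(3/2) : ℝ) ≤ ((p i : ℝ) ^ (2.9:ℝ)) ^ (-(0.51) : ℝ) := by
              rw [← Real.rpow_mul (by linarith [hp1 i])]
              exact Real.rpow_le_rpow_of_exponent_le (hp1 i) (by norm_num)
          _ ≤ D i ^ (-(0.51) : ℝ) := Real.rpow_le_rpow_of_nonpos (by linarith [hD1 i]) hiJ.2.le (by norm_num)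
          _ = _ := by norm_num
      · have hD3 : D i ≤ (p i : ℝ) ^ 3 := by
          refine (hCh i hi x hx).1.trans (le_trans ?_ (card_sl_le (p := p i)))
          exact_mod_cast Finset.card_le_univ _
        calc (p i : ℝ) ^ (-(3/2) : ℝ) = ((p i : ℝ) ^ 3) ^ (-(1 / 2) : ℝ) := by
              rw [← Real.rpow_natCast, ← Real.rpow_mul (by linarith [hp1 i])]; norm_num
          _ ≤ D i ^ (-(1/2) : ℝ) := Real.rpow_le_rpow_of_nonpos (by linarith [hD1 i]) hD3 (by norm_num)
          _ = _ := by norm_num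
    · rw [hg, if_neg hi, neg_zero, Real.exp_zero, one_mul]
      calc ∑ a, α a * coll (Ch i B x) (a i) (Ch i B y)
          ≤ ∑ a, α a * ((#(Ch i B x) : ℝ) ^ 2 * (#(Ch i B y) : ℝ) ^ 2) :=
            Finset.sum_le_sum fun a _ => mul_le_mul_of_nonneg_left (by exact_mod_cast coll_le _ _ _) (hα.1 a)
        _ = _ := by rw [← Finset.sum_mul, hα.2, one_mul]
  have hT := tree_growth B hBn α hα.1 hα.2 g hgB
  have hBpos : (0:ℝ) < #B := by exact_mod_cast Finset.card_pos.2 hBn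
  have hspos : (0:ℝ) < #(slice A 2 R) := by exact_mod_cast Finset.card_pos.2 ⟨1, h1s⟩
  have hsand : ∑ a, α a * Real.log (#(sand B a B) : ℕ) ≤ Real.log (K ^ (2 * c + 5) * #(slice A 2 R)) := by
    calc _ ≤ ∑ a, α a * Real.log (K ^ (2 * c + 5) * #(slice A 2 R)) := by
          refine Finset.sum_le_sum fun a _ => ?_
          by_cases ha : α a = 0
          · rw [ha, zero_mul, zero_mul]
          · refine mul_le_mul_of_nonneg_left (Real.log_le_log ?_ (card_sand_le hA hB (hs a ha))) (hα.1 a)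
            obtain ⟨b, hb⟩ := hBn
            exact_mod_cast Finset.card_pos.2 ⟨b * a * b, mem_sand.2 ⟨b, hb, b, hb, rfl⟩⟩
      _ = _ := by rw [← Finset.sum_mul, hα.2, one_mul]
  have hBle : (#B : ℝ) ≤ ∏ i ∈ R, 2 * D i := by
    refine (card_le_prod_Ch B (fun i => if i ∈ R then 2 * D i else 1) (fun i => ?_) fun i x hx => ?_).trans (le_of_eq ?_)
    · split_ifs <;> linarith [hD1 i]
    · split_ifs with hi
      · exact (hCh i hi x hx).2
      · exact_mod_cast Ch_card_le_one hBR hi x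
    · rw [← Finset.prod_filter]; congr 1; ext i; simp
  have hsum : ∑ i, g i = ∑ i ∈ R, Real.log (D i) + 0.01 * ∑ i ∈ J, Real.log (D i) - ∑ i ∈ R, Real.log 20 := by
    have e1 : ∑ i, g i = ∑ i ∈ R, ((if i ∈ J then 1.01 else 1) * Real.log (D i) - Real.log 20) := by
      simp only [hg]; rw [← Finset.sum_filter]; congr 1; ext i; simp
    have e2 : ∑ i ∈ J, Real.log (D i) = ∑ i ∈ R, if i ∈ J then Real.log (D i) else 0 := by
      rw [← Finset.sum_filter]; congr 1; ext i; rw [hJ]; simp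
    rw [e1, e2, Finset.mul_sum, ← Finset.sum_add_distrib, ← Finset.sum_sub_distrib]
    refine Finset.sum_congr rfl fun i _ => ?_
    split_ifs <;> ring
  have hfin : (0.01:ℝ) * ∑ i ∈ J, Real.log (D i) ≤ Real.log (K ^ (2 * c + 5) * qq p R ^ ε) := by
    have hK0 : (0:ℝ) < K ^ (2 * c + 5) := by positivity
    have h1 : Real.log (#(slice A 2 R)) ≤ ∑ i ∈ R, Real.log (D i) + Real.log (∏ i ∈ R, 2 * L i) := by
      calc _ ≤ Real.log ((∏ i ∈ R, D i) * ∏ i ∈ R, 2 * L i) := by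
            refine Real.log_le_log hspos (hc'.trans ((mul_le_mul_of_nonneg_right hBle (by linarith)).trans (le_of_eq ?_)))
            rw [← Finset.prod_mul_distrib, ← Finset.prod_mul_distrib]
            exact Finset.prod_congr rfl fun i _ => by ring
        _ = _ := by
            rw [Real.log_mul (Finset.prod_pos fun i _ => by linarith [hD1 i]).ne'
              (Finset.prod_pos fun i _ => by linarith [hL1 i]).ne', Real.log_prod fun i _ => by linarith [hD1 i]]
    have h2 : ∑ i ∈ R, Real.log 20 + Real.log (∏ i ∈ R, 2 * L i) = Real.log (∏ i ∈ R, 40 * L i) := by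
      rw [Real.log_prod fun i _ => by linarith [hL1 i], Real.log_prod fun i _ => by linarith [hL1 i],
        ← Finset.sum_add_distrib]
      refine Finset.sum_congr rfl fun i _ => ?_
      rw [← Real.log_mul (by norm_num) (by linarith [hL1 i])]; congr 1; ring
    have h3 : Real.log (∏ i ∈ R, 40 * L i) ≤ Real.log (qq p R ^ ε) :=
      Real.log_le_log (Finset.prod_pos fun i _ => by linarith [hL1 i]) hLR
    rw [Real.log_mul hK0.ne' hspos.ne'] at hsand
    rw [Real.log_mul hK0.ne' (Real.rpow_pos_of_pos (qq_pos R) ε).ne']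
    linarith
  have hZ : (0:ℝ) < K ^ (2 * c + 5) * qq p R ^ ε := mul_pos (by positivity) (Real.rpow_pos_of_pos (qq_pos R) ε)
  rw [← Real.log_le_log_iff (Finset.prod_pos fun i _ => by linarith [hD1 i]) (by positivity),
    Real.log_prod fun i _ => by linarith [hD1 i], Real.log_pow]
  push_cast
  linarith

section Sections

variable {ι : Type*} [Fintype ι] [LinearOrder ι] {p : ι → ℕ} [∀ i, Fact (p i).Prime]

theorem gowers_full {p : ℕ} [Fact p.Prime] (hp : 16 ≤ p) {X Y Z : Finset (SL p)} (hX : (p:ℝ) ^ (2.9:ℝ) ≤ #X)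
    (hY : (p:ℝ) ^ (2.9:ℝ) ≤ #Y) (hZ : (p:ℝ) ^ (2.9:ℝ) ≤ #Z) (g : SL p) : g ∈ X * Y * Z := by
  refine gowers X Y Z ?_ g
  have hp' : (16:ℝ) ≤ p := by exact_mod_cast hp
  have hp0 : (0:ℝ) < p := by linarith
  obtain ⟨s, hs⟩ : ∃ s, s = (p:ℝ) ^ (2.9:ℝ) := ⟨_, rfl⟩
  have hs0 : 0 < s := by rw [hs]; positivity
  rw [← hs] at hX hY hZ
  have h1 : (p:ℝ) ^ (0.3:ℝ) < ((p:ℝ) - 1) / 2 := by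
    have h2 : (p:ℝ) ^ (0.3:ℝ) ≤ (p:ℝ) ^ (1/2:ℝ) := Real.rpow_le_rpow_of_exponent_le (by linarith) (by norm_num)
    rw [← Real.sqrt_eq_rpow] at h2
    have h3 : Real.sqrt p ≤ p / 4 := Real.sqrt_le_iff.2 ⟨by linarith, by nlinarith⟩
    linarith
  have h4 : s ^ 3 * (p:ℝ) ^ (0.3:ℝ) = (p:ℝ) ^ 9 := by
    rw [hs, ← Real.rpow_natCast, ← Real.rpow_mul hp0.le, ← Real.rpow_add hp0, ← Real.rpow_natCast]; norm_num
  calc (Fintype.card (SL p) : ℝ) ^ 3 ≤ ((p:ℝ) ^ 3) ^ 3 := pow_le_pow_left₀ (Nat.cast_nonneg _) card_sl_le 3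
    _ = s ^ 3 * (p:ℝ) ^ (0.3:ℝ) := by rw [h4]; ring
    _ < s ^ 3 * (((p:ℝ) - 1) / 2) := by gcongr
    _ = s * s * s * (((p:ℝ) - 1) / 2) := by ring
    _ ≤ _ := by
      have : 0 ≤ ((p:ℝ) - 1) / 2 := by linarith
      gcongr

theorem exists_section {A B : Finset (Gp p)} {R S : Finset ι} (hB : B ⊆ slice A 2 R) (hBn : B.Nonempty)
    (hS : ∀ i ∈ S, 16 ≤ p i ∧ ∀ x ∈ B, (p i : ℝ) ^ (2.9:ℝ) ≤ #(Ch i B x)) (g : Gp p) :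
    ∃ s ∈ slice A 6 R, ∀ i ∈ S, s i = g i := by
  obtain ⟨x, hx, y, hy, z, hz, h⟩ := surjection B hBn S (fun i hi x hx y hy z hz g =>
    gowers_full (hS i hi).1 ((hS i hi).2 x hx) ((hS i hi).2 y hy) ((hS i hi).2 z hz) g) g
  refine ⟨x * y * z, ?_, fun i hi => ?_⟩
  · rw [show 6 = 2 + 2 + 2 by norm_num]
    exact mul_mem_slice (mul_mem_slice (hB hx) (hB hy)) (hB hz)
  · rw [Pi.mul_apply, Pi.mul_apply, h i hi]

theorem card_slice_mul_le {A : Finset (Gp p)} {R J S : Finset ι} (hJR : J ⊆ R) (hJS : ∀ i ∈ S, i ∉ J)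
    (hsec : ∀ g : Gp p, ∃ s ∈ slice A 6 R, ∀ i ∈ S, s i = g i) (n : ℕ) :
    (#(slice A n J) : ℝ) * ∏ i ∈ S, (Fintype.card (SL (p i)) : ℝ) ≤ #(slice A (n + 6) R) := by
  choose σ hσ hσS using hsec
  rw [← card_GS, ← Nat.cast_mul, ← Finset.card_product]
  refine Nat.cast_le.2 (Finset.card_le_card_of_injOn (fun q => q.1 * σ q.2) ?_ ?_)
  · intro q hq
    rw [Finset.mem_coe, Finset.mem_product] at hq
    refine mul_mem_slice ?_ (hσ _)
    have := mem_slice.1 hq.1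
    exact mem_slice.2 ⟨this.1, fun i hi => this.2 i fun h => hi (hJR h)⟩
  · intro q hq q' hq' e
    rw [Finset.mem_coe, Finset.mem_product, Finset.mem_filter] at hq hq'
    have e : q.1 * σ q.2 = q'.1 * σ q'.2 := e
    have h2 : q.2 = q'.2 := by
      funext i
      by_cases hi : i ∈ S
      · have := congrFun e i
        rwa [Pi.mul_apply, Pi.mul_apply, (mem_slice.1 hq.1).2 i (hJS i hi), (mem_slice.1 hq'.1).2 i (hJS i hi), one_mul, one_mul,
          hσS _ i hi, hσS _ i hi] at this
      · rw [hq.2.2 i hi, hq'.2.2 i hi]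
    rw [h2] at e
    exact Prod.ext (mul_right_cancel e) h2

/-- An element of a small slice is central at most primes, since it has few conjugates. -/
theorem qq_noncentral_le {κ : ℝ} {A : Finset (Gp p)} (hA : ∀ x ∈ A, x⁻¹ ∈ A) {R J : Finset ι} (hJR : J ⊆ R) {ν : Gp p → ℝ}
    (hν : IsProb ν) (hs : ∀ z, ν z ≠ 0 → z ∈ A ^ 2)
    (hT : ∀ T ⊆ R, ∀ H' : ∀ i, Subgroup (SL (p i)), (∀ i ∈ T, H' i ≠ ⊤ ∧ Metab (H' i)) → ∀ b,
        mass ν (InCoset T H' b) ≤ qq p T ^ (-(κ / 2)))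
    {n : Gp p} {k : ℕ} (hn : n ∈ slice A k J) {K1 : ℝ} (hK : (#(slice A (k + 4) J) : ℝ) ≤ K1) :
    qq p (J.filter fun j => n j ∉ Subgroup.center (SL (p j))) ^ (κ / 2) ≤ K1 := by
  obtain ⟨T, hTd⟩ : ∃ T, T = J.filter fun j => n j ∉ Subgroup.center (SL (p j)) := ⟨_, rfl⟩
  rw [← hTd]
  have hmem : ∀ a, ν a ≠ 0 → a * n * a⁻¹ ∈ slice A (k + 4) J := fun a ha => by
    have hn := mem_slice.1 hn
    refine mem_slice.2 ⟨?_, GS_conj hn.2 a⟩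
    rw [show k + 4 = 2 + k + 2 by ring, pow_add, pow_add]
    exact Finset.mul_mem_mul (Finset.mul_mem_mul (hs a ha) hn.1) (inv_mem_pow hA 2 _ (hs a ha))
  have key : ∀ w, mass ν (fun a => a * n * a⁻¹ = w) ≤ qq p T ^ (-(κ / 2)) := by
    intro w
    by_cases h : ∃ a0 : Gp p, a0 * n * a0⁻¹ = w
    · obtain ⟨a0, rfl⟩ := h
      refine le_trans (mass_mono hν.1 fun a ha => ?_) (hT T (hTd ▸ (Finset.filter_subset _ _).trans hJR)
        (fun i => Subgroup.centralizer {n i}) ?_ a0)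
      · intro i _
        rw [mem_cent]
        have h1 : (a0⁻¹ * a) * n = n * (a0⁻¹ * a) := by
          have : a * n = a0 * n * a0⁻¹ * a := by rw [← ha]; group
          rw [mul_assoc, this]; group
        exact congrFun h1 i
      · intro i hi
        rw [hTd, Finset.mem_filter] at hi
        refine ⟨fun h => hi.2 ?_, Metab.of_comm fun x hx y hy => ?_⟩
        · rw [Subgroup.mem_center_iff]
          intro g
          have : g ∈ Subgroup.centralizer {n i} := by rw [h]; exact Subgroup.mem_top g
          rwa [mem_cent] at this
        · exact centralizer_comm hi.2 (mem_cent.1 hx) (mem_cent.1 hy)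
    · refine le_trans (le_of_eq ?_) (Real.rpow_nonneg (qq_pos T).le _)
      exact Finset.sum_eq_zero fun a _ => if_neg fun e => h ⟨a, e⟩
  have h1 : (1:ℝ) ≤ #(slice A (k + 4) J) * qq p T ^ (-(κ / 2)) := by
    rw [← hν.2]
    calc ∑ a, ν a = ∑ w ∈ slice A (k + 4) J, mass ν (fun a => a * n * a⁻¹ = w) := by
          simp only [mass]
          rw [Finset.sum_comm]
          refine Finset.sum_congr rfl fun a _ => ?_
          rw [Finset.sum_ite_eq]
          by_cases ha : ν a = 0
          · rw [ha, ite_self]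
          · rw [if_pos (hmem a ha)]
      _ ≤ ∑ _w ∈ slice A (k + 4) J, qq p T ^ (-(κ / 2)) := Finset.sum_le_sum fun w _ => key w
      _ = _ := by rw [Finset.sum_const, nsmul_eq_mul]
  rw [Real.rpow_neg (qq_pos T).le, ← div_eq_mul_inv, one_le_div (Real.rpow_pos_of_pos (qq_pos T) _)] at h1
  exact h1.trans hK

/-- There is no approximate homomorphism from the coordinates in `S` to a coordinate outside `S`
whose graph carries a spread-out measure. -/
theorem no_local_hom (hp : Function.Injective p) {S : Finset ι} (hS : ∀ i ∈ S, 5 ≤ p i) {j : ι} (hj : j ∉ S)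
    (hpj : 10 ^ 14 ≤ p j) (f : Gp p → SL (p j) ⧸ Subgroup.center (SL (p j)))
    (hinv : ∀ i, i ∉ S → ∀ x : Gp p, ∀ g, f (x * (Pi.mulSingle i g : Gp p)) = f x)
    (h1 : cnt (fun q : Gp p × Gp p => f q.1 * f q.2 ≠ f (q.1 * q.2)) ≤ 1 / 100 * Fintype.card (Gp p) * Fintype.card (Gp p))
    {V : Gp p → ℝ} (hV : IsProb V)
    (hV1 : ∀ x, x ≠ 1 → push (Pi.evalMonoidHom (fun i => SL (p i)) j) V x ≤ 8192 / Fintype.card (SL (p j)))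
    (hV0 : push (Pi.evalMonoidHom (fun i => SL (p i)) j) V 1 ≤ 8192 / p j)
    (h2 : ∑ v, V v * cnt (fun y => (QuotientGroup.mk (v j) : SL (p j) ⧸ Subgroup.center (SL (p j))) * f y ≠ f (v * y)) ≤
      1 / 100 * Fintype.card (Gp p)) : False := by
  obtain ⟨N, hN⟩ : ∃ N : ℝ, N = Fintype.card (Gp p) := ⟨_, rfl⟩
  have hN0 : 0 < N := by rw [hN]; exact_mod_cast Fintype.card_pos
  obtain ⟨F, hF⟩ := hom_stability f (θ := 1 / 100) (by norm_num) h1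
  rw [← hN] at hF h2
  have htrans : ∀ P : Gp p → Prop, ∀ g, cnt (fun x => P (x * g)) = cnt P := fun P g =>
    cnt_equiv (Equiv.mulRight g) P fun x => Iff.rfl
  have htrans' : ∀ P : Gp p → Prop, ∀ g, cnt (fun x => P (g * x)) = cnt P := fun P g =>
    cnt_equiv (Equiv.mulLeft g) P fun x => Iff.rfl
  have hFS : ∀ i, i ∉ S → ∀ g, F (Pi.mulSingle i g : Gp p) = 1 := by
    intro i hi g
    by_contra hne
    have h3 : cnt (fun _ : Gp p => True) ≤ cnt (fun x => f x ≠ F x) + cnt (fun x => f (x * (Pi.mulSingle i g : Gp p)) ≠ F (x * (Pi.mulSingle i g : Gp p))) := by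
      refine cnt_le_add fun x _ => ?_
      by_contra h
      push Not at h
      rw [hinv i hi, h.1, map_mul, left_eq_mul] at h
      exact hne h.2
    rw [htrans (fun x => f x ≠ F x), cnt_true, ← hN] at h3
    linarith
  obtain ⟨P, hP⟩ : ∃ P : Subgroup (SL (p j)), P = (F.range).comap (QuotientGroup.mk' (Subgroup.center (SL (p j)))) := ⟨_, rfl⟩
  have hbad : ∀ v : Gp p, v j ∉ P → 94 / 100 * N ≤
      cnt (fun y => (QuotientGroup.mk (v j) : SL (p j) ⧸ Subgroup.center (SL (p j))) * f y ≠ f (v * y)) := by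
    intro v hv
    have h3 : cnt (fun _ : Gp p => True) ≤ cnt (fun x => f x ≠ F x ∨ f (v * x) ≠ F (v * x)) + cnt (fun y => (QuotientGroup.mk (v j) : SL (p j) ⧸ Subgroup.center (SL (p j))) * f y ≠ f (v * y)) := by
      refine cnt_le_add fun x _ => ?_
      by_contra h
      push Not at h
      refine hv ?_
      rw [hP, Subgroup.mem_comap]
      refine ⟨v, ?_⟩
      have := h.2
      rw [h.1.1, h.1.2, map_mul] at this
      exact (mul_right_cancel this).symm
    have h4 : cnt (fun x => f x ≠ F x ∨ f (v * x) ≠ F (v * x)) ≤ cnt (fun x => f x ≠ F x) + cnt (fun x => f (v * x) ≠ F (v * x)) :=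
      cnt_le_add fun x h => h
    rw [htrans' (fun x => f x ≠ F x)] at h4
    rw [cnt_true, ← hN] at h3
    linarith
  have hmass : mass V (fun v => v j ∉ P) * (94 / 100 * N) ≤ 1 / 100 * N := by
    refine le_trans ?_ h2
    rw [mass, Finset.sum_mul]
    refine Finset.sum_le_sum fun v _ => ?_
    by_cases hv : v j ∈ P
    · rw [if_neg (not_not.2 hv), zero_mul]; exact mul_nonneg (hV.1 v) (cnt_nonneg _)
    · rw [if_pos hv]; exact mul_le_mul_of_nonneg_left (hbad v hv) (hV.1 v)
  have hmass2 : mass V (fun v => v j ∉ P) ≤ 1 / 2 := by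
    by_contra h
    push Not at h
    nlinarith
  have hmass3 : mass V (fun v => v j ∈ P) + mass V (fun v => v j ∉ P) = 1 := by
    rw [mass, mass, ← Finset.sum_add_distrib, ← hV.2]
    refine Finset.sum_congr rfl fun v _ => ?_
    by_cases hv : v j ∈ P <;> simp [hv]
  obtain ⟨c, hc⟩ : ∃ c : ℝ, c = Fintype.card (SL (p j)) := ⟨_, rfl⟩
  have hc0 : 0 < c := by rw [hc]; exact_mod_cast Fintype.card_pos
  obtain ⟨X, hX⟩ : ∃ X : Finset (SL (p j)), ∀ x, x ∈ X ↔ x ∈ P := ⟨univ.filter (· ∈ P), fun x => by simp⟩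
  have hpj' : (10:ℝ) ^ 14 ≤ p j := by exact_mod_cast hpj
  have hmass4 : mass V (fun v => v j ∈ P) ≤ 8192 / p j + #X * (8192 / c) := by
    have e : mass V (fun v => v j ∈ P) = ∑ x ∈ X, push (Pi.evalMonoidHom (fun i => SL (p i)) j) V x := by
      have h3 := sum_push_mul (Pi.evalMonoidHom (fun i => SL (p i)) j) V (fun x => if x ∈ P then 1 else 0)
      calc _ = ∑ x, V x * (if (Pi.evalMonoidHom (fun i => SL (p i)) j) x ∈ P then 1 else 0) := by
            rw [mass]
            refine Finset.sum_congr rfl fun v _ => ?_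
            by_cases hv : v j ∈ P <;> simp [hv]
        _ = _ := by
            rw [← h3]
            simp only [mul_ite, mul_one, mul_zero]
            rw [← Finset.sum_filter]
            congr 1; ext x; rw [Finset.mem_filter, hX]; simp
    rw [e, ← Finset.add_sum_erase X _ ((hX 1).2 P.one_mem)]
    refine add_le_add hV0 ?_
    calc _ ≤ ∑ _x ∈ X.erase 1, 8192 / c := Finset.sum_le_sum fun x hx => by
          rw [hc]; exact hV1 x (Finset.ne_of_mem_erase hx)
      _ = #(X.erase 1) * (8192 / c) := by rw [Finset.sum_const, nsmul_eq_mul]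
      _ ≤ _ := by
          refine mul_le_mul_of_nonneg_right ?_ (by positivity)
          exact_mod_cast Finset.card_le_card (Finset.erase_subset _ _)
  have hXc : c / 32768 ≤ #X := by
    have h3 : 8192 / (p j : ℝ) ≤ 1 / 4 := by
      rw [div_le_div_iff₀ (by linarith) (by norm_num)]; linarith
    have h4 : 1 / 4 ≤ #X * (8192 / c) := by linarith
    rw [← mul_div_assoc, div_le_div_iff₀ (by norm_num) hc0] at h4
    rw [div_le_iff₀ (by norm_num)]; linarith
  have hPtop : ∀ g, g ∈ P := by
    intro g
    have h3 : g ∈ X * X * X := by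
      refine gowers X X X ?_ g
      rw [← hc]
      calc c ^ 3 < (c / 32768) ^ 3 * ((10 ^ 14 - 1) / 2) := by
            have := pow_pos hc0 3
            rw [div_pow]; norm_num; linarith
        _ ≤ (c / 32768) ^ 3 * (((p j : ℝ) - 1) / 2) := by gcongr
        _ ≤ _ := by
            have : 0 ≤ ((p j : ℝ) - 1) / 2 := by linarith
            rw [pow_three]
            calc _ = c / 32768 * (c / 32768) * (c / 32768) * (((p j : ℝ) - 1) / 2) := by ring
              _ ≤ _ := by gcongr
    obtain ⟨w, hw, z, hz, rfl⟩ := Finset.mem_mul.1 h3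
    obtain ⟨x, hx, y, hy, rfl⟩ := Finset.mem_mul.1 hw
    exact P.mul_mem (P.mul_mem ((hX _).1 hx) ((hX _).1 hy)) ((hX _).1 hz)
  have hsurj : Function.Surjective F := by
    intro w
    obtain ⟨g, rfl⟩ := QuotientGroup.mk'_surjective _ w
    have := hPtop g
    rw [hP, Subgroup.mem_comap] at this
    exact this
  have hiS : ∀ i, (∃ x : SL (p i), F (Pi.mulSingle i x : Gp p) ≠ 1) → i ∈ S := by
    intro i ⟨x, hx⟩
    by_contra hi
    exact hx (hFS i hi x)
  obtain ⟨i, hi, e⟩ := exists_index_of_surjective (by omega) F hsurj fun i hi => hS i (hiS i hi)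
  rw [hp e] at hi
  exact hj (hiS j hi)

end Sections

theorem sum_mul_mass_le {X ι : Type*} [Fintype X] (J : Finset ι) (c : ι → ℝ) {β : X → ℝ} (h0 : ∀ x, 0 ≤ β x)
    (P : ι → X → Prop) {t : ℝ} (h : ∀ x, β x ≠ 0 → ∑ j ∈ J.filter (fun j => P j x), c j ≤ t) :
    ∑ j ∈ J, c j * mass β (P j) ≤ t * ∑ x, β x := by
  simp only [mass, Finset.mul_sum]
  rw [Finset.sum_comm]
  refine Finset.sum_le_sum fun x _ => ?_
  have h1 : ∑ j ∈ J, c j * (if P j x then β x else 0) = (∑ j ∈ J.filter (fun j => P j x), c j) * β x := by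
    rw [Finset.sum_filter, Finset.sum_mul]
    exact Finset.sum_congr rfl fun j _ => by split_ifs <;> simp
  rw [h1]
  by_cases hx : β x = 0
  · simp [hx]
  · exact mul_le_mul_of_nonneg_right (h x hx) (h0 x)

theorem cnt_eq_mass {X : Type*} [Fintype X] (P : X → Prop) : cnt P = mass (fun _ => 1) P := by
  simp [cnt, mass]

theorem sum_mul_cnt {X Y : Type*} [Fintype X] [Fintype Y] (V : X → ℝ) (P : X → Y → Prop) :
    ∑ v, V v * cnt (P v) = mass (fun q : X × Y => V q.1) (fun q => P q.1 q.2) := by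
  simp only [cnt_eq_mass, mass, Fintype.sum_prod_type, Finset.mul_sum]
  exact Finset.sum_congr rfl fun x _ => Finset.sum_congr rfl fun y _ => by split_ifs <;> simp

section Local

variable {ι : Type} [Fintype ι] [LinearOrder ι] {p : ι → ℕ} [∀ i, Fact (p i).Prime]

theorem log_qq (T : Finset ι) : Real.log (qq p T) = ∑ i ∈ T, Real.log (p i) :=
  Real.log_prod fun i _ => by exact_mod_cast (Fact.out : (p i).Prime).ne_zero

theorem slice_mono {A : Finset (Gp p)} (h1 : 1 ∈ A) {n m : ℕ} (h : n ≤ m) (R : Finset ι) : slice A n R ⊆ slice A m R :=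
  fun _ hx => mem_slice.2 ⟨Finset.pow_subset_pow_right h1 h (mem_slice.1 hx).1, (mem_slice.1 hx).2⟩

theorem no_large_local (hp : Function.Injective p) {κ : ℝ} (hκ : 0 < κ) {A : Finset (Gp p)} (h1A : 1 ∈ A)
    (hA : ∀ x ∈ A, x⁻¹ ∈ A) {R J S : Finset ι} (hJR : J ⊆ R) (hRJ : ∀ i ∈ R, i ∉ S → i ∈ J) (hJS : ∀ i ∈ S, i ∉ J) (hSR : S ⊆ R)
    (hR : ∀ i ∈ R, 10 ^ 14 ≤ p i) (hsec : ∀ g : Gp p, ∃ s ∈ slice A 6 R, ∀ i ∈ S, s i = g i)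
    {ν : Gp p → ℝ} (hν : IsProb ν) (hs : ∀ z, ν z ≠ 0 → z ∈ A ^ 2)
    (hT : ∀ T ⊆ R, ∀ H' : ∀ i, Subgroup (SL (p i)), (∀ i ∈ T, H' i ≠ ⊤ ∧ Metab (H' i)) → ∀ b,
        mass ν (InCoset T H' b) ≤ qq p T ^ (-(κ / 2)))
    {V : Gp p → ℝ} (hV : IsProb V) {m : ℕ} (hVs : ∀ z, V z ≠ 0 → z ∈ slice A m R)
    (hVm : ∀ i ∈ R, (∀ x, x ≠ 1 → push (Pi.evalMonoidHom (fun i => SL (p i)) i) V x ≤ 8192 / Fintype.card (SL (p i))) ∧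
        push (Pi.evalMonoidHom (fun i => SL (p i)) i) V 1 ≤ 8192 / p i)
    {K1 : ℝ} (hK : (#(slice A (m + 22) J) : ℝ) ≤ K1) : Real.log (qq p J) ≤ 400 / κ * Real.log K1 := by
  choose σ hσ hσS using hsec
  obtain ⟨res, hres⟩ : ∃ res : Gp p → Gp p, ∀ x i, res x i = if i ∈ S then x i else 1 :=
    ⟨fun x i => if i ∈ S then x i else 1, fun _ _ => rfl⟩
  obtain ⟨ψ, hψ⟩ : ∃ ψ : Gp p → Gp p, ∀ x, ψ x = σ (res x) := ⟨_, fun _ => rfl⟩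
  have hψR : ∀ x, ψ x ∈ slice A 6 R := fun x => by rw [hψ]; exact hσ _
  have hψS : ∀ x, ∀ i ∈ S, ψ x i = x i := fun x i hi => by rw [hψ, hσS _ i hi, hres, if_pos hi]
  have hψi : ∀ i, i ∉ S → ∀ x : Gp p, ∀ g, ψ (x * (Pi.mulSingle i g : Gp p)) = ψ x := fun i hi x g => by
    rw [hψ, hψ]
    congr 1
    funext k
    rw [hres, hres]
    by_cases hk : k ∈ S
    · rw [if_pos hk, if_pos hk, Pi.mul_apply, Pi.mulSingle_eq_of_ne (show k ≠ i from fun h => hi (h ▸ hk)), mul_one]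
    · rw [if_neg hk, if_neg hk]
  have toJ : ∀ x ∈ slice A (m + 18) R, (∀ i ∈ S, x i = 1) → x ∈ slice A (m + 18) J := fun x hx h => by
    refine mem_slice.2 ⟨(mem_slice.1 hx).1, mem_GS.2 fun i hi => ?_⟩
    by_cases hiS : i ∈ S
    · exact h i hiS
    · by_cases hiR : i ∈ R
      · exact absurd (hRJ i hiR hiS) hi
      · exact mem_GS.1 (mem_slice.1 hx).2 i hiR
  have bad : ∀ x ∈ slice A (m + 18) R, (∀ i ∈ S, x i = 1) →
      ∑ j ∈ J.filter (fun j => x j ∉ Subgroup.center (SL (p j))), Real.log (p j) ≤ 2 / κ * Real.log K1 := fun x hx h => by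
    have h1 := qq_noncentral_le hA hJR hν hs hT (toJ x hx h) hK
    have h2 := Real.log_le_log (Real.rpow_pos_of_pos (qq_pos _) _) h1
    rw [Real.log_rpow (qq_pos _), log_qq] at h2
    rw [div_mul_eq_mul_div, le_div_iff₀ hκ]
    linarith
  by_contra hcon
  push Not at hcon
  obtain ⟨P, hP⟩ : ∃ P : ι → Gp p × Gp p → Prop, ∀ j q, P j q ↔ (QuotientGroup.mk (ψ q.1 j) : SL (p j) ⧸ Subgroup.center (SL (p j))) *
      QuotientGroup.mk (ψ q.2 j) ≠ QuotientGroup.mk (ψ (q.1 * q.2) j) := ⟨_, fun _ _ => Iff.rfl⟩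
  obtain ⟨P', hP'⟩ : ∃ P' : ι → Gp p × Gp p → Prop, ∀ j q, P' j q ↔ (QuotientGroup.mk (q.1 j) : SL (p j) ⧸ Subgroup.center (SL (p j))) *
      QuotientGroup.mk (ψ q.2 j) ≠ QuotientGroup.mk (ψ (q.1 * q.2) j) := ⟨_, fun _ _ => Iff.rfl⟩
  have key : ∀ j, ∀ a b c : Gp p, (QuotientGroup.mk (a j) : SL (p j) ⧸ Subgroup.center (SL (p j))) *
      QuotientGroup.mk (b j) ≠ QuotientGroup.mk (c j) → (a * b * c⁻¹) j ∉ Subgroup.center (SL (p j)) := fun j a b c h hn => by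
    refine h ?_
    have := (QuotientGroup.eq_one_iff _).2 hn
    rwa [Pi.mul_apply, Pi.mul_apply, Pi.inv_apply, QuotientGroup.mk_mul, QuotientGroup.mk_mul, QuotientGroup.mk_inv,
      mul_inv_eq_one] at this
  have hlog0 : ∀ j, 0 ≤ Real.log (p j) := fun j => Real.log_natCast_nonneg _
  have s1 := sum_mul_mass_le J (fun j => Real.log (p j)) (β := fun _ : Gp p × Gp p => 1) (fun _ => zero_le_one) P
    (t := 2 / κ * Real.log K1) fun q _ => by
      refine le_trans ?_ (bad (ψ q.1 * ψ q.2 * (ψ (q.1 * q.2))⁻¹) ?_ ?_)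
      · exact Finset.sum_le_sum_of_subset_of_nonneg (fun j hj => by
          rw [Finset.mem_filter] at hj ⊢
          exact ⟨hj.1, key j _ _ _ ((hP j q).1 hj.2)⟩) fun j _ _ => hlog0 j
      · refine slice_mono h1A (Nat.le_add_left 18 m) R ?_
        exact mul_mem_slice (n := 6 + 6) (m := 6) (mul_mem_slice (hψR _) (hψR _)) (inv_mem_slice hA (hψR _))
      · intro i hi
        rw [Pi.mul_apply, Pi.mul_apply, Pi.inv_apply, hψS _ i hi, hψS _ i hi, hψS _ i hi, Pi.mul_apply, mul_inv_cancel]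
  have s2 := sum_mul_mass_le J (fun j => Real.log (p j)) (β := fun q : Gp p × Gp p => V q.1) (fun q => hV.1 q.1) P'
    (t := 2 / κ * Real.log K1) fun q hq => by
      refine le_trans ?_ (bad (q.1 * ψ q.2 * (ψ (q.1 * q.2))⁻¹) ?_ ?_)
      · exact Finset.sum_le_sum_of_subset_of_nonneg (fun j hj => by
          rw [Finset.mem_filter] at hj ⊢
          exact ⟨hj.1, key j _ _ _ ((hP' j q).1 hj.2)⟩) fun j _ _ => hlog0 j
      · refine slice_mono h1A (show m + 6 + 6 ≤ m + 18 by omega) R ?_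
        exact mul_mem_slice (mul_mem_slice (hVs _ hq) (hψR _)) (inv_mem_slice hA (hψR _))
      · intro i hi
        rw [Pi.mul_apply, Pi.mul_apply, Pi.inv_apply, hψS _ i hi, hψS _ i hi, Pi.mul_apply, mul_inv_cancel]
  obtain ⟨N, hN⟩ : ∃ N : ℝ, N = Fintype.card (Gp p) := ⟨_, rfl⟩
  have hN0 : 0 < N := by rw [hN]; exact_mod_cast Fintype.card_pos
  have e1 : ∑ _q : Gp p × Gp p, (1:ℝ) = N * N := by simp [hN]
  have e2 : ∑ q : Gp p × Gp p, V q.1 = N := by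
    rw [Fintype.sum_prod_type]
    simp only [Finset.sum_const, Finset.card_univ, nsmul_eq_mul]
    rw [← Finset.mul_sum, hV.2, hN, mul_one]
  rw [e1] at s1
  rw [e2] at s2
  have hlt : ∑ j ∈ J, Real.log (p j) * (mass (fun _ : Gp p × Gp p => 1) (P j) / (N * N) +
      mass (fun q : Gp p × Gp p => V q.1) (P' j) / N) < ∑ j ∈ J, Real.log (p j) * (1 / 100) := by
    have e3 : ∑ j ∈ J, Real.log (p j) * (mass (fun _ : Gp p × Gp p => 1) (P j) / (N * N) +
        mass (fun q : Gp p × Gp p => V q.1) (P' j) / N) =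
        (∑ j ∈ J, Real.log (p j) * mass (fun _ : Gp p × Gp p => 1) (P j)) / (N * N) +
        (∑ j ∈ J, Real.log (p j) * mass (fun q : Gp p × Gp p => V q.1) (P' j)) / N := by
      rw [Finset.sum_div, Finset.sum_div, ← Finset.sum_add_distrib]
      exact Finset.sum_congr rfl fun j _ => by ring
    have s1' := (div_le_iff₀ (mul_pos hN0 hN0)).2 s1
    have s2' := (div_le_iff₀ hN0).2 s2
    rw [e3, ← Finset.sum_mul, ← log_qq]
    have : 400 / κ * Real.log K1 = 100 * (2 / κ * Real.log K1 + 2 / κ * Real.log K1) := by ring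
    linarith
  obtain ⟨j, hj, hlt⟩ := Finset.exists_lt_of_sum_lt hlt
  have hlt' := lt_of_mul_lt_mul_left hlt (hlog0 j)
  have hm0 : 0 ≤ mass (fun _ : Gp p × Gp p => (1:ℝ)) (P j) := mass_nonneg (fun _ => zero_le_one) _
  have hm1 : 0 ≤ mass (fun q : Gp p × Gp p => V q.1) (P' j) := mass_nonneg (fun q : Gp p × Gp p => hV.1 q.1) _
  have a1 : mass (fun _ : Gp p × Gp p => (1:ℝ)) (P j) ≤ 1 / 100 * N * N := by
    have : mass (fun _ : Gp p × Gp p => (1:ℝ)) (P j) / (N * N) ≤ 1 / 100 := by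
      have := div_nonneg hm1 hN0.le
      linarith
    rw [div_le_iff₀ (mul_pos hN0 hN0)] at this
    linarith
  have a2 : mass (fun q : Gp p × Gp p => V q.1) (P' j) ≤ 1 / 100 * N := by
    have : mass (fun q : Gp p × Gp p => V q.1) (P' j) / N ≤ 1 / 100 := by
      have := div_nonneg hm0 (mul_pos hN0 hN0).le
      linarith
    rwa [div_le_iff₀ hN0] at this
  refine no_local_hom hp (S := S) (fun i hi => le_trans (by norm_num) (hR i (hSR hi))) (j := j) (fun h => hJS j h hj)
    (hR j (hJR hj)) (fun x => QuotientGroup.mk (ψ x j)) (fun i hi x g => by rw [hψi i hi]) ?_ hV (hVm j (hJR hj)).1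
    (hVm j (hJR hj)).2 ?_
  · rw [cnt_eq_mass, ← hN, show (fun q : Gp p × Gp p => (QuotientGroup.mk (ψ q.1 j) : SL (p j) ⧸ Subgroup.center (SL (p j))) *
      QuotientGroup.mk (ψ q.2 j) ≠ QuotientGroup.mk (ψ (q.1 * q.2) j)) = P j from funext fun q => propext (hP j q).symm]
    exact a1
  · rw [sum_mul_cnt, ← hN, show (fun q : Gp p × Gp p => (QuotientGroup.mk (q.1 j) : SL (p j) ⧸ Subgroup.center (SL (p j))) *
      QuotientGroup.mk (ψ q.2 j) ≠ QuotientGroup.mk (ψ (q.1 * q.2) j)) = P' j from funext fun q => propext (hP' j q).symm]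
    exact a2

end Local

section Combine

variable {ι : Type} [Fintype ι] [LinearOrder ι] {p : ι → ℕ} [∀ i, Fact (p i).Prime]

theorem prod_univ_ite (R : Finset ι) (P : ι → Prop) (f g : ι → ℝ) :
    ∏ i, (if i ∈ R then (if P i then f i else g i) else 1) = (∏ i ∈ R.filter P, f i) * ∏ i ∈ R.filter (fun i => ¬ P i), g i := by
  rw [← Finset.prod_ite, Finset.prod_ite_mem, Finset.univ_inter]

theorem card_slice_le_growth {A B : Finset (Gp p)} {K E M : ℝ} (hA : Apx K A) (hK : 1 ≤ K) {R : Finset ι} {P : ι → Prop}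
    (hB : B ⊆ slice A 2 R) {D : ι → ℝ} (hD1 : ∀ i, 1 ≤ D i)
    (hD : ∀ i ∈ R, ∀ x ∈ B, (#(Ch i B x) : ℝ) ≤ 2 * D i) (hE : (#(slice A 2 R) : ℝ) ≤ #B * E) (hE0 : 0 ≤ E) (h2 : (2:ℝ) ^ #R ≤ E)
    (hM : ∏ i ∈ R.filter P, D i ≤ M)
    (hsec : ∀ g : Gp p, ∃ s ∈ slice A 6 R, ∀ i ∈ R.filter (fun i => ¬ P i), s i = g i) (n : ℕ) :
    (#(slice A n (R.filter P)) : ℝ) ≤ K ^ (n + 7) * (E * (E * M)) := by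
  have h1 := card_slice_mul_le (A := A) (R := R) (J := R.filter P) (S := R.filter (fun i => ¬ P i)) (Finset.filter_subset _ _)
    (fun i hi h => (Finset.mem_filter.1 hi).2 (Finset.mem_filter.1 h).2) hsec n
  obtain ⟨W, hW⟩ : ∃ W, W = ∏ i ∈ R.filter (fun i => ¬ P i), (Fintype.card (SL (p i)) : ℝ) := ⟨_, rfl⟩
  have hW0 : 0 < W := by rw [hW]; exact Finset.prod_pos fun i _ => by exact_mod_cast Fintype.card_pos
  have h3 := card_le_prod_Ch B (fun i => if i ∈ R then (if P i then 2 * D i else Fintype.card (SL (p i))) else 1)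
    (fun i => by have := hD1 i; split_ifs <;> positivity) (fun i x hx => by
      by_cases hi : i ∈ R
      · rw [if_pos hi]
        split_ifs
        · exact hD i hi x hx
        · exact_mod_cast Finset.card_le_univ _
      · rw [if_neg hi]
        exact_mod_cast Ch_card_le_one (fun x hx => (mem_slice.1 (hB hx)).2) hi x)
  rw [prod_univ_ite, ← hW, Finset.prod_mul_distrib, Finset.prod_const] at h3
  have h4 : (2:ℝ) ^ #(R.filter P) ≤ E := le_trans (pow_le_pow_right₀ one_le_two (Finset.card_filter_le _ _)) h2
  have hD0 : 0 ≤ ∏ i ∈ R.filter P, D i := Finset.prod_nonneg fun i _ => by linarith [hD1 i]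
  rw [← hW] at h1
  refine le_of_mul_le_mul_right (h1.trans ?_) hW0
  calc _ ≤ K ^ (n + 6 + 1) * (#(slice A 2 R) : ℝ) := card_slice_le hA (n + 6) R
    _ ≤ K ^ (n + 7) * ((E * M * W) * E) := by
        refine mul_le_mul_of_nonneg_left (hE.trans (mul_le_mul_of_nonneg_right (h3.trans ?_) hE0)) (by positivity)
        exact mul_le_mul_of_nonneg_right (mul_le_mul h4 hM hD0 hE0) hW0.le
    _ = _ := by ring

theorem card_slice_ge {A B : Finset (Gp p)} (hA : ∀ x ∈ A, x⁻¹ ∈ A) {R : Finset ι} {P : ι → Prop}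
    (hB : B ⊆ slice A 2 R) (hBn : B.Nonempty)
    (hS : ∀ i ∈ R.filter (fun i => ¬ P i), ∀ x ∈ B, (p i : ℝ) ^ (2.9:ℝ) ≤ #(Ch i B x)) :
    qq p (R.filter (fun i => ¬ P i)) ^ (2.9:ℝ) ≤ qq p (R.filter P) ^ 3 * #(slice A 4 (R.filter (fun i => ¬ P i))) := by
  have h1 := prod_Ch_le_card B hBn (fun i => if i ∈ R then (if P i then 1 else (p i : ℝ) ^ (2.9:ℝ)) else 1)
    (fun i => by split_ifs <;> positivity) (fun i x hx => by
      have h1 : (1:ℝ) ≤ #(Ch i B x) := by exact_mod_cast (Ch_nonempty hx).card_pos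
      by_cases hi : i ∈ R
      · by_cases hPi : P i
        · rwa [if_pos hi, if_pos hPi]
        · rw [if_pos hi, if_neg hPi]
          exact hS i (Finset.mem_filter.2 ⟨hi, hPi⟩) x hx
      · rwa [if_neg hi])
  rw [prod_univ_ite, Finset.prod_const_one, one_mul, ← qq_rpow] at h1
  refine h1.trans ?_
  obtain ⟨J, hJ⟩ : ∃ J, J = R.filter P := ⟨_, rfl⟩
  obtain ⟨Z, hZ⟩ : ∃ Z : Finset (Gp p), Z = univ.filter fun x => x ∈ GS p J := ⟨_, rfl⟩
  have hZc : (#Z : ℝ) ≤ qq p J ^ 3 := by rw [hZ, card_GS]; exact prod_card_le J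
  rw [← hJ]
  refine (card_le_mul_of_fiber_le (fun x : Gp p => (fun i => if i ∈ J then x i else 1 : Gp p)) B Z
    (#(slice A 4 (R.filter (fun i => ¬ P i)))) (fun x _ => ?_) (fun y _ => ?_)).trans
    (mul_le_mul_of_nonneg_right hZc (Nat.cast_nonneg _))
  · rw [hZ]
    exact Finset.mem_filter.2 ⟨Finset.mem_univ _, mem_GS.2 fun i hi => if_neg hi⟩
  · rcases (B.filter fun x => (fun i => if i ∈ J then x i else 1 : Gp p) = y).eq_empty_or_nonempty with h | ⟨b, hb⟩
    · refine le_trans (le_of_eq ?_) (Nat.cast_nonneg _)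
      exact_mod_cast Finset.card_eq_zero.2 (by convert h)
    refine Nat.cast_le.2 (Finset.card_le_card_of_injOn (fun x => x * b⁻¹) (fun x hx => ?_) fun x _ x' _ h => mul_right_cancel h)
    rw [Finset.mem_coe, Finset.mem_filter] at hx
    rw [Finset.mem_filter] at hb
    have h5 : x * b⁻¹ ∈ slice A (2 + 2) R := mul_mem_slice (hB hx.1) (inv_mem_slice hA (hB hb.1))
    refine mem_slice.2 ⟨(mem_slice.1 h5).1, mem_GS.2 fun i hi => ?_⟩
    by_cases hiR : i ∈ R
    · have hiJ : i ∈ J := by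
        rw [hJ]
        by_contra hn
        exact hi (Finset.mem_filter.2 ⟨hiR, fun h => hn (Finset.mem_filter.2 ⟨hiR, h⟩)⟩)
      have h6 := congrFun (hx.2.trans hb.2.symm) i
      simp only [if_pos hiJ] at h6
      show x i * (b i)⁻¹ = 1
      rw [h6, mul_inv_cancel]
    · exact mem_GS.1 (mem_slice.1 h5).2 i hiR

theorem slice_numerics {κ k L ε1 ε M lq lK1 : ℝ} (hκ : 0 < κ) (hM : 0 < M) (hL : κ / 12 * lq ≤ L)
    (hk : k ≤ ε * lq) (hε1 : ε1 = κ / 10 ^ 7) (hε : ε = κ ^ 2 / (10 ^ 6 * M)) (hL0 : 0 ≤ L)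
    (h : lK1 ≤ M * k + 102 * ε1 * L) : 400 / κ * lK1 ≤ L / 100 := by
  have h1 : M * k ≤ 12 / 10 ^ 6 * κ * L := by
    calc M * k ≤ M * (ε * lq) := mul_le_mul_of_nonneg_left hk hM.le
      _ = 12 / 10 ^ 6 * κ * (κ / 12 * lq) := by rw [hε]; field_simp
      _ ≤ _ := mul_le_mul_of_nonneg_left hL (by positivity)
  rw [div_mul_eq_mul_div, div_le_iff₀ hκ]
  rw [hε1] at h
  have := mul_nonneg hκ.le hL0
  linarith

theorem exists_large_slice {κ : ℝ} (hκ : 0 < κ) (hκ1 : κ ≤ 1) (p1 : ℕ) : ∃ ε > (0:ℝ), ∃ q0 : ℝ, ∀ {ι : Type} [Fintype ι]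
    [LinearOrder ι] {p : ι → ℕ} [∀ i, Fact (p i).Prime], Function.Injective p → q0 ≤ qq p univ → ∀ K : ℝ, 1 ≤ K →
    K ≤ qq p univ ^ ε → ∀ β : Gp p → ℝ, (∀ x, 0 ≤ β x) →
    (∀ H : ∀ i, Subgroup (SL (p i)), (∀ i, H i ≠ ⊤) → ∀ a, mass β (InCoset univ H a) ≤ qq p univ ^ (-κ)) →
    ∀ A : Finset (Gp p), Apx K A → ∀ a : Gp p, 1 ≤ K * mass β (fun x => a⁻¹ * x ∈ A) →
    ∃ S : Finset ι, (∀ i ∈ S, p1 ≤ p i) ∧ qq p univ ^ (κ / 24) ≤ qq p S ∧ qq p S ^ (2.8:ℝ) ≤ #(slice A 4 S) := by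
  obtain ⟨m, p2, hsamp⟩ := exists_samples hκ
  obtain ⟨ε1, hε1⟩ : ∃ ε1 : ℝ, ε1 = κ / 10 ^ 7 := ⟨_, rfl⟩
  obtain ⟨p3, hgrow⟩ := growth (ε := ε1) (by rw [hε1]; positivity)
  obtain ⟨P, hP, hgen⟩ := exists_generic hκ (max (max p1 p2) (max p3 (10 ^ 14)))
  obtain ⟨M, hM⟩ : ∃ M : ℝ, M = 216 * m + 529 := ⟨_, rfl⟩
  have hM0 : 1 ≤ M := by rw [hM]; have : (0:ℝ) ≤ m := Nat.cast_nonneg _; linarith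
  obtain ⟨ε, hε⟩ : ∃ ε : ℝ, ε = κ ^ 2 / (10 ^ 6 * M) := ⟨_, rfl⟩
  have hεκ : ε ≤ κ / 8 := by
    rw [hε, div_le_iff₀ (by positivity)]
    nlinarith [mul_pos hκ (one_pos.trans_le hM0)]
  refine ⟨ε, by rw [hε]; positivity, P ^ (8 / κ), ?_⟩
  intro ι _ _ p _ hp hq K hK hKq β h0 hN A hA a ha
  have hq1 : 1 ≤ qq p univ := one_le_qq _
  have hKP : K * P ≤ qq p univ ^ (κ / 4) := by
    rw [show κ / 4 = κ / 8 + κ / 8 by ring, Real.rpow_add (qq_pos _)]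
    refine mul_le_mul (hKq.trans (Real.rpow_le_rpow_of_exponent_le hq1 hεκ)) ?_ hP.le (by positivity)
    have := Real.rpow_le_rpow (by positivity) hq (show 0 ≤ κ / 8 by positivity)
    rwa [← Real.rpow_mul hP.le, show 8 / κ * (κ / 8) = 1 by field_simp, Real.rpow_one] at this
  obtain ⟨R, hR, hRq, ν, hν, hs, hH, hT⟩ := hgen hp K (by linarith) hKP β h0 hN A hA.2.1 a ha
  simp only [max_le_iff] at hR
  obtain ⟨⟨α, hα, hαs, hαm⟩, V, hV, hVs, hVm⟩ := hsamp R ν A (fun i hi => (hR i hi).1.2) hν hA.2.1 hs hH hT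
  obtain ⟨B, hB, hBn, D, hD1, hD, hBc, h2, hDJ⟩ := hgrow R A K m α (fun i hi => (hR i hi).2.1) hK hA hα hαs hαm
  obtain ⟨Pr, hPr⟩ : ∃ Pr : ι → Prop, Pr = fun i => D i < (p i : ℝ) ^ (2.9 : ℝ) := ⟨_, rfl⟩
  have hDJ : ∏ i ∈ R.filter Pr, D i ≤ (K ^ (2 * m + 5) * qq p R ^ ε1) ^ 100 := by subst hPr; convert hDJ
  have hS : ∀ i ∈ R.filter (fun i => ¬ Pr i), 16 ≤ p i ∧ ∀ x ∈ B, (p i : ℝ) ^ (2.9:ℝ) ≤ #(Ch i B x) := fun i hi => by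
    rw [Finset.mem_filter, hPr, not_lt] at hi
    exact ⟨le_trans (by norm_num) (hR i hi.1).2.2, fun x hx => hi.2.trans (hD i hi.1 x hx).1⟩
  have hsec := fun g => exists_section hB hBn hS g
  have hQ0 := qq_pos (p := p) R
  have hc := card_slice_le_growth hA hK hB hD1 (fun i hi x hx => (hD i hi x hx).2) hBc (by positivity) h2 hDJ hsec (16 * m + 22)
  have hJ := no_large_local (S := R.filter fun i => ¬ Pr i) hp hκ hA.1 hA.2.1 (Finset.filter_subset Pr R)
    (fun i hi h => by
      by_contra hn
      exact h (Finset.mem_filter.2 ⟨hi, fun h => hn (Finset.mem_filter.2 ⟨hi, h⟩)⟩))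
    (fun i hi h => (Finset.mem_filter.1 hi).2 (Finset.mem_filter.1 h).2) (Finset.filter_subset _ R)
    (fun i hi => (hR i hi).2.2) hsec hν hs hT hV hVs hVm hc
  have hge := card_slice_ge hA.2.1 hB hBn (fun i hi => (hS i hi).2)
  obtain ⟨S, hSd⟩ : ∃ S, S = R.filter (fun i => ¬ Pr i) := ⟨_, rfl⟩
  obtain ⟨J, hJd⟩ : ∃ J, J = R.filter Pr := ⟨_, rfl⟩
  rw [← hSd, ← hJd] at hge
  rw [← hJd] at hJ
  have hQ : qq p J * qq p S = qq p R := by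
    rw [hSd, hJd]; exact Finset.prod_filter_mul_prod_filter_not _ _ _
  have hlQ : Real.log (qq p J) + Real.log (qq p S) = Real.log (qq p R) := by
    rw [← hQ, Real.log_mul (qq_pos _).ne' (qq_pos _).ne']
  have hRl : κ / 12 * Real.log (qq p univ) ≤ Real.log (qq p R) := by
    rw [← Real.log_rpow (qq_pos _)]; exact Real.log_le_log (Real.rpow_pos_of_pos (qq_pos _) _) hRq
  have hKl : Real.log K ≤ ε * Real.log (qq p univ) := by
    rw [← Real.log_rpow (qq_pos _)]; exact Real.log_le_log (by linarith) hKq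
  have hK0 : 0 < K := by linarith
  have hJ2 : Real.log (qq p J) ≤ Real.log (qq p R) / 100 := by
    refine hJ.trans (slice_numerics hκ (by linarith : 0 < M) hRl hKl hε1 hε (Real.log_nonneg (one_le_qq _)) ?_)
    have hE : qq p R ^ ε1 ≠ 0 := (Real.rpow_pos_of_pos hQ0 _).ne'
    have hKn : ∀ n : ℕ, K ^ n ≠ 0 := fun n => pow_ne_zero n hK0.ne'
    rw [Real.log_mul (hKn _) (mul_ne_zero hE (mul_ne_zero hE (pow_ne_zero _ (mul_ne_zero (hKn _) hE)))),
      Real.log_mul hE (mul_ne_zero hE (pow_ne_zero _ (mul_ne_zero (hKn _) hE))),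
      Real.log_mul hE (pow_ne_zero _ (mul_ne_zero (hKn _) hE)), Real.log_pow, Real.log_pow, Real.log_mul (hKn _) hE,
      Real.log_pow, Real.log_rpow hQ0, hM]
    push_cast
    linarith
  have hl1 : 0 ≤ Real.log (qq p univ) := Real.log_nonneg hq1
  have hJ0 : 0 ≤ Real.log (qq p J) := Real.log_nonneg (one_le_qq _)
  have hn : 0 < (#(slice A 4 S) : ℝ) := by
    by_contra hcon
    have h4 : (#(slice A 4 S) : ℝ) = 0 := le_antisymm (not_lt.1 hcon) (Nat.cast_nonneg _)
    rw [h4, mul_zero] at hge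
    exact absurd hge (not_le.2 (Real.rpow_pos_of_pos (qq_pos _) _))
  refine ⟨S, fun i hi => (hR i (by rw [hSd] at hi; exact (Finset.mem_filter.1 hi).1)).1.1, ?_, ?_⟩
  · rw [← Real.log_le_log_iff (Real.rpow_pos_of_pos (qq_pos _) _) (qq_pos _), Real.log_rpow (qq_pos _)]
    linarith
  · have h5 := Real.log_le_log (Real.rpow_pos_of_pos (qq_pos _) _) hge
    rw [Real.log_mul (pow_ne_zero _ (qq_pos _).ne') hn.ne', Real.log_pow, Real.log_rpow (qq_pos _)] at h5
    rw [← Real.log_le_log_iff (Real.rpow_pos_of_pos (qq_pos _) _) hn, Real.log_rpow (qq_pos _)]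
    push_cast at h5
    linarith

end Combine

section Subset

variable {ι : Type} [Fintype ι] [LinearOrder ι] {p : ι → ℕ} [∀ i, Fact (p i).Prime]

/-- Extension by the identity from the coordinates in `S`. -/
def ext (S : Finset ι) : Gp (fun i : {i // i ∈ S} => p i) →* Gp p where
  toFun g i := if h : i ∈ S then g ⟨i, h⟩ else 1
  map_one' := by funext i; by_cases h : i ∈ S <;> simp [h]
  map_mul' x y := by funext i; by_cases h : i ∈ S <;> simp [h]

theorem ext_apply (S : Finset ι) (g : Gp (fun i : {i // i ∈ S} => p i)) (i : ι) :
    ext S g i = if h : i ∈ S then g ⟨i, h⟩ else 1 := rfl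

theorem ext_injective (S : Finset ι) : Function.Injective (ext (p := p) S) := fun x y h => by
  funext i
  simpa [ext_apply] using congrFun h i.1

theorem ext_surj {S : Finset ι} {x : Gp p} (hx : x ∈ GS p S) : ∃ g, ext S g = x :=
  ⟨fun i => x i, by
    funext i
    rw [ext_apply]
    split_ifs with h
    · rfl
    · exact (mem_GS.1 hx i h).symm⟩

theorem ext_mulSingle (S : Finset ι) (i : {i // i ∈ S}) (g : SL (p i)) :
    ext S (Pi.mulSingle i g : Gp (fun i : {i // i ∈ S} => p i)) = (Pi.mulSingle i.1 g : Gp p) := by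
  funext j
  rw [ext_apply]
  by_cases hij : j = i.1
  · subst hij; simp
  · rw [Pi.mulSingle_eq_of_ne hij]
    split_ifs with h
    · exact Pi.mulSingle_eq_of_ne (fun h' => hij (congrArg Subtype.val h')) _
    · rfl

theorem sum_eq_sum_ext {M : Type*} [AddCommMonoid M] {S : Finset ι} (c : Gp p) {f : Gp p → M} (hf : ∀ x, c⁻¹ * x ∉ GS p S → f x = 0) :
    ∑ x, f x = ∑ g, f (c * ext S g) := by
  symm
  refine Fintype.sum_of_injective (fun g => c * ext S g) (fun x y h => ext_injective S (mul_left_cancel h)) _ _ (fun x hx => ?_)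
    fun _ => rfl
  refine hf x fun h => hx ?_
  obtain ⟨g, hg⟩ := ext_surj h
  exact ⟨g, by simp only [hg, mul_inv_cancel_left]⟩

theorem quasirandom_coset {S : Finset ι} (c : Gp p) {f φ : Gp p → ℂ} (hf : ∀ x, c⁻¹ * x ∉ GS p S → f x = 0)
    (hφ : φ ∈ Ez p) : l2Norm (conv f φ) ^ 2 * ∏ i ∈ S, (((p i : ℝ) - 1) / 2) ≤
      (∏ i ∈ S, (Fintype.card (SL (p i)) : ℝ)) * l2Norm f ^ 2 * l2Norm φ ^ 2 := by
  obtain ⟨N, hN⟩ : ∃ N : ℝ, N = Fintype.card (Gp (fun i : {i // i ∈ S} => p i)) := ⟨_, rfl⟩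
  have hN0 : 0 < N := by rw [hN]; exact_mod_cast Fintype.card_pos
  have hNS : ∏ i ∈ S, (Fintype.card (SL (p i)) : ℝ) = N := by
    rw [hN, Fintype.card_pi, ← Finset.prod_coe_sort]
    push_cast
    rfl
  have hDS : ∏ i ∈ S, (((p i : ℝ) - 1) / 2) = ∏ i : {i // i ∈ S}, (((p i : ℝ) - 1) / 2) :=
    (Finset.prod_coe_sort S (fun i => (((p i : ℝ) - 1) / 2))).symm
  have hpt : ∀ y : Gp p, l2Norm (fun g => conv f φ (c * ext S g * y)) ^ 2 * ∏ i ∈ S, (((p i : ℝ) - 1) / 2) ≤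
      N * l2Norm f ^ 2 * l2Norm (fun g => φ (ext S g * y)) ^ 2 := fun y => by
    have hy : (fun g => φ (ext S g * y)) ∈ Ez (fun i : {i // i ∈ S} => p i) := fun i x => by
      simp only [map_mul, ext_mulSingle]
      exact Ez_translate hφ y i.1 (ext S x)
    have h1 := quasirandom (fun g => f (c * ext S g)) hy
    have h2 : conv (fun g => f (c * ext S g)) (fun g => φ (ext S g * y)) = fun g => conv f φ (c * ext S g * y) := by
      funext g
      unfold conv
      rw [sum_eq_sum_ext c (f := fun x => f x * φ (x⁻¹ * (c * ext S g * y))) fun x hx => by rw [hf x hx, zero_mul]]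
      refine Finset.sum_congr rfl fun z _ => ?_
      change f (c * ext S z) * φ (ext S (z⁻¹ * g) * y) = _
      rw [map_mul, map_inv]
      congr 2
      group
    have h3 : l2Norm (fun g => f (c * ext S g)) ^ 2 = l2Norm f ^ 2 := by
      rw [l2Norm_sq, l2Norm_sq, ← sum_eq_sum_ext c (f := fun x => ‖f x‖ ^ 2) fun x hx => by rw [hf x hx]; simp]
    rw [h2, h3, ← hN, ← hDS] at h1
    exact h1
  have hsum := Finset.sum_le_sum fun y (_ : y ∈ univ) => hpt y
  have hav : ∀ (F : Gp p → ℂ) (k : Gp (fun i : {i // i ∈ S} => p i) → Gp p),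
      ∑ y, l2Norm (fun g => F (k g * y)) ^ 2 = N * l2Norm F ^ 2 := fun F k => by
    simp only [l2Norm_sq]
    rw [Finset.sum_comm]
    simp only [sum_mul_left _ (fun y => ‖F y‖ ^ 2)]
    rw [Finset.sum_const, Finset.card_univ, nsmul_eq_mul, hN]
  rw [← Finset.sum_mul, ← Finset.mul_sum, hav (conv f φ) (fun g => c * ext S g), hav φ (fun g => ext S g)] at hsum
  rw [hNS]
  refine le_of_mul_le_mul_left ?_ hN0
  linarith

theorem l2Norm_conv_cosets {S : Finset ι} {η φ : Gp p → ℂ} (hφ : φ ∈ Ez p) {T : Finset (Gp p)} {r : Gp p → Gp p}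
    (hr : ∀ x i, r x i = if i ∈ S then 1 else x i) (hT : ∀ x, η x ≠ 0 → r x ∈ T) {W : ℝ}
    (hW : (∏ i ∈ S, (Fintype.card (SL (p i)) : ℝ)) ≤ W * ∏ i ∈ S, (((p i : ℝ) - 1) / 2))
    (hD : 0 < ∏ i ∈ S, (((p i : ℝ) - 1) / 2)) :
    l2Norm (conv η φ) ^ 2 ≤ #T * W * l2Norm η ^ 2 * l2Norm φ ^ 2 := by
  obtain ⟨f, hf⟩ : ∃ f : Gp p → Gp p → ℂ, ∀ c x, f c x = if r x = c then η x else 0 := ⟨_, fun _ _ => rfl⟩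
  have hη : η = ∑ c ∈ T, f c := by
    funext x
    rw [Finset.sum_apply]
    simp only [hf]
    rw [Finset.sum_ite_eq]
    split_ifs with h
    · rfl
    · by_contra hn
      exact h (hT x hn)
  have hconv : conv η φ = ∑ c ∈ T, conv (f c) φ := by
    funext x
    rw [Finset.sum_apply]
    unfold conv
    rw [Finset.sum_comm]
    refine Finset.sum_congr rfl fun g _ => ?_
    rw [← Finset.sum_mul, hη, Finset.sum_apply]
  have hpc : ∀ c, l2Norm (conv (f c) φ) ^ 2 ≤ W * l2Norm (f c) ^ 2 * l2Norm φ ^ 2 := fun c => by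
    by_cases hc : r c = c
    · have h := quasirandom_coset c (S := S) (f := f c) (fun x hx => by
        rw [hf, if_neg]
        intro h
        refine hx (mem_GS.2 fun i hi => ?_)
        have := congrFun h i
        rw [hr, if_neg hi] at this
        rw [Pi.mul_apply, Pi.inv_apply, this, inv_mul_cancel]) hφ
      refine le_of_mul_le_mul_right (h.trans ?_) hD
      calc _ ≤ (W * ∏ i ∈ S, (((p i : ℝ) - 1) / 2)) * l2Norm (f c) ^ 2 * l2Norm φ ^ 2 := by gcongr
        _ = _ := by ring
    · have h0 : f c = 0 := by
        funext x
        rw [hf, if_neg, Pi.zero_apply]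
        intro h
        refine hc ?_
        rw [← h]
        funext i
        rw [hr, hr]
        split_ifs <;> rfl
      have h1 : conv (f c) φ = 0 := by funext x; simp [conv, h0]
      rw [h1, h0]
      simp [l2Norm_sq]
  have hsq : ∑ c ∈ T, l2Norm (f c) ^ 2 = l2Norm η ^ 2 := by
    simp only [l2Norm_sq]
    rw [Finset.sum_comm]
    refine Finset.sum_congr rfl fun x _ => ?_
    by_cases hx : η x = 0
    · simp [hf, hx]
    · rw [Finset.sum_eq_single_of_mem (r x) (hT x hx) fun c _ hc => by rw [hf, if_neg hc.symm]; simp]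
      rw [hf, if_pos rfl]
  have h1 : l2Norm (conv η φ) ≤ ∑ c ∈ T, l2Norm (conv (f c) φ) := by rw [hconv]; exact l2Norm_sum_le _ _
  calc l2Norm (conv η φ) ^ 2 ≤ (∑ c ∈ T, l2Norm (conv (f c) φ)) ^ 2 := by gcongr; exact l2Norm_nonneg _
    _ ≤ #T * ∑ c ∈ T, l2Norm (conv (f c) φ) ^ 2 := sq_sum_le_card_mul_sum_sq
    _ ≤ #T * ∑ c ∈ T, W * l2Norm (f c) ^ 2 * l2Norm φ ^ 2 := by gcongr; exact hpc _
    _ = _ := by rw [← Finset.sum_mul, ← Finset.mul_sum, hsq]; ring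

theorem card_cosets_mul_le {A : Finset (Gp p)} {S : Finset ι} (a : Gp p) {r : Gp p → Gp p}
    (hr : ∀ x i, r x i = if i ∈ S then 1 else x i) :
    #(A.image fun x => r (a * x)) * #(slice A 4 S) ≤ #(A ^ 5) := by
  have hsec : ∀ c : Gp p, ∃ x, c ∈ (A.image fun x => r (a * x)) → x ∈ A ∧ r (a * x) = c := fun c => by
    by_cases h : c ∈ A.image fun x => r (a * x)
    · obtain ⟨x, hx⟩ := Finset.mem_image.1 h
      exact ⟨x, fun _ => hx⟩
    · exact ⟨1, fun h' => absurd h' h⟩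
  choose σ hσ using hsec
  rw [← Finset.card_product]
  refine Finset.card_le_card_of_injOn (fun q => σ q.1 * q.2) (fun q hq => ?_) fun q hq q' hq' h => ?_
  · rw [Finset.mem_coe, Finset.mem_product] at hq
    rw [Finset.mem_coe, show 5 = 1 + 4 by norm_num, pow_add, pow_one]
    exact Finset.mul_mem_mul (hσ _ hq.1).1 (mem_slice.1 hq.2).1
  · rw [Finset.mem_coe, Finset.mem_product] at hq hq'
    have hv : ∀ q : Gp p × Gp p, q.1 ∈ (A.image fun x => r (a * x)) ∧ q.2 ∈ slice A 4 S → r (a * (σ q.1 * q.2)) = q.1 := fun q hq => by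
      rw [← (hσ q.1 hq.1).2]
      funext i
      rw [hr, hr]
      split_ifs with hi
      · rfl
      · rw [Pi.mul_apply, Pi.mul_apply, Pi.mul_apply, mem_GS.1 (mem_slice.1 hq.2).2 i hi, mul_one, (hσ q.1 hq.1).2]
    have h1 : q.1 = q'.1 := by
      rw [← hv q hq, ← hv q' hq']
      exact congrArg (fun x => r (a * x)) h
    have h2 : σ q.1 * q.2 = σ q'.1 * q'.2 := h
    rw [← h1] at h2
    exact Prod.ext h1 (mul_left_cancel h2)

end Subset

section Composite

theorem card_sl_le_quasi {p : ℕ} [Fact p.Prime] (hp : 10 ^ 5 ≤ p) :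
    (Fintype.card (SL p) : ℝ) ≤ (p:ℝ) ^ (2.1:ℝ) * (((p:ℝ) - 1) / 2) := by
  have hp' : (10:ℝ) ^ 5 ≤ p := by exact_mod_cast hp
  have hp0 : (0:ℝ) < p := by linarith
  have h1 : (3:ℝ) ≤ (p:ℝ) ^ (1/10:ℝ) := by
    calc (3:ℝ) = ((3:ℝ) ^ 10) ^ (1/10:ℝ) := by
          rw [← Real.rpow_natCast, ← Real.rpow_mul (by norm_num)]; norm_num
      _ ≤ _ := Real.rpow_le_rpow (by norm_num) (by linarith) (by norm_num)
  have h2 : (p:ℝ) ^ 3 = (p:ℝ) ^ (2.1:ℝ) * (p:ℝ) ^ (0.9:ℝ) := by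
    rw [← Real.rpow_add hp0, ← Real.rpow_natCast]; norm_num
  have h3 : (p:ℝ) ^ (1/10:ℝ) * (p:ℝ) ^ (0.9:ℝ) = p := by
    rw [← Real.rpow_add hp0]; norm_num
  have h4 : 0 ≤ (p:ℝ) ^ (0.9:ℝ) := by positivity
  refine card_sl_le.trans ?_
  rw [h2]
  refine mul_le_mul_of_nonneg_left ?_ (by positivity)
  have := mul_le_mul_of_nonneg_right h1 h4
  linarith

variable {ι : Type} [Fintype ι] [LinearOrder ι] {p : ι → ℕ} [∀ i, Fact (p i).Prime]

theorem composite_piece {S : Finset ι} {A : Finset (Gp p)} {K : ℝ} (hA : Apx K A) {β : Gp p → ℝ}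
    (hAβ : #A * ∑ x, β x ^ 2 ≤ K) (hS : ∀ i ∈ S, 10 ^ 5 ≤ p i) (hsl : qq p S ^ (2.8:ℝ) ≤ #(slice A 4 S)) {a : Gp p}
    {η φ : Gp p → ℂ} (hη : ∀ x, ‖η x‖ ≤ β x) (hsupp : ∀ x, a⁻¹ * x ∉ A → η x = 0) (hφ : φ ∈ Ez p) :
    l2Norm (conv η φ) ^ 2 ≤ K ^ 6 * qq p S ^ (-0.7:ℝ) * l2Norm φ ^ 2 := by
  obtain ⟨r, hr⟩ : ∃ r : Gp p → Gp p, ∀ x i, r x i = if i ∈ S then 1 else x i :=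
    ⟨fun x i => if i ∈ S then 1 else x i, fun _ _ => rfl⟩
  obtain ⟨T, hT⟩ : ∃ T, T = A.image fun x => r (a * x) := ⟨_, rfl⟩
  have hq := qq_pos (p := p) S
  have h1 := l2Norm_conv_cosets hφ hr (η := η) (T := T) (W := qq p S ^ (2.1:ℝ)) (fun x hx => by
      rw [hT]
      refine Finset.mem_image.2 ⟨a⁻¹ * x, ?_, by rw [mul_inv_cancel_left]⟩
      by_contra hn
      exact hx (hsupp x hn))
    (by
      rw [qq_rpow, ← Finset.prod_mul_distrib]
      exact Finset.prod_le_prod (fun i _ => Nat.cast_nonneg _) fun i hi => card_sl_le_quasi (hS i hi))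
    (Finset.prod_pos fun i hi => by
      have : (10:ℝ) ^ 5 ≤ p i := by exact_mod_cast hS i hi
      linarith)
  have h2 : (#T : ℝ) * qq p S ^ (2.8:ℝ) ≤ K ^ 5 * #A := by
    refine le_trans ?_ (hA.2.2 5)
    refine (mul_le_mul_of_nonneg_left hsl (Nat.cast_nonneg _)).trans ?_
    rw [hT]
    exact_mod_cast card_cosets_mul_le a hr
  have h3 : l2Norm η ^ 2 ≤ ∑ x, β x ^ 2 := by
    rw [l2Norm_sq]
    exact Finset.sum_le_sum fun x _ => pow_le_pow_left₀ (norm_nonneg _) (hη x) 2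
  have e : qq p S ^ (2.1:ℝ) = qq p S ^ (2.8:ℝ) * qq p S ^ (-0.7:ℝ) := by rw [← Real.rpow_add hq]; norm_num
  have hK : 0 ≤ K := le_trans (by positivity) hAβ
  refine h1.trans (mul_le_mul_of_nonneg_right ?_ (by positivity))
  calc #T * qq p S ^ (2.1:ℝ) * l2Norm η ^ 2 = (#T * qq p S ^ (2.8:ℝ)) * qq p S ^ (-0.7:ℝ) * l2Norm η ^ 2 := by rw [e]; ring
    _ ≤ (K ^ 5 * #A) * qq p S ^ (-0.7:ℝ) * ∑ x, β x ^ 2 := by gcongr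
    _ = K ^ 5 * qq p S ^ (-0.7:ℝ) * (#A * ∑ x, β x ^ 2) := by ring
    _ ≤ K ^ 5 * qq p S ^ (-0.7:ℝ) * K := by gcongr
    _ = _ := by ring

/-- Products of proper subgroups. -/
def ProperProd (H : Subgroup (Gp p)) : Prop := ∃ H' : ∀ i, Subgroup (SL (p i)), (∀ i, H' i ≠ ⊤) ∧ H = Subgroup.pi Set.univ H'

theorem composite_op {κ : ℝ} (hκ : 0 < κ) (hκ1 : κ ≤ 1) : ∃ c > (0:ℝ), ∃ q0 : ℝ, ∀ {ι : Type} [Fintype ι] [LinearOrder ι]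
    {p : ι → ℕ} [∀ i, Fact (p i).Prime], Function.Injective p → q0 ≤ qq p univ →
    ∀ μ : Gp p → ℂ, ∑ x, ‖μ x‖ ≤ 1 → NonConc ProperProd (qq p univ ^ (-κ)) (fun x => ‖μ x‖) →
      OpB (Ez p) μ (4 * qq p univ ^ (-c)) := by
  obtain ⟨ε, hε, q1, hmain⟩ := exists_large_slice hκ hκ1 (10 ^ 5)
  obtain ⟨τ, hτ⟩ : ∃ τ : ℝ, τ = min κ ε / 10 ^ 6 := ⟨_, rfl⟩
  have hτ0 : 0 < τ := by rw [hτ]; have := lt_min hκ hε; positivity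
  have hτκ : τ * 10 ^ 6 ≤ κ := by rw [hτ]; have := min_le_left κ ε; linarith
  have hτ1 : τ * 10 ^ 6 ≤ ε := by rw [hτ]; have := min_le_right κ ε; linarith
  obtain ⟨n, hn⟩ := exists_nat_ge (4 / τ)
  rw [div_le_iff₀ hτ0] at hn
  refine ⟨κ / 200 * (1/2) ^ n, by positivity, max q1 ((16:ℝ) ^ (1/τ)), ?_⟩
  intro ι _ _ p _ hp hq0 μ hμ hN
  obtain ⟨q, hq⟩ : ∃ q, q = qq p univ := ⟨_, rfl⟩
  rw [← hq] at hq0 hN ⊢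
  have hqr : (16:ℝ) ^ (1/τ) ≤ q := (le_max_right _ _).trans hq0
  have q1' : 1 ≤ q := by rw [hq]; exact one_le_qq _
  have q00 : 0 < q := by linarith
  obtain ⟨t, ht⟩ : ∃ t : ℝ, t = q ^ τ := ⟨_, rfl⟩
  have ht16 : 16 ≤ t := by
    rw [ht]
    calc (16:ℝ) = ((16:ℝ) ^ (1/τ)) ^ τ := by rw [← Real.rpow_mul (by norm_num), one_div_mul_cancel hτ0.ne', Real.rpow_one]
      _ ≤ _ := by gcongr
  have t0 : 0 < t := by linarith
  have t1 : 1 ≤ t := by linarith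
  have htn : ∀ k : ℕ, t ^ k = q ^ (τ * k) := fun k => by rw [ht, Real.rpow_mul q00.le, Real.rpow_natCast]
  have e16 : 16 / t⁻¹ ≤ t ^ 2 := by rw [div_inv_eq_mul]; nlinarith
  have e400 : (16 / t⁻¹) ^ 400 ≤ t ^ 800 := by
    calc (16 / t⁻¹) ^ 400 ≤ (t ^ 2) ^ 400 := by gcongr
      _ = _ := by rw [← pow_mul]
  have h800 : t ^ 800 ≤ q ^ ε := by
    rw [htn]; exact Real.rpow_le_rpow_of_exponent_le q1' (by push_cast; linarith)
  have h1800 : 1 ≤ t ^ 800 := one_le_pow₀ t1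
  obtain ⟨ρ, hρ⟩ : ∃ ρ : ℝ, ρ = t ^ 2400 * q ^ (-(κ / 100)) := ⟨_, rfl⟩
  have hρ0 : 0 ≤ ρ := by rw [hρ]; positivity
  have hpiece : ∀ β : Gp p → ℝ, (∀ x, 0 ≤ β x) → NonConc ProperProd (q ^ (-κ)) β → ∀ A : Finset (Gp p),
      Apx (t ^ 800) A → #A * ∑ x, β x ^ 2 ≤ t ^ 800 → ∀ a, 1 ≤ t ^ 800 * ∑ x with a⁻¹ * x ∈ A, β x →
      ∀ η : Gp p → ℂ, (∀ x, ‖η x‖ ≤ β x) → (∀ x, a⁻¹ * x ∉ A → η x = 0) → OpB (Ez p) η ρ := by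
    intro β h0 h A hA hAβ a ha η hη hsupp φ hφ
    obtain ⟨S, hS, hSq, hsl⟩ := hmain hp ((le_max_left _ _).trans (hq ▸ hq0)) (t ^ 800) h1800 (hq ▸ h800) β h0
      (fun H hH a => by
        rw [← hq, mass_eq_sum_filter]
        refine le_trans (le_of_eq (Finset.sum_congr (Finset.filter_congr fun x _ => ?_) fun _ _ => rfl))
          (h (Subgroup.pi Set.univ H) ⟨H, hH, rfl⟩ a)
        simp [InCoset, Subgroup.mem_pi]) A hA a (by rw [mass_eq_sum_filter]; convert ha)
    have h1 := composite_piece hA hAβ hS hsl hη hsupp hφ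
    refine (pow_le_pow_iff_left₀ (l2Norm_nonneg _) (mul_nonneg hρ0 (l2Norm_nonneg _)) two_ne_zero).1 ?_
    refine h1.trans ?_
    rw [mul_pow]
    refine mul_le_mul_of_nonneg_right ?_ (by positivity)
    rw [hρ, mul_pow, ← pow_mul, ← pow_mul]
    refine mul_le_mul_of_nonneg_left ?_ (by positivity)
    rw [← hq] at hSq
    calc qq p S ^ (-0.7:ℝ) ≤ (q ^ (κ / 24)) ^ (-0.7:ℝ) :=
          Real.rpow_le_rpow_of_nonpos (by positivity) hSq (by norm_num)
      _ = q ^ (κ / 24 * (-0.7)) := by rw [← Real.rpow_mul q00.le]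
      _ ≤ q ^ (-(κ / 100) * (2:ℕ)) := Real.rpow_le_rpow_of_exponent_le q1' (by push_cast; linarith)
      _ = _ := by rw [Real.rpow_mul q00.le, Real.rpow_natCast]
  have hr12 : q ^ (-(κ / 200)) ≤ 1 := Real.rpow_le_one_of_one_le_of_nonpos q1' (by linarith)
  have key := iterate_flattening (G := Gp p) (Ez p) (NonConc ProperProd (q ^ (-κ))) t⁻¹ ρ (q ^ (-(κ / 200)))
    hρ0 (by positivity) (inv_le_one_of_one_le₀ t1) (by positivity) hr12
    (fun β β' _ h h' => h'.mono h) (fun β h0 h1 h => h.acor (by positivity) h0 h1)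
    (fun β h0 h1 h A hA hAβ a ha η hη hs => hpiece β h0 h A (hA.mono (by positivity) e400)
      (hAβ.trans e400) a (ha.trans (mul_le_mul_of_nonneg_right e400 (Finset.sum_nonneg fun x _ => h0 x))) η hη hs)
    (by
      calc 2 * (16 / t⁻¹) ^ 400 * ρ ≤ t * t ^ 800 * ρ := by
            gcongr; linarith
        _ = t ^ 3201 * q ^ (-(κ / 100)) := by rw [hρ]; ring
        _ = q ^ (τ * (3201:ℕ) + -(κ / 100)) := by rw [htn, ← Real.rpow_add q00]
        _ ≤ _ := Real.rpow_le_rpow_of_exponent_le q1' (by push_cast; linarith)) n μ hμ hN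
    (by
      have h2 : ∑ x, ‖μ x‖ ^ 2 ≤ 1 := by
        refine le_trans (Finset.sum_le_sum fun x _ => ?_) hμ
        have h3 : ‖μ x‖ ≤ 1 := (Finset.single_le_sum (f := fun x => ‖μ x‖) (fun y _ => norm_nonneg _) (Finset.mem_univ x)).trans hμ
        nlinarith [norm_nonneg (μ x)]
      have hcard : (Fintype.card (Gp p) : ℝ) ≤ q ^ 3 := by
        rw [hq, Fintype.card_pi]
        push_cast
        exact prod_card_le univ
      calc (Fintype.card (Gp p) : ℝ) * t⁻¹ ^ n * ∑ x, ‖μ x‖ ^ 2 ≤ q ^ 3 * t⁻¹ ^ n * 1 := by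
            gcongr
        _ = q ^ ((3:ℕ) + -(τ * n)) := by
            rw [mul_one, inv_pow, htn, ← Real.rpow_neg q00.le, Real.rpow_add q00, Real.rpow_natCast]
        _ ≤ q ^ (-(κ / 200) * (2:ℕ) : ℝ) := Real.rpow_le_rpow_of_exponent_le q1' (by push_cast; linarith)
        _ = _ := by rw [Real.rpow_mul q00.le, Real.rpow_natCast])
  refine key.mono (le_of_eq ?_)
  rw [← Real.rpow_mul q00.le, neg_mul]

end Composite

section Transport

theorem redSL_comp {m n k : ℕ} [NeZero m] [NeZero n] (h : n ∣ m) (h' : k ∣ n) (x : SL m) :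
    redSL n k h' (redSL m n h x) = redSL m k (h'.trans h) x := by
  ext a b
  exact RingHom.congr_fun (ZMod.castHom_comp h' h) (x a b)

theorem redSL_self {m : ℕ} [NeZero m] (x : SL m) : redSL m m dvd_rfl x = x := by
  ext a b
  exact RingHom.congr_fun ZMod.castHom_self (x a b)

/-- The joint reduction homomorphism to the coordinate groups. -/
noncomputable def redGp {ι : Type*} (p : ι → ℕ) (q : ℕ) [NeZero q] (h : ∀ i, p i ∣ q) : SL q →* Gp p :=
  MonoidHom.pi fun i => redSL q (p i) (h i)

variable {ι : Type*} [Fintype ι] {p : ι → ℕ} {q : ℕ} [NeZero q]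

theorem redGp_bijective (hc : Pairwise (Function.onFun Nat.Coprime p)) (hq : ∏ i, p i = q) (h : ∀ i, p i ∣ q) :
    Function.Bijective (redGp p q h) := by
  subst hq
  have he : ∀ b i, ZMod.prodEquivPi p hc b i = ZMod.castHom (h i) (ZMod (p i)) b :=
    fun b i => ZMod.prodEquivPi_apply p hc b i
  constructor
  · intro x y hxy
    ext a b
    apply (ZMod.prodEquivPi p hc).injective
    funext i
    rw [he, he]
    exact congrFun (congrFun (congrArg Subtype.val (congrFun hxy i)) a) b
  · intro y
    obtain ⟨M, hM⟩ : ∃ M : Matrix (Fin 2) (Fin 2) (ZMod (∏ i, p i)),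
        ∀ a b, M a b = (ZMod.prodEquivPi p hc).symm fun i => y i a b := ⟨fun a b => _, fun _ _ => rfl⟩
    have hMi : ∀ i a b, ZMod.castHom (h i) (ZMod (p i)) (M a b) = y i a b := fun i a b => by
      rw [← he, hM, RingEquiv.apply_symm_apply]
    have hdet : M.det = 1 := by
      apply (ZMod.prodEquivPi p hc).injective
      funext i
      have := (y i).det_coe
      rw [Matrix.det_fin_two] at this
      rw [he, Matrix.det_fin_two, map_sub, map_mul, map_mul, hMi, hMi, hMi, hMi, map_one, this]
      rfl
    refine ⟨⟨M, hdet⟩, ?_⟩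
    funext i
    ext a b
    exact hMi i a b

variable {G G' : Type*} [Group G] [Fintype G] [Group G'] [Fintype G']

theorem l2Norm_comp_equiv (e : G ≃* G') (φ : G' → ℂ) : l2Norm (fun x => φ (e x)) = l2Norm φ := by
  simp only [l2Norm]
  rw [Equiv.sum_comp e.toEquiv (fun y => ‖φ y‖ ^ 2) |>.symm]
  rfl

theorem conv_comp_equiv (e : G ≃* G') (μ φ : G' → ℂ) :
    conv (fun x => μ (e x)) (fun x => φ (e x)) = fun x => conv μ φ (e x) := by
  funext x
  simp only [conv, map_mul, map_inv]
  exact Equiv.sum_comp e.toEquiv (fun y => μ y * φ (y⁻¹ * e x))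

variable [LinearOrder ι] [∀ i, Fact (p i).Prime]

theorem memEq.mem_Ez (hc : Pairwise (Function.onFun Nat.Coprime p)) (hq : ∏ i, p i = q) (h : ∀ i, p i ∣ q)
    {φ : SL q → ℂ} (hφ : memEq q φ) {e : SL q ≃* Gp p} (he : ∀ x i, e x i = redSL q (p i) (h i) x) :
    (fun y => φ (e.symm y)) ∈ Ez p := by
  intro i x
  obtain ⟨q₂, hq2⟩ : ∃ q₂, q₂ = ∏ j : {j // j ≠ i}, p j := ⟨_, rfl⟩
  have hm : p i * q₂ = q := by rw [hq2, ← hq, Fintype.prod_eq_mul_prod_subtype_ne _ i]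
  have hd : q₂ ∣ q := ⟨p i, by rw [← hm, mul_comm]⟩
  have : NeZero q₂ := ⟨fun h0 => NeZero.ne q (by rw [← hm, h0, mul_zero])⟩
  have hne : q₂ ≠ q := fun h0 => by
    have h1 := (Fact.out : (p i).Prime).one_lt
    have h2 := Nat.pos_of_ne_zero (NeZero.ne q₂)
    nlinarith
  have hdj : ∀ j : {j // j ≠ i}, p j ∣ q₂ := fun j => hq2 ▸ Finset.dvd_prod_of_mem (fun j : {j // j ≠ i} => p j) (Finset.mem_univ j)
  have hinj := (redGp_bijective (p := fun j : {j // j ≠ i} => p j) (fun a b hab => hc fun h => hab (Subtype.ext h)) hq2.symm hdj).1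
  have hfib : ∀ z w : SL q, redSL q q₂ hd z = redSL q q₂ hd w ↔ ∀ j, j ≠ i → e z j = e w j := by
    intro z w
    refine ⟨fun hzw j hj => ?_, fun hzw => hinj ?_⟩
    · rw [he, he, ← redSL_comp hd (hdj ⟨j, hj⟩), hzw, redSL_comp]
    · funext j
      have := hzw j j.2
      rw [he, he, ← redSL_comp hd (hdj j), ← redSL_comp hd (hdj j)] at this
      exact this
  have key := hφ q₂ hd hne fun y => if y = redSL q q₂ hd (e.symm x) then 1 else 0
  have h1 : ∑ z with redSL q q₂ hd z = redSL q q₂ hd (e.symm x), φ z = 0 := by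
    rw [Finset.sum_filter]
    refine Eq.trans ?_ key
    refine Finset.sum_congr rfl fun z _ => ?_
    split_ifs <;> simp
  rw [← h1]
  refine Finset.sum_nbij (fun g => e.symm (x * Pi.mulSingle i g)) (fun g _ => ?_) (fun g _ g' _ hg => ?_) (fun z hz => ?_) fun _ _ => rfl
  · rw [Finset.mem_filter, hfib]
    refine ⟨Finset.mem_univ _, fun j hj => ?_⟩
    simp [Pi.mulSingle_eq_of_ne hj]
  · exact Pi.mulSingle_injective i (mul_left_cancel (e.symm.injective hg))
  · rw [Finset.mem_coe, Finset.mem_filter, hfib] at hz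
    refine ⟨(x i)⁻¹ * e z i, Finset.mem_coe.2 (Finset.mem_univ _), ?_⟩
    rw [MulEquiv.symm_apply_eq]
    ext1 j
    by_cases hj : j = i
    · subst hj; simp
    · have := hz.2 j hj
      simp [Pi.mulSingle_eq_of_ne hj, this]

end Transport

theorem flattening_of_large {κ : ℝ} (hκ : 0 < κ) (hκ1 : κ ≤ 1) : ∃ c > (0:ℝ), ∃ q0 : ℝ,
    ∀ (q : ℕ) [NeZero q], Squarefree q → 1 < q → q0 ≤ q → ∀ μ : SL q → ℂ,
      (∀ H : Subgroup (SL q), (∀ (p : ℕ), p.Prime → ∀ hp : p ∣ q, Subgroup.map (redSL q p hp) H ≠ ⊤) →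
        ∀ a : SL q, ∑ y with a⁻¹ * y ∈ H, ‖μ y‖ ≤ (q:ℝ) ^ (-κ) * l1Norm μ) →
      ∀ φ : SL q → ℂ, memEq q φ → l2Norm (conv μ φ) ≤ 4 * (q:ℝ) ^ (-c) * l1Norm μ * l2Norm φ := by
  obtain ⟨c, hc, q0, hmain⟩ := composite_op hκ hκ1
  refine ⟨c, hc, q0, ?_⟩
  intro q _ hsq hq1 hq0 μ hμ φ hφ
  have hprime : ∀ i : {x // x ∈ q.primeFactors}, Fact (i : ℕ).Prime := fun i => ⟨Nat.prime_of_mem_primeFactors i.2⟩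
  obtain ⟨p, hpv⟩ : ∃ p : {x // x ∈ q.primeFactors} → ℕ, ∀ i, p i = (i:ℕ) := ⟨_, fun _ => rfl⟩
  have : ∀ i, Fact (p i).Prime := fun i => by rw [hpv]; exact hprime i
  have hpq : ∏ i, p i = q := by
    simp only [hpv]
    rw [Finset.prod_coe_sort q.primeFactors (fun i => i)]
    exact Nat.prod_primeFactors_of_squarefree hsq
  have hinj : Function.Injective p := fun a b hab => Subtype.ext (by rwa [hpv, hpv] at hab)
  have hcop : Pairwise (Function.onFun Nat.Coprime p) := fun i j hij =>
    (Nat.coprime_primes Fact.out Fact.out).2 (hinj.ne hij)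
  have hd : ∀ i, p i ∣ q := fun i => hpq ▸ Finset.dvd_prod_of_mem p (Finset.mem_univ i)
  obtain ⟨e, he⟩ : ∃ e : SL q ≃* Gp p, ∀ x i, e x i = redSL q (p i) (hd i) x :=
    ⟨MulEquiv.ofBijective _ (redGp_bijective hcop hpq hd), fun _ _ => rfl⟩
  have hqq : qq p univ = q := by
    rw [qq, ← Nat.cast_prod]; exact congrArg _ hpq
  have hsurj : ∀ r : ℕ, r.Prime → r ∣ q → ∃ i, p i = r := fun r hr hrq =>
    ⟨⟨r, Nat.mem_primeFactors.2 ⟨hr, hrq, NeZero.ne q⟩⟩, by rw [hpv]⟩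
  have hl0 : 0 ≤ l1Norm μ := Finset.sum_nonneg fun _ _ => norm_nonneg _
  rcases hl0.eq_or_lt with h0 | hl
  · have := l2Norm_conv_le μ φ
    rw [← h0] at this ⊢
    simpa using this
  obtain ⟨ν, hν⟩ : ∃ ν : Gp p → ℂ, ν = fun y => ((l1Norm μ)⁻¹ : ℂ) * μ (e.symm y) := ⟨_, rfl⟩
  have hνn : ∀ x, ‖ν x‖ = (l1Norm μ)⁻¹ * ‖μ (e.symm x)‖ := fun x => by
    rw [hν]
    simp [abs_of_pos hl]
  have hν1 : ∑ x, ‖ν x‖ ≤ 1 := by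
    simp only [hνn]
    rw [← Finset.mul_sum]
    refine le_of_eq (Eq.trans ?_ (inv_mul_cancel₀ hl.ne'))
    exact congrArg _ (Equiv.sum_comp e.symm.toEquiv fun y => ‖μ y‖)
  have hN : NonConc ProperProd (qq p univ ^ (-κ)) (fun x => ‖ν x‖) := by
    rintro _ ⟨H', hH', rfl⟩ a
    have h1 := hμ ((Subgroup.pi Set.univ H').comap e.toMonoidHom) (fun r hr hrq htop => by
      obtain ⟨i, hi⟩ := hsurj r hr hrq
      subst hi
      refine hH' i (eq_top_iff.2 fun g _ => ?_)
      have hg : g ∈ Subgroup.map (redSL q (p i) hrq) ((Subgroup.pi Set.univ H').comap e.toMonoidHom) := by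
        rw [htop]; exact Subgroup.mem_top g
      obtain ⟨x, hx, rfl⟩ := hg
      have := (Subgroup.mem_pi _).1 (Subgroup.mem_comap.1 hx) i (Set.mem_univ i)
      rw [← he]
      exact this) (e.symm a)
    rw [hqq]
    have h2 : ∑ x with a⁻¹ * x ∈ Subgroup.pi Set.univ H', ‖ν x‖ = (l1Norm μ)⁻¹ *
        ∑ y with (e.symm a)⁻¹ * y ∈ (Subgroup.pi Set.univ H').comap e.toMonoidHom, ‖μ y‖ := by
      rw [Finset.mul_sum, Finset.sum_filter, Finset.sum_filter, ← Equiv.sum_comp e.toEquiv]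
      refine Finset.sum_congr rfl fun y _ => ?_
      have h3 : a⁻¹ * e y ∈ Subgroup.pi Set.univ H' ↔
          (e.symm a)⁻¹ * y ∈ (Subgroup.pi Set.univ H').comap e.toMonoidHom := by
        rw [Subgroup.mem_comap]
        simp
      change (if a⁻¹ * e y ∈ Subgroup.pi Set.univ H' then ‖ν (e y)‖ else 0) = _
      simp only [h3, hνn, MulEquiv.symm_apply_apply]
    refine (le_of_eq (by convert h2)).trans ?_
    rw [inv_mul_le_iff₀ hl, mul_comm]
    convert h1
  have h1 := hmain hinj (by rw [hqq]; exact hq0) ν hν1 hN _ (memEq.mem_Ez hcop hpq hd hφ he)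
  rw [hqq] at h1
  have h2 : conv μ φ = (l1Norm μ : ℂ) • fun x => conv ν (fun y => φ (e.symm y)) (e x) := by
    rw [← conv_comp_equiv e]
    funext x
    simp only [conv, hν, Pi.smul_apply, smul_eq_mul, MulEquiv.symm_apply_apply, Finset.mul_sum]
    refine Finset.sum_congr rfl fun y _ => ?_
    have : (l1Norm μ : ℂ) ≠ 0 := by exact_mod_cast hl.ne'
    field_simp
  have h3 : l2Norm (conv μ φ) = l1Norm μ * l2Norm (conv ν fun y => φ (e.symm y)) := by
    rw [h2, l2Norm_smul, l2Norm_comp_equiv e]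
    simp [abs_of_pos hl]
  have h4 : l2Norm (conv μ φ) ≤ l1Norm μ * (4 * (q:ℝ) ^ (-c) * l2Norm φ) := by
    rw [h3, ← l2Norm_comp_equiv e.symm φ]
    convert mul_le_mul_of_nonneg_left h1 hl.le
    rfl
  refine h4.trans (le_of_eq ?_)
  ring

end L2Flat

/-- Lemma (`L²`-flattening for complex measures on `SL₂(ℤ/qℤ)`, `q` squarefree).  Given
`κ > 0` there are `κ′ > 0`, `C > 0` such that for all squarefree `q` and
`G = SL₂(ℤ/qℤ)`: if `μ : G → ℂ` satisfies `|||π_{q₁}(μ)|||_∞ < q₁^{−κ} ‖μ‖₁` for every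
divisor `q₁ > 1` of `q`, then `‖μ ∗ φ‖₂ ≤ C q^{−κ′} ‖μ‖₁ ‖φ‖₂` for every `φ ∈ E_q`. -/
theorem l2_flattening_squarefree
    (κ : ℝ) (hκ : 0 < κ) :
    ∃ κ' > (0 : ℝ), ∃ C > (0 : ℝ),
      ∀ (q : ℕ) [NeZero q], Squarefree q →
      ∀ μ : Matrix.SpecialLinearGroup (Fin 2) (ZMod q) → ℂ,
        (∀ (q₁ : ℕ) [NeZero q₁], ∀ (h : q₁ ∣ q), 1 < q₁ →
          ∀ H : Subgroup (Matrix.SpecialLinearGroup (Fin 2) (ZMod q₁)),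
            (∀ (p : ℕ), p.Prime → ∀ (hp : p ∣ q₁), Subgroup.map (redSL q₁ p hp) H ≠ ⊤) →
            ∀ a : Matrix.SpecialLinearGroup (Fin 2) (ZMod q₁),
              (∑ y ∈ Finset.univ.filter (fun y => a⁻¹ * y ∈ H),
                ‖pushforward q q₁ h μ y‖) < (q₁ : ℝ) ^ (-κ) * l1Norm μ) →
        ∀ φ : Matrix.SpecialLinearGroup (Fin 2) (ZMod q) → ℂ, memEq q φ →
          l2Norm (conv μ φ) ≤ C * (q : ℝ) ^ (-κ') * l1Norm μ * l2Norm φ := by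
  obtain ⟨c, hc, q0, hmain⟩ := L2Flat.flattening_of_large (lt_min hκ one_pos) (min_le_right κ 1)
  refine ⟨c, hc, max 4 (max q0 1 ^ c), by positivity, ?_⟩
  intro q _ hsq μ hμ φ hφ
  have hq : 0 < q := Nat.pos_of_ne_zero (NeZero.ne q)
  have hqR : (1:ℝ) ≤ q := by exact_mod_cast hq
  have hl0 : 0 ≤ l1Norm μ := Finset.sum_nonneg fun _ _ => norm_nonneg _
  by_cases hbig : 1 < q ∧ q0 ≤ q
  · refine (hmain q hsq hbig.1 hbig.2 μ (fun H hH a => ?_) φ hφ).trans ?_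
    · have hpush : pushforward q q dvd_rfl μ = μ := by
        funext y
        simp only [pushforward, L2Flat.redSL_self, Finset.sum_filter, Finset.sum_ite_eq', Finset.mem_univ, if_true]
      have h1 := hμ q dvd_rfl hbig.1 H hH a
      rw [hpush] at h1
      refine h1.le.trans (mul_le_mul_of_nonneg_right ?_ hl0)
      exact Real.rpow_le_rpow_of_exponent_le hqR (neg_le_neg (min_le_left κ 1))
    · have := L2Flat.l2Norm_nonneg φ
      gcongr
      exact le_max_left _ _
  · have hle : (q:ℝ) ≤ max q0 1 := by
      by_contra hn
      rw [not_le, max_lt_iff] at hn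
      exact hbig ⟨by exact_mod_cast hn.2, hn.1.le⟩
    refine (L2Flat.l2Norm_conv_le μ φ).trans (mul_le_mul_of_nonneg_right ?_ (L2Flat.l2Norm_nonneg φ))
    refine le_mul_of_one_le_left hl0 ?_
    have hqc : 0 < (q:ℝ) ^ c := by positivity
    rw [Real.rpow_neg (by positivity), ← div_eq_mul_inv, one_le_div hqc]
    exact (Real.rpow_le_rpow (by positivity) hle hc.le).trans (le_max_right _ _)
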